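/- Suppose L(T) → ∞ and L(T)/log T → 0 as T → ∞. Then for every real x, lim_{T→∞} (1/T)·Leb{τ ∈ [T,2T] : S_{L(T)}(τ)/σ_{L(T)} < x} = (1/√(2π))·∫_{−∞}^x e^{−u²/2} du; that is, the normalized hyperbolic-class sum S_L/σ_L has a standard Gaussian limiting value distribution with respect to τ uniformly distributed in [T,2T]. -/

import Mathlib

open MeasureTheory Filter

/-- `N(n) = ((n + √(n²−4))/2)²`, the norm of a hyperbolic class of trace `n`. -/
noncomputable def Nnorm (n : ℕ) : ℝ := (((n : ℝ) + Real.sqrt ((n : ℝ) ^ 2 - 4)) / 2) ^ 2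
/-- Value of the integral binary quadratic form `(a,b,c)` at `(x,y)`. -/
def formVal (f : ℤ × ℤ × ℤ) (x y : ℤ) : ℤ := f.1 * x ^ 2 + f.2.1 * x * y + f.2.2 * y ^ 2

/-- A form `ax² + bxy + cy²` is primitive if `gcd(a,b,c) = 1`. -/
def IsPrimitiveForm (f : ℤ × ℤ × ℤ) : Prop := Int.gcd f.1 (Int.gcd f.2.1 f.2.2) = 1

/-- Discriminant `b² − 4ac` of the form `(a,b,c)`. -/
def formDisc (f : ℤ × ℤ × ℤ) : ℤ := f.2.1 ^ 2 - 4 * f.1 * f.2.2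

/-- `SL(2,ℤ)`-equivalence of binary quadratic forms:
`Q'(x,y) = Q(αx + βy, γx + δy)` for some `[[α,β],[γ,δ]] ∈ SL(2,ℤ)`. -/
def formEquiv (f g : ℤ × ℤ × ℤ) : Prop :=
  ∃ M : Matrix.SpecialLinearGroup (Fin 2) ℤ,
    ∀ x y : ℤ, formVal g x y =
      formVal f (M.1 0 0 * x + M.1 0 1 * y) (M.1 1 0 * x + M.1 1 1 * y)

/-- The class number `h(d)`: the number of `SL(2,ℤ)`-equivalence classes of
primitive integral binary quadratic forms of discriminant `d`. -/
noncomputable def classNumber (d : ℤ) : ℕ :=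
  Nat.card (Quot (fun f g : {f : ℤ × ℤ × ℤ // IsPrimitiveForm f ∧ formDisc f = d} =>
    formEquiv f.1 g.1))
/-- `t_d`: the least `t ≥ 1` such that `t² − d u² = 4` has a solution with `u ≥ 1`. -/
noncomputable def td (d : ℤ) : ℕ :=
  sInf {t : ℕ | 0 < t ∧ ∃ u : ℕ, 0 < u ∧ (t : ℤ) ^ 2 - d * (u : ℤ) ^ 2 = 4}

/-- `u_d`: the positive `u` corresponding to `t_d`. -/
noncomputable def ud (d : ℤ) : ℕ :=
  sInf {u : ℕ | 0 < u ∧ (td d : ℤ) ^ 2 - d * (u : ℤ) ^ 2 = 4}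

/-- `ε_d = (t_d + u_d √d)/2`, the fundamental solution of `t² − d u² = 4`. -/
noncomputable def eps (d : ℤ) : ℝ := ((td d : ℝ) + (ud d : ℝ) * Real.sqrt (d : ℝ)) / 2
/-- `A(n) = Σ h(d)·log(ε_d)/(u·√d)`, summed over pairs `(d,u)` of positive integers with
`d ≡ 0, 1 (mod 4)` and `d·u² = n² − 4`. -/
noncomputable def ampA (n : ℕ) : ℝ :=
  ∑ p ∈ (Finset.range (n ^ 2) ×ˢ Finset.range (n ^ 2)).filter
      (fun p => 0 < p.1 ∧ 0 < p.2 ∧ (p.1 % 4 = 0 ∨ p.1 % 4 = 1) ∧ p.1 * p.2 ^ 2 = n ^ 2 - 4),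
    (classNumber (p.1 : ℤ) : ℝ) * Real.log (eps (p.1 : ℤ)) /
      ((p.2 : ℝ) * Real.sqrt (p.1 : ℝ))
/-- `κ = (1015/864)·∏_{p ≠ 2 prime} (1 + (p⁴ − 2p³ + 1)/(p² − 1)³)`. -/
noncomputable def kappa : ℝ :=
  (1015 / 864) * ∏' p : {p : ℕ // p.Prime ∧ p ≠ 2},
    (1 + ((p.1 : ℝ) ^ 4 - 2 * (p.1 : ℝ) ^ 3 + 1) / ((p.1 : ℝ) ^ 2 - 1) ^ 3)
/-- The hyperbolic-class sum
`S_L(τ) = (1/(πL)) Σ_{n>2} A(n)·g(log N(n)/(2πL))·2cos(τ·log N(n))`. -/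
noncomputable def SL (g : ℝ → ℝ) (L τ : ℝ) : ℝ :=
  (1 / (Real.pi * L)) * ∑' n : ℕ,
    if 2 < n then
      ampA n * g (Real.log (Nnorm n) / (2 * Real.pi * L)) *
        (2 * Real.cos (τ * Real.log (Nnorm n)))
    else 0
/-- `σ_L² = (2κ/(πL))·∫₀^∞ g(u)²·e^{πLu} du`. -/
noncomputable def sigmaSq (g : ℝ → ℝ) (L : ℝ) : ℝ :=
  (2 * kappa / (Real.pi * L)) * ∫ u in Set.Ioi (0 : ℝ), g u ^ 2 * Real.exp (Real.pi * L * u)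

namespace MD
open Finset (range Icc Ioc Ico sum_congr mem_filter mem_range sum_le_sum mem_Icc abs_sum_le_sum_abs)
open Real (exp)

/-- the model region in the plane -/
def regT (e : ℝ) : Set (ℝ × ℝ) := {p | p.2 ≤ p.1 ∧ p.1 < e ^ 2 * p.2 ∧ p.1 * p.2 ≤ 1}

lemma regT_meas (e : ℝ) : MeasurableSet (regT e) := by
  unfold regT
  apply MeasurableSet.inter
  · exact measurableSet_le measurable_snd measurable_fst
  apply MeasurableSet.inter
  · exact measurableSet_lt measurable_fst (measurable_snd.const_mul _)
  · exact measurableSet_le (measurable_fst.mul measurable_snd) measurable_const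

lemma regT_pos {e : ℝ} (he : 1 < e) {p : ℝ × ℝ} (hp : p ∈ regT e) : 0 < p.1 ∧ 0 < p.2 := by
  obtain ⟨h1, h2, h3⟩ := hp
  have : 0 < p.2 := by
    by_contra h
    push Not at h
    have h4 : 0 < (e ^ 2 - 1) * p.2 := by linarith
    have h5 : 0 < e ^ 2 - 1 := by nlinarith
    nlinarith
  exact ⟨by linarith, this⟩

lemma regT_slice {e : ℝ} (he : 1 < e) (s : ℝ) :
    Prod.mk s ⁻¹' regT e = if 0 < s then Set.Ioc (s / e ^ 2) (min s (1 / s)) else ∅ := by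
  have he2 : 0 < e ^ 2 := by positivity
  ext t
  split_ifs with hs
  · simp only [regT, Set.mem_preimage, Set.mem_ofPred_eq, Set.mem_Ioc, le_min_iff]
    rw [div_lt_iff₀ he2, le_div_iff₀ hs]
    constructor
    · rintro ⟨a, b, c⟩; exact ⟨by linarith, a, by linarith⟩
    · rintro ⟨a, b, c⟩; exact ⟨b, by linarith, by linarith⟩
  · simp only [Set.mem_preimage, Set.mem_empty_iff_false, iff_false]
    intro h
    exact hs (regT_pos he h).1

lemma regT_integral {e : ℝ} (he : 1 < e) :
    ∫ s in (0:ℝ)..e, (min s (1 / s) - s / e ^ 2) = Real.log e := by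
  have he0 : 0 < e := by linarith
  have h1 : ∫ s in (0:ℝ)..1, (min s (1 / s) - s / e ^ 2) = ∫ s in (0:ℝ)..1, (s - s / e ^ 2) := by
    apply intervalIntegral.integral_congr_ae
    refine Eventually.of_forall fun s hs => ?_
    rw [Set.uIoc_of_le zero_le_one] at hs
    rw [min_eq_left]
    rw [le_div_iff₀ hs.1]; nlinarith [hs.1, hs.2]
  have h2 : ∫ s in (1:ℝ)..e, (min s (1 / s) - s / e ^ 2) = ∫ s in (1:ℝ)..e, (1 / s - s / e ^ 2) := by
    apply intervalIntegral.integral_congr_ae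
    refine Eventually.of_forall fun s hs => ?_
    rw [Set.uIoc_of_le he.le] at hs
    rw [min_eq_right]
    rw [div_le_iff₀ (by linarith [hs.1])]; nlinarith [hs.1, hs.2]
  have i1 : IntervalIntegrable (fun s : ℝ => s) volume 0 1 := continuous_id.intervalIntegrable _ _
  have i1' : ∀ a b, IntervalIntegrable (fun s : ℝ => s / e ^ 2) volume a b :=
    fun a b => (continuous_id.div_const _).intervalIntegrable _ _
  have i2 : IntervalIntegrable (fun s : ℝ => 1 / s) volume 1 e := by
    apply ContinuousOn.intervalIntegrable
    intro s hs
    rw [Set.uIcc_of_le he.le] at hs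
    have : s ≠ 0 := by linarith [hs.1]
    exact (continuousAt_const.div continuousAt_id this).continuousWithinAt
  have j1 : IntervalIntegrable (fun s : ℝ => min s (1 / s) - s / e ^ 2) volume 0 1 := by
    refine (i1.sub (i1' 0 1)).congr_ae ?_
    refine (ae_restrict_iff' measurableSet_uIoc).2 (Eventually.of_forall fun s hs => ?_)
    rw [Set.uIoc_of_le zero_le_one] at hs
    simp only []
    rw [min_eq_left]
    rw [le_div_iff₀ hs.1]; nlinarith [hs.1, hs.2]
  have j2 : IntervalIntegrable (fun s : ℝ => min s (1 / s) - s / e ^ 2) volume 1 e := by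
    refine (i2.sub (i1' 1 e)).congr_ae ?_
    refine (ae_restrict_iff' measurableSet_uIoc).2 (Eventually.of_forall fun s hs => ?_)
    rw [Set.uIoc_of_le he.le] at hs
    simp only []
    rw [min_eq_right]
    rw [div_le_iff₀ (by linarith [hs.1])]; nlinarith [hs.1, hs.2]
  rw [← intervalIntegral.integral_add_adjacent_intervals j1 j2, h1, h2,
    intervalIntegral.integral_sub i1 (i1' _ _), intervalIntegral.integral_sub i2 (i1' _ _),
    intervalIntegral.integral_div, intervalIntegral.integral_div, integral_id, integral_id,
    integral_one_div_of_pos one_pos he0]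
  field_simp
  ring

lemma regT_integrable {e : ℝ} (he : 1 < e) :
    IntervalIntegrable (fun s : ℝ => min s (1 / s) - s / e ^ 2) volume 0 e := by
  by_contra h
  have := intervalIntegral.integral_undef h
  rw [regT_integral he] at this
  have := Real.log_pos he
  linarith

lemma regT_volume {e : ℝ} (he : 1 < e) : volume (regT e) = ENNReal.ofReal (Real.log e) := by
  have he0 : 0 < e := by linarith
  rw [Measure.volume_eq_prod, Measure.prod_apply (regT_meas e)]
  have : ∀ s, volume (Prod.mk s ⁻¹' regT e) =
      Set.indicator (Set.Ioc 0 e) (fun s => ENNReal.ofReal (min s (1 / s) - s / e ^ 2)) s := by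
    intro s
    rw [regT_slice he]
    by_cases hs : 0 < s
    · rw [if_pos hs, Real.volume_Ioc]
      by_cases hse : s ≤ e
      · rw [Set.indicator_of_mem (by exact ⟨hs, hse⟩)]
      · rw [Set.indicator_of_notMem (by intro h; exact hse h.2)]
        apply ENNReal.ofReal_of_nonpos
        push Not at hse
        have : 1 / s ≤ s / e ^ 2 := by
          rw [div_le_div_iff₀ hs (by positivity)]; nlinarith
        linarith [min_le_right s (1/s)]
    · rw [if_neg hs, Set.indicator_of_notMem (by intro h; exact hs h.1), measure_empty]
  simp_rw [this]
  rw [lintegral_indicator measurableSet_Ioc, ← regT_integral he,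
    intervalIntegral.integral_of_le he0.le]
  rw [ofReal_integral_eq_lintegral_ofReal]
  · have := regT_integrable he
    rwa [intervalIntegrable_iff_integrableOn_Ioc_of_le he0.le] at this
  · refine (ae_restrict_iff' measurableSet_Ioc).2 (Eventually.of_forall fun s hs => ?_)
    simp only [Pi.zero_apply, sub_nonneg, le_min_iff]
    constructor
    · apply div_le_self hs.1.le; nlinarith
    · rw [div_le_div_iff₀ (by positivity) hs.1]; nlinarith [hs.1, hs.2]

lemma regT_frontier {e : ℝ} (he : 1 < e) : volume (frontier (regT e)) = 0 := by
  set A : Set (ℝ × ℝ) := {p | p.2 ≤ p.1 ∧ p.1 < e ^ 2 * p.2} with hA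
  set B : Set (ℝ × ℝ) := {p | 0 < p.1 ∧ 0 < p.2 ∧ 1 < p.1 * p.2} with hB
  have hAB : regT e = A ∩ Bᶜ := by
    ext p
    constructor
    · intro h
      exact ⟨⟨h.1, h.2.1⟩, fun h' => not_lt.2 h.2.2 h'.2.2⟩
    · rintro ⟨h1, h2⟩
      refine ⟨h1.1, h1.2, ?_⟩
      by_contra h
      push Not at h
      have h3 : 0 < p.2 := by
        by_contra h3
        push Not at h3
        have h4 : 0 < (e ^ 2 - 1) * p.2 := by linarith [h1.1, h1.2]
        have h5 : 0 < e ^ 2 - 1 := by nlinarith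
        nlinarith
      exact h2 ⟨by linarith [h1.1], h3, h⟩
  have cA : Convex ℝ A := by
    intro x hx y hy a b ha hb hab
    refine ⟨?_, ?_⟩
    · simp only [Prod.snd_add, Prod.smul_snd, smul_eq_mul, Prod.fst_add, Prod.smul_fst]
      nlinarith [hx.1, hy.1]
    · simp only [Prod.snd_add, Prod.smul_snd, smul_eq_mul, Prod.fst_add, Prod.smul_fst]
      rcases ha.eq_or_lt with rfl | ha
      · have : b = 1 := by linarith
        subst this; simpa using hy.2
      · nlinarith [hx.2, hy.2]
  have cB : Convex ℝ B := by
    intro x hx y hy a b ha hb hab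
    obtain ⟨x1, x2, x3⟩ := hx
    obtain ⟨y1, y2, y3⟩ := hy
    simp only [hB, Set.mem_ofPred_eq, Prod.snd_add, Prod.smul_snd, smul_eq_mul, Prod.fst_add,
      Prod.smul_fst]
    rcases ha.eq_or_lt with rfl | ha
    · have : b = 1 := by linarith
      subst this; simpa using ⟨y1, y2, y3⟩
    · refine ⟨by positivity, by positivity, ?_⟩
      have key : 2 < x.1 * y.2 + x.2 * y.1 := by
        have h1 : 1 < (x.1 * y.2) * (x.2 * y.1) := by nlinarith [mul_pos x1 x2]
        have h2 : 0 < x.1 * y.2 := by positivity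
        have h3 : 0 < x.2 * y.1 := by positivity
        nlinarith [sq_nonneg (x.1 * y.2 - x.2 * y.1)]
      have e1 : (a * x.1 + b * y.1) * (a * x.2 + b * y.2) = a ^ 2 * (x.1 * x.2) + b ^ 2 * (y.1 * y.2)
        + a * b * (x.1 * y.2 + x.2 * y.1) := by ring
      have e2 : (1 : ℝ) = a ^ 2 + b ^ 2 + a * b * 2 := by
        rw [show a ^ 2 + b ^ 2 + a * b * 2 = (a + b) ^ 2 by ring, hab]; norm_num
      rw [e1, e2]
      have t1 : a ^ 2 * 1 < a ^ 2 * (x.1 * x.2) := by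
        apply mul_lt_mul_of_pos_left x3; positivity
      have t2 : b ^ 2 * 1 ≤ b ^ 2 * (y.1 * y.2) := by
        apply mul_le_mul_of_nonneg_left y3.le; positivity
      have t3 : a * b * 2 ≤ a * b * (x.1 * y.2 + x.2 * y.1) := by
        apply mul_le_mul_of_nonneg_left key.le; positivity
      linarith
  rw [hAB]
  refine measure_mono_null (frontier_inter_subset A Bᶜ) ?_
  rw [frontier_compl]
  refine measure_union_null ?_ ?_
  · exact measure_mono_null Set.inter_subset_left (cA.addHaar_frontier volume)
  · exact measure_mono_null Set.inter_subset_right (cB.addHaar_frontier volume)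

/-- lattice points in the sector of a hyperbola -/
lemma lattice_count (p q r s e : ℝ) (hdet : p * s - q * r ≠ 0) (he : 1 < e) :
    Tendsto (fun Y : ℝ => (Nat.card {v : ℤ × ℤ |
        (r * v.1 + s * v.2 ≤ p * v.1 + q * v.2) ∧
        (p * v.1 + q * v.2 < e ^ 2 * (r * v.1 + s * v.2)) ∧
        (p * v.1 + q * v.2) * (r * v.1 + s * v.2) ≤ Y} : ℝ) / Y) atTop
      (nhds (Real.log e / |p * s - q * r|)) := by
  let Mx : Matrix (Fin 2) (Fin 2) ℝ := !![p, q; r, s]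
  let φ : (Fin 2 → ℝ) →ₗ[ℝ] (Fin 2 → ℝ) := Matrix.toLin' Mx
  have hφ0 : ∀ v, φ v 0 = p * v 0 + q * v 1 := by
    intro v; simp [φ, Mx, Matrix.toLin'_apply, Matrix.mulVec, dotProduct, Fin.sum_univ_two]
  have hφ1 : ∀ v, φ v 1 = r * v 0 + s * v 1 := by
    intro v; simp [φ, Mx, Matrix.toLin'_apply, Matrix.mulVec, dotProduct, Fin.sum_univ_two]
  have hdetφ : LinearMap.det φ = p * s - q * r := by
    simp [φ, Mx, LinearMap.det_toLin', Matrix.det_fin_two]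
  let fe := MeasurableEquiv.finTwoArrow (α := ℝ)
  have hfe : MeasurePreserving fe := volume_preserving_finTwoArrow ℝ
  let X : Set (Fin 2 → ℝ) := {v | φ v 1 ≤ φ v 0 ∧ φ v 0 < e ^ 2 * φ v 1}
  let F : (Fin 2 → ℝ) → ℝ := fun v => φ v 0 * φ v 1
  let T : Set (Fin 2 → ℝ) := fe ⁻¹' (regT e)
  have hXF : {x ∈ X | F x ≤ 1} = φ ⁻¹' T := by
    ext v
    simp [X, F, T, regT, fe, and_assoc]
  let φe := LinearEquiv.ofIsUnitDet (f := φ) (v := Pi.basisFun ℝ (Fin 2)) (v' := Pi.basisFun ℝ (Fin 2))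
    (by rw [← LinearMap.det_toMatrix (Pi.basisFun ℝ (Fin 2))] at hdetφ; rw [hdetφ]; exact hdet.isUnit)
  let feh : (Fin 2 → ℝ) ≃ₜ ℝ × ℝ := Homeomorph.finTwoArrow
  have hfeh : ∀ v, feh v = fe v := fun v => rfl
  let ψ : (Fin 2 → ℝ) ≃ₜ (Fin 2 → ℝ) := φe.toContinuousLinearEquiv.toHomeomorph
  have hψ : ∀ v, ψ v = φ v := fun v => rfl
  have key := ZLattice.covolume.tendsto_card_le_div
    (L := (Submodule.span ℤ (Set.range (Pi.basisFun ℝ (Fin 2)))))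
    (X := X) (F := F) ?_ ?_ ?_ ?_ ?_
  · have hcov : ZLattice.covolume (Submodule.span ℤ (Set.range (Pi.basisFun ℝ (Fin 2)))) = 1 := by
      rw [ZLattice.covolume_eq_measure_fundamentalDomain _ _
        (ZSpan.isAddFundamentalDomain (Pi.basisFun ℝ (Fin 2)) volume)]
      rw [ZSpan.fundamentalDomain_pi_basisFun, measureReal_def, Real.volume_pi_Ico_toReal]
      · simp
      · intro i; simp
    rw [hcov, div_one, hXF, measureReal_def,
      Measure.addHaar_preimage_linearMap _ (by rw [hdetφ]; exact hdet), hdetφ,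
      hfe.measure_preimage_equiv, regT_volume he, ENNReal.toReal_mul,
      ENNReal.toReal_ofReal (Real.log_pos he).le, ENNReal.toReal_ofReal (abs_nonneg _), abs_inv,
      mul_comm, ← div_eq_mul_inv] at key
    refine key.congr fun Y => ?_
    congr 2
    symm
    refine Nat.card_congr (Equiv.ofBijective (fun v => ⟨![(v.1.1 : ℝ), (v.1.2 : ℝ)], ?_, ?_⟩) ⟨?_, ?_⟩)
    · obtain ⟨h1, h2, h3⟩ := v.2
      refine ⟨⟨?_, ?_⟩, ?_⟩ <;> simp only [F, hφ0, hφ1] <;> simpa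
    · rw [SetLike.mem_coe, Module.Basis.mem_span_iff_repr_mem]
      intro i
      fin_cases i
      · exact ⟨v.1.1, by simp⟩
      · exact ⟨v.1.2, by simp⟩
    · rintro ⟨⟨a, b⟩, h⟩ ⟨⟨a', b'⟩, h'⟩ hh
      have hh' := congrArg Subtype.val hh
      have h0 := congrFun hh' 0
      have h1 := congrFun hh' 1
      simp at h0 h1
      subst h0; subst h1; rfl
    · rintro ⟨w, hw, hwL⟩
      rw [SetLike.mem_coe, Module.Basis.mem_span_iff_repr_mem] at hwL
      obtain ⟨a, ha⟩ := hwL 0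
      obtain ⟨b, hb⟩ := hwL 1
      simp at ha hb
      obtain ⟨⟨h1, h2⟩, h3⟩ := hw
      simp only [F, hφ0, hφ1] at h1 h2 h3
      refine ⟨⟨(a, b), ?_, ?_, ?_⟩, ?_⟩
      · simp only [ha, hb]; exact h1
      · simp only [ha, hb]; exact h2
      · simp only [ha, hb]; exact h3
      · apply Subtype.ext
        funext i
        fin_cases i
        · exact ha
        · exact hb
  · intro x t hx ht
    refine ⟨?_, ?_⟩
    · simp only [map_smul, Pi.smul_apply, smul_eq_mul]
      exact mul_le_mul_of_nonneg_left hx.1 ht.le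
    · simp only [map_smul, Pi.smul_apply, smul_eq_mul]
      have := mul_lt_mul_of_pos_left hx.2 ht
      linarith
  · intro x t ht
    simp only [F, map_smul, Pi.smul_apply, smul_eq_mul, Fintype.card_fin]
    ring
  · rw [hXF]
    have e1 : φ ⁻¹' T = φe.symm.toContinuousLinearEquiv.toContinuousLinearMap '' T := by
      ext v
      constructor
      · intro hv
        exact ⟨φ v, hv, φe.symm_apply_apply v⟩
      · rintro ⟨w, hw, rfl⟩
        show φe (φe.symm w) ∈ T
        rw [φe.apply_symm_apply]; exact hw
    rw [e1]
    refine (ContinuousLinearMap.lipschitz _).isBounded_image ?_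
    refine (Metric.isBounded_Icc (![0, 0] : Fin 2 → ℝ) ![e, 1]).subset ?_
    intro v hv
    have hp := regT_pos he hv
    obtain ⟨h1, h2, h3⟩ := hv
    have hp0 : 0 < v 0 := hp.1
    have hp1 : 0 < v 1 := hp.2
    have h1' : v 1 ≤ v 0 := h1
    have h2' : v 0 < e ^ 2 * v 1 := h2
    have h3' : v 0 * v 1 ≤ 1 := h3
    have b0 : v 0 ≤ e := by
      by_contra hh
      push Not at hh
      have k1 : v 0 * v 0 < e ^ 2 * (v 0 * v 1) := by
        nlinarith [mul_lt_mul_of_pos_left h2' hp0]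
      have k2 : e ^ 2 * (v 0 * v 1) ≤ e ^ 2 * 1 := mul_le_mul_of_nonneg_left h3' (by positivity)
      nlinarith
    have b1 : v 1 ≤ 1 := by
      by_contra hh
      push Not at hh
      nlinarith
    constructor
    · intro i; fin_cases i
      · exact hp.1.le
      · exact hp.2.le
    · intro i; fin_cases i
      · exact b0
      · exact b1
  · rw [hXF]
    exact (φ.continuous_of_finiteDimensional.measurable) (fe.measurable (regT_meas e))
  · have : {x | x ∈ X ∧ F x ≤ 1} = φ ⁻¹' T := hXF
    rw [this]
    have e1 : φ ⁻¹' T = ψ ⁻¹' (feh ⁻¹' regT e) := rfl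
    rw [e1, ← ψ.preimage_frontier, ← feh.preimage_frontier]
    have : ψ ⁻¹' (feh ⁻¹' (frontier (regT e))) = φ ⁻¹' (fe ⁻¹' (frontier (regT e))) := rfl
    rw [this, Measure.addHaar_preimage_linearMap _ (by rw [hdetφ]; exact hdet)]
    rw [hfe.measure_preimage_equiv, regT_frontier he, mul_zero]

/-- action of an integer matrix on forms -/
def act (f : ℤ × ℤ × ℤ) (α β γ δ : ℤ) : ℤ × ℤ × ℤ :=
  (f.1 * α ^ 2 + f.2.1 * α * γ + f.2.2 * γ ^ 2,
   2 * f.1 * α * β + f.2.1 * (α * δ + β * γ) + 2 * f.2.2 * γ * δ,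
   f.1 * β ^ 2 + f.2.1 * β * δ + f.2.2 * δ ^ 2)

lemma formVal_inj {f g : ℤ × ℤ × ℤ} (h : ∀ x y, formVal f x y = formVal g x y) : f = g := by
  obtain ⟨a, b, c⟩ := f
  obtain ⟨a', b', c'⟩ := g
  have h1 := h 1 0
  have h2 := h 0 1
  have h3 := h 1 1
  simp only [formVal] at h1 h2 h3
  ext <;> simp only <;> linarith

lemma formVal_act (f : ℤ × ℤ × ℤ) (α β γ δ x y : ℤ) :
    formVal (act f α β γ δ) x y = formVal f (α * x + β * y) (γ * x + δ * y) := by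
  simp only [formVal, act]; ring

lemma act_act (f : ℤ × ℤ × ℤ) (α β γ δ α' β' γ' δ' : ℤ) :
    act (act f α β γ δ) α' β' γ' δ' =
      act f (α * α' + β * γ') (α * β' + β * δ') (γ * α' + δ * γ') (γ * β' + δ * δ') := by
  apply formVal_inj
  intro x y
  simp only [formVal_act]
  congr 1 <;> ring

lemma act_one (f : ℤ × ℤ × ℤ) : act f 1 0 0 1 = f := by
  apply formVal_inj
  intro x y
  simp only [formVal_act]
  congr 1 <;> ring

lemma act_disc (f : ℤ × ℤ × ℤ) {α β γ δ : ℤ} (h : α * δ - β * γ = 1) :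
    formDisc (act f α β γ δ) = formDisc f := by
  have : formDisc (act f α β γ δ) = (α * δ - β * γ) ^ 2 * formDisc f := by
    simp only [formDisc, act]; ring
  rw [this, h]; ring

lemma formEquiv_iff (f g : ℤ × ℤ × ℤ) :
    formEquiv f g ↔ ∃ α β γ δ : ℤ, α * δ - β * γ = 1 ∧ g = act f α β γ δ := by
  constructor
  · rintro ⟨M, hM⟩
    refine ⟨M.1 0 0, M.1 0 1, M.1 1 0, M.1 1 1, ?_, ?_⟩
    · have := M.2
      rw [Matrix.det_fin_two] at this
      exact this
    · apply formVal_inj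
      intro x y
      rw [hM, formVal_act]
  · rintro ⟨α, β, γ, δ, h, rfl⟩
    refine ⟨⟨!![α, β; γ, δ], by rw [Matrix.det_fin_two]; simpa using h⟩, ?_⟩
    intro x y
    rw [formVal_act]
    simp

lemma act_inv (f : ℤ × ℤ × ℤ) {α β γ δ : ℤ} (h : α * δ - β * γ = 1) :
    act (act f α β γ δ) δ (-β) (-γ) α = f := by
  rw [act_act]
  convert act_one f using 2 <;> linarith

lemma formEquiv_equivalence : Equivalence formEquiv := by
  refine ⟨fun f => ?_, fun {f g} h => ?_, fun {f g k} h1 h2 => ?_⟩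
  · rw [formEquiv_iff]; exact ⟨1, 0, 0, 1, by norm_num, (act_one f).symm⟩
  · rw [formEquiv_iff] at *
    obtain ⟨α, β, γ, δ, h, rfl⟩ := h
    exact ⟨δ, -β, -γ, α, by linarith, (act_inv f h).symm⟩
  · rw [formEquiv_iff] at *
    obtain ⟨α, β, γ, δ, h, rfl⟩ := h1
    obtain ⟨α', β', γ', δ', h', rfl⟩ := h2
    refine ⟨_, _, _, _, ?_, act_act _ _ _ _ _ _ _ _ _⟩
    linear_combination h' + (α' * δ' - β' * γ') * h

/-- Primitive forms of discriminant `d`. -/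
abbrev PForm (d : ℤ) := {f : ℤ × ℤ × ℤ // IsPrimitiveForm f ∧ formDisc f = d}

abbrev Cls (d : ℤ) := Quot (fun f g : PForm d => formEquiv f.1 g.1)

lemma cls_eq {d : ℤ} {f g : PForm d} :
    (Quot.mk _ f : Cls d) = Quot.mk _ g ↔ formEquiv f.1 g.1 := by
  constructor
  · intro h
    have := Quot.eqvGen_exact h
    have he : Equivalence (fun f g : PForm d => formEquiv f.1 g.1) :=
      ⟨fun f => formEquiv_equivalence.1 _, fun h => formEquiv_equivalence.2 h,
        fun h h' => formEquiv_equivalence.3 h h'⟩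
    exact he.eqvGen_iff.1 this
  · intro h; exact Quot.sound h

lemma prim_iff (f : ℤ × ℤ × ℤ) :
    IsPrimitiveForm f ↔ ∀ k : ℤ, k ∣ f.1 → k ∣ f.2.1 → k ∣ f.2.2 → IsUnit k := by
  unfold IsPrimitiveForm
  constructor
  · intro h k h1 h2 h3
    have : k ∣ (Int.gcd f.1 (Int.gcd f.2.1 f.2.2) : ℤ) :=
      Int.dvd_coe_gcd h1 (Int.dvd_coe_gcd h2 h3)
    rw [h] at this
    exact isUnit_of_dvd_one (by exact_mod_cast this)
  · intro h
    have := h (Int.gcd f.1 (Int.gcd f.2.1 f.2.2) : ℤ) (Int.gcd_dvd_left _ _)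
      ((Int.gcd_dvd_right _ _).trans (Int.gcd_dvd_left _ _))
      ((Int.gcd_dvd_right _ _).trans (Int.gcd_dvd_right _ _))
    rw [Int.isUnit_iff] at this
    omega

lemma prim_act {f : ℤ × ℤ × ℤ} (hf : IsPrimitiveForm f) {α β γ δ : ℤ}
    (h : α * δ - β * γ = 1) : IsPrimitiveForm (act f α β γ δ) := by
  rw [prim_iff] at *
  intro k h1 h2 h3
  have hk := act_inv f h
  set g := act f α β γ δ
  apply hf k
  · rw [← hk]; simp only [act]
    exact dvd_add (dvd_add (h1.mul_right _) ((h2.mul_right _).mul_right _)) (h3.mul_right _)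
  · rw [← hk]; simp only [act]
    refine dvd_add (dvd_add ?_ (h2.mul_right _)) ?_
    · obtain ⟨r, hr⟩ := h1; rw [hr]; exact ⟨2 * r * δ * (-β), by ring⟩
    · obtain ⟨r, hr⟩ := h3; rw [hr]; exact ⟨2 * r * (-γ) * α, by ring⟩
  · rw [← hk]; simp only [act]
    exact dvd_add (dvd_add (h1.mul_right _) ((h2.mul_right _).mul_right _)) (h3.mul_right _)

/-- nonsquare discriminants -/
lemma a_ne {d : ℤ} (hd : ¬ IsSquare d) {f : ℤ × ℤ × ℤ} (h : formDisc f = d) : f.1 ≠ 0 := by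
  intro h0
  apply hd
  rw [← h, formDisc, h0]
  exact ⟨f.2.1, by ring⟩

lemma reduce {d : ℤ} (hd : ¬ IsSquare d) (hd0 : 0 < d) (f : PForm d) :
    ∃ g : PForm d, formEquiv f.1 g.1 ∧ |g.1.1| ≤ d ∧ |g.1.2.1| ≤ d ∧ |g.1.2.2| ≤ d := by
  let P : ℕ → Prop := fun k => ∃ g : PForm d, formEquiv f.1 g.1 ∧ g.1.1.natAbs = k
  have hP : ∃ k, P k := ⟨_, f, formEquiv_equivalence.1 _, rfl⟩
  classical
  obtain ⟨g, hg, hgk⟩ := Nat.find_spec hP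
  have hmin : ∀ g' : PForm d, formEquiv f.1 g'.1 → Nat.find hP ≤ g'.1.1.natAbs :=
    fun g' h' => Nat.find_min' hP ⟨g', h', rfl⟩
  have ha := a_ne hd g.2.2
  obtain ⟨⟨a, b, c⟩, hgp, hgd⟩ := g
  simp only at ha hgk hg
  -- shift
  obtain ⟨j, hj⟩ : ∃ j : ℤ, |2 * a * j + b| ≤ |a| := by
    have h2 : (0:ℤ) < 2 * |a| := by have := abs_pos.2 ha; omega
    have e1 := Int.emod_add_mul_ediv (b + |a|) (2 * |a|)
    have e2 := Int.emod_nonneg (b + |a|) h2.ne'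
    have e3 := Int.emod_lt_of_pos (b + |a|) h2
    set q := (b + |a|) / (2 * |a|)
    rcases abs_cases a with ⟨h, _⟩ | ⟨h, _⟩
    · refine ⟨-q, ?_⟩
      have e4 : |a| * q = a * q := by rw [h]
      rw [abs_le]; constructor <;> nlinarith
    · refine ⟨q, ?_⟩
      have e4 : |a| * q = -(a * q) := by rw [h]; ring
      rw [abs_le]; constructor <;> nlinarith
  have hdet : (1:ℤ) * 1 - j * 0 = 1 := by ring
  set g1 := act (a, b, c) 1 j 0 1 with hg1
  have hg1e : formEquiv (a, b, c) g1 := (formEquiv_iff _ _).2 ⟨1, j, 0, 1, hdet, rfl⟩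
  have hg1f := formEquiv_equivalence.3 hg hg1e
  have hp1 := prim_act hgp hdet
  have hd1 : formDisc g1 = d := (act_disc _ hdet).trans hgd
  have hdet2 : (0:ℤ) * 0 - (-1) * 1 = 1 := by ring
  have hg2e : formEquiv g1 (act g1 0 (-1) 1 0) := (formEquiv_iff _ _).2 ⟨_, _, _, _, hdet2, rfl⟩
  have hm := hmin ⟨act g1 0 (-1) 1 0, prim_act hp1 hdet2, (act_disc _ hdet2).trans hd1⟩
    (formEquiv_equivalence.3 hg1f hg2e)
  refine ⟨⟨g1, hp1, hd1⟩, hg1f, ?_⟩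
  have v1 : g1.1 = a := by simp [hg1, act]
  have v2 : g1.2.1 = 2 * a * j + b := by simp [hg1, act]
  have v3 : (act g1 0 (-1) 1 0).1 = g1.2.2 := by simp [act]
  simp only [v3, ← hgk] at hm
  have hm' : |a| ≤ |g1.2.2| := by
    rw [Int.abs_eq_natAbs, Int.abs_eq_natAbs]; exact_mod_cast hm
  set C := g1.2.2
  simp only [v1, v2]
  have hd2 : (2 * a * j + b) ^ 2 - 4 * a * C = d := by rw [← hd1, formDisc, v1, v2]
  set B := 2 * a * j + b
  have hB : B ^ 2 ≤ a ^ 2 := sq_le_sq.2 hj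
  have hapos : 0 < |a| := abs_pos.2 ha
  have hmul : |a| * |a| ≤ |a| * |C| := mul_le_mul_of_nonneg_left hm' hapos.le
  have haa : |a| * |a| = a ^ 2 := by rw [← sq, sq_abs]
  have hneg : a * C < 0 := by
    by_contra hh
    push Not at hh
    have : |a| * |C| = a * C := by rw [← abs_mul, abs_of_nonneg hh]
    nlinarith
  have hac : |a| * |C| = -(a * C) := by rw [← abs_mul, abs_of_neg hneg]
  have h1C : |C| ≤ |a| * |C| := le_mul_of_one_le_left (abs_nonneg _) hapos
  have hsq := sq_nonneg B
  refine ⟨?_, ?_, ?_⟩ <;> nlinarith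

lemma cls_finite {d : ℤ} (hd : ¬ IsSquare d) (hd0 : 0 < d) : Finite (Cls d) := by
  have hfin : Finite {g : PForm d // |g.1.1| ≤ d ∧ |g.1.2.1| ≤ d ∧ |g.1.2.2| ≤ d} := by
    let φ : {g : PForm d // |g.1.1| ≤ d ∧ |g.1.2.1| ≤ d ∧ |g.1.2.2| ≤ d} →
      (Set.Icc (-d) d) × (Set.Icc (-d) d) × (Set.Icc (-d) d) := fun g =>
      (⟨g.1.1.1, abs_le.1 g.2.1⟩, ⟨g.1.1.2.1, abs_le.1 g.2.2.1⟩, ⟨g.1.1.2.2, abs_le.1 g.2.2.2⟩)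
    apply Finite.of_injective φ
    rintro ⟨⟨⟨a, b, c⟩, h1⟩, h2⟩ ⟨⟨⟨a', b', c'⟩, h1'⟩, h2'⟩ h
    simp only [φ, Prod.mk.injEq] at h
    have e1 : a = a' := congrArg Subtype.val h.1
    have e2 : b = b' := congrArg Subtype.val h.2.1
    have e3 : c = c' := congrArg Subtype.val h.2.2
    subst e1; subst e2; subst e3
    rfl
  apply Finite.of_surjective (fun g : {g : PForm d // |g.1.1| ≤ d ∧ |g.1.2.1| ≤ d ∧ |g.1.2.2| ≤ d} =>
    (Quot.mk _ g.1 : Cls d))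
  intro q
  induction q using Quot.ind with
  | mk f =>
    obtain ⟨g, hg, hb⟩ := reduce hd hd0 f
    exact ⟨⟨g, hb⟩, (cls_eq.2 hg).symm⟩


lemma eps_spec {d : ℤ} (hd0 : 0 < d) (hne : ∃ t u : ℕ, 0 < t ∧ 0 < u ∧ (t:ℤ) ^ 2 - d * (u:ℤ) ^ 2 = 4) :
    0 < td d ∧ 0 < ud d ∧ (td d : ℤ) ^ 2 - d * (ud d : ℤ) ^ 2 = 4 := by
  have h1 : td d ∈ {t : ℕ | 0 < t ∧ ∃ u : ℕ, 0 < u ∧ (t : ℤ) ^ 2 - d * (u : ℤ) ^ 2 = 4} := by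
    apply Nat.sInf_mem
    obtain ⟨t, u, ht, hu, h⟩ := hne
    exact ⟨t, ht, u, hu, h⟩
  have h2 : ud d ∈ {u : ℕ | 0 < u ∧ (td d : ℤ) ^ 2 - d * (u : ℤ) ^ 2 = 4} := by
    apply Nat.sInf_mem
    obtain ⟨_, u, hu, h⟩ := h1
    exact ⟨u, hu, h⟩
  exact ⟨h1.1, h2.1, h2.2⟩

lemma td_le {d : ℤ} {t u : ℕ} (ht : 0 < t) (hu : 0 < u) (h : (t:ℤ) ^ 2 - d * (u:ℤ) ^ 2 = 4) :
    td d ≤ t := Nat.sInf_le ⟨ht, u, hu, h⟩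

/-- value of a unit -/
noncomputable def un (d : ℤ) (t w : ℤ) : ℝ := ((t:ℝ) + w * Real.sqrt d) / 2

lemma un_mul_conj {d : ℤ} (hd0 : 0 < d) {t w : ℤ} (h : t ^ 2 - d * w ^ 2 = 4) :
    un d t w * un d t (-w) = 1 := by
  have hs : Real.sqrt d ^ 2 = d := Real.sq_sqrt (by exact_mod_cast hd0.le)
  have h' : (t:ℝ) ^ 2 - d * w ^ 2 = 4 := by exact_mod_cast h
  simp only [un]; push_cast
  linear_combination (-(w:ℝ) ^ 2 / 4) * hs + h' / 4

lemma eps_eq_un (d : ℤ) : eps d = un d (td d) (ud d) := by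
  simp [eps, un]

lemma eps_gt_one {d : ℤ} (hd0 : 0 < d)
    (hne : ∃ t u : ℕ, 0 < t ∧ 0 < u ∧ (t:ℤ) ^ 2 - d * (u:ℤ) ^ 2 = 4) : 1 < eps d := by
  obtain ⟨h1, h2, h3⟩ := eps_spec hd0 hne
  have h4 : (2:ℤ) < td d := by
    have : 0 < d * (ud d : ℤ) ^ 2 := by positivity
    nlinarith
  have h5 : (2:ℝ) < td d := by exact_mod_cast h4
  have : 0 < (ud d : ℝ) * Real.sqrt d := by
    have : (0:ℝ) < d := by exact_mod_cast hd0
    positivity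
  rw [eps]; linarith

/-- no unit strictly between 1 and `eps`. -/
lemma eps_le_un {d : ℤ} (hd0 : 0 < d)
    (hne : ∃ t u : ℕ, 0 < t ∧ 0 < u ∧ (t:ℤ) ^ 2 - d * (u:ℤ) ^ 2 = 4) {t w : ℤ}
    (h : t ^ 2 - d * w ^ 2 = 4) (h1 : 1 < un d t w) : eps d ≤ un d t w := by
  have hc := un_mul_conj hd0 h
  have hcp : 0 < un d t (-w) := by
    by_contra hh
    push Not at hh
    nlinarith
  have hc1 : un d t (-w) < 1 := by
    by_contra hh
    push Not at hh
    nlinarith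
  have hsq : 0 < Real.sqrt d := Real.sqrt_pos.2 (by exact_mod_cast hd0)
  have ht : 0 < t := by
    have : (0:ℝ) < t := by
      simp only [un] at h1 hcp; push_cast at hcp; linarith
    exact_mod_cast this
  have hw : 0 < w := by
    have : (0:ℝ) < w := by
      simp only [un] at h1 hc1; push_cast at hc1
      have : 0 < (w:ℝ) * Real.sqrt d := by linarith
      exact (pos_iff_pos_of_mul_pos this).2 hsq
    exact_mod_cast this
  lift t to ℕ using ht.le
  lift w to ℕ using hw.le
  obtain ⟨p1, p2, p3⟩ := eps_spec hd0 hne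
  have hle := td_le (by exact_mod_cast ht) (by exact_mod_cast hw) h
  have hlu : ud d ≤ w := by
    have hle' : (td d : ℤ) ≤ t := by exact_mod_cast hle
    have : (td d : ℤ) ^ 2 ≤ t ^ 2 := by nlinarith
    have h6 : d * (ud d : ℤ) ^ 2 ≤ d * (w : ℤ) ^ 2 := by linarith
    have h7 := le_of_mul_le_mul_left h6 hd0
    exact_mod_cast (le_abs_self _).trans (abs_le_of_sq_le_sq h7 (by positivity))
  rw [eps]; simp only [un]
  push_cast
  have a1 : (td d : ℝ) ≤ t := by exact_mod_cast hle
  have a2 : (ud d : ℝ) ≤ w := by exact_mod_cast hlu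
  nlinarith

lemma parity {d t w : ℤ} (h : t ^ 2 - d * w ^ 2 = 4) : (2:ℤ) ∣ t - d * w := by
  rcases Int.even_or_odd' t with ⟨k, rfl | rfl⟩ <;> rcases Int.even_or_odd' w with ⟨l, rfl | rfl⟩ <;>
  rcases Int.even_or_odd' d with ⟨m, rfl | rfl⟩ <;> ring_nf at h ⊢ <;> omega

lemma un_mul {d : ℤ} (hd0 : 0 < d) {t w t' w' : ℤ} (h : t ^ 2 - d * w ^ 2 = 4)
    (h' : t' ^ 2 - d * w' ^ 2 = 4) :
    ∃ t'' w'' : ℤ, t'' ^ 2 - d * w'' ^ 2 = 4 ∧ un d t w * un d t' w' = un d t'' w'' := by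
  have hs : Real.sqrt d ^ 2 = d := Real.sq_sqrt (by exact_mod_cast hd0.le)
  obtain ⟨k, hk⟩ := parity h
  obtain ⟨k', hk'⟩ := parity h'
  have e1 : t = 2 * k + d * w := by linarith
  have e2 : t' = 2 * k' + d * w' := by linarith
  obtain ⟨r, hr⟩ : ∃ r, d * d + d = 2 * r := by
    rcases Int.even_or_odd' d with ⟨m, rfl | rfl⟩
    · exact ⟨2 * m * m + m, by ring⟩
    · exact ⟨2 * m * m + 3 * m + 1, by ring⟩
  have E1 : ∃ T, t * t' + d * w * w' = 2 * T :=
    ⟨2 * k * k' + k * d * w' + k' * d * w + r * w * w', by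
      rw [e1, e2]; linear_combination w * w' * hr⟩
  have E2 : ∃ W, t * w' + t' * w = 2 * W := ⟨k * w' + k' * w + d * w * w', by rw [e1, e2]; ring⟩
  obtain ⟨T, hT⟩ := E1
  obtain ⟨W, hW⟩ := E2
  refine ⟨T, W, ?_, ?_⟩
  · have : 4 * (T ^ 2 - d * W ^ 2) = 4 * 4 := by
      have : 4 * (T ^ 2 - d * W ^ 2) = (2 * T) ^ 2 - d * (2 * W) ^ 2 := by ring
      rw [this, ← hT, ← hW]
      linear_combination (t' ^ 2 - d * w' ^ 2) * h + 4 * h'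
    linarith
  · have hT' : (t:ℝ) * t' + d * w * w' = 2 * T := by exact_mod_cast hT
    have hW' : (t:ℝ) * w' + t' * w = 2 * W := by exact_mod_cast hW
    simp only [un]
    linear_combination (w * w' / 4 : ℝ) * hs + hT' / 4 + Real.sqrt d * hW' / 4

lemma eps_zpow {d : ℤ} (hd0 : 0 < d)
    (hne : ∃ t u : ℕ, 0 < t ∧ 0 < u ∧ (t:ℤ) ^ 2 - d * (u:ℤ) ^ 2 = 4) (j : ℤ) :
    ∃ t w : ℤ, t ^ 2 - d * w ^ 2 = 4 ∧ eps d ^ j = un d t w := by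
  have hn : ∀ k : ℕ, ∃ t w : ℤ, t ^ 2 - d * w ^ 2 = 4 ∧ eps d ^ k = un d t w := by
    intro k
    induction k with
    | zero => exact ⟨2, 0, by norm_num, by simp [un]⟩
    | succ k ih =>
      obtain ⟨t, w, h, e⟩ := ih
      obtain ⟨t', w', h', e'⟩ := un_mul hd0 h (eps_spec hd0 hne).2.2
      exact ⟨t', w', h', by rw [pow_succ, e, eps_eq_un, e']⟩
  obtain ⟨k, rfl | rfl⟩ := Int.eq_nat_or_neg j
  · simpa using hn k
  · obtain ⟨t, w, h, e⟩ := hn k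
    refine ⟨t, -w, by simpa using h, ?_⟩
    rw [zpow_neg, zpow_natCast, e]
    exact inv_eq_of_mul_eq_one_right (un_mul_conj hd0 h)

noncomputable def xi (d : ℤ) (f : ℤ × ℤ × ℤ) (x y : ℤ) : ℝ :=
  (f.1 : ℝ) * x + ((f.2.1 : ℝ) + Real.sqrt d) / 2 * y

noncomputable def sg (a : ℤ) : ℝ := if 0 < a then 1 else -1

noncomputable def et (d : ℤ) (f : ℤ × ℤ × ℤ) (x y : ℤ) : ℝ :=
  sg f.1 * ((f.1 : ℝ) * x + ((f.2.1 : ℝ) - Real.sqrt d) / 2 * y)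

lemma sg_mul (a : ℤ) : sg a * a = |(a:ℝ)| := by
  unfold sg
  split_ifs with h
  · rw [abs_of_pos (by exact_mod_cast h)]; ring
  · push Not at h
    rw [abs_of_nonpos (by exact_mod_cast h)]; ring

lemma sg_sq (a : ℤ) : sg a * sg a = 1 := by
  unfold sg; split_ifs <;> norm_num

lemma xi_mul_et {d : ℤ} (hd0 : 0 < d) {f : ℤ × ℤ × ℤ} (h : formDisc f = d) (x y : ℤ) :
    xi d f x y * et d f x y = |(f.1:ℝ)| * formVal f x y := by
  have hs : Real.sqrt d ^ 2 = d := Real.sq_sqrt (by exact_mod_cast hd0.le)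
  have h' : (f.2.1:ℝ) ^ 2 - 4 * f.1 * f.2.2 = d := by exact_mod_cast h
  rw [← sg_mul]
  simp only [xi, et, formVal]; push_cast
  linear_combination (- sg f.1 * (y:ℝ) ^ 2 / 4) * hs + sg f.1 * y ^ 2 / 4 * h'

lemma xi_et_inj {d : ℤ} (hd0 : 0 < d) {f : ℤ × ℤ × ℤ} (ha : f.1 ≠ 0) {x y x' y' : ℤ}
    (h1 : xi d f x y = xi d f x' y') (h2 : et d f x y = et d f x' y') : x = x' ∧ y = y' := by
  have hsq : Real.sqrt d ≠ 0 := (Real.sqrt_pos.2 (by exact_mod_cast hd0)).ne'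
  have ha' : (f.1 : ℝ) ≠ 0 := by exact_mod_cast ha
  have h3 : sg f.1 * et d f x y = sg f.1 * et d f x' y' := by rw [h2]
  simp only [et, ← mul_assoc, sg_sq] at h3
  simp only [xi] at h1
  have hy : (y:ℝ) = y' := by
    apply mul_left_cancel₀ hsq
    linear_combination h1 - h3
  have hx : (x:ℝ) = x' := by
    apply mul_left_cancel₀ ha'
    rw [hy] at h1
    linarith
  exact ⟨by exact_mod_cast hx, by exact_mod_cast hy⟩

lemma bezout3 {f : ℤ × ℤ × ℤ} (hf : IsPrimitiveForm f) :
    ∃ r s t : ℤ, r * f.1 + s * f.2.1 + t * f.2.2 = 1 := by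
  unfold IsPrimitiveForm at hf
  have h1 := Int.gcd_eq_gcd_ab f.1 (Int.gcd f.2.1 f.2.2)
  have h2 := Int.gcd_eq_gcd_ab f.2.1 f.2.2
  rw [hf, h2] at h1
  push_cast at h1
  generalize Int.gcdA f.2.1 f.2.2 = p1 at h1
  generalize Int.gcdB f.2.1 f.2.2 = p2 at h1
  generalize Int.gcdA f.1 (f.2.1 * p1 + f.2.2 * p2) = p3 at h1
  generalize Int.gcdB f.1 (f.2.1 * p1 + f.2.2 * p2) = p4 at h1
  exact ⟨p3, p1 * p4, p2 * p4, by linear_combination -h1⟩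

lemma aut_forward {d : ℤ} (hd0 : 0 < d) {f : ℤ × ℤ × ℤ} (hp : IsPrimitiveForm f)
    (h : formDisc f = d) {α β γ δ : ℤ} (hdet : α * δ - β * γ = 1) (hact : act f α β γ δ = f) :
    ∃ t w : ℤ, t ^ 2 - d * w ^ 2 = 4 ∧ ∀ x y : ℤ,
      xi d f (α * x + β * y) (γ * x + δ * y) = un d t w * xi d f x y ∧
      et d f (α * x + β * y) (γ * x + δ * y) = un d t (-w) * et d f x y := by
  obtain ⟨a, b, c⟩ := f
  simp only [act, Prod.mk.injEq] at hact
  obtain ⟨e1, e2, e3⟩ := hact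
  have L1 : a * (δ - α) = b * γ := by
    have : 2 * (a * (δ - α)) = 2 * (b * γ) := by
      linear_combination -2 * δ * e1 + γ * e2 + (2 * a * α + b * γ) * hdet
    linarith
  have L2 : a * β = - (c * γ) := by
    have : 2 * (a * β) = 2 * (-(c * γ)) := by
      linear_combination δ * e2 - 2 * γ * e3 - (2 * a * β + b * δ) * hdet
    linarith
  have L3 : b * β = c * (α - δ) := by
    have : 2 * (b * β) = 2 * (c * (α - δ)) := by
      linear_combination 2 * α * e3 - β * e2 - (b * β + 2 * c * δ) * hdet
    linarith
  obtain ⟨r, s, t, hb⟩ := bezout3 hp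
  simp only at hb
  set w := r * γ + s * (δ - α) - t * β with hw
  have W1 : γ = a * w := by rw [hw]; linear_combination (-γ) * hb + (-s) * L1 + t * L2
  have W2 : δ - α = b * w := by
    rw [hw]; linear_combination (-(δ - α)) * hb + r * L1 + t * L3
  have W3 : β = - (c * w) := by
    rw [hw]; linear_combination (-β) * hb + (r) * L2 + s * L3
  have hd : b ^ 2 - 4 * a * c = d := h
  refine ⟨α + δ, w, ?_, ?_⟩
  · have : δ = α + b * w := by linarith
    rw [this, W1, W3] at hdet
    rw [this, ← hd]
    linear_combination 4 * hdet
  · intro x y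
    have hs : Real.sqrt d ^ 2 = d := Real.sq_sqrt (by exact_mod_cast hd0.le)
    have hd' : (b:ℝ) ^ 2 - 4 * a * c = d := by exact_mod_cast hd
    have hδ : δ = α + b * w := by linarith
    rw [hδ, W1, W3]
    constructor
    · simp only [xi, un]; push_cast
      linear_combination (-(y:ℝ) * w / 4) * hs + (y * w / 4 : ℝ) * hd'
    · simp only [et, un]; push_cast
      linear_combination sg a * ((-(y:ℝ) * w / 4) * hs + (y * w / 4 : ℝ) * hd')

lemma aut_backward {d : ℤ} (hd0 : 0 < d) {f : ℤ × ℤ × ℤ}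
    (h : formDisc f = d) {t w : ℤ} (htw : t ^ 2 - d * w ^ 2 = 4) :
    ∃ α β γ δ : ℤ, α * δ - β * γ = 1 ∧ act f α β γ δ = f ∧ ∀ x y : ℤ,
      xi d f (α * x + β * y) (γ * x + δ * y) = un d t w * xi d f x y ∧
      et d f (α * x + β * y) (γ * x + δ * y) = un d t (-w) * et d f x y := by
  obtain ⟨a, b, c⟩ := f
  have hd : b ^ 2 - 4 * a * c = d := h
  obtain ⟨e, he⟩ : ∃ e, t = b * w + 2 * e := by
    obtain ⟨k, hk⟩ := parity htw
    rcases Int.even_or_odd' b with ⟨m, rfl | rfl⟩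
    · exact ⟨k + (2 * m * m - 2 * a * c) * w - m * w, by linear_combination hk - w * hd⟩
    · exact ⟨k + (2 * m * m + m - 2 * a * c) * w, by linear_combination hk - w * hd⟩
  have hdet : e * (e + b * w) - (-(c * w)) * (a * w) = 1 := by
    rw [he, ← hd] at htw
    linarith
  refine ⟨e, -(c * w), a * w, e + b * w, hdet, ?_, ?_⟩
  · simp only [act, Prod.mk.injEq]
    refine ⟨?_, ?_, ?_⟩
    · linear_combination a * hdet
    · linear_combination b * hdet
    · linear_combination c * hdet
  · intro x y
    have hs : Real.sqrt d ^ 2 = d := Real.sq_sqrt (by exact_mod_cast hd0.le)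
    have hd' : (b:ℝ) ^ 2 - 4 * a * c = d := by exact_mod_cast hd
    rw [he]
    constructor
    · simp only [xi, un]; push_cast
      linear_combination (-(y:ℝ) * w / 4) * hs + (y * w / 4 : ℝ) * hd'
    · simp only [et, un]; push_cast
      linear_combination sg a * ((y * w / 4 : ℝ) * hd' + (-(y:ℝ) * w / 4) * hs)

/-- fundamental domain -/
def Dom (d : ℤ) (f : ℤ × ℤ × ℤ) (x y : ℤ) : Prop :=
  et d f x y ≤ xi d f x y ∧ xi d f x y < eps d ^ 2 * et d f x y

lemma dom_pos {d : ℤ} (he : 1 < eps d) {f : ℤ × ℤ × ℤ} {x y : ℤ} (h : Dom d f x y) :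
    0 < xi d f x y ∧ 0 < et d f x y := by
  have h2 : 0 < (eps d ^ 2 - 1) * et d f x y := by have := h.1; have := h.2; linarith
  have h3 : 0 < eps d ^ 2 - 1 := by nlinarith
  have := (pos_iff_pos_of_mul_pos h2).1 h3
  exact ⟨this.trans_le h.1, this⟩

lemma dom_unique {d : ℤ} (hd0 : 0 < d)
    (hne : ∃ t u : ℕ, 0 < t ∧ 0 < u ∧ (t:ℤ) ^ 2 - d * (u:ℤ) ^ 2 = 4)
    {f : ℤ × ℤ × ℤ} (hp : IsPrimitiveForm f) (ha : f.1 ≠ 0)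
    (h : formDisc f = d) {α β γ δ : ℤ} (hdet : α * δ - β * γ = 1) (hact : act f α β γ δ = f)
    {x y : ℤ} (h1 : Dom d f x y) (h2 : Dom d f (α * x + β * y) (γ * x + δ * y)) :
    α * x + β * y = x ∧ γ * x + δ * y = y := by
  obtain ⟨t, w, htw, hv⟩ := aut_forward hd0 hp h hdet hact
  have hE := eps_gt_one hd0 hne
  obtain ⟨p1, p2⟩ := dom_pos hE h1
  obtain ⟨p1', p2'⟩ := dom_pos hE h2
  obtain ⟨d1, d2⟩ := h1
  obtain ⟨d1', d2'⟩ := h2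
  have hc := un_mul_conj hd0 htw
  have htw' : t ^ 2 - d * (-w) ^ 2 = 4 := by simpa using htw
  obtain ⟨hx, hy⟩ := hv x y
  set e := un d t w with hedef
  set e' := un d t (-w) with he'def
  set X := xi d f x y
  set Y := et d f x y
  rw [hx] at d1' d2' p1'
  rw [hy] at d1' d2' p2'
  have he : 0 < e := (pos_iff_pos_of_mul_pos p1').2 p1
  have he' : 0 < e' := (pos_iff_pos_of_mul_pos p2').2 p2
  have hEpos : 0 < eps d := by linarith
  have key : e = 1 := by
    rcases lt_trichotomy e 1 with hlt | heq | hgt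
    · exfalso
      have : 1 < e' := by nlinarith
      have hle := eps_le_un hd0 hne htw' this
      have : e' * Y < e * eps d ^ 2 * Y := by nlinarith
      have := lt_of_mul_lt_mul_right this p2.le
      have : e' * e' < eps d ^ 2 := by nlinarith
      nlinarith
    · exact heq
    · exfalso
      have hle := eps_le_un hd0 hne htw hgt
      have : e * Y < eps d ^ 2 * e' * Y := by nlinarith
      have := lt_of_mul_lt_mul_right this p2.le
      have : e * e < eps d ^ 2 := by nlinarith
      nlinarith
  have key' : e' = 1 := by rw [key, one_mul] at hc; exact hc
  rw [key, one_mul] at hx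
  rw [key', one_mul] at hy
  exact xi_et_inj hd0 ha hx hy

lemma dom_exists {d : ℤ} (hd0 : 0 < d)
    (hne : ∃ t u : ℕ, 0 < t ∧ 0 < u ∧ (t:ℤ) ^ 2 - d * (u:ℤ) ^ 2 = 4)
    {f : ℤ × ℤ × ℤ} (ha : f.1 ≠ 0)
    (h : formDisc f = d) {x y : ℤ} (hpos : 0 < formVal f x y) :
    ∃ α β γ δ : ℤ, α * δ - β * γ = 1 ∧ act f α β γ δ = f ∧
      Dom d f (α * x + β * y) (γ * x + δ * y) := by
  have hE := eps_gt_one hd0 hne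
  have hEpos : 0 < eps d := by linarith
  have hprod : 0 < xi d f x y * et d f x y := by
    rw [xi_mul_et hd0 h]
    have : (f.1:ℝ) ≠ 0 := by exact_mod_cast ha
    have : (0:ℝ) < formVal f x y := by exact_mod_cast hpos
    positivity
  -- sign
  obtain ⟨s, hs1, hsx, hsy⟩ : ∃ s : ℤ, s ^ 2 = 1 ∧ 0 < (s:ℝ) * xi d f x y ∧ 0 < (s:ℝ) * et d f x y := by
    rcases pos_and_pos_or_neg_and_neg_of_mul_pos hprod with ⟨h1, h2⟩ | ⟨h1, h2⟩
    · exact ⟨1, by norm_num, by simpa using h1, by simpa using h2⟩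
    · exact ⟨-1, by norm_num, by push_cast; linarith, by push_cast; linarith⟩
  set X := (s:ℝ) * xi d f x y with hX
  set Y := (s:ℝ) * et d f x y with hY
  have hE2 : 1 < eps d ^ 2 := by nlinarith
  obtain ⟨j, hj1, hj2⟩ := exists_mem_Ico_zpow (x := X / Y) (y := eps d ^ 2) (by positivity) hE2
  obtain ⟨t, w, htw, hu⟩ := eps_zpow hd0 hne (-j)
  have htw2 : (s * t) ^ 2 - d * (s * w) ^ 2 = 4 := by
    linear_combination htw + (t ^ 2 - d * w ^ 2) * hs1
  obtain ⟨α, β, γ, δ, hdet, hact, hv⟩ := aut_backward hd0 h htw2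
  refine ⟨α, β, γ, δ, hdet, hact, ?_⟩
  have hc := un_mul_conj hd0 htw
  rw [← hu] at hc
  have hu' : un d t (-w) = eps d ^ j := by
    have : eps d ^ (-j) * eps d ^ j = 1 := by rw [← zpow_add₀ hEpos.ne']; simp
    have hz : eps d ^ (-j) ≠ 0 := (zpow_pos hEpos _).ne'
    exact mul_left_cancel₀ hz (hc.trans this.symm)
  have q1 : un d (s * t) (s * w) = s * eps d ^ (-j) := by rw [hu]; simp only [un]; push_cast; ring
  have q2 : un d (s * t) (-(s * w)) = s * eps d ^ j := by
    rw [← hu']; simp only [un]; push_cast; ring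
  have q3 : (eps d ^ 2) ^ j = eps d ^ j * eps d ^ j := by
    rw [← zpow_natCast, ← zpow_mul, ← zpow_add₀ hEpos.ne']; congr 1; push_cast; ring
  have q4 : (eps d ^ 2) ^ (j + 1) = eps d ^ 2 * (eps d ^ j * eps d ^ j) := by
    rw [zpow_add_one₀ (by positivity), q3]; ring
  rw [q3, le_div_iff₀ hsy] at hj1
  rw [q4, div_lt_iff₀ hsy] at hj2
  have hzz : eps d ^ (-j) * eps d ^ j = 1 := by rw [← zpow_add₀ hEpos.ne']; simp
  set z := eps d ^ j with hz
  set z' := eps d ^ (-j) with hz'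
  have hz'p : 0 < z' := zpow_pos hEpos _
  have r1 : xi d f (α * x + β * y) (γ * x + δ * y) = z' * X := by
    rw [(hv x y).1, q1, hX]; ring
  have r2 : et d f (α * x + β * y) (γ * x + δ * y) = z * Y := by
    rw [(hv x y).2, q2, hY]; ring
  constructor
  · rw [r1, r2]
    have := mul_le_mul_of_nonneg_left hj1 hz'p.le
    calc z * Y = z' * z * z * Y := by rw [hzz]; ring
      _ ≤ _ := by linarith
  · rw [r1, r2]
    have := mul_lt_mul_of_pos_left hj2 hz'p
    calc z' * X < _ := this
      _ = z' * z * (eps d ^ 2 * (z * Y)) := by ring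
      _ = _ := by rw [hzz]; ring

/-- the count for one form -/
lemma dom_count {d : ℤ} (hd0 : 0 < d) (he : 1 < eps d) {f : ℤ × ℤ × ℤ} (ha : f.1 ≠ 0)
    (h : formDisc f = d) {u : ℕ} (hu : 0 < u) :
    Tendsto (fun X : ℕ => (Nat.card {v : ℤ × ℤ // Dom d f v.1 v.2 ∧ (u:ℤ) * formVal f v.1 v.2 ≤ X} : ℝ) / X)
      atTop (nhds (Real.log (eps d) / (u * Real.sqrt d))) := by
  have hsq : 0 < Real.sqrt d := Real.sqrt_pos.2 (by exact_mod_cast hd0)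
  have ha' : (f.1:ℝ) ≠ 0 := by exact_mod_cast ha
  have hapos : 0 < |(f.1:ℝ)| := abs_pos.2 ha'
  have hu' : (0:ℝ) < u := by exact_mod_cast hu
  have hdet : (f.1:ℝ) * (sg f.1 * (((f.2.1 : ℝ) - Real.sqrt d) / 2)) -
      ((f.2.1 : ℝ) + Real.sqrt d) / 2 * |(f.1:ℝ)| = - (|(f.1:ℝ)| * Real.sqrt d) := by
    rw [← sg_mul]; ring
  have key := lattice_count (f.1 : ℝ) (((f.2.1 : ℝ) + Real.sqrt d) / 2) |(f.1:ℝ)|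
    (sg f.1 * (((f.2.1 : ℝ) - Real.sqrt d) / 2)) (eps d) (by rw [hdet]; simpa using ⟨ha, hsq.ne'⟩) he
  rw [hdet, abs_neg, abs_of_pos (mul_pos hapos hsq)] at key
  have hlim : Tendsto (fun X : ℕ => (|(f.1:ℝ)| / u) * (X:ℝ)) atTop atTop :=
    tendsto_natCast_atTop_atTop.const_mul_atTop (by positivity)
  have key2 := (key.comp hlim).const_mul (|(f.1:ℝ)| / u)
  have e1 : |(f.1:ℝ)| / u * (Real.log (eps d) / (|(f.1:ℝ)| * Real.sqrt d)) =
      Real.log (eps d) / (u * Real.sqrt d) := by field_simp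
  rw [e1] at key2
  refine key2.congr fun X => ?_
  simp only [Function.comp]
  rw [← div_div, mul_div_assoc', mul_div_assoc', mul_div_cancel_left₀ _ (by positivity)]
  congr 2
  apply Nat.card_congr
  apply Equiv.subtypeEquivRight
  intro v
  have w1 : (f.1:ℝ) * v.1 + (((f.2.1 : ℝ) + Real.sqrt d) / 2) * v.2 = xi d f v.1 v.2 := rfl
  have w2 : |(f.1:ℝ)| * v.1 + (sg f.1 * (((f.2.1 : ℝ) - Real.sqrt d) / 2)) * v.2 = et d f v.1 v.2 := by
    rw [← sg_mul, et]; ring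
  have hiff : xi d f v.1 v.2 * et d f v.1 v.2 ≤ |(f.1:ℝ)| / u * X ↔
      (u:ℤ) * formVal f v.1 v.2 ≤ X := by
    rw [xi_mul_et hd0 h, div_mul_eq_mul_div, mul_div_assoc, mul_le_mul_iff_right₀ hapos,
      le_div_iff₀ hu', mul_comm]
    norm_cast
  simp only [w1, w2, Dom, Set.mem_ofPred_eq, hiff, and_assoc]

/-- number of roots of `c² + n c + 1` mod `m` -/
def rho (n m : ℕ) : ℕ := ((range m).filter (fun c => m ∣ c ^ 2 + n * c + 1)).card

/-- The pairs `(d,u)` -/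
def pairs (n : ℕ) : Finset (ℕ × ℕ) := (range (n ^ 2) ×ˢ range (n ^ 2)).filter
      (fun p => 0 < p.1 ∧ 0 < p.2 ∧ (p.1 % 4 = 0 ∨ p.1 % 4 = 1) ∧ p.1 * p.2 ^ 2 = n ^ 2 - 4)

lemma pairs_spec {n : ℕ} (hn : 2 < n) {p : ℕ × ℕ} (hp : p ∈ pairs n) :
    (0:ℤ) < p.1 ∧ (0:ℤ) < p.2 ∧ (p.1:ℤ) * p.2 ^ 2 = n ^ 2 - 4 := by
  simp only [pairs, mem_filter] at hp
  obtain ⟨_, h1, h2, _, h3⟩ := hp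
  refine ⟨by exact_mod_cast h1, by exact_mod_cast h2, ?_⟩
  have h4 : 4 ≤ n ^ 2 := by nlinarith
  zify [h4] at h3
  exact h3

lemma nonsq {n : ℕ} (hn : 2 < n) {d u : ℤ} (h : d * u ^ 2 = n ^ 2 - 4) : ¬ IsSquare d := by
  rintro ⟨r, rfl⟩
  have h1 : (r * u) ^ 2 = (n:ℤ) ^ 2 - 4 := by rw [← h]; ring
  have hn' : (2:ℤ) < n := by exact_mod_cast hn
  rw [← sq_abs] at h1
  have h2 : |r * u| < n := by
    by_contra hh
    push Not at hh
    nlinarith [abs_nonneg (r * u)]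
  have h3 : |r * u| ≤ n - 1 := by omega
  nlinarith [abs_nonneg (r * u)]

lemma pell_ex {n : ℕ} (hn : 2 < n) {d : ℤ} {u : ℕ} (hu : 0 < u) (h : d * (u:ℤ) ^ 2 = n ^ 2 - 4) :
    ∃ t u : ℕ, 0 < t ∧ 0 < u ∧ (t:ℤ) ^ 2 - d * (u:ℤ) ^ 2 = 4 :=
  ⟨n, u, by omega, hu, by linarith⟩

abbrev Idx (n : ℕ) := Σ p : {p // p ∈ pairs n}, Cls (p.1.1 : ℤ)

noncomputable def rep {n : ℕ} (i : Idx n) : PForm (i.1.1.1 : ℤ) := Quot.out i.2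

abbrev W (n X : ℕ) := Σ i : Idx n, {v : ℤ × ℤ // Dom (i.1.1.1 : ℤ) (rep i).1 v.1 v.2 ∧
  ((i.1.1.2 : ℕ) : ℤ) * formVal (rep i).1 v.1 v.2 ≤ X}

def Tset (n X : ℕ) : Finset (Σ _ : ℕ, Σ _ : ℕ, ℕ) :=
  (Icc 1 X).sigma fun k => (Icc 1 (X / k ^ 2)).sigma fun m =>
    (range m).filter (fun c => m ∣ c ^ 2 + n * c + 1)

lemma Tset_card (n X : ℕ) : (Tset n X).card =
    ∑ k ∈ Icc 1 X, ∑ m ∈ Icc 1 (X / k ^ 2), rho n m := by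
  simp only [Tset, Finset.card_sigma, rho]

lemma mem_Tset {n X : ℕ} {t : Σ _ : ℕ, Σ _ : ℕ, ℕ} : t ∈ Tset n X ↔
    0 < t.1 ∧ 0 < t.2.1 ∧ t.2.1 * t.1 ^ 2 ≤ X ∧ t.2.2 < t.2.1 ∧
      t.2.1 ∣ t.2.2 ^ 2 + n * t.2.2 + 1 := by
  simp only [Tset, Finset.mem_sigma, mem_Icc, mem_filter, mem_range]
  constructor
  · rintro ⟨⟨h1, h2⟩, ⟨h3, h4⟩, h5, h6⟩
    exact ⟨h1, h3, (Nat.le_div_iff_mul_le (by positivity)).1 h4, h5, h6⟩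
  · rintro ⟨h1, h2, h3, h4, h5⟩
    refine ⟨⟨h1, ?_⟩, ⟨h2, (Nat.le_div_iff_mul_le (by positivity)).2 h3⟩, h4, h5⟩
    nlinarith [Nat.mul_le_mul h2 (Nat.mul_le_mul h1 (le_refl t.1))]

/-- the relation -/
def Rel (n u : ℕ) (f : ℤ × ℤ × ℤ) (x y : ℤ) (k m c : ℕ) : Prop :=
  ∃ α β γ δ : ℤ, α * δ - β * γ = 1 ∧ (u:ℤ) * (act f α β γ δ).1 = m ∧
    (u:ℤ) * (act f α β γ δ).2.1 = n + 2 * c ∧ x = k * α ∧ y = k * γ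

lemma rel_exists {n : ℕ} (hn : 2 < n) {d : ℤ} {u : ℕ} (hu : 0 < u)
    (hd : d * (u:ℤ) ^ 2 = n ^ 2 - 4) {f : ℤ × ℤ × ℤ} (hf : formDisc f = d) {x y : ℤ}
    (hpos : 0 < formVal f x y) {X : ℕ} (hX : (u:ℤ) * formVal f x y ≤ X) :
    ∃ t ∈ Tset n X, Rel n u f x y t.1 t.2.1 t.2.2 := by
  have hxy : x ≠ 0 ∨ y ≠ 0 := by
    by_contra hh
    push Not at hh
    rw [hh.1, hh.2] at hpos
    simp [formVal] at hpos
  have hg : 0 < Int.gcd x y := by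
    rcases Nat.eq_zero_or_pos (Int.gcd x y) with h | h
    · rw [Int.gcd_eq_zero_iff] at h
      rcases hxy with h' | h'
      · exact absurd h.1 h'
      · exact absurd h.2 h'
    · exact h
  obtain ⟨α, γ, hcop, hx, hy⟩ := Int.exists_gcd_one hg
  set k := Int.gcd x y
  obtain ⟨r, s, hrs⟩ := Int.isCoprime_iff_gcd_eq_one.2 hcop
  -- β = -s, δ = r
  have hdet0 : α * r - (-s) * γ = 1 := by linarith
  set g0 := act f α (-s) γ r with hg0
  have hval : formVal f x y = k ^ 2 * g0.1 := by
    rw [hx, hy, hg0]; simp only [formVal, act]; ring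
  have hk : (0:ℤ) < k := by exact_mod_cast hg
  have hg0pos : 0 < g0.1 := by
    rw [hval] at hpos
    exact (pos_iff_pos_of_mul_pos hpos).1 (by positivity)
  have hu' : (0:ℤ) < u := by exact_mod_cast hu
  obtain ⟨m, hm⟩ : ∃ m : ℕ, (u:ℤ) * g0.1 = m := ⟨((u:ℤ) * g0.1).toNat, by
    rw [Int.toNat_of_nonneg (by positivity)]⟩
  have hmpos : (0:ℤ) < m := by rw [← hm]; positivity
  have hdisc0 : formDisc g0 = d := (act_disc f hdet0).trans hf
  -- parity
  obtain ⟨b0, hb0⟩ : ∃ b0 : ℤ, (u:ℤ) * g0.2.1 = n + 2 * b0 := by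
    have h1 : ((u:ℤ) * g0.2.1) ^ 2 = (n:ℤ) ^ 2 + 2 * (2 * (u ^ 2 * g0.1 * g0.2.2 - 1)) := by
      have : g0.2.1 ^ 2 - 4 * g0.1 * g0.2.2 = d := hdisc0
      linear_combination (u:ℤ) ^ 2 * this + hd
    generalize (u:ℤ) * g0.2.1 = B at *
    generalize 2 * ((u:ℤ) ^ 2 * g0.1 * g0.2.2 - 1) = Z at *
    rcases Int.even_or_odd' B with ⟨p, rfl | rfl⟩ <;> rcases Int.even_or_odd' (n:ℤ) with ⟨q, hq | hq⟩
    · exact ⟨p - q, by rw [hq]; ring⟩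
    · exfalso; rw [hq] at h1; ring_nf at h1; omega
    · exfalso; rw [hq] at h1; ring_nf at h1; omega
    · exact ⟨p - q, by rw [hq]; ring⟩
  obtain ⟨c, hc⟩ : ∃ c : ℕ, b0 % m = c := ⟨(b0 % m).toNat, by
    rw [Int.toNat_of_nonneg (Int.emod_nonneg _ hmpos.ne')]⟩
  have hcm : c < m := by have := Int.emod_lt_of_pos b0 hmpos; rw [hc] at this; exact_mod_cast this
  have hb1 := Int.emod_add_mul_ediv b0 m
  rw [hc] at hb1
  set j := -(b0 / m) with hj
  have hbj : (c:ℤ) = b0 + m * j := by rw [hj]; linarith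
  have hdet1 : α * (α * 0 + 0 * 0 + (γ * j + r)) - (α * j + -s) * γ = 1 := by
    linear_combination hdet0
  have hG : act g0 1 j 0 1 = act f α (α * j + -s) γ (γ * j + r) := by
    rw [hg0, act_act]; congr 1 <;> ring
  have hdet2 : α * (γ * j + r) - (α * j + -s) * γ = 1 := by linear_combination hdet0
  set g1 := act f α (α * j + -s) γ (γ * j + r) with hg1
  have v1 : g1.1 = g0.1 := by rw [← hG]; simp [act]
  have v2 : g1.2.1 = 2 * g0.1 * j + g0.2.1 := by rw [← hG]; simp [act]
  have hB : (u:ℤ) * g1.2.1 = n + 2 * c := by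
    rw [v2, hbj]; linear_combination 2 * j * hm + hb0
  have hM : (u:ℤ) * g1.1 = m := by rw [v1, hm]
  refine ⟨⟨k, m, c⟩, ?_, α, (α * j + -s), γ, (γ * j + r), hdet2, hM, hB, by rw [hx]; ring, by rw [hy]; ring⟩
  rw [mem_Tset]
  refine ⟨hg, by exact_mod_cast hmpos, ?_, hcm, ?_⟩
  · rw [hval] at hX
    have : (m:ℤ) * k ^ 2 ≤ X := by rw [← hm]; linarith
    exact_mod_cast this
  · have hdisc1 : g1.2.1 ^ 2 - 4 * g1.1 * g1.2.2 = d := (act_disc f hdet2).trans hf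
    have : (c:ℤ) ^ 2 + n * c + 1 = m * (u * g1.2.2) := by
      have : 4 * ((c:ℤ) ^ 2 + n * c + 1) = 4 * (m * (u * g1.2.2)) := by
        linear_combination (u:ℤ) ^ 2 * hdisc1 + hd + 4 * u * g1.2.2 * hM - (u * g1.2.1 + n + 2 * c) * hB
      linarith
    have h2 : (m:ℤ) ∣ ((c ^ 2 + n * c + 1 : ℕ) : ℤ) := ⟨_, by push_cast; exact this⟩
    exact_mod_cast h2

lemma rel_unique_t {n u : ℕ} {f : ℤ × ℤ × ℤ} {x y : ℤ} {k m c k' m' c' : ℕ} (hk : 0 < k)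
    (hk' : 0 < k') (hc : c < m) (hc' : c' < m')
    (h : Rel n u f x y k m c) (h' : Rel n u f x y k' m' c') : k = k' ∧ m = m' ∧ c = c' := by
  obtain ⟨α, β, γ, δ, hdet, h1, h2, h3, h4⟩ := h
  obtain ⟨α', β', γ', δ', hdet', h1', h2', h3', h4'⟩ := h'
  have g1 : Int.gcd x y = k := by
    rw [h3, h4, Int.gcd_mul_left]
    have : Int.gcd α γ = 1 := by
      rw [← Int.isCoprime_iff_gcd_eq_one]; exact ⟨δ, -β, by linarith⟩
    rw [this]; simp
  have g2 : Int.gcd x y = k' := by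
    rw [h3', h4', Int.gcd_mul_left]
    have : Int.gcd α' γ' = 1 := by
      rw [← Int.isCoprime_iff_gcd_eq_one]; exact ⟨δ', -β', by linarith⟩
    rw [this]; simp
  have hkk : k = k' := g1.symm.trans g2
  subst hkk
  have hk0 : (k:ℤ) ≠ 0 := by exact_mod_cast hk.ne'
  have ea : α = α' := mul_left_cancel₀ hk0 (h3.symm.trans h3')
  have eg : γ = γ' := mul_left_cancel₀ hk0 (h4.symm.trans h4')
  subst ea; subst eg
  have em : (m:ℤ) = m' := by rw [← h1, ← h1']; simp [act]
  have em' : m = m' := by exact_mod_cast em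
  subst em'
  refine ⟨rfl, rfl, ?_⟩
  set j := δ * (β' - β) - β * (δ' - δ) with hj
  have E : α * (δ' - δ) = γ * (β' - β) := by linarith
  have j1 : β' = β + α * j := by rw [hj]; linear_combination (-(β' - β)) * hdet + β * E
  have j2 : δ' = δ + γ * j := by rw [hj]; linear_combination (-(δ' - δ)) * hdet + δ * E
  have hcc : (c':ℤ) = c + m * j := by
    have : 2 * (c':ℤ) = 2 * (c + m * j) := by
      simp only [act] at h1 h2 h2'
      rw [j1, j2] at h2'
      linear_combination h2 - h2' + 2 * j * h1
    linarith
  have : (c:ℤ) % m = c' % m := by rw [hcc, Int.add_mul_emod_self_left]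
  rw [Int.emod_eq_of_lt (by positivity) (by exact_mod_cast hc),
    Int.emod_eq_of_lt (by positivity) (by exact_mod_cast hc')] at this
  exact_mod_cast this

lemma dvd_of_prim {u u' : ℤ} {g g' : ℤ × ℤ × ℤ} (hg' : IsPrimitiveForm g')
    (h1 : u * g.1 = u' * g'.1) (h2 : u * g.2.1 = u' * g'.2.1) (h3 : u * g.2.2 = u' * g'.2.2) :
    u ∣ u' := by
  obtain ⟨r, s, t, h⟩ := bezout3 hg'
  exact ⟨r * g.1 + s * g.2.1 + t * g.2.2, by
    linear_combination (-u') * h - r * h1 - s * h2 - t * h3⟩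

/-- forms related to the same `t` -/
lemma rel_same {n : ℕ} (hn : 2 < n) {d d' : ℤ} {u u' : ℕ} (hu : 0 < u) (hu' : 0 < u')
    (hd : d * (u:ℤ) ^ 2 = n ^ 2 - 4) (hd' : d' * (u':ℤ) ^ 2 = n ^ 2 - 4) {f f' : ℤ × ℤ × ℤ}
    (hf : formDisc f = d) (hf' : formDisc f' = d') (hp : IsPrimitiveForm f)
    (hp' : IsPrimitiveForm f') {x y x' y' : ℤ} {k m c : ℕ} (hm : 0 < m)
    (h : Rel n u f x y k m c) (h' : Rel n u' f' x' y' k m c) :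
    u = u' ∧ d = d' ∧ ∃ α β γ δ : ℤ, α * δ - β * γ = 1 ∧ act f' α β γ δ = f ∧
      x' = α * x + β * y ∧ y' = γ * x + δ * y := by
  obtain ⟨α, β, γ, δ, hdet, h1, h2, h3, h4⟩ := h
  obtain ⟨α', β', γ', δ', hdet', h1', h2', h3', h4'⟩ := h'
  have hD := (act_disc f hdet).trans hf
  have hD' := (act_disc f' hdet').trans hf'
  have hP := prim_act hp hdet
  have hP' := prim_act hp' hdet'
  set g := act f α β γ δ with hg
  set g' := act f' α' β' γ' δ' with hg'
  simp only [formDisc] at hD hD'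
  have hm0 : (m:ℤ) ≠ 0 := by exact_mod_cast hm.ne'
  have e1 : (u:ℤ) * g.1 = u' * g'.1 := h1.trans h1'.symm
  have e2 : (u:ℤ) * g.2.1 = u' * g'.2.1 := h2.trans h2'.symm
  have e3 : (u:ℤ) * g.2.2 = u' * g'.2.2 := by
    apply mul_left_cancel₀ hm0
    have : 4 * ((m:ℤ) * (u * g.2.2)) = 4 * (m * (u' * g'.2.2)) := by
      linear_combination (-(u:ℤ) ^ 2) * hD - hd + (u':ℤ) ^ 2 * hD' + hd' - 4 * (u * g.2.2) * h1
        + 4 * (u' * g'.2.2) * h1' + (u * g.2.1 + u' * g'.2.1) * e2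
    linarith
  have huu : u = u' := by
    have a1 := dvd_of_prim hP' e1 e2 e3
    have a2 := dvd_of_prim hP e1.symm e2.symm e3.symm
    exact Nat.dvd_antisymm (by exact_mod_cast a1) (by exact_mod_cast a2)
  subst huu
  have hu0 : (u:ℤ) ≠ 0 := by exact_mod_cast hu.ne'
  refine ⟨rfl, mul_right_cancel₀ (pow_ne_zero 2 hu0) (hd.trans hd'.symm), ?_⟩
  have hgg : g = g' := by
    ext
    · exact mul_left_cancel₀ hu0 e1
    · exact mul_left_cancel₀ hu0 e2
    · exact mul_left_cancel₀ hu0 e3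
  have hi := act_inv f hdet
  rw [← hg, hgg, hg', act_act] at hi
  refine ⟨_, _, _, _, ?_, hi, ?_, ?_⟩
  · linear_combination (α * δ - β * γ) * hdet' + hdet
  · rw [h3', h3, h4]; linear_combination (-(k:ℤ) * α') * hdet
  · rw [h4', h3, h4]; linear_combination (-(k:ℤ) * γ') * hdet

lemma W_equiv {n : ℕ} (hn : 2 < n) (X : ℕ) : Nonempty (W n X ≃ {t // t ∈ Tset n X}) := by
  let P : W n X → {t // t ∈ Tset n X} → Prop := fun w t =>
    Rel n w.1.1.1.2 (rep w.1).1 w.2.1.1 w.2.1.2 t.1.1 t.1.2.1 t.1.2.2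
  have h1 : ∀ w, ∃ t, P w t := by
    rintro ⟨i, v, hv, hX⟩
    obtain ⟨q1, q2, q3⟩ := pairs_spec hn i.1.2
    have hE := eps_gt_one q1 (pell_ex hn (by exact_mod_cast q2) q3)
    have hpos : 0 < formVal (rep i).1 v.1 v.2 := by
      have := xi_mul_et q1 (rep i).2.2 v.1 v.2
      have h2 := dom_pos hE hv
      have h3 := mul_pos h2.1 h2.2
      rw [this] at h3
      have := (pos_iff_pos_of_mul_pos h3).1 (abs_pos.2 (by exact_mod_cast a_ne (nonsq hn q3) (rep i).2.2))
      exact_mod_cast this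
    obtain ⟨t, ht, hr⟩ := rel_exists hn (by exact_mod_cast q2) q3 (rep i).2.2 hpos hX
    exact ⟨⟨t, ht⟩, hr⟩
  have h2 : ∀ w t t', P w t → P w t' → t = t' := by
    rintro w ⟨⟨k, m, c⟩, ht⟩ ⟨⟨k', m', c'⟩, ht'⟩ hP hP'
    have ht1 := mem_Tset.1 ht
    have ht2 := mem_Tset.1 ht'
    obtain ⟨e1, e2, e3⟩ := rel_unique_t ht1.1 ht2.1 ht1.2.2.2.1 ht2.2.2.2.1 hP hP'
    simp only at e1 e2 e3
    subst e1; subst e2; subst e3; rfl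
  have h3 : ∀ w w' t, P w t → P w' t → w = w' := by
    rintro ⟨⟨⟨⟨d, u⟩, hdu⟩, q⟩, ⟨x, y⟩, hv, hX⟩ ⟨⟨⟨⟨d', u'⟩, hdu'⟩, q'⟩, ⟨x', y'⟩, hv', hX'⟩ t hP hP'
    have ht := mem_Tset.1 t.2
    obtain ⟨q1, q2, q3⟩ := pairs_spec hn hdu
    obtain ⟨q1', q2', q3'⟩ := pairs_spec hn hdu'
    have hmain := rel_same hn (by exact_mod_cast q2) (by exact_mod_cast q2') q3 q3'
      (rep ⟨⟨⟨d, u⟩, hdu⟩, q⟩).2.2 (rep ⟨⟨⟨d', u'⟩, hdu'⟩, q'⟩).2.2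
      (rep ⟨⟨⟨d, u⟩, hdu⟩, q⟩).2.1 (rep ⟨⟨⟨d', u'⟩, hdu'⟩, q'⟩).2.1 ht.2.1 hP hP'
    obtain ⟨e1, e2, α, β, γ, δ, hdet, hact, hx, hy⟩ := hmain
    simp only at e1 e2 hx hy
    have e2' : d = d' := by exact_mod_cast e2
    subst e1; subst e2'
    have hq : q = q' := by
      rw [← Quot.out_eq q, ← Quot.out_eq q', eq_comm, cls_eq]
      exact (formEquiv_iff _ _).2 ⟨α, β, γ, δ, hdet, hact.symm⟩
    subst hq
    have := dom_unique q1 (pell_ex hn (by exact_mod_cast q2) q3) (rep ⟨⟨⟨d, u⟩, hdu⟩, q⟩).2.1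
      (a_ne (nonsq hn q3) (rep ⟨⟨⟨d, u⟩, hdu⟩, q⟩).2.2) (rep ⟨⟨⟨d, u⟩, hdu⟩, q⟩).2.2 hdet hact
      (x := x) (y := y) hv (by rw [← hx, ← hy]; exact hv')
    have ex : x' = x := hx.trans this.1
    have ey : y' = y := hy.trans this.2
    subst ex; subst ey
    rfl
  have h4 : ∀ t, ∃ w, P w t := by
    rintro ⟨⟨k, m, c⟩, ht⟩
    obtain ⟨k0, m0, hX, hc, C, hC⟩ := mem_Tset.1 ht
    simp only at k0 m0 hX hc hC
    have hCz : (c:ℤ) ^ 2 + n * c + 1 = m * C := by exact_mod_cast hC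
    set B : ℤ := n + 2 * c with hB
    have hdiscG : B ^ 2 - 4 * m * C = (n:ℤ) ^ 2 - 4 := by rw [hB]; linear_combination (-4) * (-hCz)
    set u : ℕ := Int.gcd m (Int.gcd B C) with hu
    have hu0 : 0 < u := by
      rw [hu]; apply Int.gcd_pos_of_ne_zero_left; exact_mod_cast m0.ne'
    have huz : (0:ℤ) < u := by exact_mod_cast hu0
    obtain ⟨a1, ha1⟩ : (u:ℤ) ∣ m := Int.gcd_dvd_left _ _
    obtain ⟨b1, hb1⟩ : (u:ℤ) ∣ B := (Int.gcd_dvd_right _ _).trans (Int.gcd_dvd_left _ _)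
    obtain ⟨c1, hc1⟩ : (u:ℤ) ∣ (C:ℤ) := (Int.gcd_dvd_right _ _).trans (Int.gcd_dvd_right _ _)
    have hprim : IsPrimitiveForm (a1, b1, c1) := by
      rw [prim_iff]
      intro l l1 l2 l3
      have : (u:ℤ) * l ∣ u := by
        conv_rhs => rw [hu]
        refine Int.dvd_coe_gcd ?_ (Int.dvd_coe_gcd ?_ ?_)
        · rw [ha1]; exact mul_dvd_mul_left _ l1
        · rw [hb1]; exact mul_dvd_mul_left _ l2
        · rw [hc1]; exact mul_dvd_mul_left _ l3
      have h5 : (u:ℤ) * l ∣ u * 1 := by simpa using this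
      exact isUnit_of_dvd_one ((mul_dvd_mul_iff_left huz.ne').1 h5)
    have hDpos : (0:ℤ) < (n:ℤ) ^ 2 - 4 := by
      have : (2:ℤ) < n := by exact_mod_cast hn
      nlinarith
    set D1 : ℤ := b1 ^ 2 - 4 * a1 * c1 with hD1
    have hD1u : D1 * (u:ℤ) ^ 2 = n ^ 2 - 4 := by
      rw [← hdiscG, ha1, hb1, hc1]; ring
    have hD1pos : 0 < D1 := by
      rw [← hD1u] at hDpos
      exact (pos_iff_pos_of_mul_pos hDpos).2 (by positivity)
    obtain ⟨d, hd⟩ : ∃ d : ℕ, D1 = d := ⟨D1.toNat, by rw [Int.toNat_of_nonneg hD1pos.le]⟩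
    have hpr : (d, u) ∈ pairs n := by
      have h4 : 4 ≤ n ^ 2 := by nlinarith
      have hduN : d * u ^ 2 = n ^ 2 - 4 := by
        zify [h4]; rw [← hd]; exact hD1u
      have hd0 : 0 < d := by rw [hd] at hD1pos; exact_mod_cast hD1pos
      simp only [pairs, mem_filter, Finset.mem_product, mem_range]
      refine ⟨⟨?_, ?_⟩, hd0, hu0, ?_, hduN⟩
      · have : d ≤ d * u ^ 2 := Nat.le_mul_of_pos_right _ (by positivity)
        omega
      · have : u ≤ u ^ 2 := Nat.le_self_pow (by norm_num) _
        have : u ^ 2 ≤ d * u ^ 2 := Nat.le_mul_of_pos_left _ hd0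
        omega
      · have : (d:ℤ) % 4 = 0 ∨ (d:ℤ) % 4 = 1 := by
          rw [← hd, hD1]
          rcases Int.even_or_odd' b1 with ⟨p, hp | hp⟩
          · left; rw [hp]; ring_nf; omega
          · right; rw [hp]; ring_nf; omega
        omega
    obtain ⟨q1, q2, q3⟩ := pairs_spec hn hpr
    simp only at q1 q2 q3
    have hfd : formDisc (a1, b1, c1) = (d:ℤ) := by rw [← hd]; rfl
    let F : PForm (d:ℤ) := ⟨(a1, b1, c1), hprim, hfd⟩
    let i : Idx n := ⟨⟨(d, u), hpr⟩, Quot.mk _ F⟩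
    have hrepF : formEquiv (rep i).1 F.1 := by
      rw [← cls_eq]; exact Quot.out_eq _
    obtain ⟨α, β, γ, δ, hdet, hact⟩ := (formEquiv_iff _ _).1 hrepF
    have hFa : F.1 = (a1, b1, c1) := rfl
    rw [hFa] at hact
    have hval0 : formVal (rep i).1 α γ = a1 := by
      have := congrArg Prod.fst hact
      simp only [act] at this
      rw [this]; rfl
    have hval : formVal (rep i).1 (k * α) (k * γ) = k ^ 2 * a1 := by
      rw [← hval0]; simp only [formVal]; ring
    have ha1pos : 0 < a1 := by
      have : (0:ℤ) < u * a1 := by rw [← ha1]; exact_mod_cast m0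
      exact (pos_iff_pos_of_mul_pos this).1 huz
    have hk' : (0:ℤ) < k := by exact_mod_cast k0
    obtain ⟨α', β', γ', δ', hdet', hact', hDom⟩ := dom_exists q1 (pell_ex hn hu0 q3)
      (a_ne (nonsq hn q3) (rep i).2.2) (rep i).2.2 (x := k * α) (y := k * γ) (by rw [hval]; positivity)
    refine ⟨⟨i, ⟨(α' * (k * α) + β' * (k * γ), γ' * (k * α) + δ' * (k * γ)), hDom, ?_⟩⟩, ?_⟩
    · show (u:ℤ) * formVal (rep i).1 _ _ ≤ X
      rw [← formVal_act, hact', hval]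
      have : (m:ℤ) * k ^ 2 ≤ X := by exact_mod_cast hX
      rw [ha1] at this
      linarith
    · have hA : act (rep i).1 (α' * α + β' * γ) (α' * β + β' * δ) (γ' * α + δ' * γ) (γ' * β + δ' * δ)
          = (a1, b1, c1) := by rw [← act_act, hact', ← hact]
      refine ⟨α' * α + β' * γ, α' * β + β' * δ, γ' * α + δ' * γ, γ' * β + δ' * δ, ?_, ?_, ?_, ?_, ?_⟩
      · linear_combination (α * δ - β * γ) * hdet' + hdet
      · show (u:ℤ) * (act (rep i).1 _ _ _ _).1 = _
        rw [hA]; exact ha1.symm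
      · show (u:ℤ) * (act (rep i).1 _ _ _ _).2.1 = _
        rw [hA]; exact hb1.symm
      · show α' * (k * α) + β' * (k * γ) = k * (α' * α + β' * γ); ring
      · show γ' * (k * α) + δ' * (k * γ) = k * (γ' * α + δ' * γ); ring
  choose φ hφ using h1
  refine ⟨Equiv.ofBijective φ ⟨?_, ?_⟩⟩
  · intro w w' h
    exact h3 w w' (φ w) (hφ w) (by rw [h]; exact hφ w')
  · intro t
    obtain ⟨w, hw⟩ := h4 t
    exact ⟨w, h2 w _ _ (hφ w) hw⟩

/-- Part A -/
theorem partA {n : ℕ} (hn : 2 < n) :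
    Tendsto (fun X : ℕ => ((∑ k ∈ Icc 1 X, ∑ m ∈ Icc 1 (X / k ^ 2), rho n m : ℕ) : ℝ) / X)
      atTop (nhds (ampA n)) := by
  have hfin : ∀ p : {p // p ∈ pairs n}, Finite (Cls (p.1.1 : ℤ)) := fun p =>
    cls_finite (nonsq hn (pairs_spec hn p.2).2.2) (pairs_spec hn p.2).1
  have hft : ∀ p : {p // p ∈ pairs n}, Fintype (Cls (p.1.1 : ℤ)) := fun p => Fintype.ofFinite _
  have hcard : ∀ X : ℕ, (∑ k ∈ Icc 1 X, ∑ m ∈ Icc 1 (X / k ^ 2), rho n m : ℕ) =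
      ∑ i : Idx n, Nat.card {v : ℤ × ℤ // Dom (i.1.1.1 : ℤ) (rep i).1 v.1 v.2 ∧
        ((i.1.1.2 : ℕ) : ℤ) * formVal (rep i).1 v.1 v.2 ≤ X} := by
    intro X
    obtain ⟨e⟩ := W_equiv hn X
    have : Finite (W n X) := Finite.of_equiv _ e.symm
    have hfi : ∀ i : Idx n, Finite {v : ℤ × ℤ // Dom (i.1.1.1 : ℤ) (rep i).1 v.1 v.2 ∧
        ((i.1.1.2 : ℕ) : ℤ) * formVal (rep i).1 v.1 v.2 ≤ X} := fun i =>
      Finite.of_injective (fun v => (⟨i, v⟩ : W n X)) (by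
        intro v v' h
        exact eq_of_heq (Sigma.mk.inj h).2)
    rw [← Tset_card, ← Nat.card_sigma]
    have := Nat.card_congr e
    rw [this]; simp
  have hlim : Tendsto (fun X : ℕ => ∑ i : Idx n, (Nat.card {v : ℤ × ℤ // Dom (i.1.1.1 : ℤ) (rep i).1 v.1 v.2 ∧
        ((i.1.1.2 : ℕ) : ℤ) * formVal (rep i).1 v.1 v.2 ≤ X} : ℝ) / X) atTop
        (nhds (∑ i : Idx n, Real.log (eps (i.1.1.1:ℤ)) / (i.1.1.2 * Real.sqrt ((i.1.1.1:ℤ):ℝ)))) := by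
    apply tendsto_finsetSum
    intro i _
    obtain ⟨q1, q2, q3⟩ := pairs_spec hn i.1.2
    exact dom_count q1 (eps_gt_one q1 (pell_ex hn (by exact_mod_cast q2) q3))
      (a_ne (nonsq hn q3) (rep i).2.2) (rep i).2.2 (by exact_mod_cast q2)
  have hval : (∑ i : Idx n, Real.log (eps (i.1.1.1:ℤ)) / (i.1.1.2 * Real.sqrt ((i.1.1.1:ℤ):ℝ))) = ampA n := by
    rw [Fintype.sum_sigma, ampA]
    have hsw := Finset.sum_coe_sort (pairs n) (fun p => (classNumber (p.1 : ℤ) : ℝ) *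
      Real.log (eps (p.1 : ℤ)) / ((p.2 : ℝ) * Real.sqrt (p.1 : ℝ)))
    refine Eq.trans ?_ hsw
    apply sum_congr rfl
    intro p _
    simp only [Finset.sum_const, Finset.card_univ, nsmul_eq_mul]
    have : Fintype.card (Cls (p.1.1:ℤ)) = classNumber (p.1.1:ℤ) := by
      rw [classNumber, Nat.card_eq_fintype_card]
    rw [this, mul_div_assoc]
    push_cast
    rfl
  rw [hval] at hlim
  refine hlim.congr fun X => ?_
  rw [hcard, Nat.cast_sum, Finset.sum_div]

/-- root set in `ZMod m` -/
abbrev RootZ (n m : ℕ) : Type := {c : ZMod m // c ^ 2 + (n : ZMod m) * c + 1 = 0}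

lemma rho_eq_card (n m : ℕ) (hm : 0 < m) : rho n m = Nat.card (RootZ n m) := by
  haveI : NeZero m := ⟨hm.ne'⟩
  rw [rho, ← Nat.card_eq_finsetCard]
  refine Nat.card_congr (Equiv.ofBijective
    (fun c => ⟨((c : ℕ) : ZMod m), ?_⟩) ⟨?_, ?_⟩)
  · have := (Finset.mem_filter.mp c.2).2
    rw [← ZMod.natCast_eq_zero_iff] at this
    push_cast at this
    exact this
  · intro a b h
    simp only [Subtype.mk.injEq] at h
    rw [ZMod.natCast_eq_natCast_iff] at h
    have ha := Finset.mem_range.mp (Finset.mem_filter.mp a.2).1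
    have hb := Finset.mem_range.mp (Finset.mem_filter.mp b.2).1
    exact Subtype.ext (Nat.ModEq.eq_of_lt_of_lt h ha hb)
  · rintro ⟨z, hz⟩
    refine ⟨⟨z.val, ?_⟩, ?_⟩
    · rw [mem_filter, mem_range]
      refine ⟨ZMod.val_lt z, ?_⟩
      rw [← ZMod.natCast_eq_zero_iff]
      push_cast
      rw [ZMod.natCast_zmod_val]; exact hz
    · simp

lemma rho_zero (n : ℕ) : rho n 0 = 0 := by simp [rho]
lemma rho_one (n : ℕ) : rho n 1 = 1 := by simp [rho]

lemma rho_mul (n : ℕ) {a b : ℕ} (hab : Nat.Coprime a b) : rho n (a * b) = rho n a * rho n b := by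
  rcases Nat.eq_zero_or_pos a with rfl | ha
  · simp [rho_zero]
  rcases Nat.eq_zero_or_pos b with rfl | hb
  · simp [rho_zero]
  rw [rho_eq_card n _ (Nat.mul_pos ha hb), rho_eq_card n _ ha, rho_eq_card n _ hb, ← Nat.card_prod]
  let e := ZMod.chineseRemainder hab
  refine Nat.card_congr (((e.toEquiv.subtypeEquiv (q := fun z =>
    z ^ 2 + (n : ZMod a × ZMod b) * z + 1 = 0) ?_)).trans ?_)
  · intro z
    have : e (z ^ 2 + (n : ZMod (a*b)) * z + 1) = (e z) ^ 2 + (n : ZMod a × ZMod b) * e z + 1 := by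
      simp
    constructor
    · intro h; rw [h, map_zero] at this; exact this.symm
    · intro h
      have h' : e (z ^ 2 + (n : ZMod (a*b)) * z + 1) = 0 := this.trans h
      exact (map_eq_zero_iff e e.injective).mp h'
  · refine ⟨fun z => (⟨z.1.1, ?_⟩, ⟨z.1.2, ?_⟩), fun z => ⟨(z.1.1, z.2.1), ?_⟩, ?_, ?_⟩
    · exact congrArg Prod.fst z.2
    · exact congrArg Prod.snd z.2
    · exact Prod.ext z.1.2 z.2.2
    · intro z; rfl
    · intro z; rfl

lemma rho_period (n m k : ℕ) : rho (n + m * k) m = rho n m := by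
  unfold rho
  congr 1
  apply Finset.filter_congr
  intro c _
  have : c ^ 2 + (n + m * k) * c + 1 = (c ^ 2 + n * c + 1) + m * (k * c) := by ring
  rw [this]
  exact (Nat.dvd_add_left (dvd_mul_right _ _))

lemma rho_mod (n m : ℕ) : rho (n % m) m = rho n m := by
  conv_rhs => rw [← Nat.mod_add_div n m]
  rw [rho_period]

lemma card_filter_modEq_le (p a k : ℕ) (hp : 0 < p) (hak : a ≤ k) (v : ℤ) :
    ((range (p ^ k)).filter (fun c : ℕ => ((p:ℤ) ^ a ∣ (c : ℤ) - v))).card ≤ p ^ (k - a) := by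
  have hpa : 0 < p ^ a := pow_pos hp a
  calc _ ≤ (range (p ^ (k - a))).card := by
        apply Finset.card_le_card_of_injOn (fun c => c / p ^ a)
        · intro c hc
          simp only [Finset.coe_filter, mem_range, Set.mem_ofPred_eq] at hc
          simp only [Finset.coe_range, Set.mem_Iio]
          apply Nat.div_lt_of_lt_mul
          rw [← pow_add]
          rw [Nat.add_sub_cancel' hak]; exact hc.1
        · intro c hc d hd hcd
          simp only [Finset.coe_filter, mem_range, Set.mem_ofPred_eq] at hc hd
          have h1 : ((p ^ a : ℕ) : ℤ) ∣ (d : ℤ) - c := by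
            have := dvd_sub hd.2 hc.2
            push_cast
            rwa [sub_sub_sub_cancel_right] at this
          have h2 : c % p ^ a = d % p ^ a := (Nat.modEq_iff_dvd.mpr h1)
          rw [← Nat.div_add_mod c (p ^ a), ← Nat.div_add_mod d (p ^ a), h2]
          simp only at hcd
          rw [hcd]
    _ = _ := Finset.card_range _

lemma rho_pp_le (n p k : ℕ) (hp : p.Prime) : rho n (p ^ k) ≤ 2 * p ^ (k / 2) := by
  unfold rho
  by_cases hne : ((range (p ^ k)).filter (fun c => p ^ k ∣ c ^ 2 + n * c + 1)) = ∅
  · rw [hne]; simp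
  obtain ⟨c0, hc0⟩ := Finset.nonempty_iff_ne_empty.mpr hne
  have h0 := (Finset.mem_filter.mp hc0).2
  have hk : k - (k + 1) / 2 = k / 2 := by omega
  have hk2 : (k + 1) / 2 ≤ k := by omega
  calc _ ≤ (((range (p ^ k)).filter (fun c : ℕ => ((p:ℤ) ^ ((k+1)/2) ∣ (c : ℤ) - c0))) ∪
        ((range (p ^ k)).filter (fun c : ℕ => ((p:ℤ) ^ ((k+1)/2) ∣ (c : ℤ) - (-c0-n))))).card := by
        apply Finset.card_le_card
        intro c hc
        rw [mem_filter] at hc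
        rw [Finset.mem_union, mem_filter, mem_filter]
        have hd : (p:ℤ) ^ k ∣ ((c:ℤ) - c0) * ((c : ℤ) - (-c0-n)) := by
          have a1 : ((p ^ k : ℕ) : ℤ) ∣ ((c ^ 2 + n * c + 1 : ℕ) : ℤ) := Int.natCast_dvd_natCast.mpr hc.2
          have a2 : ((p ^ k : ℕ) : ℤ) ∣ ((c0 ^ 2 + n * c0 + 1 : ℕ) : ℤ) := Int.natCast_dvd_natCast.mpr h0
          have := dvd_sub a1 a2
          push_cast at this
          have e : ((c:ℤ) - c0) * ((c : ℤ) - (-c0-n)) = (c:ℤ) ^ 2 + n * c + 1 - (c0 ^ 2 + n * c0 + 1) := by ring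
          rwa [e]
        have hpi : Prime (p : ℤ) := Nat.prime_iff_prime_int.mp hp
        by_cases h1 : (p:ℤ) ^ ((k+1)/2) ∣ (c : ℤ) - c0
        · exact Or.inl ⟨hc.1, h1⟩
        right
        refine ⟨hc.1, ?_⟩
        by_contra h2
        obtain ⟨u, v, hv1, hv2, huv⟩ := (dvd_mul.mp hd)
        obtain ⟨i, hi, hi'⟩ := (dvd_prime_pow hpi k).mp (Dvd.intro _ huv.symm)
        obtain ⟨j, hj, hj'⟩ := (dvd_prime_pow hpi k).mp (Dvd.intro_left _ huv.symm)
        have hij : i + j = k := by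
          have e1 : Associated ((p:ℤ) ^ k) ((p:ℤ) ^ (i + j)) := by
            rw [huv, pow_add]
            exact Associated.mul_mul hi' hj'
          have e2 := Int.associated_iff_natAbs.mp e1
          rw [Int.natAbs_pow, Int.natAbs_pow, Int.natAbs_natCast] at e2
          exact (Nat.pow_right_injective hp.two_le e2).symm
        have hi3 : i < (k+1)/2 := by
          by_contra hcon
          push Not at hcon
          exact h1 ((pow_dvd_pow _ hcon).trans ((hi'.symm.dvd).trans hv1))
        have hj3 : j < (k+1)/2 := by
          by_contra hcon
          push Not at hcon
          exact h2 ((pow_dvd_pow _ hcon).trans ((hj'.symm.dvd).trans hv2))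
        omega
    _ ≤ p ^ (k - (k+1)/2) + p ^ (k - (k+1)/2) := by
        refine (Finset.card_union_le _ _).trans (add_le_add ?_ ?_)
        · exact card_filter_modEq_le p _ k hp.pos hk2 _
        · exact card_filter_modEq_le p _ k hp.pos hk2 _
    _ = _ := by rw [hk]; ring

/-- square root lifting -/
lemma sqrt_lift (p : ℕ) (hp : p.Prime) (hp2 : p ≠ 2) (D : ℤ) (hD : ¬ (p:ℤ) ∣ D)
    (h1 : ∃ z : ℤ, (p:ℤ) ∣ z ^ 2 - D) (k : ℕ) : ∃ z : ℤ, (p:ℤ) ^ (k + 1) ∣ z ^ 2 - D := by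
  induction k with
  | zero => simpa using h1
  | succ k ih =>
    obtain ⟨z, w, hw⟩ := ih
    have hpi : Prime (p : ℤ) := Nat.prime_iff_prime_int.mp hp
    have hz : ¬ (p:ℤ) ∣ 2 * z := by
      intro h
      rcases hpi.dvd_or_dvd h with h | h
      · have : p ∣ 2 := by exact_mod_cast h
        exact hp2 ((Nat.prime_dvd_prime_iff_eq hp Nat.prime_two).mp this)
      · apply hD
        have : (p:ℤ) ∣ z ^ 2 - (z ^ 2 - D) := by
          apply dvd_sub
          · exact dvd_pow h two_ne_zero
          · rw [hw, pow_succ]; exact ⟨p ^ k * w, by ring⟩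
        simpa using this
    have hcop : IsCoprime (2 * z) (p:ℤ) := by
      rw [isCoprime_comm]
      exact (hpi.coprime_iff_not_dvd).mpr hz
    obtain ⟨a, b, hab⟩ := hcop
    refine ⟨z - a * w * p ^ (k+1), ?_⟩
    have : (z - a * w * p ^ (k+1)) ^ 2 - D = p ^ (k+1+1) * (b * w + a ^ 2 * w ^ 2 * p ^ k) := by
      have hh : z ^ 2 = D + p ^ (k+1) * w := by linarith
      have h3 : a * (2 * z) = 1 - b * p := by linarith
      calc _ = z ^ 2 - D - (a * (2 * z)) * w * p ^ (k+1) + a ^ 2 * w ^ 2 * p ^ (2 * k + 2) := by ring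
        _ = _ := by rw [hh, h3]; ring
    rw [this]
    exact dvd_mul_right _ _

/-- The character `J` as a function. -/
def Jn (E : ℤ) (m : ℕ) : ℤ := if Odd m then jacobiSym E m else 0

lemma rho_good (n p k : ℕ) (hp : p.Prime) (hp2 : p ≠ 2) (hD : ¬ (p:ℤ) ∣ (n:ℤ) ^ 2 - 4) :
    (rho n (p ^ (k+1)) : ℤ) = 1 + Jn ((n:ℤ) ^ 2 - 4) p := by
  have hodd : Odd p := hp.odd_of_ne_two hp2
  haveI : Fact p.Prime := ⟨hp⟩
  have hpi : Prime (p : ℤ) := Nat.prime_iff_prime_int.mp hp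
  rw [Jn, if_pos hodd, ← jacobiSym.legendreSym.to_jacobiSym]
  set D : ℤ := (n:ℤ) ^ 2 - 4 with hDdef
  have hDz : ((D : ℤ) : ZMod p) ≠ 0 := by
    rwa [Ne, ZMod.intCast_zmod_eq_zero_iff_dvd]
  have hpk : 0 < p ^ (k+1) := pow_pos hp.pos _
  rw [rho_eq_card _ _ hpk]
  have h2u : IsUnit (2 : ZMod (p ^ (k+1))) := by
    have : IsUnit ((2 : ℕ) : ZMod (p ^ (k+1))) := by
      rw [ZMod.isUnit_iff_coprime]
      exact ((Nat.coprime_primes Nat.prime_two hp).mpr hp2.symm).pow_right _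
    simpa using this
  -- unit criterion
  have hunit : ∀ z : ℤ, ¬ (p:ℤ) ∣ z → IsUnit ((z : ℤ) : ZMod (p ^ (k+1))) := by
    intro z hz
    have h1 : IsCoprime ((p ^ (k+1) : ℕ) : ℤ) z := by
      push_cast
      exact IsCoprime.pow_left ((hpi.coprime_iff_not_dvd).mpr hz)
    obtain ⟨a, b, hab⟩ := h1
    have : ((b:ℤ) : ZMod (p ^ (k+1))) * (z : ZMod (p ^ (k+1))) = 1 := by
      have := congrArg (fun t : ℤ => (t : ZMod (p ^ (k+1)))) hab
      simp only [Int.cast_add, Int.cast_mul, Int.cast_natCast, ZMod.natCast_self, mul_zero, zero_add, Int.cast_one] at this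
      exact this
    exact IsUnit.of_mul_eq_one_right _ this
  -- equivalence with square roots
  have hDcast : ((D:ℤ) : ZMod (p ^ (k+1))) = (n : ZMod (p ^ (k+1))) ^ 2 - 4 := by
    rw [hDdef]; push_cast; rfl
  have e : Nat.card (RootZ n (p ^ (k+1))) = Nat.card {z : ZMod (p ^ (k+1)) // z ^ 2 = (D : ZMod (p ^ (k+1)))} := by
    obtain ⟨u, hu⟩ := h2u
    have hinv : (2 : ZMod (p ^ (k+1))) * (↑u⁻¹ : ZMod (p ^ (k+1))) = 1 := by rw [← hu]; exact u.mul_inv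
    refine Nat.card_congr (Equiv.subtypeEquiv
      ⟨fun c => 2 * c + n, fun z => (↑u⁻¹ : ZMod (p ^ (k+1))) * (z - n), ?_, ?_⟩ ?_)
    · intro c
      linear_combination c * hinv
    · intro z
      linear_combination (z - n) * hinv
    · intro c
      simp only [Equiv.coe_fn_mk]
      rw [hDcast]
      constructor
      · intro h; linear_combination 4 * h
      · intro h
        have : (2:ZMod (p ^ (k+1))) * (2 * (c ^ 2 + n * c + 1)) = 0 := by linear_combination h
        have hI : IsUnit (2:ZMod (p ^ (k+1))) := ⟨u, hu⟩
        have := (hI.mul_right_eq_zero).mp this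
        exact (hI.mul_right_eq_zero).mp this
  rw [e]
  rcases legendreSym.eq_one_or_neg_one p hDz with h | h
  · rw [h]
    have hsq := (legendreSym.eq_one_iff p hDz).mp h
    have hex : ∃ z : ℤ, (p:ℤ) ∣ z ^ 2 - D := by
      obtain ⟨r, hr⟩ := hsq
      refine ⟨(r.val : ℤ), ?_⟩
      rw [← ZMod.intCast_zmod_eq_zero_iff_dvd]
      push_cast
      rw [ZMod.natCast_zmod_val, hr]; ring
    obtain ⟨z, hz⟩ := sqrt_lift p hp hp2 D hD hex k
    have hzp : ¬ (p:ℤ) ∣ z := by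
      intro h
      apply hD
      have : (p:ℤ) ∣ z ^ 2 - (z ^ 2 - D) := by
        apply dvd_sub
        · exact dvd_pow h two_ne_zero
        · exact (dvd_pow_self _ (Nat.succ_ne_zero k)).trans hz
      simpa using this
    have hzD : ((z:ℤ) : ZMod (p ^ (k+1))) ^ 2 = D := by
      have : (((z ^ 2 - D : ℤ)) : ZMod (p ^ (k+1))) = 0 := by
        rw [ZMod.intCast_zmod_eq_zero_iff_dvd]; push_cast; exact hz
      push_cast at this
      linear_combination this
    have hset : {y : ZMod (p ^ (k+1)) | y ^ 2 = (D : ZMod (p ^ (k+1)))} = {(z : ZMod (p ^ (k+1))), -(z : ZMod (p ^ (k+1)))} := by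
      ext y
      simp only [Set.mem_ofPred_eq, Set.mem_insert_iff, Set.mem_singleton_iff]
      constructor
      · intro hy
        obtain ⟨y, rfl⟩ := ZMod.intCast_surjective y
        have hprod : ((y - z : ℤ) : ZMod (p ^ (k+1))) * ((y + z : ℤ) : ZMod (p ^ (k+1))) = 0 := by
          push_cast; linear_combination hy - hzD
        by_cases hd : (p:ℤ) ∣ y - z
        · left
          have : ¬ (p:ℤ) ∣ y + z := by
            intro hd2
            have h3 : (p:ℤ) ∣ 2 * z := by
              have := dvd_sub hd2 hd
              have e : y + z - (y - z) = 2 * z := by ring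
              rwa [e] at this
            rcases hpi.dvd_or_dvd h3 with h | h
            · have : p ∣ 2 := by exact_mod_cast h
              exact hp2 ((Nat.prime_dvd_prime_iff_eq hp Nat.prime_two).mp this)
            · exact hzp h
          have := ((hunit _ this).mul_left_eq_zero).mp hprod
          push_cast at this
          linear_combination this
        · right
          have := ((hunit _ hd).mul_right_eq_zero).mp hprod
          push_cast at this
          linear_combination this
      · rintro (rfl | rfl)
        · exact hzD
        · rw [neg_sq]; exact hzD
    have hne : (z : ZMod (p ^ (k+1))) ≠ -(z : ZMod (p ^ (k+1))) := by
      intro hh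
      have h2 : (2 : ZMod (p ^ (k+1))) * (z : ZMod (p ^ (k+1))) = 0 := by linear_combination hh
      have := (h2u.mul_right_eq_zero).mp h2
      rw [ZMod.intCast_zmod_eq_zero_iff_dvd] at this
      push_cast at this
      exact hzp ((dvd_pow_self _ (Nat.succ_ne_zero k)).trans this)
    have : Nat.card {y : ZMod (p ^ (k+1)) // y ^ 2 = (D : ZMod (p ^ (k+1)))} = 2 := by
      have h5 := Set.ncard_pair hne
      rw [← hset] at h5
      exact h5
    rw [this]; norm_num
  · rw [h]
    have hsq := (legendreSym.eq_neg_one_iff p).mp h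
    have : IsEmpty {y : ZMod (p ^ (k+1)) // y ^ 2 = (D : ZMod (p ^ (k+1)))} := by
      constructor
      rintro ⟨y, hy⟩
      obtain ⟨y, rfl⟩ := ZMod.intCast_surjective y
      apply hsq
      refine ⟨(y : ZMod p), ?_⟩
      have h6 : (((y ^ 2 - D : ℤ)) : ZMod (p ^ (k+1))) = 0 := by
        push_cast; linear_combination hy
      rw [ZMod.intCast_zmod_eq_zero_iff_dvd] at h6
      push_cast at h6
      have h7 : (p:ℤ) ∣ y ^ 2 - D := (dvd_pow_self _ (Nat.succ_ne_zero k)).trans h6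
      rw [← ZMod.intCast_zmod_eq_zero_iff_dvd] at h7
      push_cast at h7
      linear_combination -h7
    rw [Nat.card_of_isEmpty]; norm_num

section
open scoped ArithmeticFunction.Moebius ArithmeticFunction.zeta
lemma conv_pp (f g : ArithmeticFunction ℝ) {p : ℕ} (hp : p.Prime) (k : ℕ) :
    (f * g) (p ^ k) = ∑ i ∈ range (k + 1), f (p ^ i) * g (p ^ (k - i)) := by
  rw [ArithmeticFunction.mul_apply, Nat.sum_divisorsAntidiagonal (fun a b => f a * g b),
    Nat.sum_divisors_prime_pow hp]
  apply sum_congr rfl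
  intro i hi
  rw [Nat.pow_div (by simp at hi; omega) hp.pos]

noncomputable def rhoA (n : ℕ) : ArithmeticFunction ℝ := ⟨fun m => (rho n m : ℝ), by simp [rho_zero]⟩
noncomputable def liouR : ArithmeticFunction ℝ := (ArithmeticFunction.liouville : ArithmeticFunction ℝ)
noncomputable def lam (n : ℕ) : ArithmeticFunction ℝ := rhoA n * liouR

lemma Jn_one (E : ℤ) : Jn E 1 = 1 := by simp [Jn]
lemma Jn_zero (E : ℤ) : Jn E 0 = 0 := by simp [Jn]
lemma Jn_mul (E : ℤ) (a b : ℕ) : Jn E (a * b) = Jn E a * Jn E b := by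
  unfold Jn
  by_cases ha : Odd a
  · by_cases hb : Odd b
    · rw [if_pos (ha.mul hb), if_pos ha, if_pos hb, jacobiSym.mul_right' _ (by rintro rfl; simp at ha) (by rintro rfl; simp at hb)]
    · rw [if_neg (by rw [Nat.odd_mul]; tauto), if_neg hb, mul_zero]
  · rw [if_neg (by rw [Nat.odd_mul]; tauto), if_neg ha, zero_mul]
lemma Jn_tri (E : ℤ) (a : ℕ) : Jn E a = 0 ∨ Jn E a = 1 ∨ Jn E a = -1 := by
  unfold Jn
  split_ifs
  · exact jacobiSym.trichotomy _ _
  · simp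
lemma Jn_abs (E : ℤ) (a : ℕ) : |(Jn E a : ℝ)| ≤ 1 := by
  rcases Jn_tri E a with h | h | h <;> rw [h] <;> simp

noncomputable def JA (E : ℤ) : ArithmeticFunction ℝ := ⟨fun m => (Jn E m : ℝ), by simp [Jn_zero]⟩
lemma JA_apply (E : ℤ) (m : ℕ) : JA E m = (Jn E m : ℝ) := rfl

lemma JA_mult (E : ℤ) : (JA E).IsMultiplicative := by
  refine ⟨by simp [JA_apply, Jn_one], ?_⟩
  intro a b _
  simp [JA_apply, Jn_mul]

noncomputable def muJ (E : ℤ) : ArithmeticFunction ℝ := (μ : ArithmeticFunction ℝ).pmul (JA E)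

lemma muJ_mult (E : ℤ) : (muJ E).IsMultiplicative :=
  (ArithmeticFunction.isMultiplicative_moebius.intCast).pmul (JA_mult E)

lemma muJ_mul_JA (E : ℤ) : muJ E * JA E = 1 := by
  ext m
  rw [ArithmeticFunction.mul_apply]
  have : ∀ x ∈ m.divisorsAntidiagonal, muJ E x.1 * JA E x.2 = (μ x.1 : ℝ) * JA E m := by
    intro x hx
    have := (Nat.mem_divisorsAntidiagonal.mp hx).1
    simp only [muJ, ArithmeticFunction.pmul_apply, ArithmeticFunction.intCoe_apply, JA_apply]
    rw [← this, Jn_mul]; push_cast; ring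
  rw [sum_congr rfl this, ← Finset.sum_mul]
  have h2 : ∑ x ∈ m.divisorsAntidiagonal, (μ x.1 : ℝ) = (1 : ArithmeticFunction ℝ) m := by
    have h3 := congrArg (fun f : ArithmeticFunction ℝ => f m) (ArithmeticFunction.coe_moebius_mul_coe_zeta (R := ℝ))
    simp only [ArithmeticFunction.mul_apply] at h3
    rw [← h3]
    apply sum_congr rfl
    intro x hx
    have h4 := (Nat.mem_divisorsAntidiagonal.mp hx)
    have : x.2 ≠ 0 := by rintro h; rw [h, mul_zero] at h4; exact h4.2 h4.1.symm
    simp [ArithmeticFunction.natCoe_apply, ArithmeticFunction.zeta_apply, this]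
  rw [h2, ArithmeticFunction.one_apply]
  split_ifs with h
  · rw [h]; simp [JA_apply, Jn_one]
  · simp

/-- discriminant -/
def Dz (n : ℕ) : ℤ := (n:ℤ) ^ 2 - 4

noncomputable def bet (n : ℕ) : ArithmeticFunction ℝ := lam n * muJ (Dz n)

lemma lam_eq (n : ℕ) : lam n = bet n * JA (Dz n) := by
  rw [bet, mul_assoc, muJ_mul_JA, mul_one]

lemma rhoA_mult (n : ℕ) : (rhoA n).IsMultiplicative := by
  refine ⟨by simp [rhoA, rho_one], ?_⟩
  intro a b h
  simp [rhoA, rho_mul n h]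

lemma liouR_mult : liouR.IsMultiplicative := ArithmeticFunction.isMultiplicative_liouville.intCast
lemma lam_mult (n : ℕ) : (lam n).IsMultiplicative := (rhoA_mult n).mul liouR_mult
lemma bet_mult (n : ℕ) : (bet n).IsMultiplicative := (lam_mult n).mul (muJ_mult _)

lemma liouR_pp {p : ℕ} (hp : p.Prime) (k : ℕ) : liouR (p ^ k) = (-1) ^ k := by
  rw [liouR, ArithmeticFunction.intCoe_apply, ArithmeticFunction.liouville_apply (pow_ne_zero _ hp.ne_zero),
    ArithmeticFunction.cardFactors_apply_prime_pow hp]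
  push_cast; rfl

lemma lam_pp {p : ℕ} (hp : p.Prime) (n k : ℕ) :
    lam n (p ^ k) = ∑ i ∈ range (k + 1), (rho n (p ^ i) : ℝ) * (-1) ^ (k - i) := by
  rw [lam, conv_pp _ _ hp]
  apply sum_congr rfl
  intro i _
  rw [liouR_pp hp]; rfl

lemma lam_pp_succ {p : ℕ} (hp : p.Prime) (n k : ℕ) :
    lam n (p ^ (k+1)) = (rho n (p ^ (k+1)) : ℝ) - lam n (p ^ k) := by
  rw [lam_pp hp, lam_pp hp, Finset.sum_range_succ, Nat.sub_self, pow_zero, mul_one, sub_eq_add_neg,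
    add_comm, ← Finset.sum_neg_distrib]
  congr 1
  apply sum_congr rfl
  intro i hi
  rw [Nat.sub_add_comm (by simp at hi; omega), pow_succ]; ring

lemma lam_pp_abs {p : ℕ} (hp : p.Prime) (n k : ℕ) :
    |lam n (p ^ k)| ≤ 2 * (k + 1) * Real.sqrt p ^ k := by
  have hs : 1 ≤ Real.sqrt p := by
    rw [Real.one_le_sqrt]; exact_mod_cast hp.one_lt.le
  have hr : ∀ i, (rho n (p ^ i) : ℝ) ≤ 2 * Real.sqrt p ^ i := by
    intro i
    have h1 : (rho n (p ^ i) : ℝ) ≤ 2 * (p:ℝ) ^ (i / 2) := by exact_mod_cast rho_pp_le n p i hp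
    refine h1.trans ?_
    have : (p:ℝ) ^ (i/2) = Real.sqrt p ^ (2 * (i / 2)) := by
      rw [pow_mul, Real.sq_sqrt (by positivity)]
    rw [this]
    have := pow_le_pow_right₀ hs (show 2 * (i/2) ≤ i by omega)
    linarith
  rw [lam_pp hp]
  calc _ ≤ ∑ i ∈ range (k+1), |(rho n (p ^ i) : ℝ) * (-1) ^ (k - i)| := abs_sum_le_sum_abs _ _
    _ ≤ ∑ i ∈ range (k+1), 2 * Real.sqrt p ^ k := by
        apply sum_le_sum
        intro i hi
        rw [abs_mul, abs_pow, abs_neg, abs_one, one_pow, mul_one, abs_of_nonneg (by positivity)]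
        refine (hr i).trans ?_
        have := pow_le_pow_right₀ hs (show i ≤ k by simp at hi; omega)
        linarith
    _ = _ := by rw [Finset.sum_const, Finset.card_range, nsmul_eq_mul]; push_cast; ring

lemma muJ_pp {p : ℕ} (hp : p.Prime) (E : ℤ) (k : ℕ) :
    muJ E (p ^ k) = if k = 0 then 1 else if k = 1 then -(Jn E p : ℝ) else 0 := by
  rw [muJ, ArithmeticFunction.pmul_apply, ArithmeticFunction.intCoe_apply, JA_apply]
  rcases Nat.lt_or_ge k 2 with h | h
  · interval_cases k
    · simp [Jn_one]
    · simp [ArithmeticFunction.moebius_apply_prime hp]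
  · rw [if_neg (by omega), if_neg (by omega), ArithmeticFunction.moebius_apply_prime_pow hp (by omega),
      if_neg (by omega)]
    simp

lemma bet_pp_succ {p : ℕ} (hp : p.Prime) (n k : ℕ) :
    bet n (p ^ (k+1)) = lam n (p ^ (k+1)) - (Jn (Dz n) p : ℝ) * lam n (p ^ k) := by
  rw [bet, conv_pp _ _ hp, Finset.sum_range_succ, Finset.sum_range_succ, Finset.sum_eq_zero]
  · rw [muJ_pp hp, muJ_pp hp]
    simp; ring
  · intro i hi
    rw [muJ_pp hp, if_neg (by simp at hi; omega), if_neg (by simp at hi; omega), mul_zero]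

lemma lam_good {p : ℕ} (hp : p.Prime) (hp2 : p ≠ 2) (n : ℕ) (hD : ¬ (p:ℤ) ∣ Dz n) (k : ℕ) :
    lam n (p ^ k) = (Jn (Dz n) p : ℝ) ^ k := by
  have hsq : (Jn (Dz n) p : ℝ) = 1 ∨ (Jn (Dz n) p : ℝ) = -1 := by
    have hc : (Dz n).gcd p = 1 := by
      rw [← Int.isCoprime_iff_gcd_eq_one, isCoprime_comm]
      exact ((Nat.prime_iff_prime_int.mp hp).coprime_iff_not_dvd).mpr hD
    rw [Jn, if_pos (hp.odd_of_ne_two hp2)]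
    rcases jacobiSym.eq_one_or_neg_one hc with h | h <;> rw [h] <;> simp
  induction k with
  | zero => simp [(lam_mult n).1]
  | succ k ih =>
    have h := rho_good n p k hp hp2 hD
    have h' : (rho n (p ^ (k+1)) : ℝ) = 1 + (Jn (Dz n) p : ℝ) := by
      have := congrArg (fun z : ℤ => (z : ℝ)) h
      push_cast at this; exact this
    rw [lam_pp_succ hp, ih, h']
    rcases hsq with h | h <;> rw [h]
    · simp
    · rw [pow_succ]; ring

lemma bet_good {p : ℕ} (hp : p.Prime) (hp2 : p ≠ 2) (n : ℕ) (hD : ¬ (p:ℤ) ∣ Dz n) (k : ℕ) :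
    bet n (p ^ (k+1)) = 0 := by
  rw [bet_pp_succ hp, lam_good hp hp2 n hD, lam_good hp hp2 n hD, pow_succ]; ring

lemma bet_bad {p : ℕ} (hp : p.Prime) (n : ℕ) (hD : p = 2 ∨ (p:ℤ) ∣ Dz n) (k : ℕ) :
    bet n (p ^ k) = lam n (p ^ k) := by
  cases k with
  | zero => rw [pow_zero, (lam_mult n).1, (bet_mult n).1]
  | succ k =>
    have : Jn (Dz n) p = 0 := by
      unfold Jn
      rcases hD with rfl | h
      · rw [if_neg (by decide)]
      · split_ifs
        · rw [jacobiSym.eq_zero_iff]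
          refine ⟨hp.ne_zero, ?_⟩
          intro hg
          have := Int.dvd_coe_gcd h (dvd_refl (p:ℤ))
          rw [hg] at this
          have h2 : p ∣ 1 := by exact_mod_cast this
          exact hp.one_lt.ne' (Nat.dvd_one.mp h2)
        · rfl
    rw [bet_pp_succ hp, this]; simp

lemma bet_pp_abs {p : ℕ} (hp : p.Prime) (n k : ℕ) :
    |bet n (p ^ k)| ≤ 2 * (k + 1) * Real.sqrt p ^ k := by
  by_cases hD : p = 2 ∨ (p:ℤ) ∣ Dz n
  · rw [bet_bad hp n hD]; exact lam_pp_abs hp n k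
  · push Not at hD
    cases k with
    | zero => rw [pow_zero, (bet_mult n).1]; norm_num
    | succ k => rw [bet_good hp hD.1 n hD.2]; rw [abs_zero]; positivity

lemma bet_vanish {n : ℕ} (hn : 2 < n) (l : ℕ) (hl : l ∉ Nat.factoredNumbers (2 * (n ^ 2 - 4)).primeFactors) :
    bet n l = 0 := by
  by_contra hne
  apply hl
  have hl0 : l ≠ 0 := by rintro rfl; simp at hne
  rw [Nat.mem_factoredNumbers']
  intro p hp hpl
  rw [Nat.mem_primeFactors]
  have hn4 : 4 < n ^ 2 := by nlinarith
  refine ⟨hp, ?_, by omega⟩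
  by_contra hpd
  have hp2 : p ≠ 2 := by rintro rfl; exact hpd (dvd_mul_right _ _)
  have hD : ¬ (p:ℤ) ∣ Dz n := by
    intro h
    apply hpd
    apply Dvd.dvd.mul_left
    have : ((n ^ 2 - 4 : ℕ) : ℤ) = Dz n := by rw [Dz]; push_cast [hn4.le]; rfl
    rw [← this] at h
    exact_mod_cast h
  obtain ⟨k, m, hm, rfl⟩ := Nat.exists_eq_pow_mul_and_not_dvd hl0 p hp.ne_one
  apply hne
  have hk : k ≠ 0 := by rintro rfl; rw [pow_zero, one_mul] at hpl; exact hm hpl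
  rw [(bet_mult n).2 (((Nat.Prime.coprime_iff_not_dvd hp).mpr hm).pow_left k)]
  obtain ⟨k, rfl⟩ := Nat.exists_eq_succ_of_ne_zero hk
  rw [bet_good hp hp2 n hD, zero_mul]

/-- the constant -/
noncomputable def q0 : ℝ := (2:ℝ) ^ (-(1/4) : ℝ)
lemma q0_pos : 0 < q0 := by unfold q0; positivity
lemma q0_lt : q0 < 1 := by
  unfold q0
  exact Real.rpow_lt_one_of_one_lt_of_neg (by norm_num) (by norm_num)
lemma q0_summable : Summable (fun k : ℕ => 2 * ((k:ℝ) + 1) * q0 ^ k) := by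
  have h1 := summable_pow_mul_geometric_of_norm_lt_one 1 (r := q0) (by rw [Real.norm_of_nonneg q0_pos.le]; exact q0_lt)
  have h2 := summable_geometric_of_lt_one q0_pos.le q0_lt
  have := (h1.add h2).mul_left 2
  refine this.congr ?_
  intro k; ring
noncomputable def C0 : ℝ := ∑' k : ℕ, 2 * ((k:ℝ) + 1) * q0 ^ k
lemma C0_ge : 1 ≤ C0 := by
  have := q0_summable.le_tsum 0 (fun j _ => by have := q0_pos; positivity)
  simp at this
  unfold C0; linarith

noncomputable def betw (n l : ℕ) : ℝ := |bet n l| * (l:ℝ) ^ (-(3/4) : ℝ)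

lemma betw_pp {p : ℕ} (hp : p.Prime) (n k : ℕ) : betw n (p ^ k) ≤ 2 * ((k:ℝ)+1) * q0 ^ k := by
  unfold betw
  have hp0 : (0:ℝ) < p := by exact_mod_cast hp.pos
  have h1 := bet_pp_abs hp n k
  have h2 : (((p ^ k : ℕ)) : ℝ) ^ (-(3/4) : ℝ) = ((p:ℝ) ^ (-(3/4) : ℝ)) ^ k := by
    push_cast
    rw [← Real.rpow_natCast, ← Real.rpow_natCast, ← Real.rpow_mul hp0.le, ← Real.rpow_mul hp0.le]
    congr 1; ring
  have h3 : Real.sqrt p * (p:ℝ) ^ (-(3/4) : ℝ) ≤ q0 := by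
    rw [Real.sqrt_eq_rpow, ← Real.rpow_add hp0, q0]
    have : (1/2 + -(3/4) : ℝ) = -(1/4) := by norm_num
    rw [this]
    exact Real.rpow_le_rpow_of_nonpos (by norm_num) (by exact_mod_cast hp.two_le) (by norm_num)
  rw [h2]
  calc _ ≤ 2 * ((k:ℝ) + 1) * Real.sqrt p ^ k * ((p:ℝ) ^ (-(3/4) : ℝ)) ^ k := by gcongr
    _ = 2 * ((k:ℝ) + 1) * (Real.sqrt p * (p:ℝ) ^ (-(3/4) : ℝ)) ^ k := by rw [mul_pow]; ring
    _ ≤ _ := by gcongr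

lemma betw_nonneg (n l : ℕ) : 0 ≤ betw n l := by unfold betw; positivity

lemma betw_sum {n : ℕ} (hn : 2 < n) : Summable (betw n) ∧
    ∑' l, betw n l ≤ C0 ^ (2 * (n ^ 2 - 4)).primeFactors.card := by
  set s := (2 * (n ^ 2 - 4)).primeFactors
  have hpp : ∀ {p : ℕ}, p.Prime → Summable (fun k : ℕ => ‖betw n (p ^ k)‖) := by
    intro p hp
    refine Summable.of_nonneg_of_le (fun _ => norm_nonneg _) ?_ q0_summable
    intro k
    rw [Real.norm_of_nonneg (betw_nonneg _ _)]; exact betw_pp hp n k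
  have h1 : betw n 1 = 1 := by simp [betw, (bet_mult n).1]
  have hmul : ∀ {a b : ℕ}, Nat.Coprime a b → betw n (a * b) = betw n a * betw n b := by
    intro a b h
    unfold betw
    rw [(bet_mult n).2 h, abs_mul]
    push_cast
    rw [Real.mul_rpow (by positivity) (by positivity)]; ring
  obtain ⟨hs, hsum⟩ := EulerProduct.summable_and_hasSum_factoredNumbers_prod_filter_prime_tsum (R := ℝ)
    (f := betw n) h1 hmul hpp s
  have hsupp : Function.support (betw n) ⊆ Nat.factoredNumbers s := by
    intro l hl
    by_contra h
    apply hl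
    simp [betw, bet_vanish hn l h]
  have hfull : HasSum (betw n) (∏ p ∈ s with p.Prime, ∑' k : ℕ, betw n (p ^ k)) :=
    (hasSum_subtype_iff_of_support_subset hsupp).mp hsum
  refine ⟨hfull.summable, ?_⟩
  rw [hfull.tsum_eq]
  calc _ ≤ ∏ p ∈ s with p.Prime, C0 := by
        apply Finset.prod_le_prod
        · intro p _; exact tsum_nonneg (fun _ => betw_nonneg _ _)
        · intro p hp
          have hp := (Finset.mem_filter.mp hp).2
          have := (hpp hp).of_norm
          exact this.tsum_le_tsum (fun k => betw_pp hp n k) q0_summable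
    _ = C0 ^ (s.filter Nat.Prime).card := by rw [Finset.prod_const]
    _ ≤ _ := pow_le_pow_right₀ C0_ge (Finset.card_filter_le _ _)

lemma omega_bound (C ε : ℝ) (hC : 1 ≤ C) (hε : 0 < ε) :
    ∃ K : ℝ, 0 < K ∧ ∀ m : ℕ, 0 < m → C ^ m.primeFactors.card ≤ K * (m:ℝ) ^ ε := by
  obtain ⟨P, hP⟩ := exists_nat_ge (C ^ (1/ε))
  refine ⟨C ^ P, by positivity, ?_⟩
  intro m hm
  have h1 : C ^ m.primeFactors.card = ∏ p ∈ m.primeFactors, C := by rw [Finset.prod_const]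
  rw [h1, ← Finset.prod_filter_mul_prod_filter_not m.primeFactors (fun p => p < P)]
  have h2 : ∏ p ∈ m.primeFactors with p < P, C ≤ C ^ P := by
    rw [Finset.prod_const]
    apply pow_le_pow_right₀ hC
    calc _ ≤ (range P).card := by
          apply Finset.card_le_card
          intro p hp
          simp at hp; simp [hp.2]
      _ = P := Finset.card_range P
  have h3 : ∏ p ∈ m.primeFactors with ¬ p < P, C ≤ (m:ℝ) ^ ε := by
    calc _ ≤ ∏ p ∈ m.primeFactors with ¬ p < P, (p:ℝ) ^ ε := by
          apply Finset.prod_le_prod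
          · intro _ _; linarith
          · intro p hp
            have hp' : P ≤ p := by have := (Finset.mem_filter.mp hp).2; omega
            have : C ^ (1/ε) ≤ p := hP.trans (by exact_mod_cast hp')
            calc C = (C ^ (1/ε)) ^ ε := by
                  rw [← Real.rpow_mul (by linarith)]; field_simp; simp
              _ ≤ _ := Real.rpow_le_rpow (by positivity) this hε.le
      _ ≤ ∏ p ∈ m.primeFactors, (p:ℝ) ^ ε := by
          rw [Finset.prod_filter]
          apply Finset.prod_le_prod
          · intro p _; split_ifs <;> positivity
          · intro p hp
            have hp1 : (1:ℝ) ≤ p := by exact_mod_cast (Nat.prime_of_mem_primeFactors hp).one_lt.le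
            split_ifs
            · exact Real.one_le_rpow hp1 hε.le
            · exact le_rfl
      _ = (((∏ p ∈ m.primeFactors, p : ℕ)) : ℝ) ^ ε := by
          push_cast
          rw [Real.finsetProd_rpow]
          intro i _; positivity
      _ ≤ _ := by
          apply Real.rpow_le_rpow (by positivity) _ hε.le
          exact_mod_cast Nat.le_of_dvd hm (Nat.prod_primeFactors_dvd m)
  exact mul_le_mul h2 h3 (Finset.prod_nonneg (fun _ _ => by linarith)) (by positivity)

lemma betw_bound (ε : ℝ) (hε : 0 < ε) : ∃ K : ℝ, 0 < K ∧ ∀ n : ℕ, 2 < n →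
    ∑' l, betw n l ≤ K * (n:ℝ) ^ ε := by
  obtain ⟨K, hK, h⟩ := omega_bound C0 (ε/3) C0_ge (by positivity)
  refine ⟨K, hK, ?_⟩
  intro n hn
  refine (betw_sum hn).2.trans ?_
  have hn4 : 4 < n ^ 2 := by nlinarith
  refine (h _ (by omega)).trans ?_
  have hn0 : (0:ℝ) < n := by positivity
  have : ((2 * (n ^ 2 - 4) : ℕ) : ℝ) ≤ (n:ℝ) ^ 3 := by
    have : 2 * (n ^ 2 - 4) ≤ n ^ 3 := by
      have : n ^ 3 = n * n ^ 2 := by ring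
      have h2 : 2 * n ^ 2 ≤ n * n ^ 2 := Nat.mul_le_mul_right _ hn.le
      omega
    exact_mod_cast this
  have h5 : (n:ℝ) ^ ε = ((n:ℝ) ^ 3) ^ (ε/3) := by
    rw [← Real.rpow_natCast, ← Real.rpow_mul hn0.le]; congr 1; push_cast; ring
  rw [h5]
  gcongr
end

lemma exists_neg_one_odd (p : ℕ) (hp : p.Prime) (hp2 : p ≠ 2) (j E' : ℕ) (hj : Odd j) (hE' : ¬ p ∣ E')
    : ∃ m : ℕ, Odd m ∧ jacobiSym ((p ^ j * E' : ℕ) : ℤ) m = -1 := by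
  have : Fact p.Prime := ⟨hp⟩
  have hE0 : E' ≠ 0 := by rintro rfl; simp at hE'
  have hodd : Odd p := hp.odd_of_ne_two hp2
  obtain ⟨r, hr⟩ : ∃ r : ℤ, legendreSym p r = -1 := by
    obtain ⟨a, ha⟩ := FiniteField.exists_nonsquare (F := ZMod p) (by rw [ZMod.ringChar_zmod_n]; exact hp2)
    obtain ⟨r, rfl⟩ := ZMod.intCast_surjective a
    exact ⟨r, (legendreSym.eq_neg_one_iff p).mpr ha⟩
  have hcop : Nat.Coprime (4 * E') p := by
    rw [Nat.coprime_comm, Nat.Prime.coprime_iff_not_dvd hp]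
    intro h
    rcases hp.dvd_mul.mp h with h | h
    · have : p ∣ 2 ^ 2 := by simpa using h
      exact hp2 ((Nat.prime_dvd_prime_iff_eq hp Nat.prime_two).mp (hp.dvd_of_dvd_pow this))
    · exact hE' h
  obtain ⟨m, hm1, hm2⟩ := Nat.chineseRemainder hcop 1 ((r % p).toNat)
  have hm4 : m % 4 = 1 := by
    have : m ≡ 1 [MOD 4] := hm1.of_mul_right _
    exact this
  have hmo : Odd m := by rw [Nat.odd_iff]; omega
  refine ⟨m, hmo, ?_⟩
  push_cast
  rw [jacobiSym.mul_left, jacobiSym.pow_left]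
  have h1 : jacobiSym (E' : ℤ) m = 1 := by
    rw [jacobiSym.mod_right' E' hmo, hm1]
    have : 1 % (4 * E') = 1 := Nat.mod_eq_of_lt (by omega)
    rw [this, jacobiSym.one_right]
  have h2 : jacobiSym (p : ℤ) m = -1 := by
    rw [jacobiSym.quadratic_reciprocity_one_mod_four' hodd hm4]
    have h3 : ((m:ℤ)) % p = r % p := by
      have h4 : ((m:ℕ):ℤ) % (p:ℤ) = ((r % p).toNat : ℤ) % p := by exact_mod_cast hm2
      rw [h4, Int.toNat_of_nonneg (Int.emod_nonneg _ (by exact_mod_cast hp.ne_zero)), Int.emod_emod]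
    rw [jacobiSym.mod_left' h3, ← jacobiSym.legendreSym.to_jacobiSym, hr]
  rw [h1, h2, hj.neg_one_pow, mul_one]

lemma exists_neg_one_two (j t : ℕ) (hj : Odd j) (ht : Odd t) :
    ∃ m : ℕ, Odd m ∧ jacobiSym ((2 ^ j * t ^ 2 : ℕ) : ℤ) m = -1 := by
  have hcop : Nat.Coprime 8 t := by
    have : Nat.Coprime 2 t := by rwa [Nat.coprime_two_left]
    exact this.pow_left 3
  obtain ⟨m, hm1, hm2⟩ := Nat.chineseRemainder hcop 5 1
  have hm8 : m % 8 = 5 := hm1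
  have hmo : Odd m := by rw [Nat.odd_iff]; omega
  refine ⟨m, hmo, ?_⟩
  push_cast
  rw [jacobiSym.mul_left, jacobiSym.pow_left]
  have h2 : jacobiSym 2 m = -1 := by
    rw [jacobiSym.at_two hmo, ZMod.χ₈_nat_eq_if_mod_eight]
    rw [if_neg (by omega), if_neg (by omega)]
  have h3 : jacobiSym ((t:ℤ) ^ 2) m = 1 := by
    apply jacobiSym.sq_one'
    rw [Int.gcd_natCast_natCast]
    rw [Nat.gcd_comm]
    have := hm2.gcd_eq
    rw [this]; simp
  rw [h2, h3, hj.neg_one_pow, mul_one]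

lemma exists_neg_one (E : ℕ) (hE0 : E ≠ 0) (hE : ¬ IsSquare E) : ∃ m : ℕ, Odd m ∧ jacobiSym (E : ℤ) m = -1 := by
  obtain ⟨j, t, ht, rfl⟩ := Nat.exists_eq_pow_mul_and_not_dvd hE0 2 (by norm_num)
  have hto : Odd t := by rwa [← Nat.not_even_iff_odd, even_iff_two_dvd]
  have ht0 : t ≠ 0 := by rintro rfl; simp at ht
  obtain ⟨a, b, hab, hsq⟩ := Nat.sq_mul_squarefree t
  by_cases ha : a = 1
  · subst ha
    rw [mul_one] at hab
    subst hab
    have hj : Odd j := by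
      by_contra hj
      rw [Nat.not_odd_iff_even] at hj
      apply hE
      exact (hj.isSquare_pow 2).mul ⟨b, by ring⟩
    apply exists_neg_one_two j b hj
    exact Nat.Odd.of_mul_left (n := b) (by rw [← sq]; exact hto)
  · obtain ⟨p, hp, hpa⟩ := Nat.exists_prime_and_dvd ha
    have hpt : p ∣ t := by rw [← hab]; exact hpa.mul_left _
    have hp2 : p ≠ 2 := by rintro rfl; exact ht hpt
    obtain ⟨a', rfl⟩ := hpa
    have hpa' : ¬ p ∣ a' := by
      intro h
      obtain ⟨c, rfl⟩ := h
      have := hsq p ⟨c, by ring⟩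
      exact hp.one_lt.ne' (Nat.isUnit_iff.mp this)
    have hb0 : b ≠ 0 := by rintro rfl; simp at hab; exact ht0 hab.symm
    obtain ⟨i, b', hb', rfl⟩ := Nat.exists_eq_pow_mul_and_not_dvd hb0 p hp.ne_one
    have : 2 ^ j * t = p ^ (2 * i + 1) * (2 ^ j * (b' ^ 2 * a')) := by
      rw [← hab]; ring
    rw [this]
    apply exists_neg_one_odd p hp hp2 _ _ ⟨i, rfl⟩
    intro h
    rcases hp.dvd_mul.mp h with h | h
    · exact hp2 ((Nat.prime_dvd_prime_iff_eq hp Nat.prime_two).mp (hp.dvd_of_dvd_pow h))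
    rcases hp.dvd_mul.mp h with h | h
    · exact hb' (hp.dvd_of_dvd_pow h)
    · exact hpa' h

lemma Jn_period (E : ℕ) (m k : ℕ) : Jn E (m + 4 * E * k) = Jn E m := by
  unfold Jn
  have hpar : Odd (m + 4 * E * k) ↔ Odd m := by
    rw [Nat.odd_add]
    have : Even (4 * E * k) := ⟨2 * E * k, by ring⟩
    tauto
  by_cases h : Odd m
  · rw [if_pos (hpar.mpr h), if_pos h, jacobiSym.mod_right' E (hpar.mpr h), jacobiSym.mod_right' E h]
    rw [Nat.add_mul_mod_self_left]
  · rw [if_neg (by tauto), if_neg h]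

lemma Jn_mod (E : ℕ) (m : ℕ) : Jn E (m % (4 * E)) = Jn E m := by
  conv_rhs => rw [← Nat.mod_add_div m (4 * E)]
  rw [Jn_period]

lemma Jn_full_sum (E : ℕ) (hE0 : E ≠ 0) (hE : ¬ IsSquare E) : ∑ m ∈ range (4 * E), Jn E m = 0 := by
  obtain ⟨m0, hm0, hJ⟩ := exists_neg_one E hE0 hE
  have : NeZero (4 * E) := ⟨by omega⟩
  have hJ' : Jn E m0 = -1 := by rw [Jn, if_pos hm0, hJ]
  have hcop : Nat.Coprime m0 (4 * E) := by
    have h2 : Nat.Coprime m0 2 := by rwa [Nat.coprime_two_right]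
    have h4 : Nat.Coprime m0 4 := h2.pow_right 2
    refine h4.mul_right ?_
    by_contra hc
    have : jacobiSym (E:ℤ) m0 = 0 := by
      rw [jacobiSym.eq_zero_iff]
      refine ⟨by rintro rfl; simp at hm0, ?_⟩
      rw [Int.gcd_natCast_natCast, Nat.gcd_comm]; exact hc
    rw [hJ] at this; norm_num at this
  let u := ZMod.unitOfCoprime m0 hcop
  let F : ZMod (4 * E) → ℤ := fun z => Jn E z.val
  have hF : ∀ a : ℕ, F (a : ZMod (4 * E)) = Jn E a := by
    intro a
    simp only [F, ZMod.val_natCast]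
    exact Jn_mod E a
  have hsum : ∑ z : ZMod (4 * E), F z = ∑ m ∈ range (4 * E), Jn E m := by
    symm
    apply Finset.sum_nbij (fun m : ℕ => (m : ZMod (4 * E)))
    · intro a _; simp
    · intro a ha b hb hab
      simp at ha hb
      simp only [ZMod.natCast_eq_natCast_iff] at hab
      exact Nat.ModEq.eq_of_lt_of_lt hab ha hb
    · intro z _
      exact ⟨z.val, by simp [ZMod.val_lt], by simp⟩
    · intro a _; rw [hF]
  have hmul : ∀ z, F ((m0 : ZMod (4 * E)) * z) = - F z := by
    intro z
    have : (m0 : ZMod (4 * E)) * z = ((m0 * z.val : ℕ) : ZMod (4 * E)) := by simp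
    rw [this, hF, Jn_mul, hJ']; simp [F]
  have hperm : ∑ z : ZMod (4 * E), F ((m0 : ZMod (4 * E)) * z) = ∑ z : ZMod (4 * E), F z := by
    exact Equiv.sum_comp (Units.mulLeft u) F
  simp only [hmul, Finset.sum_neg_distrib] at hperm
  rw [← hsum]; linarith

lemma Jn_partial (E : ℕ) (hE0 : E ≠ 0) (hE : ¬ IsSquare E) (Q : ℕ) :
    |((∑ m ∈ range Q, Jn E m : ℤ) : ℝ)| ≤ 4 * E := by
  induction Q using Nat.strong_induction_on with
  | _ Q ih =>
    rcases Nat.lt_or_ge Q (4 * E) with h | h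
    · push_cast
      calc _ ≤ ∑ m ∈ range Q, |(Jn E m : ℝ)| := abs_sum_le_sum_abs _ _
        _ ≤ ∑ m ∈ range Q, (1:ℝ) := sum_le_sum (fun m _ => Jn_abs _ _)
        _ = Q := by simp
        _ ≤ _ := by exact_mod_cast h.le
    · obtain ⟨Q', rfl⟩ := Nat.exists_eq_add_of_le h
      rw [Finset.sum_range_add, Jn_full_sum E hE0 hE, zero_add]
      have : ∀ m, Jn E (4 * E + m) = Jn E m := by
        intro m
        have := Jn_period E m 1
        rwa [mul_one, add_comm] at this
      simp only [this]
      exact ih Q' (by omega)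

lemma abel_bound (f : ℕ → ℝ) (B : ℝ) (hB : ∀ Q, |∑ m ∈ range Q, f m| ≤ B)
    (w : ℕ → ℝ) (y z : ℕ) (hyz : y ≤ z) (hw : ∀ a, y ≤ a → w (a+1) ≤ w a) (hw0 : ∀ a, y ≤ a → 0 ≤ w a) :
    |∑ a ∈ Ico y z, f a * w a| ≤ 2 * B * w y := by
  have hT : ∀ z, y ≤ z → |∑ a ∈ Ico y z, f a| ≤ 2 * B := by
    intro z hz
    rw [Finset.sum_Ico_eq_sub _ hz]
    have := abs_sub (∑ m ∈ range z, f m) (∑ m ∈ range y, f m)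
    linarith [hB z, hB y]
  have key : ∀ z, y ≤ z → |∑ a ∈ Ico y z, f a * w a - (∑ a ∈ Ico y z, f a) * w z| ≤ 2 * B * (w y - w z) := by
    intro z hz
    induction z, hz using Nat.le_induction with
    | base => simp
    | succ z hz ih =>
      rw [Finset.sum_Ico_succ_top hz, Finset.sum_Ico_succ_top hz]
      have e : ∑ a ∈ Ico y z, f a * w a + f z * w z - (∑ a ∈ Ico y z, f a + f z) * w (z+1)
        = (∑ a ∈ Ico y z, f a * w a - (∑ a ∈ Ico y z, f a) * w z)
          + (∑ a ∈ Ico y (z+1), f a) * (w z - w (z+1)) := by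
        rw [Finset.sum_Ico_succ_top hz]; ring
      rw [e]
      refine (abs_add_le _ _).trans ?_
      rw [abs_mul, abs_of_nonneg (sub_nonneg.mpr (hw z hz))]
      have h1 := mul_le_mul_of_nonneg_right (hT (z+1) (by omega)) (sub_nonneg.mpr (hw z hz))
      linarith
  have h1 := key z hyz
  have h2 := mul_le_mul_of_nonneg_right (hT z hyz) (hw0 z hyz)
  have h3 : |(∑ a ∈ Ico y z, f a) * w z| ≤ 2 * B * w z := by
    rw [abs_mul, abs_of_nonneg (hw0 z hyz)]; exact h2
  have := abs_sub_abs_le_abs_sub (∑ a ∈ Ico y z, f a * w a) ((∑ a ∈ Ico y z, f a) * w z)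
  linarith

/-- partial sums of `∑ J(m)/m`, over `1 ≤ m ≤ Y` -/
noncomputable def PL (E : ℤ) (Y : ℕ) : ℝ := ∑ m ∈ range (Y + 1), (Jn E m : ℝ) / m
noncomputable def Lval (E : ℤ) : ℝ := limUnder atTop (PL E)

lemma PL_diff (E : ℕ) (hE0 : E ≠ 0) (hE : ¬ IsSquare E) (Y Z : ℕ) (h : Y ≤ Z) :
    |PL E Z - PL E Y| ≤ 8 * E / ((Y:ℝ) + 1) := by
  unfold PL
  rw [← Finset.sum_Ico_eq_sub _ (by omega : Y + 1 ≤ Z + 1)]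
  have := abel_bound (fun m => (Jn E m : ℝ)) (4 * E)
    (fun Q => by have := Jn_partial E hE0 hE Q; push_cast at this; exact this)
    (fun m => (1:ℝ) / m) (Y+1) (Z+1) (by omega)
    (fun a ha => by
      have : (0:ℝ) < a := by exact_mod_cast (by omega : 0 < a)
      push_cast
      gcongr; linarith) (fun a _ => by positivity)
  simp only [mul_one_div] at this
  refine this.trans (le_of_eq ?_)
  push_cast; ring

lemma PL_tendsto (E : ℕ) (hE0 : E ≠ 0) (hE : ¬ IsSquare E) : Tendsto (PL E) atTop (nhds (Lval E)) := by
  have hc : CauchySeq (PL E) := by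
    apply cauchySeq_of_le_tendsto_0 (fun Y : ℕ => 2 * (8 * (E:ℝ) / ((Y:ℝ) + 1)))
    · intro a b N ha hb
      have h1 := PL_diff E hE0 hE N a ha
      have h2 := PL_diff E hE0 hE N b hb
      rw [Real.dist_eq]
      have : PL E a - PL E b = (PL E a - PL E N) - (PL E b - PL E N) := by ring
      rw [this]
      refine (abs_sub _ _).trans ?_
      linarith
    · have := (tendsto_one_div_add_atTop_nhds_zero_nat (𝕜 := ℝ)).const_mul (2 * (8 * (E:ℝ)))
      rw [mul_zero] at this
      refine this.congr ?_
      intro Y; ring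
  exact hc.tendsto_limUnder

lemma PL_bound (E : ℕ) (hE0 : E ≠ 0) (hE : ¬ IsSquare E) (Y : ℕ) :
    |Lval E - PL E Y| ≤ 8 * E / ((Y:ℝ) + 1) := by
  have h := ((PL_tendsto E hE0 hE).sub_const (PL E Y)).abs
  refine le_of_tendsto h ?_
  filter_upwards [eventually_ge_atTop Y] with Z hZ
  exact PL_diff E hE0 hE Y Z hZ

/-- nonsquare discriminants -/
lemma D_nonsq {n : ℕ} (hn : 2 < n) : ¬ IsSquare (n ^ 2 - 4) := by
  rintro ⟨r, hr⟩
  have h4 : 4 < n ^ 2 := by nlinarith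
  have h5 : n ^ 2 = r * r + 4 := by omega
  have h6 : r < n := by nlinarith
  have h7 : r + 1 ≤ n := h6
  have h8 : n ^ 2 ≥ (r + 1) ^ 2 := Nat.pow_le_pow_left h7 2
  have : r ≤ 1 := by nlinarith
  interval_cases r
  · have : n ^ 2 = 4 := by omega
    omega
  · have h9 : n ^ 2 = 5 := by omega
    have : 3 ≤ n := hn
    nlinarith

lemma Dz_eq {n : ℕ} (hn : 2 < n) : Dz n = ((n ^ 2 - 4 : ℕ) : ℤ) := by
  have h4 : 4 < n ^ 2 := by nlinarith
  rw [Dz]; push_cast [h4.le]; rfl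

lemma PL_bound_D {n : ℕ} (hn : 2 < n) (Y : ℕ) :
    |Lval (Dz n) - PL (Dz n) Y| ≤ 8 * (n:ℝ) ^ 2 / ((Y:ℝ) + 1) := by
  have h4 : 4 < n ^ 2 := by nlinarith
  rw [Dz_eq hn]
  refine (PL_bound _ (by omega) (D_nonsq hn) Y).trans ?_
  gcongr
  have : n ^ 2 - 4 ≤ n ^ 2 := Nat.sub_le _ _
  exact_mod_cast this

section
open scoped ArithmeticFunction.Moebius ArithmeticFunction.zeta
open Classical in
noncomputable def sqA : ArithmeticFunction ℝ := ⟨fun m => if m ≠ 0 ∧ IsSquare m then 1 else 0, by simp⟩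

lemma sqA_mult : sqA.IsMultiplicative := by
  classical
  rw [ArithmeticFunction.IsMultiplicative.iff_ne_zero]
  refine ⟨by simp [sqA], ?_⟩
  intro a b ha hb hab
  have key : IsSquare (a * b) ↔ IsSquare a ∧ IsSquare b := by
    constructor
    · rintro ⟨r, hr⟩
      constructor
      · obtain ⟨d, hd⟩ := exists_eq_pow_of_mul_eq_pow (a := a) (b := b) (c := r) (k := 2)
          (by rw [Nat.isUnit_iff]; exact hab) (by rw [hr, sq])
        exact ⟨d, by rw [hd, sq]⟩
      · obtain ⟨d, hd⟩ := exists_eq_pow_of_mul_eq_pow (a := b) (b := a) (c := r) (k := 2)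
          (by rw [Nat.isUnit_iff]; exact hab.symm) (by rw [mul_comm, hr, sq])
        exact ⟨d, by rw [hd, sq]⟩
    · rintro ⟨h1, h2⟩; exact h1.mul h2
  simp only [sqA, ArithmeticFunction.coe_mk, key]
  by_cases h1 : IsSquare a <;> by_cases h2 : IsSquare b <;> simp [h1, h2, ha, hb]

lemma sqA_pp {p : ℕ} (hp : p.Prime) (k : ℕ) : sqA (p ^ k) = if Even k then 1 else 0 := by
  classical
  have : IsSquare (p ^ k) ↔ Even k := by
    constructor
    · rintro ⟨r, hr⟩
      have : (p ^ k).factorization p = (r * r).factorization p := by rw [hr]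
      have hr0 : r ≠ 0 := by rintro rfl; simp [hp.ne_zero] at hr
      rw [hp.factorization_pow, Nat.factorization_mul hr0 hr0] at this
      simp at this
      exact ⟨_, this⟩
    · intro h; exact h.isSquare_pow p
  simp [sqA, this, hp.ne_zero]

lemma liou_zeta : liouR * (ζ : ArithmeticFunction ℝ) = sqA := by
  have hz : (ζ : ArithmeticFunction ℝ).IsMultiplicative := ArithmeticFunction.isMultiplicative_zeta.natCast
  rw [(liouR_mult.mul hz).eq_iff_eq_on_prime_powers _ _ sqA_mult]
  intro p k hp
  rw [sqA_pp hp, conv_pp _ _ hp]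
  have : ∀ i ∈ range (k+1), liouR (p ^ i) * (ζ : ArithmeticFunction ℝ) (p ^ (k - i)) = (-1) ^ i := by
    intro i _
    rw [liouR_pp hp, ArithmeticFunction.natCoe_apply, ArithmeticFunction.zeta_apply_ne (pow_ne_zero _ hp.ne_zero)]
    simp
  rw [sum_congr rfl this]
  induction k with
  | zero => simp
  | succ k ih =>
    rw [Finset.sum_range_succ, ih (fun i _ => by
      rw [liouR_pp hp, ArithmeticFunction.natCoe_apply, ArithmeticFunction.zeta_apply_ne (pow_ne_zero _ hp.ne_zero)]
      simp), pow_succ]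
    by_cases h : Even k
    · rw [if_pos h, if_neg (by rw [Nat.even_add_one]; tauto), h.neg_one_pow]; norm_num
    · rw [if_neg h, if_pos (by rw [Nat.even_add_one]; tauto), (Nat.not_even_iff_odd.mp h).neg_one_pow]; norm_num

noncomputable def HJ (n Y : ℕ) : ℝ := ∑ a ∈ Ioc 0 Y, (Jn (Dz n) a : ℝ) * ((Y / a : ℕ) : ℝ)

lemma partA_sum (n X : ℕ) : ((∑ k ∈ Icc 1 X, ∑ m ∈ Icc 1 (X / k ^ 2), rho n m : ℕ) : ℝ)
    = ∑ l ∈ Ioc 0 X, bet n l * HJ n (X / l) := by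
  classical
  have h1 : ∑ N ∈ Ioc 0 X, (sqA * rhoA n) N = ((∑ k ∈ Icc 1 X, ∑ m ∈ Icc 1 (X / k ^ 2), rho n m : ℕ) : ℝ) := by
    rw [ArithmeticFunction.sum_Ioc_mul_eq_sum_sum]
    push_cast
    have e1 : ∀ j ∈ Ioc 0 X, sqA j * ∑ m ∈ Ioc 0 (X / j), rhoA n m
        = if IsSquare j then ∑ m ∈ Icc 1 (X / j), (rho n m : ℝ) else 0 := by
      intro j hj
      have : j ≠ 0 := by simp at hj; omega
      simp only [sqA, ArithmeticFunction.coe_mk, rhoA]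
      by_cases h : IsSquare j
      · simp only [h, this, ne_eq, not_false_eq_true, and_self, if_true, one_mul]
        rfl
      · simp [h]
    rw [sum_congr rfl e1, ← Finset.sum_filter]
    have e2 : ∑ k ∈ Icc 1 X, ∑ m ∈ Icc 1 (X / k ^ 2), (rho n m : ℝ)
      = ∑ k ∈ (Icc 1 X).filter (fun k => k ^ 2 ≤ X), ∑ m ∈ Icc 1 (X / k ^ 2), (rho n m : ℝ) := by
      rw [Finset.sum_filter]
      apply sum_congr rfl
      intro k _
      split_ifs with h
      · rfl
      · rw [Nat.div_eq_of_lt (by omega)]; simp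
    rw [e2]
    symm
    apply Finset.sum_bij (fun k _ => k ^ 2)
    · intro k hk
      simp only [mem_filter, mem_Icc, Finset.mem_Ioc] at hk ⊢
      exact ⟨⟨by have := hk.1.1; positivity, hk.2⟩, ⟨k, sq k⟩⟩
    · intro a _ b _ h
      exact Nat.pow_left_injective (two_ne_zero) h
    · intro j hj
      simp only [mem_filter, Finset.mem_Ioc] at hj
      obtain ⟨⟨h0, hX⟩, r, rfl⟩ := hj
      have hr : 0 < r := Nat.pos_of_ne_zero (by rintro rfl; simp at h0)
      refine ⟨r, ?_, sq r⟩
      simp only [mem_filter, mem_Icc]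
      exact ⟨⟨hr, by nlinarith⟩, by rw [sq]; exact hX⟩
    · intro k _; rfl
  have h2 : sqA * rhoA n = bet n * (JA (Dz n) * (ζ : ArithmeticFunction ℝ)) := by
    rw [← mul_assoc, ← lam_eq, lam, ← liou_zeta]; ring
  rw [← h1, h2, ArithmeticFunction.sum_Ioc_mul_eq_sum_sum]
  apply sum_congr rfl
  intro l _
  rw [ArithmeticFunction.sum_Ioc_mul_zeta_eq_sum]
  rfl

lemma Jn_partial_D {n : ℕ} (hn : 2 < n) (Q : ℕ) :
    |∑ m ∈ range Q, (Jn (Dz n) m : ℝ)| ≤ 4 * (n:ℝ) ^ 2 := by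
  have h4 : 4 < n ^ 2 := by nlinarith
  have := Jn_partial (n ^ 2 - 4) (by omega) (D_nonsq hn) Q
  push_cast at this
  rw [Dz_eq hn]
  refine this.trans ?_
  have : n ^ 2 - 4 ≤ n ^ 2 := Nat.sub_le _ _
  have : ((n ^ 2 - 4 : ℕ) : ℝ) ≤ (n:ℝ) ^ 2 := by exact_mod_cast this
  linarith

lemma HJ_tail {n : ℕ} (hn : 2 < n) (Y z : ℕ) (hz : z ≤ Y) :
    |∑ a ∈ Ico (z+1) (Y+1), (Jn (Dz n) a : ℝ) * ((Y / a : ℕ) : ℝ)| ≤ 8 * (n:ℝ)^2 * (Y / (z+1)) := by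
  have := abel_bound (fun m => (Jn (Dz n) m : ℝ)) (4 * (n:ℝ)^2) (Jn_partial_D hn)
    (fun a => ((Y / a : ℕ) : ℝ)) (z+1) (Y+1) (by omega)
    (fun a ha => by
      have : Y / (a+1) ≤ Y / a := Nat.div_le_div_left (by omega) (by omega)
      exact_mod_cast this) (fun a _ => by positivity)
  refine this.trans ?_
  have h : ((Y / (z+1) : ℕ) : ℝ) ≤ (Y:ℝ) / ((z:ℝ)+1) := by
    have := @Nat.cast_div_le ℝ _ _ _ Y (z+1)
    push_cast at this; exact this
  calc _ = 8 * (n:ℝ)^2 * ((Y / (z+1) : ℕ) : ℝ) := by ring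
    _ ≤ _ := by gcongr

lemma Ioc_Ico (Y : ℕ) : Ioc 0 Y = Ico 1 (Y+1) := by ext; simp; omega

lemma HJ_abs {n : ℕ} (hn : 2 < n) (Y : ℕ) : |HJ n Y| ≤ 8 * (n:ℝ)^2 * Y := by
  unfold HJ
  rw [Ioc_Ico]
  have := HJ_tail hn Y 0 (by omega)
  simpa using this

lemma HJ_approx {n : ℕ} (hn : 2 < n) (Y z : ℕ) (hz : z ≤ Y) :
    |HJ n Y - Y * Lval (Dz n)| ≤ z + 16 * (n:ℝ)^2 * (Y / (z+1)) := by
  have h1 : HJ n Y = ∑ a ∈ Ico 1 (z+1), (Jn (Dz n) a : ℝ) * ((Y / a : ℕ) : ℝ)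
    + ∑ a ∈ Ico (z+1) (Y+1), (Jn (Dz n) a : ℝ) * ((Y / a : ℕ) : ℝ) := by
    unfold HJ
    rw [Ioc_Ico, Finset.sum_Ico_consecutive _ (by omega) (by omega)]
  have h2 : PL (Dz n) z = ∑ a ∈ Ico 1 (z+1), (Jn (Dz n) a : ℝ) / a := by
    unfold PL
    rw [Finset.range_eq_Ico, Finset.sum_eq_sum_Ico_succ_bot (by omega)]
    simp
  have h3 : |∑ a ∈ Ico 1 (z+1), (Jn (Dz n) a : ℝ) * ((Y / a : ℕ) : ℝ) - Y * PL (Dz n) z| ≤ z := by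
    rw [h2, Finset.mul_sum, ← Finset.sum_sub_distrib]
    calc _ ≤ ∑ a ∈ Ico 1 (z+1), |(Jn (Dz n) a : ℝ) * ((Y / a : ℕ) : ℝ) - Y * ((Jn (Dz n) a : ℝ) / a)| :=
          abs_sum_le_sum_abs _ _
      _ ≤ ∑ a ∈ Ico 1 (z+1), (1:ℝ) := by
          apply sum_le_sum
          intro a ha
          have e : (Jn (Dz n) a : ℝ) * ((Y / a : ℕ) : ℝ) - Y * ((Jn (Dz n) a : ℝ) / a)
            = (Jn (Dz n) a : ℝ) * (((Y / a : ℕ) : ℝ) - (Y:ℝ) / a) := by ring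
          rw [e, abs_mul]
          have h5 : |((Y / a : ℕ) : ℝ) - (Y:ℝ) / a| ≤ 1 := by
            have b1 := @Nat.cast_div_le ℝ _ _ _ Y a
            have ha0 : (0:ℝ) < a := by simp at ha; exact_mod_cast (by omega)
            have b2 : (Y:ℝ) / a ≤ ((Y / a : ℕ) : ℝ) + 1 := by
              rw [div_le_iff₀ ha0]
              have : Y < (Y / a + 1) * a := by
                rw [mul_comm]; exact Nat.lt_mul_div_succ Y (by simp at ha; omega)
              exact_mod_cast this.le
            rw [abs_le]; constructor <;> linarith
          calc _ ≤ 1 * 1 := mul_le_mul (Jn_abs _ _) h5 (abs_nonneg _) (by norm_num)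
            _ = 1 := by norm_num
      _ = z := by simp
  have h4 := HJ_tail hn Y z hz
  have h5 : |(Y:ℝ) * (PL (Dz n) z - Lval (Dz n))| ≤ 8 * (n:ℝ)^2 * (Y / (z+1)) := by
    rw [abs_mul, abs_sub_comm, abs_of_nonneg (by positivity : (0:ℝ) ≤ Y)]
    have := PL_bound_D hn z
    calc _ ≤ (Y:ℝ) * (8 * (n:ℝ) ^ 2 / ((z:ℝ) + 1)) := by gcongr
      _ = _ := by ring
  rw [h1]
  have e : ∑ a ∈ Ico 1 (z+1), (Jn (Dz n) a : ℝ) * ((Y / a : ℕ) : ℝ)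
    + ∑ a ∈ Ico (z+1) (Y+1), (Jn (Dz n) a : ℝ) * ((Y / a : ℕ) : ℝ) - Y * Lval (Dz n)
    = (∑ a ∈ Ico 1 (z+1), (Jn (Dz n) a : ℝ) * ((Y / a : ℕ) : ℝ) - Y * PL (Dz n) z)
     + (∑ a ∈ Ico (z+1) (Y+1), (Jn (Dz n) a : ℝ) * ((Y / a : ℕ) : ℝ)
      + (Y:ℝ) * (PL (Dz n) z - Lval (Dz n))) := by ring
  rw [e]
  refine (abs_add_le _ _).trans ?_
  have := abs_add_le (∑ a ∈ Ico (z+1) (Y+1), (Jn (Dz n) a : ℝ) * ((Y / a : ℕ) : ℝ)) ((Y:ℝ) * (PL (Dz n) z - Lval (Dz n)))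
  linarith

lemma HJ_tendsto {n : ℕ} (hn : 2 < n) : Tendsto (fun Y : ℕ => HJ n Y / Y) atTop (nhds (Lval (Dz n))) := by
  rw [tendsto_iff_dist_tendsto_zero]
  have hlim : Tendsto (fun Y : ℕ => (1 + 16 * (n:ℝ)^2) / (Nat.sqrt Y : ℝ)) atTop (nhds 0) := by
    apply Tendsto.div_atTop tendsto_const_nhds
    apply tendsto_natCast_atTop_atTop.comp
    apply tendsto_atTop.mpr
    intro b
    filter_upwards [eventually_ge_atTop (b * b)] with Y hY
    exact Nat.le_sqrt.mpr hY
  apply squeeze_zero' (Eventually.of_forall (fun _ => dist_nonneg)) _ hlim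
  filter_upwards [eventually_ge_atTop 1] with Y hY
  have hY0 : (0:ℝ) < Y := by exact_mod_cast hY
  set z := Nat.sqrt Y with hz
  have hz1 : 1 ≤ z := Nat.le_sqrt.mpr (by omega)
  have hz0 : (0:ℝ) < z := by exact_mod_cast hz1
  have hzz : (z:ℝ) * z ≤ Y := by exact_mod_cast Nat.sqrt_le Y
  have := HJ_approx hn Y z (Nat.sqrt_le_self Y)
  rw [Real.dist_eq]
  have e : HJ n Y / Y - Lval (Dz n) = (HJ n Y - Y * Lval (Dz n)) / Y := by field_simp
  rw [e, abs_div, abs_of_pos hY0, div_le_iff₀ hY0]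
  refine this.trans ?_
  have a1 : (z:ℝ) ≤ Y / z := by rw [le_div_iff₀ hz0]; exact hzz
  have a2 : (Y:ℝ) / (z+1) ≤ Y / z := by gcongr; linarith
  have e2 : (1 + 16 * (n:ℝ)^2) / z * Y = Y / z + 16 * (n:ℝ)^2 * (Y / z) := by ring
  rw [e2]
  gcongr

noncomputable def Bn (n : ℕ) : ℝ := ∑' l, bet n l / l

lemma bet_div_le (n l : ℕ) : |bet n l / l| ≤ betw n l := by
  rcases Nat.eq_zero_or_pos l with rfl | h
  · simp [betw]
  have h1 : (1:ℝ) ≤ l := by exact_mod_cast h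
  unfold betw
  rw [abs_div, div_eq_mul_inv, abs_of_pos (by linarith : (0:ℝ) < l), ← Real.rpow_neg_one]
  gcongr
  · norm_num

lemma bet_summable {n : ℕ} (hn : 2 < n) : Summable (fun l : ℕ => bet n l / l) :=
  Summable.of_norm_bounded (betw_sum hn).1 (fun l => bet_div_le n l)

lemma nat_div_tendsto (l : ℕ) (hl : 0 < l) : Tendsto (fun X : ℕ => ((X / l : ℕ) : ℝ) / X) atTop (nhds (1 / l)) := by
  have h := (tendsto_nat_floor_mul_div_atTop (R := ℝ) (a := 1 / l) (by positivity)).comp tendsto_natCast_atTop_atTop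
  refine h.congr ?_
  intro X
  simp only [Function.comp]
  congr 2
  rw [one_div_mul_eq_div, Nat.floor_div_eq_div]

theorem ampA_eq {n : ℕ} (hn : 2 < n) : ampA n = Lval (Dz n) * Bn n := by
  refine tendsto_nhds_unique (partA hn) ?_
  have h1 : ∀ X : ℕ, ((∑ k ∈ Icc 1 X, ∑ m ∈ Icc 1 (X / k ^ 2), rho n m : ℕ) : ℝ) / X
     = ∑' l : ℕ, bet n l * (HJ n (X / l) / X) := by
    intro X
    rw [partA_sum, Finset.sum_div]
    rw [tsum_eq_sum (s := Ioc 0 X)]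
    · apply sum_congr rfl; intro l _; ring
    · intro l hl
      simp only [Finset.mem_Ioc, not_and, not_le] at hl
      rcases Nat.eq_zero_or_pos l with rfl | h
      · simp
      · rw [Nat.div_eq_of_lt (hl h)]; simp [HJ]
  simp only [h1]
  have h2 : Lval (Dz n) * Bn n = ∑' l : ℕ, bet n l * (Lval (Dz n) * (1 / l)) := by
    rw [Bn, ← tsum_mul_left]
    apply tsum_congr; intro l; ring
  rw [h2]
  apply tendsto_tsum_of_dominated_convergence (bound := fun l => 8 * (n:ℝ)^2 * betw n l)
  · exact (betw_sum hn).1.mul_left _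
  · intro l
    apply Tendsto.const_mul
    rcases Nat.eq_zero_or_pos l with rfl | hl
    · simp [HJ]
    have a1 : Tendsto (fun X : ℕ => X / l) atTop atTop := by
      apply tendsto_atTop.mpr
      intro b
      filter_upwards [eventually_ge_atTop (b * l)] with X hX
      exact (Nat.le_div_iff_mul_le hl).mpr hX
    have a2 := ((HJ_tendsto hn).comp a1).mul (nat_div_tendsto l hl)
    refine a2.congr' ?_
    filter_upwards [a1.eventually_gt_atTop 0] with X hX
    simp only [Function.comp]
    have : ((X / l : ℕ) : ℝ) ≠ 0 := by exact_mod_cast hX.ne'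
    field_simp
  · filter_upwards [eventually_gt_atTop 0] with X hX l
    have hX0 : (0:ℝ) < X := by exact_mod_cast hX
    rw [Real.norm_eq_abs, abs_mul, abs_div, abs_of_pos hX0]
    have b1 := HJ_abs hn (X / l)
    have b2 : ((X / l : ℕ) : ℝ) ≤ X / l := Nat.cast_div_le
    calc |bet n l| * (|HJ n (X / l)| / X) ≤ |bet n l| * ((8 * (n:ℝ)^2 * (X / l)) / X) := by
          gcongr
          exact b1.trans (by gcongr)
      _ = 8 * (n:ℝ)^2 * |bet n l / l| := by
          rw [abs_div, abs_of_nonneg (by positivity : (0:ℝ) ≤ l)]; field_simp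
      _ ≤ _ := by
          have := bet_div_le n l
          gcongr

lemma PL_abs (E : ℤ) (Y : ℕ) : |PL E Y| ≤ 1 + Real.log Y := by
  have h := harmonic_le_one_add_log Y
  refine le_trans ?_ h
  unfold PL
  rw [Finset.sum_range_succ']
  simp only [Nat.cast_zero, div_zero, add_zero]
  rw [harmonic]
  push_cast
  refine (abs_sum_le_sum_abs _ _).trans ?_
  apply sum_le_sum
  intro m _
  rw [abs_div, abs_of_pos (by positivity : (0:ℝ) < (m:ℝ)+1), ← one_div]
  gcongr
  exact Jn_abs _ _

lemma Lval_abs {n : ℕ} (hn : 2 < n) : |Lval (Dz n)| ≤ 9 + 2 * Real.log n := by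
  have h1 := PL_bound_D hn (n ^ 2)
  have h2 := PL_abs (Dz n) (n ^ 2)
  push_cast at h1 h2
  rw [Real.log_pow] at h2
  have h3 : 8 * (n:ℝ)^2 / ((n:ℝ)^2 + 1) ≤ 8 := by
    rw [div_le_iff₀ (by positivity)]; linarith
  have := abs_sub_abs_le_abs_sub (Lval (Dz n)) (PL (Dz n) (n^2))
  push_cast at h2
  linarith

lemma Bn_abs {n : ℕ} (hn : 2 < n) : |Bn n| ≤ ∑' l, betw n l := by
  exact tsum_of_norm_bounded (f := fun l : ℕ => bet n l / l) (betw_sum hn).1.hasSum (fun l => bet_div_le n l)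

lemma Lval_bound (ε : ℝ) (hε : 0 < ε) : ∃ K : ℝ, 0 < K ∧ ∀ n : ℕ, 2 < n → |Lval (Dz n)| ≤ K * (n:ℝ) ^ ε := by
  refine ⟨9 + 2 / ε, by positivity, ?_⟩
  intro n hn
  refine (Lval_abs hn).trans ?_
  have hn1 : (1:ℝ) ≤ n := by exact_mod_cast (by omega)
  have h1 := Real.log_le_rpow_div (by linarith : (0:ℝ) ≤ n) hε
  have h2 := Real.one_le_rpow hn1 hε.le
  have : (9 + 2 / ε) * (n:ℝ) ^ ε = 9 * (n:ℝ)^ε + 2 * ((n:ℝ)^ε / ε) := by ring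
  rw [this]; linarith

theorem ampA_bound (ε : ℝ) (hε : 0 < ε) : ∃ K : ℝ, 0 < K ∧ ∀ n : ℕ, 2 < n → |ampA n| ≤ K * (n:ℝ) ^ ε := by
  obtain ⟨K1, h1, H1⟩ := Lval_bound (ε/2) (by positivity)
  obtain ⟨K2, h2, H2⟩ := betw_bound (ε/2) (by positivity)
  refine ⟨K1 * K2, by positivity, ?_⟩
  intro n hn
  rw [ampA_eq hn, abs_mul]
  have hn0 : (0:ℝ) < n := by exact_mod_cast (by omega)
  have e : (n:ℝ)^ε = (n:ℝ)^(ε/2) * (n:ℝ)^(ε/2) := by rw [← Real.rpow_add hn0]; congr 1; ring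
  calc _ ≤ (K1 * (n:ℝ)^(ε/2)) * (K2 * (n:ℝ)^(ε/2)) :=
        mul_le_mul (H1 n hn) ((Bn_abs hn).trans (H2 n hn)) (abs_nonneg _) (by positivity)
    _ = _ := by rw [e]; ring

/-- truncated amplitude -/
noncomputable def AM (n M : ℕ) : ℝ := ∑ m ∈ Ioc 0 M, lam n m / m

lemma AM_eq (n M : ℕ) : AM n M = ∑ l ∈ Ioc 0 M, bet n l / l * PL (Dz n) (M / l) := by
  unfold AM
  let dv : ArithmeticFunction ℝ → ArithmeticFunction ℝ := fun f => ⟨fun m => f m / m, by simp⟩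
  have h1 : ∀ m, lam n m / m = (dv (bet n) * dv (JA (Dz n))) m := by
    intro m
    rw [lam_eq, ArithmeticFunction.mul_apply, ArithmeticFunction.mul_apply, Finset.sum_div]
    apply sum_congr rfl
    intro x hx
    have := (Nat.mem_divisorsAntidiagonal.mp hx).1
    simp only [dv, ArithmeticFunction.coe_mk]
    rw [← this]; push_cast
    rw [mul_div_mul_comm]
  simp only [h1]
  rw [ArithmeticFunction.sum_Ioc_mul_eq_sum_sum]
  apply sum_congr rfl
  intro l _
  congr 1
  unfold PL
  rw [Finset.range_eq_Ico, Finset.sum_eq_sum_Ico_succ_bot (Nat.succ_pos _), Ioc_Ico]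
  simp [dv, JA_apply]

theorem ampA_sub_AM {n : ℕ} (hn : 2 < n) (M : ℕ) :
    Summable (fun l : ℕ => bet n l / l * (Lval (Dz n) - PL (Dz n) (M / l))) ∧
    ampA n - AM n M = ∑' l : ℕ, bet n l / l * (Lval (Dz n) - PL (Dz n) (M / l)) := by
  have hz : ∀ l ∉ Ioc 0 M, bet n l / l * PL (Dz n) (M / l) = 0 := by
    intro l hl
    simp only [Finset.mem_Ioc, not_and, not_le] at hl
    rcases Nat.eq_zero_or_pos l with rfl | h
    · simp
    · rw [Nat.div_eq_of_lt (hl h)]; simp [PL]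
  have s1 : Summable (fun l : ℕ => bet n l / l * Lval (Dz n)) := (bet_summable hn).mul_right _
  have s2 : Summable (fun l : ℕ => bet n l / l * PL (Dz n) (M / l)) :=
    summable_of_ne_finset_zero hz
  constructor
  · refine (s1.sub s2).congr ?_
    intro l; ring
  · rw [ampA_eq hn, AM_eq, ← (tsum_eq_sum hz : ∑' l : ℕ, bet n l / l * PL (Dz n) (M / l) = _), Bn, ← tsum_mul_left, ← Summable.tsum_sub]
    · apply tsum_congr; intro l; ring
    · refine s1.congr ?_; intro l; ring
    · exact s2
end

lemma doubling_int (a b s : ℤ) (ha : 3 ≤ a) (hab : a < b) (hs : 0 ≤ s)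
    (h : (a ^ 2 - 4) * (b ^ 2 - 4) = s * s) : 2 * a ≤ b := by
  have hpar : ∃ t, a * b - s = 2 * t := by
    have h1 : Even ((a * b - s) * (a * b + s)) := by
      have : (a * b - s) * (a * b + s) = 2 * (2 * a ^ 2 + 2 * b ^ 2 - 8) := by linear_combination h
      rw [this]; exact even_two_mul _
    rcases Int.even_mul.mp h1 with h2 | h2
    · obtain ⟨r, hr⟩ := h2; exact ⟨r, by linarith⟩
    · obtain ⟨r, hr⟩ := h2; exact ⟨r - s, by linarith⟩
  obtain ⟨t, ht⟩ := hpar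
  have hf : a ^ 2 + b ^ 2 + t ^ 2 - t * (a * b) = 4 := by
    have : s = a * b - 2 * t := by linarith
    rw [this] at h
    nlinarith
  have hab12 : 12 ≤ a * b := by nlinarith
  have ht0 : 0 < t := by
    by_contra hc
    push Not at hc
    nlinarith [mul_nonneg (neg_nonneg.mpr hc) (by linarith : 0 ≤ a * b), sq_nonneg t]
  have ht2 : 2 * t ≤ a * b := by linarith
  have h1 : t ≠ 1 := by rintro rfl; nlinarith [sq_nonneg (a - b)]
  have h2 : t ≠ 2 := by
    rintro rfl
    have : (b - a) ^ 2 = 0 := by linarith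
    have : b - a = 0 := by simpa using this
    linarith
  have h3 : 3 ≤ t := by omega
  have h4 : 0 ≤ a ^ 2 + b ^ 2 + 5 - 3 * (a * b) := by
    nlinarith [mul_nonneg (by linarith : 0 ≤ t - 3) (by linarith : 0 ≤ a * b - t - 3)]
  by_contra hc
  push Not at hc
  nlinarith [mul_nonneg (by linarith : 0 ≤ b - a) (by linarith : 0 ≤ 2 * a - b)]

def sqRel (a b : ℕ) : Prop := IsSquare ((a ^ 2 - 4) * (b ^ 2 - 4))

lemma D_pos {n : ℕ} (hn : 2 < n) : 0 < n ^ 2 - 4 := by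
  have : 3 ^ 2 ≤ n ^ 2 := Nat.pow_le_pow_left hn 2
  omega

lemma sqRel_symm {a b : ℕ} (h : sqRel a b) : sqRel b a := by
  unfold sqRel at *; rwa [mul_comm]

lemma sqRel_trans {a b c : ℕ} (hb : 2 < b) (h1 : sqRel a b) (h2 : sqRel b c) : sqRel a c := by
  unfold sqRel at *
  obtain ⟨s, hs⟩ := h1
  obtain ⟨r, hr⟩ := h2
  have hb0 := D_pos hb
  set A := a ^ 2 - 4
  set B := b ^ 2 - 4
  set C := c ^ 2 - 4
  have h : B ^ 2 * (A * C) = (s * r) ^ 2 := by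
    calc B ^ 2 * (A * C) = (A * B) * (B * C) := by ring
      _ = _ := by rw [hs, hr]; ring
  have hd : B ∣ s * r := by
    rw [← Nat.pow_dvd_pow_iff (n := 2) (by norm_num)]
    exact ⟨_, h.symm⟩
  obtain ⟨q, hq⟩ := hd
  refine ⟨q, ?_⟩
  rw [hq] at h
  have : B ^ 2 * (A * C) = B ^ 2 * (q * q) := by rw [h]; ring
  exact Nat.eq_of_mul_eq_mul_left (by positivity) this

lemma sqRel_doubling {a b : ℕ} (ha : 2 < a) (hab : a < b) (h : sqRel a b) : 2 * a ≤ b := by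
  obtain ⟨s, hs⟩ := h
  have e1 : ((a ^ 2 - 4 : ℕ) : ℤ) = (a : ℤ) ^ 2 - 4 := by
    have := D_pos ha; push_cast [show 4 ≤ a ^ 2 by omega]; ring
  have e2 : ((b ^ 2 - 4 : ℕ) : ℤ) = (b : ℤ) ^ 2 - 4 := by
    have := D_pos (ha.trans hab); push_cast [show 4 ≤ b ^ 2 by omega]; ring
  have := doubling_int a b s (by exact_mod_cast ha) (by exact_mod_cast hab) (by positivity)
    (by rw [← e1, ← e2]; exact_mod_cast hs)
  exact_mod_cast this

open Classical in
lemma class_card (x a : ℕ) (ha : 2 < a) :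
    ((Icc 3 x).filter (fun b => sqRel a b)).card ≤ Nat.log 2 x + 1 := by
  rw [← Finset.card_range (Nat.log 2 x + 1)]
  refine Finset.card_le_card_of_injOn (fun b => Nat.log 2 b) ?_ ?_
  · intro b hb
    simp only [Finset.coe_filter, mem_Icc, Set.mem_ofPred_eq] at hb
    simp only [Finset.coe_range, Set.mem_Iio]
    exact Nat.lt_succ_of_le (Nat.log_mono_right hb.1.2)
  · have key : ∀ b c : ℕ, 3 ≤ b → sqRel a b → sqRel a c → b < c → Nat.log 2 b < Nat.log 2 c := by
      intro b c hb h1 h2 hbc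
      have := sqRel_doubling hb hbc (sqRel_trans ha (sqRel_symm h1) h2)
      have h3 : Nat.log 2 (b * 2) = Nat.log 2 b + 1 := Nat.log_mul_base (by norm_num) (by omega)
      have h4 := Nat.log_mono_right (b := 2) this
      rw [mul_comm] at h4
      omega
    intro b hb c hc hbc
    simp only [Finset.coe_filter, mem_Icc, Set.mem_ofPred_eq] at hb hc
    rcases lt_trichotomy b c with h | h | h
    · exact absurd hbc (key b c hb.1.1 hb.2 hc.2 h).ne
    · exact h
    · exact absurd hbc (key c b hc.1.1 hc.2 hb.2 h).ne'

lemma Jn_mul_left (E F : ℤ) (m : ℕ) : Jn (E * F) m = Jn E m * Jn F m := by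
  unfold Jn
  split_ifs
  · exact jacobiSym.mul_left _ _ _
  · simp

open Classical in
lemma large_sieve (x Q : ℕ) (c : ℕ → ℝ) :
    ∑ m ∈ range Q, (∑ n ∈ Icc 3 x, c n * (Jn (Dz n) m : ℝ)) ^ 2 ≤
      ((Q : ℝ) * (Nat.log 2 x + 1) + 4 * (x : ℝ) ^ 5) * ∑ n ∈ Icc 3 x, c n ^ 2 := by
  have h1 : ∑ m ∈ range Q, (∑ n ∈ Icc 3 x, c n * (Jn (Dz n) m : ℝ)) ^ 2 =
      ∑ n ∈ Icc 3 x, ∑ n' ∈ Icc 3 x, c n * c n' *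
        ((∑ m ∈ range Q, Jn (Dz n * Dz n') m : ℤ) : ℝ) := by
    simp only [sq, Finset.sum_mul_sum]
    rw [Finset.sum_comm]
    refine sum_congr rfl fun n _ => ?_
    rw [Finset.sum_comm]
    refine sum_congr rfl fun n' _ => ?_
    push_cast
    rw [Finset.mul_sum]
    refine sum_congr rfl fun m _ => ?_
    rw [Jn_mul_left]; push_cast; ring
  let w : ℕ → ℕ → ℝ := fun n n' => if sqRel n n' then (Q : ℝ) else 4 * (x : ℝ) ^ 4
  have hwsymm : ∀ n n', w n n' = w n' n := by
    intro n n'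
    have : sqRel n n' ↔ sqRel n' n := ⟨sqRel_symm, sqRel_symm⟩
    simp only [w, this]
  have hw : ∀ n ∈ Icc 3 x, ∀ n' ∈ Icc 3 x,
      |((∑ m ∈ range Q, Jn (Dz n * Dz n') m : ℤ) : ℝ)| ≤ w n n' := by
    intro n hn n' hn'
    rw [mem_Icc] at hn hn'
    simp only [w]
    split_ifs with h
    · push_cast
      refine (abs_sum_le_sum_abs _ _).trans ?_
      calc _ ≤ ∑ m ∈ range Q, (1 : ℝ) := by
            refine sum_le_sum fun m _ => ?_
            exact_mod_cast Jn_abs _ _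
        _ = Q := by simp
    · have hd : Dz n * Dz n' = (((n ^ 2 - 4) * (n' ^ 2 - 4) : ℕ) : ℤ) := by
        rw [Dz_eq (by omega), Dz_eq (by omega)]; push_cast; rfl
      rw [hd]
      have p1 := D_pos (show 2 < n by omega)
      have p2 := D_pos (show 2 < n' by omega)
      refine (Jn_partial _ (by positivity) h Q).trans ?_
      have : (n ^ 2 - 4) * (n' ^ 2 - 4) ≤ x ^ 4 := by
        calc _ ≤ x ^ 2 * x ^ 2 := Nat.mul_le_mul
              ((Nat.sub_le _ _).trans (Nat.pow_le_pow_left hn.2 2))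
              ((Nat.sub_le _ _).trans (Nat.pow_le_pow_left hn'.2 2))
          _ = _ := by ring
      have : (((n ^ 2 - 4) * (n' ^ 2 - 4) : ℕ) : ℝ) ≤ (x : ℝ) ^ 4 := by exact_mod_cast this
      linarith
  have hw2 : ∀ n ∈ Icc 3 x, ∑ n' ∈ Icc 3 x, w n n' ≤
      (Q : ℝ) * (Nat.log 2 x + 1) + 4 * (x : ℝ) ^ 5 := by
    intro n hn
    rw [mem_Icc] at hn
    simp only [w]
    rw [Finset.sum_ite]
    simp only [Finset.sum_const, nsmul_eq_mul]
    refine add_le_add ?_ ?_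
    · rw [mul_comm]
      have := class_card x n (by omega)
      refine mul_le_mul_of_nonneg_left ?_ (by positivity)
      exact_mod_cast this
    · have : ((Icc 3 x).filter (fun b => ¬ sqRel n b)).card ≤ x :=
        (Finset.card_filter_le _ _).trans (by simp)
      have : (((Icc 3 x).filter (fun b => ¬ sqRel n b)).card : ℝ) ≤ x := by
        exact_mod_cast this
      nlinarith [show (0 : ℝ) ≤ 4 * (x : ℝ) ^ 4 by positivity]
  rw [h1]
  calc _ ≤ ∑ n ∈ Icc 3 x, ∑ n' ∈ Icc 3 x, (c n ^ 2 / 2 * w n n' + c n' ^ 2 / 2 * w n n') := by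
        refine sum_le_sum fun n hn => sum_le_sum fun n' hn' => ?_
        refine (le_abs_self _).trans ?_
        rw [abs_mul, ← add_mul]
        refine mul_le_mul ?_ (hw n hn n' hn') (abs_nonneg _) (by positivity)
        rw [abs_mul]
        nlinarith [sq_nonneg (|c n| - |c n'|), sq_abs (c n), sq_abs (c n')]
    _ = ∑ n ∈ Icc 3 x, c n ^ 2 * ∑ n' ∈ Icc 3 x, w n n' := by
        simp only [Finset.sum_add_distrib]
        have : ∑ n ∈ Icc 3 x, ∑ n' ∈ Icc 3 x, c n' ^ 2 / 2 * w n n' =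
            ∑ n ∈ Icc 3 x, ∑ n' ∈ Icc 3 x, c n ^ 2 / 2 * w n n' := by
          rw [Finset.sum_comm]
          refine sum_congr rfl fun n _ => sum_congr rfl fun n' _ => ?_
          rw [hwsymm]
        rw [this, ← Finset.sum_add_distrib]
        refine sum_congr rfl fun n _ => ?_
        rw [← Finset.mul_sum]; ring
    _ ≤ ∑ n ∈ Icc 3 x, c n ^ 2 * ((Q : ℝ) * (Nat.log 2 x + 1) + 4 * (x : ℝ) ^ 5) :=
        sum_le_sum fun n hn => mul_le_mul_of_nonneg_left (hw2 n hn) (sq_nonneg _)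
    _ = _ := by rw [← Finset.sum_mul, mul_comm]

lemma divisor_bound (ε : ℝ) (hε : 0 < ε) :
    ∃ K : ℝ, 0 < K ∧ ∀ m : ℕ, 0 < m → (m.divisors.card : ℝ) ≤ K * (m : ℝ) ^ ε := by
  have hl2 : 0 < Real.log 2 := Real.log_pos (by norm_num)
  set e := ε / 2 with he
  have he0 : 0 < e := by positivity
  set K1 := 1 + 1 / (e * Real.log 2) with hK1
  have hK1' : 1 ≤ K1 := by rw [hK1]; have : 0 < 1 / (e * Real.log 2) := by positivity
                           linarith
  obtain ⟨K, hK, h⟩ := omega_bound K1 e hK1' he0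
  refine ⟨K, hK, fun m hm => ?_⟩
  have h1 : (m.divisors.card : ℝ) ≤ K1 ^ m.primeFactors.card * (m : ℝ) ^ e := by
    rw [Nat.card_divisors hm.ne']
    push_cast
    have hmprod : (m : ℝ) ^ e = ∏ p ∈ m.primeFactors, ((p : ℝ) ^ m.factorization p) ^ e := by
      rw [Real.finsetProd_rpow _ _ (fun i _ => by positivity)]
      congr 1
      conv_lhs => rw [← Nat.prod_factorization_pow_eq_self hm.ne']
      rw [Finsupp.prod]; push_cast; rfl
    rw [hmprod, ← Finset.prod_const, ← Finset.prod_mul_distrib]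
    refine Finset.prod_le_prod (fun i _ => by positivity) fun p hp => ?_
    have hp2 : (2 : ℝ) ≤ p := by exact_mod_cast (Nat.prime_of_mem_primeFactors hp).two_le
    set k := m.factorization p
    have h2 : 1 + (k : ℝ) * e * Real.log 2 ≤ ((p : ℝ) ^ k) ^ e := by
      calc _ ≤ exp ((k : ℝ) * e * Real.log 2) := by
            have := Real.add_one_le_exp ((k : ℝ) * e * Real.log 2); linarith
        _ = (2 ^ k) ^ e := by
            rw [← Real.rpow_natCast 2 k, ← Real.rpow_mul (by norm_num), Real.rpow_def_of_pos (by norm_num)]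
            congr 1; ring
        _ ≤ _ := by gcongr
    calc (k : ℝ) + 1 ≤ K1 * (1 + (k : ℝ) * e * Real.log 2) := by
          have : K1 * (1 + (k : ℝ) * e * Real.log 2) = K1 + k * (e * Real.log 2) + k := by
            rw [hK1]; field_simp; ring
          rw [this]
          have : 0 ≤ k * (e * Real.log 2) := by positivity
          linarith
      _ ≤ _ := by gcongr
  calc _ ≤ _ := h1
    _ ≤ (K * (m : ℝ) ^ e) * (m : ℝ) ^ e := by gcongr; exact h m hm
    _ = K * (m : ℝ) ^ ε := by
      rw [mul_assoc, ← Real.rpow_add (by exact_mod_cast hm)]; congr 2; rw [he]; ring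

/-- dyadic block -/
noncomputable def Sb (y z n : ℕ) : ℝ := ∑ m ∈ Ioc y z, (Jn (Dz n) m : ℝ) / m

lemma Jn_prod (E : ℤ) {k : ℕ} (t : Fin k → ℕ) : Jn E (∏ i, t i) = ∏ i, Jn E (t i) := by
  induction k with
  | zero => simp [Jn_one]
  | succ k ih => rw [Fin.prod_univ_succ, Fin.prod_univ_succ, Jn_mul, ih]

lemma moment_bound (k x y z : ℕ) (hy : 0 < y) (hz : z ≤ 2 * y) (R : ℝ)
    (hR : ∀ M : ℕ, 0 < M → M ≤ (2 * y) ^ k → (M.divisors.card : ℝ) ^ k ≤ R) :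
    ∑ n ∈ Icc 3 x, Sb y z n ^ (2 * k) ≤
      R / (y : ℝ) ^ k * ((((2 * y) ^ k + 1 : ℕ) : ℝ) * (Nat.log 2 x + 1) + 4 * (x : ℝ) ^ 5) := by
  set V := ∑ n ∈ Icc 3 x, Sb y z n ^ (2 * k) with hV
  set Q := (2 * y) ^ k + 1 with hQ
  set P := Fintype.piFinset (fun _ : Fin k => Ioc y z) with hP
  let B : ℕ → ℝ := fun M => ∑ n ∈ Icc 3 x, Sb y z n ^ k * (Jn (Dz n) M : ℝ)
  have hR0 : 0 ≤ R := le_trans (by positivity) (hR 1 one_pos (Nat.one_le_pow _ _ (by omega)))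
  have hyR : (0 : ℝ) < y := by exact_mod_cast hy
  have hV0 : 0 ≤ V := Finset.sum_nonneg fun n _ => by rw [pow_mul]; positivity
  have hmem : ∀ t ∈ P, ∀ i, y < t i ∧ t i ≤ 2 * y := by
    intro t ht i
    have := Fintype.mem_piFinset.mp ht i
    rw [Finset.mem_Ioc] at this
    exact ⟨this.1, this.2.trans hz⟩
  have hexp : ∀ n, Sb y z n ^ k = ∑ t ∈ P, (∏ i, (t i : ℝ)⁻¹) * (Jn (Dz n) (∏ i, t i) : ℝ) := by
    intro n
    have := Finset.prod_univ_sum (fun _ : Fin k => Ioc y z)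
      (fun _ m => (Jn (Dz n) m : ℝ) / m)
    rw [Finset.prod_const, Finset.card_univ, Fintype.card_fin] at this
    unfold Sb
    rw [this]
    refine sum_congr rfl fun t _ => ?_
    rw [Jn_prod]; push_cast
    rw [← Finset.prod_mul_distrib]
    refine Finset.prod_congr rfl fun i _ => ?_
    rw [div_eq_mul_inv, mul_comm]
  have hVB : V = ∑ t ∈ P, (∏ i, (t i : ℝ)⁻¹) * B (∏ i, t i) := by
    simp only [B, Finset.mul_sum]
    rw [Finset.sum_comm]
    refine sum_congr rfl fun n _ => ?_
    rw [two_mul, pow_add]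
    nth_rewrite 2 [hexp]
    rw [Finset.mul_sum]
    refine sum_congr rfl fun t _ => ?_
    ring
  have hcard : (P.card : ℝ) ≤ (y : ℝ) ^ k := by
    have : P.card ≤ y ^ k := by
      rw [hP, Fintype.card_piFinset, Finset.prod_const, Finset.card_univ, Fintype.card_fin,
        Nat.card_Ioc]
      exact Nat.pow_le_pow_left (by omega) k
    exact_mod_cast this
  have hle : |V| ≤ ((y : ℝ) ^ k)⁻¹ * ∑ t ∈ P, |B (∏ i, t i)| := by
    rw [hVB, Finset.mul_sum]
    refine (abs_sum_le_sum_abs _ _).trans (sum_le_sum fun t ht => ?_)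
    rw [abs_mul]
    refine mul_le_mul_of_nonneg_right ?_ (abs_nonneg _)
    rw [abs_of_nonneg (by positivity)]
    calc ∏ i, (t i : ℝ)⁻¹ ≤ ∏ i : Fin k, (y : ℝ)⁻¹ := by
          refine Finset.prod_le_prod (fun i _ => by positivity) fun i _ => ?_
          refine inv_anti₀ hyR ?_
          exact_mod_cast (hmem t ht i).1.le
      _ = _ := by simp
  have hB : ∑ t ∈ P, B (∏ i, t i) ^ 2 ≤ R * ∑ M ∈ range Q, B M ^ 2 := by
    have hmap : ∀ t ∈ P, ∏ i, t i ∈ range Q := by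
      intro t ht
      rw [mem_range, hQ, Nat.lt_succ_iff]
      calc ∏ i, t i ≤ ∏ i : Fin k, (2 * y) := Finset.prod_le_prod' fun i _ => (hmem t ht i).2
        _ = _ := by simp
    rw [← Finset.sum_fiberwise_of_maps_to hmap, Finset.mul_sum]
    refine sum_le_sum fun M hM => ?_
    rw [sum_congr rfl (g := fun _ => B M ^ 2)
      (fun t ht => by rw [(Finset.mem_filter.mp ht).2])]
    rw [Finset.sum_const, nsmul_eq_mul]
    refine mul_le_mul_of_nonneg_right ?_ (sq_nonneg _)
    rcases Finset.eq_empty_or_nonempty (P.filter (fun t => ∏ i, t i = M)) with h | ⟨t, ht⟩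
    · rw [h]; simpa using hR0
    have hMpos : 0 < M := by
      rw [← (Finset.mem_filter.mp ht).2]
      exact Finset.prod_pos fun i _ => (Nat.zero_le _).trans_lt (hmem t (Finset.mem_filter.mp ht).1 i).1
    refine le_trans ?_ (hR M hMpos (by rw [mem_range] at hM; omega))
    have : (P.filter (fun t => ∏ i, t i = M)).card ≤ M.divisors.card ^ k := by
      calc _ ≤ (Fintype.piFinset (fun _ : Fin k => M.divisors)).card := by
            refine Finset.card_le_card fun t ht => ?_
            rw [Fintype.mem_piFinset]
            intro i
            rw [Nat.mem_divisors]
            refine ⟨?_, hMpos.ne'⟩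
            rw [← (Finset.mem_filter.mp ht).2]
            exact Finset.dvd_prod_of_mem _ (Finset.mem_univ i)
        _ = _ := by simp [Fintype.card_piFinset]
    exact_mod_cast this
  have hsieve : ∑ M ∈ range Q, B M ^ 2 ≤ ((Q : ℝ) * (Nat.log 2 x + 1) + 4 * (x : ℝ) ^ 5) * V := by
    have := large_sieve x Q (fun n => Sb y z n ^ k)
    simp only [← pow_mul] at this
    rw [mul_comm k 2] at this
    exact this
  set G := ((Q : ℝ) * (Nat.log 2 x + 1) + 4 * (x : ℝ) ^ 5) with hG
  have hG0 : 0 ≤ G := by positivity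
  have hV2 : V * V ≤ R / (y : ℝ) ^ k * G * V := by
    have h1 : (∑ t ∈ P, |B (∏ i, t i)|) ^ 2 ≤ P.card * ∑ t ∈ P, |B (∏ i, t i)| ^ 2 :=
      sq_sum_le_card_mul_sum_sq
    simp only [sq_abs] at h1
    calc V * V = |V| ^ 2 := by rw [sq_abs]; ring
      _ ≤ (((y : ℝ) ^ k)⁻¹ * ∑ t ∈ P, |B (∏ i, t i)|) ^ 2 := by gcongr
      _ = (((y : ℝ) ^ k)⁻¹) ^ 2 * (∑ t ∈ P, |B (∏ i, t i)|) ^ 2 := by ring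
      _ ≤ (((y : ℝ) ^ k)⁻¹) ^ 2 * ((y : ℝ) ^ k * (R * (G * V))) := by
          gcongr
          refine h1.trans ?_
          have : 0 ≤ ∑ t ∈ P, B (∏ i, t i) ^ 2 := Finset.sum_nonneg fun _ _ => sq_nonneg _
          gcongr
          refine hB.trans ?_
          gcongr
      _ = _ := by field_simp
  rcases hV0.eq_or_lt with h | h
  · rw [← h]; positivity
  · exact le_of_mul_le_mul_right hV2 h

lemma natlog_bound (ε : ℝ) (hε : 0 < ε) :
    ∃ C : ℝ, 0 < C ∧ ∀ x : ℕ, 0 < x → (Nat.log 2 x : ℝ) + 1 ≤ C * (x : ℝ) ^ ε := by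
  have hl2 : 0 < Real.log 2 := Real.log_pos (by norm_num)
  refine ⟨1 / (ε * Real.log 2) + 1, by positivity, fun x hx => ?_⟩
  have hx1 : (1 : ℝ) ≤ x := by exact_mod_cast hx
  have h1 : (2 : ℝ) ^ Nat.log 2 x ≤ x := by exact_mod_cast Nat.pow_log_le_self 2 hx.ne'
  have h2 : (Nat.log 2 x : ℝ) * Real.log 2 ≤ Real.log x := by
    rw [← Real.log_pow]; exact Real.log_le_log (by positivity) h1
  have h3 := Real.log_le_rpow_div (show (0 : ℝ) ≤ x by positivity) hε
  have h4 : (1 : ℝ) ≤ (x : ℝ) ^ ε := Real.one_le_rpow hx1 hε.le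
  have h5 : (Nat.log 2 x : ℝ) ≤ (x : ℝ) ^ ε / ε / Real.log 2 := by
    rw [le_div_iff₀ hl2]; linarith
  have : (1 / (ε * Real.log 2) + 1) * (x : ℝ) ^ ε = (x : ℝ) ^ ε / ε / Real.log 2 + (x : ℝ) ^ ε := by
    field_simp
  rw [this]; linarith

lemma V_bound (k : ℕ) (hk : 0 < k) (ε : ℝ) (hε : 0 < ε) :
    ∃ C : ℝ, 0 < C ∧ ∀ x y z : ℕ, 0 < x → 0 < y → z ≤ 2 * y → x ^ 5 ≤ y ^ k → y ≤ x ^ 4 →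
      ∑ n ∈ Icc 3 x, Sb y z n ^ (2 * k) ≤ C * (x : ℝ) ^ ε := by
  set e := ε / (8 * k ^ 2) with he
  have hkR : (0 : ℝ) < k := by exact_mod_cast hk
  have he0 : 0 < e := by positivity
  obtain ⟨K, hK, hdiv⟩ := divisor_bound e he0
  obtain ⟨C1, hC1, hlog⟩ := natlog_bound (ε / 2) (by positivity)
  refine ⟨(K * ((2 : ℝ) ^ k) ^ e) ^ k * ((2 ^ k + 5) * C1), by positivity, ?_⟩
  intro x y z hx hy hz hxy hyx
  have hxR : (0 : ℝ) < x := by exact_mod_cast hx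
  have hyR : (0 : ℝ) < y := by exact_mod_cast hy
  set R := (K * ((2 : ℝ) ^ k) ^ e) ^ k * (x : ℝ) ^ (ε / 2) with hR
  have hR0 : 0 ≤ R := by positivity
  refine (moment_bound k x y z hy hz R ?_).trans ?_
  · intro M hM0 hM
    have h1 : (M : ℝ) ≤ 2 ^ k * (x : ℝ) ^ (4 * k) := by
      have : M ≤ 2 ^ k * x ^ (4 * k) := by
        refine hM.trans ?_
        rw [mul_pow, pow_mul]
        exact Nat.mul_le_mul_left _ (Nat.pow_le_pow_left hyx k)
      exact_mod_cast this
    calc (M.divisors.card : ℝ) ^ k ≤ (K * (M : ℝ) ^ e) ^ k := by gcongr; exact hdiv M hM0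
      _ ≤ (K * (2 ^ k * (x : ℝ) ^ (4 * k)) ^ e) ^ k := by gcongr
      _ = R := by
        rw [Real.mul_rpow (by positivity) (by positivity), ← mul_assoc, mul_pow, hR]
        congr 1
        rw [← Real.rpow_natCast (x : ℝ), ← Real.rpow_mul hxR.le, ← Real.rpow_natCast,
          ← Real.rpow_mul hxR.le]
        congr 1
        rw [he]; push_cast; field_simp; ring
  · have h5 : (x : ℝ) ^ 5 ≤ (y : ℝ) ^ k := by exact_mod_cast hxy
    have hlx := hlog x hx
    set cl := (Nat.log 2 x : ℝ) + 1 with hcl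
    have hcl1 : 1 ≤ cl := by rw [hcl]; linarith [(Nat.cast_nonneg (Nat.log 2 x) : (0:ℝ) ≤ _)]
    have hyk : (1 : ℝ) ≤ (y : ℝ) ^ k := one_le_pow₀ (by exact_mod_cast hy)
    have h6 : (((2 * y) ^ k + 1 : ℕ) : ℝ) * cl + 4 * (x : ℝ) ^ 5 ≤ (y : ℝ) ^ k * ((2 ^ k + 5) * cl) := by
      push_cast
      rw [mul_pow]
      nlinarith [mul_le_mul_of_nonneg_right hyk (by linarith : 0 ≤ cl),
        mul_le_mul_of_nonneg_left hcl1 (by linarith : 0 ≤ (y : ℝ) ^ k)]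
    calc _ ≤ R / (y : ℝ) ^ k * ((y : ℝ) ^ k * ((2 ^ k + 5) * cl)) := by gcongr
      _ = R * ((2 ^ k + 5) * cl) := by field_simp
      _ ≤ R * ((2 ^ k + 5) * (C1 * (x : ℝ) ^ (ε / 2))) := by gcongr
      _ = (K * ((2 : ℝ) ^ k) ^ e) ^ k * ((2 ^ k + 5) * C1) * ((x : ℝ) ^ (ε / 2) * (x : ℝ) ^ (ε / 2)) := by
          rw [hR]; ring
      _ = _ := by rw [← Real.rpow_add hxR]; congr 2; ring

/-- mean square of a dyadic block -/
lemma Sb_sq (k : ℕ) :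
    ∃ C : ℝ, 0 < C ∧ ∀ x y z : ℕ, 0 < x → 0 < y → z ≤ 2 * y → x ^ 5 ≤ y ^ (k + 1) → y ≤ x ^ 4 →
      ∑ n ∈ Icc 3 x, Sb y z n ^ 2 ≤ C * (x : ℝ) ^ (1 - 1 / (2 * ((k : ℝ) + 1))) := by
  obtain ⟨C, hC, h⟩ := V_bound (k + 1) (by omega) (1 / 2) (by norm_num)
  refine ⟨C ^ (1 / ((k : ℝ) + 1)), by positivity, ?_⟩
  intro x y z hx hy hz hxy hyx
  have hxR : (0 : ℝ) < x := by exact_mod_cast hx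
  have h0 := h x y z hx hy hz hxy hyx
  have h1 := pow_sum_le_card_mul_sum_pow (s := Icc 3 x) (f := fun n => Sb y z n ^ 2)
    (fun i _ => sq_nonneg _) k
  simp only [← pow_mul] at h1
  set A := ∑ n ∈ Icc 3 x, Sb y z n ^ 2 with hA
  have hA0 : 0 ≤ A := Finset.sum_nonneg fun _ _ => sq_nonneg _
  have h2 : A ^ (k + 1) ≤ (x : ℝ) ^ k * (C * (x : ℝ) ^ (1 / 2 : ℝ)) := by
    refine h1.trans ?_
    have hc : ((Icc 3 x).card : ℝ) ≤ x := by
      have : (Icc 3 x).card ≤ x := by simp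
      exact_mod_cast this
    have : 0 ≤ ∑ n ∈ Icc 3 x, Sb y z n ^ (2 * (k + 1)) :=
      Finset.sum_nonneg fun _ _ => by rw [pow_mul]; positivity
    gcongr
  refine le_of_pow_le_pow_left₀ (n := k + 1) (by omega) (by positivity) (h2.trans (le_of_eq ?_))
  have hk1 : (k : ℝ) + 1 ≠ 0 := by positivity
  rw [mul_pow, ← Real.rpow_natCast (C ^ _), ← Real.rpow_mul hC.le, ← Real.rpow_natCast ((x : ℝ) ^ _),
    ← Real.rpow_mul hxR.le, ← Real.rpow_natCast (x : ℝ) k]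
  have e1 : 1 / ((k : ℝ) + 1) * ((k + 1 : ℕ) : ℝ) = 1 := by push_cast; field_simp
  have e2 : (1 - 1 / (2 * ((k : ℝ) + 1))) * ((k + 1 : ℕ) : ℝ) = k + 1 / 2 := by
    push_cast; field_simp; ring
  rw [e1, e2, Real.rpow_one, Real.rpow_add hxR]; ring

noncomputable def TL (n y : ℕ) : ℝ := Lval (Dz n) - PL (Dz n) y

lemma PL_sub_eq (n y z : ℕ) (h : y ≤ z) : PL (Dz n) z - PL (Dz n) y = Sb y z n := by
  unfold PL Sb
  rw [← Finset.sum_Ico_eq_sub _ (by omega : y + 1 ≤ z + 1)]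
  refine sum_congr ?_ fun _ _ => rfl
  ext m; simp only [Finset.mem_Ico, Finset.mem_Ioc]; omega

lemma TL_dyadic (n y J : ℕ) :
    TL n y = ∑ j ∈ range J, Sb (y * 2 ^ j) (y * 2 ^ (j + 1)) n + TL n (y * 2 ^ J) := by
  induction J with
  | zero => simp
  | succ J ih =>
    rw [Finset.sum_range_succ, ← PL_sub_eq n _ _ (Nat.mul_le_mul_left _ (Nat.pow_le_pow_right (by norm_num) (by omega)))]
    rw [ih]; unfold TL; ring

lemma TL_sq (k : ℕ) :
    ∃ C : ℝ, 0 < C ∧ ∀ x y : ℕ, 0 < x → 0 < y → y ≤ x → x ^ 5 ≤ y ^ (k + 1) →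
      ∑ n ∈ Icc 3 x, TL n y ^ 2 ≤ C * (x : ℝ) ^ (1 - 1 / (3 * ((k : ℝ) + 1))) := by
  obtain ⟨C, hC, h⟩ := Sb_sq k
  set e : ℝ := 1 / (12 * ((k : ℝ) + 1)) with he
  have hk1 : (0 : ℝ) < (k : ℝ) + 1 := by positivity
  have he0 : 0 < e := by positivity
  obtain ⟨C1, hC1, hlog⟩ := natlog_bound (e / 3) (by positivity)
  refine ⟨(2 * C1) ^ 2 * (C + 64), by positivity, ?_⟩
  intro x y hx hy hyx hxy
  have hxR : (0 : ℝ) < x := by exact_mod_cast hx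
  have hx1 : (1 : ℝ) ≤ x := by exact_mod_cast hx
  obtain ⟨J, hJ⟩ : ∃ J, J = Nat.log 2 (x ^ 3) + 1 := ⟨_, rfl⟩
  have hJ1 : x ^ 3 < 2 ^ J := by rw [hJ]; exact Nat.lt_pow_succ_log_self (by norm_num) _
  have hJ2 : (J : ℝ) ≤ C1 * (x : ℝ) ^ e := by
    have := hlog (x ^ 3) (by positivity)
    rw [hJ]; push_cast at this ⊢
    refine this.trans (le_of_eq ?_)
    rw [← Real.rpow_natCast, ← Real.rpow_mul hxR.le]
    congr 2; push_cast; ring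
  set P := (x : ℝ) ^ (1 - 1 / (2 * ((k : ℝ) + 1))) with hP
  have hP1 : 1 ≤ P := by
    refine Real.one_le_rpow hx1 ?_
    rw [sub_nonneg, div_le_one (by positivity)]; linarith [(Nat.cast_nonneg k : (0:ℝ) ≤ _)]
  have h1 : ∀ n ∈ Icc 3 x, TL n y ^ 2 ≤ ((J : ℝ) + 1) *
      (∑ j ∈ range J, Sb (y * 2 ^ j) (y * 2 ^ (j + 1)) n ^ 2 + 64 / (x : ℝ)) := by
    intro n hn
    rw [mem_Icc] at hn
    have hT : TL n (y * 2 ^ J) ^ 2 ≤ 64 / (x : ℝ) := by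
      have hb := PL_bound_D (show 2 < n by omega) (y * 2 ^ J)
      have hb' : |TL n (y * 2 ^ J)| ≤ 8 / x := by
        refine hb.trans ?_
        rw [div_le_div_iff₀ (by positivity) hxR]
        have a1 : (n : ℝ) ≤ x := by exact_mod_cast hn.2
        have a2 : (x : ℝ) ^ 3 ≤ ((y * 2 ^ J : ℕ) : ℝ) := by
          have : x ^ 3 ≤ y * 2 ^ J := hJ1.le.trans (Nat.le_mul_of_pos_left _ hy)
          exact_mod_cast this
        have a3 : (n : ℝ) ^ 2 * x ≤ (x : ℝ) ^ 2 * x := by gcongr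
        nlinarith
      rw [← sq_abs]
      calc _ ≤ (8 / (x : ℝ)) ^ 2 := by gcongr
        _ = 64 / (x : ℝ) * (1 / x) := by ring
        _ ≤ 64 / (x : ℝ) * 1 := by
            gcongr; rw [div_le_one hxR]; exact hx1
        _ = _ := by ring
    have hc : (∑ j ∈ range (J + 1), (if j < J then Sb (y * 2 ^ j) (y * 2 ^ (j + 1)) n else TL n (y * 2 ^ J))) ^ 2
        ≤ (range (J + 1)).card * ∑ j ∈ range (J + 1),
          (if j < J then Sb (y * 2 ^ j) (y * 2 ^ (j + 1)) n else TL n (y * 2 ^ J)) ^ 2 :=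
      sq_sum_le_card_mul_sum_sq
    rw [Finset.sum_range_succ, Finset.sum_range_succ, Finset.card_range] at hc
    simp only [lt_irrefl, if_false] at hc
    rw [sum_congr rfl (g := fun j => Sb (y * 2 ^ j) (y * 2 ^ (j + 1)) n)
      (fun j hj => by rw [if_pos (Finset.mem_range.mp hj)]), ← TL_dyadic,
      sum_congr rfl (g := fun j => Sb (y * 2 ^ j) (y * 2 ^ (j + 1)) n ^ 2)
      (fun j hj => by rw [if_pos (Finset.mem_range.mp hj)])] at hc
    refine hc.trans ?_
    push_cast
    gcongr
  have h2 : ∀ j ∈ range J, ∑ n ∈ Icc 3 x, Sb (y * 2 ^ j) (y * 2 ^ (j + 1)) n ^ 2 ≤ C * P := by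
    intro j hj
    rw [mem_range] at hj
    have hj2 : 2 ^ j ≤ x ^ 3 :=
      (Nat.pow_le_pow_right (by norm_num) (by omega)).trans (Nat.pow_log_le_self 2 (by positivity))
    refine h x (y * 2 ^ j) (y * 2 ^ (j + 1)) hx (by positivity) ?_ ?_ ?_
    · rw [pow_succ]; apply le_of_eq; ring
    · exact hxy.trans (Nat.pow_le_pow_left (Nat.le_mul_of_pos_right _ (by positivity)) _)
    · calc y * 2 ^ j ≤ x * x ^ 3 := Nat.mul_le_mul hyx hj2
        _ = _ := by ring
  have hJR : (1 : ℝ) ≤ J := by rw [hJ]; push_cast; linarith [(Nat.cast_nonneg (Nat.log 2 (x^3)) : (0:ℝ) ≤ _)]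
  calc _ ≤ ∑ n ∈ Icc 3 x, ((J : ℝ) + 1) *
      (∑ j ∈ range J, Sb (y * 2 ^ j) (y * 2 ^ (j + 1)) n ^ 2 + 64 / (x : ℝ)) := sum_le_sum h1
    _ = ((J : ℝ) + 1) * (∑ j ∈ range J, ∑ n ∈ Icc 3 x, Sb (y * 2 ^ j) (y * 2 ^ (j + 1)) n ^ 2
        + ∑ n ∈ Icc 3 x, 64 / (x : ℝ)) := by
        rw [← Finset.mul_sum, Finset.sum_add_distrib, Finset.sum_comm]
    _ ≤ ((J : ℝ) + 1) * (∑ j ∈ range J, C * P + 64) := by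
        gcongr with j hj
        · exact h2 j hj
        · rw [Finset.sum_const, nsmul_eq_mul]
          have : ((Icc 3 x).card : ℝ) ≤ x := by
            have : (Icc 3 x).card ≤ x := by simp
            exact_mod_cast this
          calc _ ≤ (x : ℝ) * (64 / x) := by gcongr
            _ = _ := by field_simp
    _ ≤ (2 * J) * (2 * J * ((C + 64) * P)) := by
        rw [Finset.sum_const, Finset.card_range, nsmul_eq_mul]
        have : 0 < C * P := by positivity
        gcongr
        · linarith
        · nlinarith
    _ ≤ (2 * (C1 * (x : ℝ) ^ e)) * (2 * (C1 * (x : ℝ) ^ e) * ((C + 64) * P)) := by gcongr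
    _ = (2 * C1) ^ 2 * (C + 64) * ((x : ℝ) ^ e * (x : ℝ) ^ e * P) := by ring
    _ = _ := by
      rw [hP, ← Real.rpow_add hxR, ← Real.rpow_add hxR]
      congr 2
      rw [he]; field_simp; ring

lemma approx (k : ℕ) (δ : ℝ) (hδ : 0 < δ) :
    ∃ C : ℝ, 0 < C ∧ ∀ x M W : ℕ, 0 < x → 0 < W → M ≤ x →
      (∀ l, 0 < l → l ≤ W → x ^ 5 ≤ (M / l) ^ (k + 1)) →
      ∑ n ∈ Icc 3 x, (ampA n - AM n M) ^ 2 ≤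
        C * (x : ℝ) ^ δ * ((W : ℝ) ^ 2 * (x : ℝ) ^ (1 - 1 / (3 * ((k : ℝ) + 1))) +
          x * (W : ℝ) ^ (-(1/2) : ℝ)) := by
  obtain ⟨C, hC, h⟩ := TL_sq k
  obtain ⟨K, hK, hb⟩ := betw_bound (δ / 4) (by positivity)
  refine ⟨2 * K ^ 2 * (C + (10 + 3 * (4 / δ)) ^ 2), by positivity, ?_⟩
  intro x M W hx hW hMx hl
  have hxR : (0 : ℝ) < x := by exact_mod_cast hx
  have hx1 : (1 : ℝ) ≤ x := by exact_mod_cast hx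
  have hWR : (0 : ℝ) < W := by exact_mod_cast hW
  set X := (x : ℝ) ^ (δ / 4) with hX
  have hX1 : 1 ≤ X := Real.one_le_rpow hx1 (by positivity)
  have hX4 : X ^ 4 = (x : ℝ) ^ δ := by
    rw [hX, ← Real.rpow_natCast, ← Real.rpow_mul hxR.le]; congr 1; push_cast; ring
  set b := (W : ℝ) ^ (-(1/4) : ℝ) with hbdef
  have hb0 : 0 < b := by positivity
  have hb2 : b ^ 2 = (W : ℝ) ^ (-(1/2) : ℝ) := by
    rw [hbdef, ← Real.rpow_natCast, ← Real.rpow_mul hWR.le]; congr 1; push_cast; ring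
  set c := 10 + 3 * (4 / δ) with hc
  have hc0 : 0 < c := by positivity
  have hlog : 10 + 3 * Real.log x ≤ c * X := by
    have h3 := Real.log_le_rpow_div hxR.le (show 0 < δ / 4 by positivity)
    rw [← hX] at h3
    have : X / (δ / 4) = 4 / δ * X := by field_simp
    rw [this] at h3
    rw [hc]; nlinarith
  have hpt : ∀ n ∈ Icc 3 x, (ampA n - AM n M) ^ 2 ≤
      2 * (K * X) ^ 2 * (W * ∑ l ∈ Icc 1 W, TL n (M / l) ^ 2) + 2 * (b * (c * X) * (K * X)) ^ 2 := by
    intro n hn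
    rw [mem_Icc] at hn
    have hn2 : 2 < n := by omega
    have hbs : ∑' l, betw n l ≤ K * X := by
      refine (hb n hn2).trans ?_
      rw [hX]; gcongr; exact hn.2
    have hbl : ∀ l, betw n l ≤ K * X := fun l =>
      ((betw_sum hn2).1.le_tsum l (fun j _ => betw_nonneg n j)).trans hbs
    have hT : ∀ l, |TL n (M / l)| ≤ c * X := by
      intro l
      refine le_trans ?_ hlog
      have a1 := Lval_abs hn2
      have a2 := PL_abs (Dz n) (M / l)
      have a3 : Real.log n ≤ Real.log x := Real.log_le_log (by positivity) (by exact_mod_cast hn.2)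
      have a4 : Real.log ((M / l : ℕ) : ℝ) ≤ Real.log x := by
        rcases Nat.eq_zero_or_pos (M / l) with h0 | h0
        · rw [h0]; simp; exact Real.log_nonneg hx1
        · refine Real.log_le_log (by exact_mod_cast h0) ?_
          exact_mod_cast (Nat.div_le_self _ _).trans hMx
      unfold TL
      have := abs_sub (Lval (Dz n)) (PL (Dz n) (M / l))
      linarith
    obtain ⟨hs, heq⟩ := ampA_sub_AM hn2 M
    have hmain : |ampA n - AM n M| ≤
        ∑ l ∈ Icc 1 W, (K * X) * |TL n (M / l)| + b * (c * X) * (K * X) := by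
      rw [heq]
      let g : ℕ → ℝ := fun l => (if l ∈ Icc 1 W then (K * X) * |TL n (M / l)| else 0)
      have hg : HasSum g (∑ l ∈ Icc 1 W, (K * X) * |TL n (M / l)|) := by
        have : HasSum g (∑ l ∈ Icc 1 W, g l) := hasSum_sum_of_ne_finset_zero
          (fun l hl => by simp only [g]; rw [if_neg hl])
        rwa [sum_congr rfl (fun l hl => by simp only [g]; rw [if_pos hl])] at this
      have hg2 := hg.add (((betw_sum hn2).1.hasSum).mul_left (b * (c * X)))
      have := tsum_of_norm_bounded (f := fun l => bet n l / l * (Lval (Dz n) - PL (Dz n) (M / l))) hg2 ?_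
      · rw [Real.norm_eq_abs] at this
        refine this.trans ?_
        gcongr
      · intro l
        rw [Real.norm_eq_abs, abs_mul]
        simp only [g]
        have hTl := hT l
        have hnn := betw_nonneg n l
        have hTnn : 0 ≤ |TL n (M / l)| := abs_nonneg _
        change |bet n l / l| * |TL n (M / l)| ≤ _
        split_ifs with hlW
        · have := (bet_div_le n l).trans (hbl l)
          have h2 : |bet n l / l| * |TL n (M / l)| ≤ K * X * |TL n (M / l)| := by gcongr
          have h3 : 0 ≤ b * (c * X) * betw n l := by positivity
          linarith
        · rw [zero_add]
          rcases Nat.eq_zero_or_pos l with rfl | hl0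
          · simp only [Nat.cast_zero, div_zero, abs_zero, zero_mul]; positivity
          have hlR : (0 : ℝ) < l := by exact_mod_cast hl0
          have hWl : (W : ℝ) ≤ l := by
            rw [mem_Icc] at hlW
            have : W ≤ l := by omega
            exact_mod_cast this
          have h4 : |bet n l / l| ≤ b * betw n l := by
            unfold betw
            rw [abs_div, abs_of_pos hlR]
            have e1 : |bet n l| / (l : ℝ) = (l : ℝ) ^ (-(1/4) : ℝ) * (|bet n l| * (l : ℝ) ^ (-(3/4) : ℝ)) := by
              have : (l : ℝ) ^ (-(1/4) : ℝ) * (l : ℝ) ^ (-(3/4) : ℝ) = (l : ℝ)⁻¹ := by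
                rw [← Real.rpow_add hlR, ← Real.rpow_neg_one]; norm_num
              rw [div_eq_mul_inv, ← this]; ring
            rw [e1]
            refine mul_le_mul_of_nonneg_right ?_ (by positivity)
            exact Real.rpow_le_rpow_of_nonpos hWR hWl (by norm_num)
          calc _ ≤ (b * betw n l) * (c * X) := by gcongr
            _ = _ := by ring
    have hcs : (∑ l ∈ Icc 1 W, (K * X) * |TL n (M / l)|) ^ 2 ≤
        (K * X) ^ 2 * (W * ∑ l ∈ Icc 1 W, TL n (M / l) ^ 2) := by
      rw [← Finset.mul_sum, mul_pow]
      gcongr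
      have := sq_sum_le_card_mul_sum_sq (s := Icc 1 W) (f := fun l => |TL n (M / l)|)
      simpa using this
    rw [← sq_abs]
    set u := ∑ l ∈ Icc 1 W, (K * X) * |TL n (M / l)| with hu
    have hu0 : 0 ≤ u := Finset.sum_nonneg fun _ _ => by positivity
    set v := b * (c * X) * (K * X) with hv
    calc _ ≤ (u + v) ^ 2 := by gcongr
      _ ≤ 2 * u ^ 2 + 2 * v ^ 2 := by nlinarith [sq_nonneg (u - v)]
      _ ≤ _ := by nlinarith
  set P := (x : ℝ) ^ (1 - 1 / (3 * ((k : ℝ) + 1))) with hP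
  have hP0 : 0 < P := by positivity
  have hTs : ∀ l ∈ Icc 1 W, ∑ n ∈ Icc 3 x, TL n (M / l) ^ 2 ≤ C * P := by
    intro l hl'
    rw [mem_Icc] at hl'
    have h5 := hl l hl'.1 hl'.2
    refine h x (M / l) hx ?_ ((Nat.div_le_self _ _).trans hMx) h5
    by_contra h0
    have h0 : M / l = 0 := Nat.eq_zero_of_not_pos h0
    rw [h0, zero_pow (by omega)] at h5
    have : 0 < x ^ 5 := by positivity
    omega
  calc _ ≤ ∑ n ∈ Icc 3 x, (2 * (K * X) ^ 2 * (W * ∑ l ∈ Icc 1 W, TL n (M / l) ^ 2) + 2 * (b * (c * X) * (K * X)) ^ 2) :=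
        sum_le_sum hpt
    _ = 2 * (K * X) ^ 2 * (W * ∑ l ∈ Icc 1 W, ∑ n ∈ Icc 3 x, TL n (M / l) ^ 2)
        + ((Icc 3 x).card : ℝ) * (2 * (b * (c * X) * (K * X)) ^ 2) := by
        rw [Finset.sum_add_distrib, ← Finset.mul_sum, ← Finset.mul_sum, Finset.sum_comm,
          Finset.sum_const, nsmul_eq_mul]
    _ ≤ 2 * (K * X) ^ 2 * (W * ∑ l ∈ Icc 1 W, C * P)
        + (x : ℝ) * (2 * (b * (c * X) * (K * X)) ^ 2) := by
        have : ((Icc 3 x).card : ℝ) ≤ x := by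
          have : (Icc 3 x).card ≤ x := by simp
          exact_mod_cast this
        gcongr with l hl'
        exact hTs l hl'
    _ = 2 * K ^ 2 * (X ^ 2 * (C * ((W : ℝ) ^ 2 * P)) + X ^ 4 * (c ^ 2 * (x * b ^ 2))) := by
        rw [Finset.sum_const, nsmul_eq_mul, Nat.card_Icc]; push_cast; ring
    _ ≤ 2 * K ^ 2 * (X ^ 4 * (C * ((W : ℝ) ^ 2 * P)) + X ^ 4 * (c ^ 2 * (x * b ^ 2))) := by
        gcongr
        norm_num
    _ ≤ 2 * K ^ 2 * (X ^ 4 * ((C + c ^ 2) * ((W : ℝ) ^ 2 * P)) + X ^ 4 * ((C + c ^ 2) * (x * b ^ 2))) := by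
        gcongr
        · nlinarith
        · linarith
    _ = _ := by rw [hX4, hb2]; ring

/-- truncation parameter -/
noncomputable def Mx (x : ℕ) : ℕ := ⌊(x : ℝ) ^ (1/10 : ℝ)⌋₊

lemma approx_final : ∃ C : ℝ, 0 < C ∧ ∀ᶠ x : ℕ in atTop,
    ∑ n ∈ Icc 3 x, (ampA n - AM n (Mx x)) ^ 2 ≤ C * (x : ℝ) ^ (1 - 1/6000 : ℝ) := by
  obtain ⟨C, hC, h⟩ := approx 119 (1/6000) (by norm_num)
  refine ⟨C * 3, by positivity, ?_⟩
  have hlarge : ∀ᶠ x : ℕ in atTop, (4 : ℝ) ≤ (x : ℝ) ^ (1/90 : ℝ) :=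
    ((tendsto_rpow_atTop (by norm_num : (0:ℝ) < 1/90)).comp tendsto_natCast_atTop_atTop).eventually_ge_atTop 4
  filter_upwards [hlarge, eventually_ge_atTop 1] with x hx4 hx
  have hxR : (0 : ℝ) < x := by exact_mod_cast hx
  have hx1 : (1 : ℝ) ≤ x := by exact_mod_cast hx
  set w := (x : ℝ) ^ (1/1440 : ℝ) with hw
  have hw1 : 1 ≤ w := Real.one_le_rpow hx1 (by norm_num)
  set W := ⌊w⌋₊ with hWdef
  have hW : 0 < W := Nat.floor_pos.mpr hw1
  have hWle : (W : ℝ) ≤ w := Nat.floor_le (by positivity)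
  have hWge : w / 2 ≤ W := by
    have := Nat.lt_floor_add_one w
    have h1 : (1 : ℝ) ≤ W := by exact_mod_cast hW
    rw [← hWdef] at this
    linarith
  set M := Mx x with hM
  have hMx : M ≤ x := by
    have : (x : ℝ) ^ (1/10 : ℝ) ≤ x := by
      conv_rhs => rw [← Real.rpow_one (x : ℝ)]
      exact Real.rpow_le_rpow_of_exponent_le hx1 (by norm_num)
    exact Nat.floor_le_of_le this
  have hMge : (x : ℝ) ^ (1/10 : ℝ) - 1 ≤ M := by
    have := Nat.lt_floor_add_one ((x : ℝ) ^ (1/10 : ℝ))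
    change _ ≤ ((⌊(x : ℝ) ^ (1/10 : ℝ)⌋₊ : ℕ) : ℝ)
    linarith
  set c := ⌈(x : ℝ) ^ (1/24 : ℝ)⌉₊ with hc
  have hcge : (x : ℝ) ^ (1/24 : ℝ) ≤ c := Nat.le_ceil _
  have h24 : 1 ≤ (x : ℝ) ^ (1/24 : ℝ) := Real.one_le_rpow hx1 (by norm_num)
  have hcle : (c : ℝ) ≤ 2 * (x : ℝ) ^ (1/24 : ℝ) := by
    have := Nat.ceil_lt_add_one (show 0 ≤ (x : ℝ) ^ (1/24 : ℝ) by positivity)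
    linarith
  have hcW : c * W ≤ M := by
    have h1 : (c : ℝ) * W ≤ M := by
      have e : (x : ℝ) ^ (1/10 : ℝ) ≥ 4 * ((x : ℝ) ^ (1/24 : ℝ) * w) := by
        rw [hw]
        calc (x : ℝ) ^ (1/10 : ℝ) ≥ (x : ℝ) ^ (1/90 + 1/24 + 1/1440 : ℝ) :=
              Real.rpow_le_rpow_of_exponent_le hx1 (by norm_num)
          _ = (x : ℝ) ^ (1/90 : ℝ) * ((x : ℝ) ^ (1/24 : ℝ) * (x : ℝ) ^ (1/1440 : ℝ)) := by
              rw [Real.rpow_add hxR, Real.rpow_add hxR]; ring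
          _ ≥ _ := by gcongr
      have e2 : 1 ≤ (x : ℝ) ^ (1/24 : ℝ) * w := by nlinarith
      calc (c : ℝ) * W ≤ 2 * (x : ℝ) ^ (1/24 : ℝ) * w := by gcongr
        _ ≤ _ := by linarith
    exact_mod_cast h1
  have hmain := h x M W hx hW hMx ?_
  · refine hmain.trans ?_
    have t1 : (W : ℝ) ^ 2 * (x : ℝ) ^ (1 - 1 / (3 * (((119 : ℕ) : ℝ) + 1))) ≤ (x : ℝ) ^ (1 - 1/3000 : ℝ) := by
      calc _ ≤ w ^ 2 * (x : ℝ) ^ (1 - 1 / (3 * (((119 : ℕ) : ℝ) + 1))) := by gcongr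
        _ = (x : ℝ) ^ (1/720 + (1 - 1/360) : ℝ) := by
          rw [hw, ← Real.rpow_natCast, ← Real.rpow_mul hxR.le, ← Real.rpow_add hxR]
          norm_num
        _ ≤ _ := Real.rpow_le_rpow_of_exponent_le hx1 (by norm_num)
    have t2 : (x : ℝ) * (W : ℝ) ^ (-(1/2) : ℝ) ≤ 2 * (x : ℝ) ^ (1 - 1/3000 : ℝ) := by
      have hw0 : 0 < w := by linarith
      calc (x : ℝ) * (W : ℝ) ^ (-(1/2) : ℝ) ≤ x * (w / 2) ^ (-(1/2) : ℝ) := by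
            gcongr ?_ * ?_
            exact Real.rpow_le_rpow_of_nonpos (by positivity) hWge (by norm_num)
        _ = (2 : ℝ) ^ (1/2 : ℝ) * ((x : ℝ) ^ (1 : ℝ) * w ^ (-(1/2) : ℝ)) := by
            rw [Real.div_rpow hw0.le (by norm_num), Real.rpow_neg (by norm_num : (0:ℝ) ≤ 2), Real.rpow_one]
            field_simp
        _ ≤ 2 * ((x : ℝ) ^ (1 : ℝ) * w ^ (-(1/2) : ℝ)) := by
            gcongr
            calc (2 : ℝ) ^ (1/2 : ℝ) ≤ (2 : ℝ) ^ (1 : ℝ) :=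
                  Real.rpow_le_rpow_of_exponent_le (by norm_num) (by norm_num)
              _ = 2 := Real.rpow_one 2
        _ = 2 * (x : ℝ) ^ (1 - 1/2880 : ℝ) := by
            rw [hw, ← Real.rpow_mul hxR.le, ← Real.rpow_add hxR]; norm_num
        _ ≤ _ := by
            gcongr
            norm_num
    calc _ ≤ C * (x : ℝ) ^ (1/6000 : ℝ) * ((x : ℝ) ^ (1 - 1/3000 : ℝ) + 2 * (x : ℝ) ^ (1 - 1/3000 : ℝ)) := by
          gcongr
      _ = C * 3 * ((x : ℝ) ^ (1/6000 : ℝ) * (x : ℝ) ^ (1 - 1/3000 : ℝ)) := by ring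
      _ = _ := by rw [← Real.rpow_add hxR]; norm_num
  · intro l hl0 hlW
    have h1 : c ≤ M / l := by
      rw [Nat.le_div_iff_mul_le hl0]
      exact (Nat.mul_le_mul_left _ hlW).trans hcW
    refine le_trans ?_ (Nat.pow_le_pow_left h1 _)
    have : (x : ℝ) ^ 5 ≤ (c : ℝ) ^ (119 + 1) := by
      calc (x : ℝ) ^ 5 = ((x : ℝ) ^ (1/24 : ℝ)) ^ (119 + 1) := by
            rw [← Real.rpow_natCast, ← Real.rpow_natCast, ← Real.rpow_mul hxR.le]; norm_num
        _ ≤ _ := by gcongr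
    exact_mod_cast this

lemma sum_crt (u v : ℕ → ℝ) {a b : ℕ} (ha : 0 < a) (hb : 0 < b) (hab : Nat.Coprime a b)
    (hu : ∀ n, u (n % a) = u n) (hv : ∀ n, v (n % b) = v n) :
    ∑ n ∈ range (a * b), u n * v n = (∑ n ∈ range a, u n) * ∑ n ∈ range b, v n := by
  rw [Finset.sum_mul_sum, ← Finset.sum_product']
  refine Finset.sum_nbij' (fun n => (n % a, n % b)) (fun r => (Nat.chineseRemainder hab r.1 r.2 : ℕ)) ?_ ?_ ?_ ?_ ?_
  · intro n _
    simp [Nat.mod_lt _ ha, Nat.mod_lt _ hb]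
  · intro r _
    rw [mem_range]
    exact Nat.chineseRemainder_lt_mul hab _ _ ha.ne' hb.ne'
  · intro n hn
    rw [mem_range] at hn
    have h := (Nat.chineseRemainder hab (n % a) (n % b)).2
    have hlt := Nat.chineseRemainder_lt_mul hab (n % a) (n % b) ha.ne' hb.ne'
    have h1 : (Nat.chineseRemainder hab (n % a) (n % b) : ℕ) ≡ n [MOD a] := h.1.trans (Nat.mod_modEq _ _)
    have h2 : (Nat.chineseRemainder hab (n % a) (n % b) : ℕ) ≡ n [MOD b] := h.2.trans (Nat.mod_modEq _ _)
    exact Nat.ModEq.eq_of_lt_of_lt ((Nat.modEq_and_modEq_iff_modEq_mul hab).mp ⟨h1, h2⟩) hlt hn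
  · rintro ⟨r, s⟩ hrs
    rw [Finset.mem_product, mem_range, mem_range] at hrs
    have h := (Nat.chineseRemainder hab r s).2
    ext
    · change _ % a = r
      rw [h.1]; exact Nat.mod_eq_of_lt hrs.1
    · change _ % b = s
      rw [h.2]; exact Nat.mod_eq_of_lt hrs.2
  · intro n _
    simp [hu, hv]

lemma sum_periodic (u : ℕ → ℝ) {q : ℕ} (hu : ∀ n, u (n % q) = u n) (k r : ℕ) :
    ∑ n ∈ range (q * k + r), u n =
      k * (∑ n ∈ range q, u n) + ∑ n ∈ range r, u n := by
  have hs : ∀ n k, u (q * k + n) = u n := by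
    intro n k
    rw [← hu, Nat.mul_add_mod, hu]
  rw [Finset.sum_range_add]
  congr 1
  · induction k with
    | zero => simp
    | succ k ih =>
      rw [Nat.mul_succ, Finset.sum_range_add, ih]
      simp only [hs]; push_cast; ring
  · simp only [hs]

lemma mean_periodic (u : ℕ → ℝ) {q : ℕ} (hq : 0 < q) (hu : ∀ n, u (n % q) = u n) (B : ℝ)
    (hB : ∀ n, |u n| ≤ B) (N : ℕ) :
    |∑ n ∈ range N, u n - N * ((∑ n ∈ range q, u n) / q)| ≤ 2 * q * B := by
  have hqR : (0 : ℝ) < q := by exact_mod_cast hq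
  have hB0 : 0 ≤ B := (abs_nonneg _).trans (hB 0)
  have hsum : ∀ r, |∑ n ∈ range r, u n| ≤ r * B := by
    intro r
    refine (abs_sum_le_sum_abs _ _).trans ?_
    refine (sum_le_sum fun n _ => hB n).trans ?_
    simp
  have h1 := sum_periodic u hu (N / q) (N % q)
  rw [Nat.div_add_mod] at h1
  have hN : (N : ℝ) = q * (N / q : ℕ) + (N % q : ℕ) := by exact_mod_cast (Nat.div_add_mod N q).symm
  have hr : ((N % q : ℕ) : ℝ) ≤ q := by exact_mod_cast (Nat.mod_lt _ hq).le
  set S := ∑ n ∈ range q, u n with hS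
  have e : ∑ n ∈ range N, u n - N * (S / q) =
      ∑ n ∈ range (N % q), u n - ((N % q : ℕ) : ℝ) / q * S := by
    rw [h1, hN]; field_simp; ring
  rw [e]
  refine (abs_sub _ _).trans ?_
  have a1 := hsum (N % q)
  have a2 : |((N % q : ℕ) : ℝ) / q * S| ≤ q * B := by
    rw [abs_mul, abs_of_nonneg (by positivity)]
    calc _ ≤ 1 * (q * B) := by
          gcongr
          · rw [div_le_one hqR]; exact hr
          · exact hsum q
      _ = _ := one_mul _
  have a3 : ((N % q : ℕ) : ℝ) * B ≤ q * B := by gcongr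
  linarith

lemma lam_mod_dvd {m q : ℕ} (h : m ∣ q) (n : ℕ) : lam (n % q) m = lam n m := by
  unfold lam
  rw [ArithmeticFunction.mul_apply, ArithmeticFunction.mul_apply]
  refine sum_congr rfl fun d hd => ?_
  congr 1
  simp only [rhoA, ArithmeticFunction.coe_mk]
  have hdq : d.1 ∣ q := (Dvd.intro _ (Nat.mem_divisorsAntidiagonal.mp hd).1).trans h
  rw [← rho_mod (n % q), Nat.mod_mod_of_dvd _ hdq, rho_mod]

lemma lam_abs (n m : ℕ) : |lam n m| ≤ (m : ℝ) ^ 2 := by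
  unfold lam
  rw [ArithmeticFunction.mul_apply]
  rcases Nat.eq_zero_or_pos m with rfl | hm
  · simp
  refine (abs_sum_le_sum_abs _ _).trans ?_
  calc _ ≤ ∑ d ∈ m.divisorsAntidiagonal, (m : ℝ) := by
        refine sum_le_sum fun d hd => ?_
        have hd' := Nat.mem_divisorsAntidiagonal.mp hd
        have h1 : |rhoA n d.1| ≤ m := by
          have : rho n d.1 ≤ m := by
            unfold rho
            refine (Finset.card_filter_le _ _).trans ?_
            rw [Finset.card_range]
            exact Nat.le_of_dvd hm (Dvd.intro _ hd'.1)
          simp only [rhoA, ArithmeticFunction.coe_mk]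
          rw [abs_of_nonneg (by positivity)]
          exact_mod_cast this
        have h2 : |liouR d.2| ≤ 1 := by
          have hd2 : d.2 ≠ 0 := by rintro h; rw [h] at hd'; omega
          rw [liouR, ArithmeticFunction.intCoe_apply, ArithmeticFunction.liouville_apply hd2]
          push_cast; rw [abs_pow]; simp
        rw [abs_mul]
        calc _ ≤ (m : ℝ) * 1 := by gcongr
          _ = m := mul_one _
    _ ≤ (m : ℝ) ^ 2 := by
        rw [Finset.sum_const, nsmul_eq_mul, sq]
        gcongr
        rw [← Nat.map_div_right_divisors, Finset.card_map]
        exact Nat.card_divisors_le_self m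

/-- mean of `lam n a * lam n b` -/
noncomputable def ee (a b : ℕ) : ℝ := (∑ n ∈ range (a * b), lam n a * lam n b) / ((a * b : ℕ) : ℝ)

lemma ee_period (a b n : ℕ) : lam (n % (a * b)) a * lam (n % (a * b)) b = lam n a * lam n b := by
  rw [lam_mod_dvd (Dvd.intro _ rfl), lam_mod_dvd (Dvd.intro_left _ rfl)]

lemma ee_mul {a b a' b' : ℕ} (ha : 0 < a) (hb : 0 < b) (ha' : 0 < a') (hb' : 0 < b')
    (h : Nat.Coprime (a * b) (a' * b')) : ee (a * a') (b * b') = ee a b * ee a' b' := by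
  have h1 : Nat.Coprime a a' := h.coprime_mul_right.coprime_mul_right_right
  have h2 : Nat.Coprime b b' := h.coprime_mul_left.coprime_mul_left_right
  unfold ee
  have e1 : (a * a') * (b * b') = (a * b) * (a' * b') := by ring
  rw [e1, div_mul_div_comm, ← sum_crt _ _ (by positivity) (by positivity) h (ee_period a b) (ee_period a' b')]
  congr 1
  · refine sum_congr rfl fun n _ => ?_
    rw [(lam_mult n).2 h1, (lam_mult n).2 h2]; ring
  · push_cast; ring

/-- Dirichlet-type sum -/
noncomputable def dsum (G : ℕ → ℕ → ℝ) (m : ℕ) : ℝ := ∑ d ∈ m.divisors, G d (m / d)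

lemma dsum_mul (G : ℕ → ℕ → ℝ) (hG : ∀ a b a' b' : ℕ, 0 < a → 0 < b → 0 < a' → 0 < b' →
    Nat.Coprime (a * b) (a' * b') → G (a * a') (b * b') = G a b * G a' b') {m n : ℕ}
    (h : Nat.Coprime m n) : dsum G (m * n) = dsum G m * dsum G n := by
  unfold dsum
  rw [Nat.divisors_mul, Finset.mul_def, Finset.sum_image h.mul_injOn_divisors, Finset.sum_mul_sum,
    ← Finset.sum_product']
  refine sum_congr rfl ?_
  rintro ⟨d, e⟩ hde
  rw [Finset.mem_product, Nat.mem_divisors, Nat.mem_divisors] at hde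
  obtain ⟨⟨⟨r, rfl⟩, h1⟩, ⟨⟨s, rfl⟩, h2⟩⟩ := hde
  simp only at h1 h2 ⊢
  have hd : 0 < d := Nat.pos_of_ne_zero (by rintro rfl; simp at h1)
  have he : 0 < e := Nat.pos_of_ne_zero (by rintro rfl; simp at h2)
  have hr : 0 < r := Nat.pos_of_ne_zero (by rintro rfl; simp at h1)
  have hs : 0 < s := Nat.pos_of_ne_zero (by rintro rfl; simp at h2)
  rw [Nat.mul_div_cancel_left _ hd, Nat.mul_div_cancel_left _ he,
    show d * r * (e * s) = (d * e) * (r * s) by ring, Nat.mul_div_cancel_left _ (by positivity)]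
  exact hG d r e s hd hr he hs h

lemma dsum_pp (G : ℕ → ℕ → ℝ) {p : ℕ} (hp : p.Prime) (k : ℕ) :
    dsum G (p ^ k) = ∑ i ∈ range (k + 1), G (p ^ i) (p ^ (k - i)) := by
  unfold dsum
  rw [Nat.sum_divisors_prime_pow hp]
  refine sum_congr rfl fun i hi => ?_
  rw [mem_range] at hi
  rw [Nat.pow_div (by omega) hp.pos]

lemma dsum_zero (G : ℕ → ℕ → ℝ) : dsum G 0 = 0 := by simp [dsum]
lemma dsum_one (G : ℕ → ℕ → ℝ) : dsum G 1 = G 1 1 := by simp [dsum]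

lemma ee_one : ee 1 1 = 1 := by
  have := fun n => (lam_mult n).1
  simp [ee, this]

/-- main-term extraction for `AM ^ 2` -/
lemma AM_sq_mean (M x : ℕ) :
    |∑ n ∈ Icc 3 x, AM n M ^ 2 - x * ∑ a ∈ Ioc 0 M, ∑ b ∈ Ioc 0 M, ee a b / (a * b)|
      ≤ 8 * (M : ℝ) ^ 6 := by
  have h1 : ∑ n ∈ Icc 3 x, AM n M ^ 2 = ∑ a ∈ Ioc 0 M, ∑ b ∈ Ioc 0 M,
      (∑ n ∈ Icc 3 x, lam n a * lam n b) / (a * b) := by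
    unfold AM
    simp only [sq, Finset.sum_mul_sum]
    rw [Finset.sum_comm]
    refine sum_congr rfl fun a _ => ?_
    rw [Finset.sum_comm]
    refine sum_congr rfl fun b _ => ?_
    rw [Finset.sum_div]
    refine sum_congr rfl fun n _ => ?_
    rw [div_mul_div_comm]
  rw [h1, Finset.mul_sum, ← Finset.sum_sub_distrib]
  refine (abs_sum_le_sum_abs _ _).trans ?_
  have key : ∀ a ∈ Ioc 0 M, |∑ b ∈ Ioc 0 M, (∑ n ∈ Icc 3 x, lam n a * lam n b) / (a * b) -
      x * ∑ b ∈ Ioc 0 M, ee a b / (a * b)| ≤ ∑ b ∈ Ioc 0 M, 8 * (M : ℝ) ^ 4 := by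
    intro a ha
    rw [Finset.mul_sum, ← Finset.sum_sub_distrib]
    refine (abs_sum_le_sum_abs _ _).trans (sum_le_sum fun b hb => ?_)
    rw [Finset.mem_Ioc] at ha hb
    have ha0 := ha.1
    have hb0 := hb.1
    have haR : (0 : ℝ) < a := by exact_mod_cast ha.1
    have hbR : (0 : ℝ) < b := by exact_mod_cast hb.1
    have haM : (a : ℝ) ≤ M := by exact_mod_cast ha.2
    have hbM : (b : ℝ) ≤ M := by exact_mod_cast hb.2
    have hB : ∀ n, |lam n a * lam n b| ≤ ((a : ℝ) * b) ^ 2 := by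
      intro n
      rw [abs_mul, mul_pow]
      exact mul_le_mul (lam_abs n a) (lam_abs n b) (abs_nonneg _) (by positivity)
    have hm := mean_periodic (fun n => lam n a * lam n b) (q := a * b) (by positivity)
      (ee_period a b) _ hB
    change ∀ N : ℕ, |_ - (N : ℝ) * ee a b| ≤ _ at hm
    have hee : |ee a b| ≤ ((a : ℝ) * b) ^ 2 := by
      unfold ee
      rw [abs_div, abs_of_nonneg (by positivity : (0:ℝ) ≤ ((a * b : ℕ) : ℝ)), div_le_iff₀ (by push_cast; positivity)]
      refine (abs_sum_le_sum_abs _ _).trans ((sum_le_sum fun n _ => hB n).trans ?_)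
      rw [Finset.sum_const, Finset.card_range, nsmul_eq_mul, mul_comm]
    have hab1 : (1 : ℝ) ≤ a * b := by exact_mod_cast (show 1 ≤ a * b from Nat.mul_pos ha.1 hb.1)
    have hdiff : |∑ n ∈ Icc 3 x, lam n a * lam n b - x * ee a b| ≤ 8 * ((a : ℝ) * b) ^ 3 := by
      rcases Nat.lt_or_ge x 3 with hx | hx
      · rw [Finset.Icc_eq_empty (by omega), Finset.sum_empty, zero_sub, abs_neg, abs_mul,
          abs_of_nonneg (by positivity : (0:ℝ) ≤ (x:ℝ))]
        have : (x : ℝ) ≤ 2 := by exact_mod_cast (show x ≤ 2 by omega)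
        calc _ ≤ 2 * ((a : ℝ) * b) ^ 2 := by gcongr
          _ ≤ _ := by nlinarith [pow_nonneg (by linarith : (0:ℝ) ≤ (a:ℝ)*b) 2]
      · have e1 : ∑ n ∈ Icc 3 x, lam n a * lam n b =
            ∑ n ∈ range (x + 1), lam n a * lam n b - ∑ n ∈ range 3, lam n a * lam n b := by
          rw [← Finset.sum_Ico_eq_sub _ (by omega)]
          rfl
        have e2 : |∑ n ∈ range 3, lam n a * lam n b| ≤ 3 * ((a : ℝ) * b) ^ 2 := by
          refine (abs_sum_le_sum_abs _ _).trans ((sum_le_sum fun n _ => hB n).trans ?_)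
          simp
        have e3 := hm (x + 1)
        push_cast at e3
        have e4 : ((a : ℝ) * b) ^ 2 ≤ ((a : ℝ) * b) ^ 3 := pow_le_pow_right₀ hab1 (by norm_num)
        have e5 : 2 * ((a : ℝ) * b) * ((a : ℝ) * b) ^ 2 = 2 * ((a : ℝ) * b) ^ 3 := by ring
        rw [e5] at e3
        rw [e1]
        rw [abs_le] at *
        constructor <;> nlinarith
    have e6 : (∑ n ∈ Icc 3 x, lam n a * lam n b) / (a * b) - x * (ee a b / (a * b)) =
        (∑ n ∈ Icc 3 x, lam n a * lam n b - x * ee a b) / (a * b) := by ring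
    rw [e6, abs_div, abs_of_pos (by positivity : (0:ℝ) < (a:ℝ) * b), div_le_iff₀ (by positivity)]
    refine hdiff.trans ?_
    have e7 : ((a : ℝ) * b) ^ 2 ≤ (M : ℝ) ^ 4 := by
      calc ((a : ℝ) * b) ^ 2 ≤ ((M : ℝ) * M) ^ 2 := by gcongr
        _ = _ := by ring
    calc 8 * ((a : ℝ) * b) ^ 3 = 8 * ((a : ℝ) * b) ^ 2 * (a * b) := by ring
      _ ≤ _ := by gcongr
  refine (sum_le_sum key).trans (le_of_eq ?_)
  simp only [Finset.sum_const, nsmul_eq_mul, Nat.card_Ioc, Nat.sub_zero]; ring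

lemma pow_dvd_mul_iff_fg {p : ℕ} (hp : p.Prime) (X Y : ℤ) (j v1 v2 : ℕ)
    (h1 : ∀ s ≤ j, ((p : ℤ) ^ s ∣ X ↔ s ≤ v1)) (h2 : ∀ s ≤ j, ((p : ℤ) ^ s ∣ Y ↔ s ≤ v2))
    (hv1 : v1 ≤ j) (hv2 : v2 ≤ j) : (p : ℤ) ^ j ∣ X * Y ↔ j ≤ v1 + v2 := by
  have a1 := (h1 v1 hv1).2 le_rfl
  have a2 := (h2 v2 hv2).2 le_rfl
  constructor
  · intro h
    by_contra hlt
    push Not at hlt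
    have hp' : Prime (p : ℤ) := Nat.prime_iff_prime_int.mp hp
    obtain ⟨x, rfl⟩ := a1
    obtain ⟨y, rfl⟩ := a2
    have hx : ¬ (p : ℤ) ∣ x := fun hx => by
      have := (h1 (v1 + 1) (by omega)).1 (by rw [pow_succ]; exact mul_dvd_mul_left _ hx)
      omega
    have hy : ¬ (p : ℤ) ∣ y := fun hx => by
      have := (h2 (v2 + 1) (by omega)).1 (by rw [pow_succ]; exact mul_dvd_mul_left _ hx)
      omega
    have h3 : (p : ℤ) ^ (v1 + v2) * p ∣ (p : ℤ) ^ (v1 + v2) * (x * y) := by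
      refine ((pow_succ (p : ℤ) (v1 + v2)) ▸ pow_dvd_pow (p : ℤ) (show v1 + v2 + 1 ≤ j by omega)).trans ?_
      have e : (p : ℤ) ^ v1 * x * ((p : ℤ) ^ v2 * y) = (p : ℤ) ^ (v1 + v2) * (x * y) := by
        rw [pow_add]; ring
      rwa [e] at h
    have h4 := (mul_dvd_mul_iff_left (pow_ne_zero _ hp'.ne_zero)).1 h3
    rcases hp'.dvd_or_dvd h4 with h | h
    · exact hx h
    · exact hy h
  · intro h
    refine (pow_dvd_pow (p : ℤ) h).trans ?_
    rw [pow_add]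
    exact mul_dvd_mul a1 a2

lemma exists_val {p : ℕ} (X : ℤ) (j : ℕ) : ∃ v ≤ j, ∀ s ≤ j, ((p : ℤ) ^ s ∣ X ↔ s ≤ v) := by
  classical
  refine ⟨Nat.findGreatest (fun s => (p : ℤ) ^ s ∣ X) j, Nat.findGreatest_le _, fun s hs => ⟨fun h => ?_, fun h => ?_⟩⟩
  · exact Nat.le_findGreatest hs h
  · have := Nat.findGreatest_spec (P := fun s => (p : ℤ) ^ s ∣ X) (n := j) (m := 0) (Nat.zero_le _) (by simp)
    exact (pow_dvd_pow _ h).trans this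

lemma staircase {p : ℕ} (hp : p.Prime) (X Y : ℤ) (j : ℕ) :
    (if (p : ℤ) ^ j ∣ X * Y then (1 : ℝ) else 0) =
      ∑ s ∈ range (j + 1), (if (p : ℤ) ^ s ∣ X ∧ (p : ℤ) ^ (j - s) ∣ Y then (1 : ℝ) else 0) -
      ∑ s ∈ range j, (if (p : ℤ) ^ (s + 1) ∣ X ∧ (p : ℤ) ^ (j - s) ∣ Y then (1 : ℝ) else 0) := by
  obtain ⟨v1, hv1, h1⟩ := exists_val (p := p) X j
  obtain ⟨v2, hv2, h2⟩ := exists_val (p := p) Y j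
  rw [Finset.sum_boole, Finset.sum_boole]
  have e1 : (range (j + 1)).filter (fun s => (p : ℤ) ^ s ∣ X ∧ (p : ℤ) ^ (j - s) ∣ Y) =
      Icc (j - v2) v1 := by
    ext s
    rw [mem_filter, mem_range, mem_Icc]
    constructor
    · rintro ⟨a, b, c⟩
      rw [h1 s (by omega)] at b
      rw [h2 _ (by omega)] at c
      omega
    · rintro ⟨a, b⟩
      refine ⟨by omega, (h1 s (by omega)).2 (by omega), (h2 _ (by omega)).2 (by omega)⟩
  have e2 : (range j).filter (fun s => (p : ℤ) ^ (s + 1) ∣ X ∧ (p : ℤ) ^ (j - s) ∣ Y) =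
      Ico (j - v2) v1 := by
    ext s
    rw [mem_filter, mem_range, Finset.mem_Ico]
    constructor
    · rintro ⟨a, b, c⟩
      rw [h1 _ (by omega)] at b
      rw [h2 _ (by omega)] at c
      omega
    · rintro ⟨a, b⟩
      refine ⟨by omega, (h1 _ (by omega)).2 (by omega), (h2 _ (by omega)).2 (by omega)⟩
  rw [e1, e2, Nat.card_Icc, Nat.card_Ico]
  have := pow_dvd_mul_iff_fg hp X Y j v1 v2 h1 h2 hv1 hv2
  by_cases hj : j ≤ v1 + v2
  · rw [if_pos (this.2 hj)]
    have : v1 + 1 - (j - v2) = (v1 - (j - v2)) + 1 := by omega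
    rw [this]; push_cast; ring
  · rw [if_neg (fun h => hj (this.1 h))]
    have a : v1 + 1 - (j - v2) = 0 := by omega
    have b : v1 - (j - v2) = 0 := by omega
    rw [a, b]; simp

/-- number of residues -/
lemma card_resid {p : ℕ} (hp : p.Prime) (j t : ℕ) (ht : t ≤ j) (r : ℤ) :
    ((range (p ^ j)).filter (fun b : ℕ => (p : ℤ) ^ t ∣ (b : ℤ) - r)).card = p ^ (j - t) := by
  have hpt : (0 : ℤ) < (p : ℤ) ^ t := by have := hp.pos; positivity
  obtain ⟨r', hr'⟩ : ∃ r' : ℕ, (r' : ℤ) = r % (p : ℤ) ^ t :=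
    ⟨(r % (p : ℤ) ^ t).toNat, Int.toNat_of_nonneg (Int.emod_nonneg _ hpt.ne')⟩
  have e : (range (p ^ j)).filter (fun b : ℕ => (p : ℤ) ^ t ∣ (b : ℤ) - r) =
      (range (p ^ j)).filter (fun b : ℕ => b ≡ r' [MOD p ^ t]) := by
    refine Finset.filter_congr fun b _ => ?_
    rw [← Int.natCast_modEq_iff, hr']
    push_cast
    rw [← Int.modEq_iff_dvd]
    constructor
    · intro h; exact (h.symm.trans (Int.mod_modEq _ _).symm)
    · intro h; exact (h.trans (Int.mod_modEq _ _)).symm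
  rw [e, ← Nat.count_eq_card_filter_range, Nat.count_modEq_card (p ^ j) (by have := hp.pos; positivity) r']
  have h1 : p ^ j = p ^ t * p ^ (j - t) := by rw [← pow_add]; congr 1; omega
  have hpt' : 0 < p ^ t := by have := hp.pos; positivity
  have h2 : p ^ j % p ^ t = 0 := by rw [h1]; simp
  rw [h2, if_neg (Nat.not_lt_zero _), Nat.add_zero, h1, Nat.mul_div_cancel_left _ hpt']

open Classical in
/-- `w_r` -/
noncomputable def wv (p r : ℕ) : ℝ :=
  if r = 0 then 1 - 1 / p else
    (((range (p ^ r)).filter (fun c : ℕ => ((p : ℤ) ^ r ∣ (c : ℤ) ^ 2 - 1))).card : ℝ)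

lemma unit_of_sq {p r c : ℕ} (hp : p.Prime) (hr : r ≠ 0) (h : (p : ℤ) ^ r ∣ (c : ℤ) ^ 2 - 1) : ¬ p ∣ c := by
  intro hc
  have h1 : (p : ℤ) ∣ (c : ℤ) ^ 2 - 1 := (dvd_pow_self _ hr).trans h
  have h2 : (p : ℤ) ∣ (c : ℤ) ^ 2 := (Int.natCast_dvd_natCast.mpr hc).trans (dvd_pow_self _ two_ne_zero)
  have h3 : (p : ℤ) ∣ 1 := by
    have := dvd_sub h2 h1
    rwa [show (c : ℤ) ^ 2 - ((c : ℤ) ^ 2 - 1) = 1 by ring] at this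
  have := Int.natCast_dvd_natCast.mp (by exact_mod_cast h3 : ((p : ℕ) : ℤ) ∣ ((1 : ℕ) : ℤ))
  exact hp.one_lt.ne' (Nat.dvd_one.mp this)

lemma card_units_sq {p : ℕ} (hp : p.Prime) (k r : ℕ) (hr : r ≤ k) (hk : k ≠ 0) :
    (((range (p ^ k)).filter (fun c : ℕ => ¬ p ∣ c ∧ ((p : ℤ) ^ r ∣ (c : ℤ) ^ 2 - 1))).card : ℝ) =
      wv p r * (p : ℝ) ^ (k - r) := by
  have hp0 : (0 : ℝ) < p := by exact_mod_cast hp.pos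
  unfold wv
  split_ifs with h
  · subst h
    simp only [pow_zero, one_dvd, and_true, Nat.sub_zero]
    have h1 := Finset.card_filter_add_card_filter_not (s := range (p ^ k)) (fun c => p ∣ c)
    have h2 := card_resid hp k 1 (by omega) 0
    simp only [pow_one, sub_zero, Int.natCast_dvd_natCast] at h2
    rw [h2, Finset.card_range] at h1
    have h3 : (p : ℝ) ^ (k - 1) + ((Finset.filter (fun c => ¬ p ∣ c) (range (p ^ k))).card : ℝ) = (p : ℝ) ^ k := by
      exact_mod_cast h1
    obtain ⟨k, rfl⟩ := Nat.exists_eq_succ_of_ne_zero hk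
    simp only [Nat.succ_eq_add_one, Nat.add_sub_cancel] at h3 ⊢
    have h4 : ((Finset.filter (fun c => ¬ p ∣ c) (range (p ^ (k + 1)))).card : ℝ) = (p : ℝ) ^ (k + 1) - (p : ℝ) ^ k := by
      linarith
    rw [h4, pow_succ]
    field_simp
  · have e : (range (p ^ k)).filter (fun c : ℕ => ¬ p ∣ c ∧ ((p : ℤ) ^ r ∣ (c : ℤ) ^ 2 - 1)) =
        (range (p ^ k)).filter (fun c : ℕ => ((p : ℤ) ^ r ∣ (c : ℤ) ^ 2 - 1)) := by
      refine Finset.filter_congr fun c _ => ⟨fun h => h.2, fun h' => ⟨unit_of_sq hp h h', h'⟩⟩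
    rw [e, ← Finset.sum_boole, ← Finset.sum_boole]
    have hper := sum_periodic (fun c : ℕ => if (p : ℤ) ^ r ∣ (c : ℤ) ^ 2 - 1 then (1 : ℝ) else 0) (q := p ^ r) (by
      intro n
      have : (p : ℤ) ^ r ∣ ((n % p ^ r : ℕ) : ℤ) ^ 2 - 1 ↔ (p : ℤ) ^ r ∣ (n : ℤ) ^ 2 - 1 := by
        push_cast
        rw [← Int.modEq_iff_dvd, ← Int.modEq_iff_dvd]
        have := (Int.mod_modEq (n : ℤ) ((p : ℤ) ^ r)).pow 2
        exact ⟨fun h => h.trans this, fun h => h.trans this.symm⟩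
      simp only [this]) (p ^ (k - r)) 0
    rw [Finset.range_zero, Finset.sum_empty, add_zero, add_zero, ← pow_add, show r + (k - r) = k by omega] at hper
    rw [hper]; push_cast; ring

lemma exists_inv {p : ℕ} (hp : p.Prime) (c : ℕ) (hc : ¬ p ∣ c) (t : ℕ) : ∃ r : ℤ, (p : ℤ) ^ t ∣ r * c - 1 := by
  have h : IsCoprime (c : ℤ) ((p : ℤ) ^ t) := by
    refine IsCoprime.pow_right ?_
    rw [Nat.isCoprime_iff_coprime]
    exact ((Nat.Prime.coprime_iff_not_dvd hp).2 hc).symm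
  obtain ⟨a, b, hab⟩ := h
  exact ⟨a, -b, by linear_combination hab⟩

lemma isCop {p : ℕ} (hp : p.Prime) (c : ℕ) (hc : ¬ p ∣ c) (t : ℕ) : IsCoprime ((p : ℤ) ^ t) (c : ℤ) := by
  refine IsCoprime.pow_left ?_
  rw [Nat.isCoprime_iff_coprime]
  exact ((Nat.Prime.coprime_iff_not_dvd hp).2 hc)

lemma card_b {p : ℕ} (hp : p.Prime) (c : ℕ) (hc : ¬ p ∣ c) (j s t : ℕ) (hs : s ≤ j) (ht : t ≤ j) :
    ∑ b ∈ range (p ^ j), (if (p : ℤ) ^ s ∣ (b : ℤ) - c ∧ (p : ℤ) ^ t ∣ (b : ℤ) * c - 1 then (1 : ℝ) else 0) =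
      if (p : ℤ) ^ (min s t) ∣ (c : ℤ) ^ 2 - 1 then (p : ℝ) ^ (j - max s t) else 0 := by
  split_ifs with h
  · rw [Finset.sum_boole]
    rcases le_total s t with hst | hst
    · rw [min_eq_left hst] at h
      rw [max_eq_right hst]
      obtain ⟨r, hr⟩ := exists_inv hp c hc t
      have e : (range (p ^ j)).filter (fun b : ℕ => (p : ℤ) ^ s ∣ (b : ℤ) - c ∧ (p : ℤ) ^ t ∣ (b : ℤ) * c - 1) =
          (range (p ^ j)).filter (fun b : ℕ => (p : ℤ) ^ t ∣ (b : ℤ) - r) := by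
        refine Finset.filter_congr fun b _ => ⟨fun hb => ?_, fun hb => ?_⟩
        · have : (p : ℤ) ^ t ∣ ((b : ℤ) - r) * c := by
            have := dvd_sub hb.2 hr
            rwa [show (b : ℤ) * c - 1 - (r * c - 1) = (b - r) * c by ring] at this
          exact (isCop hp c hc t).dvd_of_dvd_mul_right this
        · have h2 : (p : ℤ) ^ t ∣ (b : ℤ) * c - 1 := by
            have := dvd_add (hb.mul_right c) hr
            rwa [show ((b : ℤ) - r) * c + (r * c - 1) = b * c - 1 by ring] at this
          refine ⟨?_, h2⟩
          have : (p : ℤ) ^ s ∣ ((b : ℤ) - c) * c := by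
            have := dvd_sub ((pow_dvd_pow _ hst).trans h2) h
            rwa [show (b : ℤ) * c - 1 - ((c : ℤ) ^ 2 - 1) = (b - c) * c by ring] at this
          exact (isCop hp c hc s).dvd_of_dvd_mul_right this
      rw [e, card_resid hp j t ht r]; push_cast; rfl
    · rw [min_eq_right hst] at h
      rw [max_eq_left hst]
      have e : (range (p ^ j)).filter (fun b : ℕ => (p : ℤ) ^ s ∣ (b : ℤ) - c ∧ (p : ℤ) ^ t ∣ (b : ℤ) * c - 1) =
          (range (p ^ j)).filter (fun b : ℕ => (p : ℤ) ^ s ∣ (b : ℤ) - c) := by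
        refine Finset.filter_congr fun b _ => ⟨fun hb => hb.1, fun hb => ⟨hb, ?_⟩⟩
        have := dvd_add (((pow_dvd_pow _ hst).trans hb).mul_right c) h
        rwa [show ((b : ℤ) - c) * c + ((c : ℤ) ^ 2 - 1) = b * c - 1 by ring] at this
      rw [e, card_resid hp j s hs]; push_cast; rfl
  · refine Finset.sum_eq_zero fun b _ => if_neg fun hb => h ?_
    have h1 := (pow_dvd_pow (p : ℤ) (min_le_left s t)).trans hb.1
    have h2 := (pow_dvd_pow (p : ℤ) (min_le_right s t)).trans hb.2
    have := dvd_sub h2 (h1.mul_right c)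
    rwa [show (b : ℤ) * c - 1 - ((b : ℤ) - c) * c = (c : ℤ) ^ 2 - 1 by ring] at this

/-- the count of unit pairs -/
lemma card_K {p : ℕ} (hp : p.Prime) (k j s t : ℕ) (hs : s ≤ j) (ht : t ≤ j) (hj : j ≤ k) (hk : k ≠ 0) :
    ∑ c ∈ (range (p ^ k)).filter (fun c => ¬ p ∣ c), ∑ b ∈ range (p ^ j),
      (if (p : ℤ) ^ s ∣ (b : ℤ) - c ∧ (p : ℤ) ^ t ∣ (b : ℤ) * c - 1 then (1 : ℝ) else 0) =
      wv p (min s t) * (p : ℝ) ^ (k - min s t) * (p : ℝ) ^ (j - max s t) := by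
  rw [← card_units_sq hp k (min s t) (by omega) hk, ← Finset.sum_boole, Finset.sum_mul]
  rw [Finset.sum_filter]
  refine sum_congr rfl fun c _ => ?_
  by_cases hc : p ∣ c
  · simp [hc]
  · rw [if_pos hc, card_b hp c hc j s t hs ht]
    by_cases h : (p : ℤ) ^ (min s t) ∣ (c : ℤ) ^ 2 - 1
    · rw [if_pos h, if_pos ⟨hc, h⟩, one_mul]
    · rw [if_neg h, if_neg (fun h' => h h'.2), zero_mul]

/-- `q_j` -/
noncomputable def qv (p j : ℕ) : ℝ :=
  ∑ s ∈ range (j + 1), wv p (min s (j - s)) - (1 / p) * ∑ s ∈ range j, wv p (min (s + 1) (j - s))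

lemma sum_rho_rho {p : ℕ} (hp : p.Prime) (j k : ℕ) (hj : j ≤ k) (hk : k ≠ 0) :
    (∑ n ∈ range (p ^ k), (rho n (p ^ j) : ℝ) * rho n (p ^ k)) = qv p j * (p : ℝ) ^ k := by
  have hp0 : (p : ℝ) ≠ 0 := by exact_mod_cast hp.pos.ne'
  have step1 : ∑ n ∈ range (p ^ k), (rho n (p ^ j) : ℝ) * rho n (p ^ k) =
      ∑ c ∈ (range (p ^ k)).filter (fun c => ¬ p ∣ c), ∑ b ∈ range (p ^ j),
        (if (p : ℤ) ^ j ∣ ((b : ℤ) - c) * ((b : ℤ) * c - 1) then (1 : ℝ) else 0) := by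
    unfold rho
    simp only [← Finset.sum_boole, Finset.sum_mul_sum]
    rw [Finset.sum_filter]
    calc _ = ∑ n ∈ range (p ^ k), ∑ c ∈ range (p ^ k), ∑ b ∈ range (p ^ j),
        (if p ^ j ∣ b ^ 2 + n * b + 1 then (1 : ℝ) else 0) * (if p ^ k ∣ c ^ 2 + n * c + 1 then (1 : ℝ) else 0) := by
          refine sum_congr rfl fun n _ => Finset.sum_comm
      _ = ∑ c ∈ range (p ^ k), ∑ n ∈ range (p ^ k), ∑ b ∈ range (p ^ j),
        (if p ^ j ∣ b ^ 2 + n * b + 1 then (1 : ℝ) else 0) * (if p ^ k ∣ c ^ 2 + n * c + 1 then (1 : ℝ) else 0) :=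
          Finset.sum_comm
      _ = _ := by
          refine sum_congr rfl fun c _ => ?_
          by_cases hc : p ∣ c
          · rw [if_neg (not_not.mpr hc)]
            refine Finset.sum_eq_zero fun n _ => Finset.sum_eq_zero fun b _ => ?_
            rw [if_neg (c := p ^ k ∣ c ^ 2 + n * c + 1), mul_zero]
            intro h
            have h1 := (dvd_pow_self p hk).trans h
            have h2 : p ∣ c ^ 2 + n * c := dvd_add (hc.trans (dvd_pow_self _ two_ne_zero)) (hc.mul_left n)
            exact hp.one_lt.ne' (Nat.dvd_one.mp ((Nat.dvd_add_right h2).mp h1))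
          · rw [if_pos hc]
            obtain ⟨r, hr⟩ := exists_inv hp c hc k
            have hpk : (0 : ℤ) < (p : ℤ) ^ k := by have := hp.pos; positivity
            obtain ⟨n0, hn0⟩ : ∃ n0 : ℕ, (n0 : ℤ) = (-(c + r)) % (p : ℤ) ^ k :=
              ⟨((-(c + r)) % (p : ℤ) ^ k).toNat, Int.toNat_of_nonneg (Int.emod_nonneg _ hpk.ne')⟩
            have hn0' : (p : ℤ) ^ k ∣ n0 + (c + r) := by
              have : (p : ℤ) ^ k ∣ (-(c + r)) - (-(c + r)) % (p : ℤ) ^ k := Int.dvd_self_sub_emod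
              rw [← hn0] at this
              have := this.neg_right
              rwa [show -(-((c : ℤ) + r) - n0) = n0 + (c + r) by ring] at this
            have hlt : n0 < p ^ k := by
              have := Int.emod_lt_of_pos (-(c + r)) hpk
              rw [← hn0] at this
              exact_mod_cast this
            have hroot : ∀ n : ℕ, p ^ k ∣ c ^ 2 + n * c + 1 ↔ (p : ℤ) ^ k ∣ n + (c + r) := by
              intro n
              rw [← Int.natCast_dvd_natCast]
              push_cast
              constructor
              · intro h
                have := dvd_add h hr
                rw [show (c : ℤ) ^ 2 + n * c + 1 + (r * c - 1) = (n + (c + r)) * c by ring] at this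
                exact (isCop hp c hc k).dvd_of_dvd_mul_right this
              · intro h
                have := dvd_sub (h.mul_right (c : ℤ)) hr
                rwa [show ((n : ℤ) + (c + r)) * c - (r * c - 1) = c ^ 2 + n * c + 1 by ring] at this
            rw [Finset.sum_eq_single_of_mem n0 (Finset.mem_range.mpr hlt)]
            · have hr0 := (hroot n0).2 hn0'
              refine sum_congr rfl fun b _ => ?_
              rw [if_pos hr0, mul_one]
              have hr1 : (p : ℤ) ^ j ∣ (c : ℤ) ^ 2 + n0 * c + 1 := by
                refine (pow_dvd_pow _ hj).trans ?_
                have := Int.natCast_dvd_natCast.mpr hr0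
                exact_mod_cast this
              have : p ^ j ∣ b ^ 2 + n0 * b + 1 ↔ (p : ℤ) ^ j ∣ ((b : ℤ) - c) * ((b : ℤ) * c - 1) := by
                rw [← Int.natCast_dvd_natCast]
                push_cast
                constructor
                · intro h
                  have := dvd_sub (h.mul_right (c : ℤ)) (hr1.mul_right (b : ℤ))
                  rwa [show ((b : ℤ) ^ 2 + n0 * b + 1) * c - (c ^ 2 + n0 * c + 1) * b =
                    (b - c) * (b * c - 1) by ring] at this
                · intro h
                  have := dvd_add h (hr1.mul_right (b : ℤ))
                  rw [show ((b : ℤ) - c) * (b * c - 1) + (c ^ 2 + n0 * c + 1) * b =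
                    ((b : ℤ) ^ 2 + n0 * b + 1) * c by ring] at this
                  exact (isCop hp c hc j).dvd_of_dvd_mul_right this
              simp only [this]
            · intro n hn hne
              refine Finset.sum_eq_zero fun b _ => ?_
              rw [if_neg (c := p ^ k ∣ c ^ 2 + n * c + 1), mul_zero]
              intro h
              have h1 := dvd_sub ((hroot n).1 h) hn0'
              rw [show (n : ℤ) + (c + r) - (n0 + (c + r)) = n - n0 by ring] at h1
              apply hne
              have h2 : (n0 : ℤ) ≡ n [ZMOD ((p ^ k : ℕ) : ℤ)] := by
                rw [Int.modEq_iff_dvd]; exact_mod_cast h1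
              exact (Nat.ModEq.eq_of_lt_of_lt (Int.natCast_modEq_iff.mp h2) hlt (Finset.mem_range.mp hn)).symm
  rw [step1]
  have step2 : ∀ c b : ℕ, _ := fun c b => staircase hp ((b : ℤ) - c) ((b : ℤ) * c - 1) j
  simp only [step2, Finset.sum_sub_distrib]
  have sw : ∀ (N : ℕ) (φ : ℕ → ℕ → ℕ → ℝ), ∑ c ∈ (range (p ^ k)).filter (fun c => ¬ p ∣ c), ∑ b ∈ range (p ^ j),
      ∑ s ∈ range N, φ c b s = ∑ s ∈ range N, ∑ c ∈ (range (p ^ k)).filter (fun c => ¬ p ∣ c), ∑ b ∈ range (p ^ j), φ c b s := by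
    intro N φ
    rw [Finset.sum_comm]
    have : ∀ b, ∑ c ∈ (range (p ^ k)).filter (fun c => ¬ p ∣ c), ∑ s ∈ range N, φ c b s =
      ∑ s ∈ range N, ∑ c ∈ (range (p ^ k)).filter (fun c => ¬ p ∣ c), φ c b s := fun b => Finset.sum_comm
    simp only [this]
    rw [Finset.sum_comm]
    refine sum_congr rfl fun s _ => Finset.sum_comm
  rw [sw, sw]
  unfold qv
  rw [sub_mul, Finset.sum_mul, mul_assoc, Finset.sum_mul, Finset.mul_sum]
  congr 1
  · refine sum_congr rfl fun s hs => ?_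
    rw [mem_range] at hs
    rw [card_K hp k j s (j - s) (by omega) (by omega) hj hk, mul_assoc, ← pow_add]
    congr 2; omega
  · refine sum_congr rfl fun s hs => ?_
    rw [mem_range] at hs
    rw [card_K hp k j (s + 1) (j - s) (by omega) (by omega) hj hk, mul_assoc, ← pow_add]
    have : k = (k - min (s + 1) (j - s) + (j - max (s + 1) (j - s))) + 1 := by omega
    obtain ⟨K, hK⟩ : ∃ K, K = k - min (s + 1) (j - s) + (j - max (s + 1) (j - s)) := ⟨_, rfl⟩
    rw [← hK] at this ⊢
    rw [this, pow_succ]; field_simp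

lemma wv_zero (p : ℕ) : wv p 0 = 1 - 1 / p := by simp [wv]

lemma wv_odd {p : ℕ} (hp : p.Prime) (h2 : p ≠ 2) (r : ℕ) (hr : r ≠ 0) : wv p r = 2 := by
  have hp' : Prime (p : ℤ) := Nat.prime_iff_prime_int.mp hp
  have hpr : 2 < p ^ r := by
    have h3 : 3 ≤ p := by have := hp.two_le; omega
    calc 2 < p := h3
      _ = p ^ 1 := (pow_one p).symm
      _ ≤ p ^ r := Nat.pow_le_pow_right hp.pos (by omega)
  unfold wv
  rw [if_neg hr]
  have e : (range (p ^ r)).filter (fun c : ℕ => ((p : ℤ) ^ r ∣ (c : ℤ) ^ 2 - 1)) = {1, p ^ r - 1} := by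
    ext c
    simp only [mem_filter, mem_range, Finset.mem_insert, Finset.mem_singleton]
    have hc1 : ((p ^ r - 1 : ℕ) : ℤ) = (p : ℤ) ^ r - 1 := by push_cast [show 1 ≤ p ^ r by omega]; ring
    constructor
    · rintro ⟨hc, h⟩
      rw [show (c : ℤ) ^ 2 - 1 = ((c : ℤ) - 1) * (c + 1) by ring] at h
      have hno : ¬ ((p : ℤ) ∣ (c : ℤ) - 1 ∧ (p : ℤ) ∣ (c : ℤ) + 1) := by
        rintro ⟨a, b⟩
        have := dvd_sub b a
        rw [show (c : ℤ) + 1 - (c - 1) = ((2 : ℕ) : ℤ) by push_cast; ring, Int.natCast_dvd_natCast] at this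
        exact h2 ((Nat.prime_dvd_prime_iff_eq hp Nat.prime_two).mp this)
      by_cases ha : (p : ℤ) ∣ (c : ℤ) - 1
      · have hb : ¬ (p : ℤ) ∣ (c : ℤ) + 1 := fun hb => hno ⟨ha, hb⟩
        have h3 : (p : ℤ) ^ r ∣ (c : ℤ) - 1 :=
          (IsCoprime.pow_left ((Prime.coprime_iff_not_dvd hp').mpr hb)).dvd_of_dvd_mul_right h
        left
        have h5 : (1 : ℤ) ≡ c [ZMOD ((p ^ r : ℕ) : ℤ)] := by rw [Int.modEq_iff_dvd]; exact_mod_cast h3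
        have h4 : 1 ≡ c [MOD p ^ r] := Int.natCast_modEq_iff.mp (by exact_mod_cast h5)
        exact (Nat.ModEq.eq_of_lt_of_lt h4 (by omega) hc).symm
      · have h3 : (p : ℤ) ^ r ∣ (c : ℤ) + 1 :=
          (IsCoprime.pow_left ((Prime.coprime_iff_not_dvd hp').mpr ha)).dvd_of_dvd_mul_left h
        right
        have h4 : p ^ r ∣ c + 1 := by exact_mod_cast h3
        have := Nat.le_of_dvd (by omega) h4
        omega
    · rintro (rfl | rfl)
      · exact ⟨by omega, by simp⟩
      · refine ⟨by omega, ?_⟩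
        rw [hc1]
        exact ⟨(p : ℤ) ^ r - 2, by ring⟩
  rw [e, Finset.card_pair (by omega)]; norm_num

lemma wv_two_one : wv 2 1 = 1 := by
  have : ((range (2 ^ 1)).filter (fun c : ℕ => (((2 : ℕ) : ℤ) ^ 1 ∣ (c : ℤ) ^ 2 - 1))).card = 1 := by decide
  unfold wv; rw [if_neg (by norm_num), this]; norm_num
lemma wv_two_two : wv 2 2 = 2 := by
  have : ((range (2 ^ 2)).filter (fun c : ℕ => (((2 : ℕ) : ℤ) ^ 2 ∣ (c : ℤ) ^ 2 - 1))).card = 2 := by decide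
  unfold wv; rw [if_neg (by norm_num), this]; norm_num

lemma wv_two_ge (r : ℕ) : wv 2 (r + 3) = 4 := by
  unfold wv
  rw [if_neg (by omega)]
  obtain ⟨P, hP⟩ : ∃ P : ℕ, P = 2 ^ (r + 1) := ⟨_, rfl⟩
  have hP2 : 2 ≤ P := by
    rw [hP]; calc 2 = 2 ^ 1 := by norm_num
      _ ≤ _ := Nat.pow_le_pow_right (by norm_num) (by omega)
  have h8 : 2 ^ (r + 3) = 4 * P := by rw [hP]; ring
  have h8' : ((2 : ℕ) : ℤ) ^ (r + 3) = 4 * P := by exact_mod_cast h8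
  have e : (range (2 ^ (r + 3))).filter (fun c : ℕ => (((2 : ℕ) : ℤ) ^ (r + 3) ∣ (c : ℤ) ^ 2 - 1)) =
      {1, 2 * P - 1, 2 * P + 1, 4 * P - 1} := by
    ext c
    simp only [mem_filter, mem_range, Finset.mem_insert, Finset.mem_singleton, h8, h8']
    constructor
    · rintro ⟨hc, h⟩
      have hodd : c % 2 = 1 := by
        by_contra hne
        obtain ⟨d, hd⟩ : ∃ d, c = 2 * d := ⟨c / 2, by omega⟩
        obtain ⟨z, hz⟩ := h
        rw [hd] at hz
        push_cast at hz
        have : (4 : ℤ) * (d ^ 2 - P * z) = 1 := by linear_combination hz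
        omega
      obtain ⟨d, hd⟩ : ∃ d, c = 2 * d + 1 := ⟨c / 2, by omega⟩
      have h1 : (P : ℤ) ∣ d * (d + 1) := by
        obtain ⟨z, hz⟩ := h
        refine ⟨z, ?_⟩
        rw [hd] at hz
        push_cast at hz
        have : (4 : ℤ) * (d * (d + 1) - P * z) = 0 := by linear_combination hz
        have := (mul_eq_zero.mp this).resolve_left (by norm_num)
        linarith
      have h1' : P ∣ d * (d + 1) := by exact_mod_cast h1
      rcases (show d % 2 = 0 ∨ d % 2 = 1 by omega) with hd2 | hd2
      · have hcop : Nat.Coprime P (d + 1) := by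
          rw [hP]; apply Nat.Coprime.pow_left
          rw [Nat.coprime_two_left]; rw [Nat.odd_iff]; omega
        obtain ⟨z, hz⟩ := hcop.dvd_of_dvd_mul_right h1'
        have : z < 2 := by
          by_contra hh; push Not at hh
          have : P * 2 ≤ P * z := Nat.mul_le_mul_left _ hh
          omega
        interval_cases z <;> omega
      · have hcop : Nat.Coprime P d := by
          rw [hP]; apply Nat.Coprime.pow_left
          rw [Nat.coprime_two_left]; rw [Nat.odd_iff]; omega
        obtain ⟨z, hz⟩ := hcop.dvd_of_dvd_mul_left h1'
        have : z < 3 := by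
          by_contra hh; push Not at hh
          have : P * 3 ≤ P * z := Nat.mul_le_mul_left _ hh
          omega
        interval_cases z <;> omega
    · have hev : (P : ℤ) = 2 * 2 ^ r := by rw [hP]; push_cast; ring
      rintro (rfl | rfl | rfl | rfl)
      · exact ⟨by omega, by simp⟩
      · refine ⟨by omega, ⟨(P : ℤ) - 1, ?_⟩⟩
        push_cast [show 1 ≤ 2 * P by omega]; ring
      · refine ⟨by omega, ⟨(P : ℤ) + 1, ?_⟩⟩
        push_cast; ring
      · refine ⟨by omega, ⟨4 * (P : ℤ) - 2, ?_⟩⟩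
        push_cast [show 1 ≤ 4 * P by omega]; ring
  rw [e]
  rw [Finset.card_insert_of_notMem (by simp only [Finset.mem_insert, Finset.mem_singleton]; omega),
    Finset.card_insert_of_notMem (by simp only [Finset.mem_insert, Finset.mem_singleton]; omega),
    Finset.card_pair (by omega)]
  norm_num

lemma wv_bound {p : ℕ} (hp : p.Prime) (r : ℕ) : 0 ≤ wv p r ∧ wv p r ≤ 4 := by
  rcases Nat.eq_zero_or_pos r with rfl | hr
  · rw [wv_zero]
    have hp1 : (1 : ℝ) ≤ p := by exact_mod_cast hp.one_le
    have h1 : (1 : ℝ) / p ≤ 1 := by rw [div_le_one (by linarith)]; exact hp1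
    have h2 : (0 : ℝ) ≤ 1 / p := by positivity
    constructor <;> linarith
  · by_cases h2 : p = 2
    · subst h2
      obtain rfl | rfl | h : r = 1 ∨ r = 2 ∨ 3 ≤ r := by omega
      · rw [wv_two_one]; norm_num
      · rw [wv_two_two]; norm_num
      · obtain ⟨s, rfl⟩ := Nat.exists_eq_add_of_le' h
        rw [wv_two_ge]; norm_num
    · rw [wv_odd hp h2 r (by omega)]; norm_num

lemma qv_bound {p : ℕ} (hp : p.Prime) (j : ℕ) : |qv p j| ≤ 8 * (j + 1) := by
  have hp1 : (1 : ℝ) ≤ p := by exact_mod_cast hp.one_le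
  have h1 : (1 : ℝ) / p ≤ 1 := by rw [div_le_one (by linarith)]; exact hp1
  have h2 : (0 : ℝ) ≤ 1 / p := by positivity
  unfold qv
  have a1 : 0 ≤ ∑ s ∈ range (j + 1), wv p (min s (j - s)) := Finset.sum_nonneg fun s _ => (wv_bound hp _).1
  have a2 : ∑ s ∈ range (j + 1), wv p (min s (j - s)) ≤ ((j : ℝ) + 1) * 4 := by
    refine (sum_le_sum fun s _ => (wv_bound hp _).2).trans ?_
    simp
  have b1 : 0 ≤ ∑ s ∈ range j, wv p (min (s + 1) (j - s)) := Finset.sum_nonneg fun s _ => (wv_bound hp _).1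
  have b2 : ∑ s ∈ range j, wv p (min (s + 1) (j - s)) ≤ (j : ℝ) * 4 := by
    refine (sum_le_sum fun s _ => (wv_bound hp _).2).trans ?_
    simp
  have b3 : (1 : ℝ) / p * ∑ s ∈ range j, wv p (min (s + 1) (j - s)) ≤ 1 * ((j : ℝ) * 4) := by gcongr
  have b4 : 0 ≤ (1 : ℝ) / p * ∑ s ∈ range j, wv p (min (s + 1) (j - s)) := by positivity
  have : (0 : ℝ) ≤ j := by positivity
  rw [abs_le]; constructor <;> linarith

/-- mean of `rho rho` -/
noncomputable def rr (p i j : ℕ) : ℝ := qv p (min i j) + if i = 0 ∧ j = 0 then 1 / (p : ℝ) else 0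

lemma mean_indep (u : ℕ → ℝ) {q k : ℕ} (hq : 0 < q) (hk : 0 < k) (hu : ∀ n, u (n % q) = u n) :
    (∑ n ∈ range (q * k), u n) / ((q * k : ℕ) : ℝ) = (∑ n ∈ range q, u n) / q := by
  have := sum_periodic u hu k 0
  rw [Finset.range_zero, Finset.sum_empty, add_zero, add_zero] at this
  have hq' : (q : ℝ) ≠ 0 := by positivity
  have hk' : (k : ℝ) ≠ 0 := by positivity
  rw [this]; push_cast; field_simp

lemma rho_mod_dvd {m q : ℕ} (h : m ∣ q) (n : ℕ) : rho (n % q) m = rho n m := by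
  rw [← rho_mod (n % q), Nat.mod_mod_of_dvd _ h, rho_mod]

lemma rr_le {p : ℕ} (hp : p.Prime) (i j K : ℕ) (hij : i ≤ j) (hj : j ≤ K) :
    (∑ n ∈ range (p ^ K), (rho n (p ^ i) : ℝ) * rho n (p ^ j)) / ((p ^ K : ℕ) : ℝ) = rr p i j := by
  have hp0 : (p : ℝ) ≠ 0 := by exact_mod_cast hp.pos.ne'
  have h1 : p ^ K = p ^ j * p ^ (K - j) := by rw [← pow_add]; congr 1; omega
  have hpos : ∀ k, 0 < p ^ k := fun k => pow_pos hp.pos k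
  rw [h1, mean_indep (fun n => (rho n (p ^ i) : ℝ) * rho n (p ^ j)) (hpos _) (hpos _)]
  · unfold rr
    rcases Nat.eq_zero_or_pos j with rfl | hj0
    · have hi : i = 0 := by omega
      subst hi
      have : rho 0 1 = 1 := by decide
      simp [this, qv, wv_zero]
    · rw [sum_rho_rho hp i j hij (by omega), min_eq_left hij, if_neg (by omega)]
      push_cast; field_simp; ring
  · intro n
    rw [rho_mod_dvd (pow_dvd_pow p hij), rho_mod_dvd dvd_rfl]

lemma rr_symm (p i j : ℕ) : rr p i j = rr p j i := by
  unfold rr; rw [min_comm]; simp only [and_comm]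

lemma rr_mean {p : ℕ} (hp : p.Prime) (i j K : ℕ) (hi : i ≤ K) (hj : j ≤ K) :
    (∑ n ∈ range (p ^ K), (rho n (p ^ i) : ℝ) * rho n (p ^ j)) / ((p ^ K : ℕ) : ℝ) = rr p i j := by
  rcases le_total i j with h | h
  · exact rr_le hp i j K h hj
  · rw [rr_symm, ← rr_le hp j i K h hi]
    simp only [mul_comm]

lemma ee_mean {p : ℕ} (hp : p.Prime) (i j K : ℕ) (h : i + j ≤ K) :
    (∑ n ∈ range (p ^ K), lam n (p ^ i) * lam n (p ^ j)) / ((p ^ K : ℕ) : ℝ) = ee (p ^ i) (p ^ j) := by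
  have h1 : p ^ K = p ^ i * p ^ j * p ^ (K - (i + j)) := by rw [← pow_add, ← pow_add]; congr 1; omega
  have hpos : ∀ k, 0 < p ^ k := fun k => pow_pos hp.pos k
  rw [h1, mean_indep (fun n => lam n (p ^ i) * lam n (p ^ j)) (mul_pos (hpos _) (hpos _)) (hpos _) (ee_period _ _)]
  rfl

lemma rr_bound {p : ℕ} (hp : p.Prime) (i j : ℕ) : |rr p i j| ≤ 8 * (i + 1) := by
  unfold rr
  split_ifs with h
  · obtain ⟨rfl, rfl⟩ := h
    simp [qv, wv_zero]
  · rw [add_zero]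
    refine (qv_bound hp _).trans ?_
    have : ((min i j : ℕ) : ℝ) ≤ i := by exact_mod_cast min_le_left i j
    linarith

lemma ee_bound {p : ℕ} (hp : p.Prime) (i j : ℕ) : |ee (p ^ i) (p ^ j)| ≤ 8 * ((i : ℝ) + 1) ^ 2 * (j + 1) := by
  have e : ee (p ^ i) (p ^ j) = ∑ a ∈ range (i + 1), ∑ b ∈ range (j + 1),
      (-1 : ℝ) ^ (i - a) * (-1) ^ (j - b) * rr p a b := by
    rw [← ee_mean hp i j (i + j) le_rfl]
    have : ∀ n, lam n (p ^ i) * lam n (p ^ j) = ∑ a ∈ range (i + 1), ∑ b ∈ range (j + 1),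
        (-1 : ℝ) ^ (i - a) * (-1) ^ (j - b) * ((rho n (p ^ a) : ℝ) * rho n (p ^ b)) := by
      intro n
      rw [lam_pp hp, lam_pp hp, Finset.sum_mul_sum]
      refine sum_congr rfl fun a _ => sum_congr rfl fun b _ => ?_
      ring
    simp only [this]
    rw [Finset.sum_comm, Finset.sum_div]
    refine sum_congr rfl fun a ha => ?_
    rw [Finset.sum_comm, Finset.sum_div]
    refine sum_congr rfl fun b hb => ?_
    rw [mem_range] at ha hb
    rw [← rr_mean hp a b (i + j) (by omega) (by omega), ← Finset.mul_sum, mul_div_assoc]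
  rw [e]
  refine (abs_sum_le_sum_abs _ _).trans ?_
  calc _ ≤ ∑ a ∈ range (i + 1), ∑ b ∈ range (j + 1), 8 * ((i : ℝ) + 1) := by
        refine sum_le_sum fun a ha => (abs_sum_le_sum_abs _ _).trans (sum_le_sum fun b _ => ?_)
        rw [abs_mul, abs_mul, abs_pow, abs_pow]
        simp only [abs_neg, abs_one, one_pow, one_mul]
        refine (rr_bound hp a b).trans ?_
        have : (a : ℝ) ≤ i := by exact_mod_cast Nat.lt_succ_iff.mp (Finset.mem_range.mp ha)
        linarith
    _ = _ := by simp only [Finset.sum_const, Finset.card_range, nsmul_eq_mul]; push_cast; ring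

/-- four-term relation -/
lemma rr_rel {p : ℕ} (hp : p.Prime) (i j : ℕ) :
    rr p i j = ee (p ^ i) (p ^ j) + (if i = 0 then 0 else ee (p ^ (i - 1)) (p ^ j)) +
      ((if j = 0 then 0 else ee (p ^ i) (p ^ (j - 1))) +
        if i = 0 then 0 else if j = 0 then 0 else ee (p ^ (i - 1)) (p ^ (j - 1))) := by
  rw [← rr_mean hp i j (i + j) (by omega) (by omega), ← ee_mean hp i j (i + j) le_rfl,
    ← ee_mean hp (i - 1) j (i + j) (by omega), ← ee_mean hp i (j - 1) (i + j) (by omega),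
    ← ee_mean hp (i - 1) (j - 1) (i + j) (by omega)]
  have hr : ∀ n i, (rho n (p ^ i) : ℝ) = lam n (p ^ i) + if i = 0 then 0 else lam n (p ^ (i - 1)) := by
    intro n i
    rcases Nat.eq_zero_or_pos i with rfl | h
    · simp [(lam_mult n).1, rho_one]
    · obtain ⟨i, rfl⟩ := Nat.exists_eq_succ_of_ne_zero h.ne'
      rw [Nat.succ_eq_add_one, lam_pp_succ hp]; simp
  simp only [hr]
  by_cases hi : i = 0 <;> by_cases hj : j = 0 <;>
    simp only [hi, hj, if_true, if_false, add_zero, add_mul, mul_add, Finset.sum_add_distrib, add_div, zero_add] <;> ring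

lemma hs_congr {α : Type*} {f g : α → ℝ} {s t : ℝ} (h : HasSum f s) (hf : ∀ x, g x = f x) (hs : t = s) : HasSum g t := by
  rw [hs, show g = f from funext hf]; exact h

lemma hasSum_shift1 {f : ℕ × ℕ → ℝ} {s : ℝ} (h : HasSum f s) :
    HasSum (fun x : ℕ × ℕ => if x.1 = 0 then 0 else f (x.1 - 1, x.2)) s := by
  have hi : Function.Injective (fun x : ℕ × ℕ => (x.1 + 1, x.2)) := by
    rintro ⟨a, b⟩ ⟨c, d⟩ h; simp at h; simp [h]
  rw [← hi.hasSum_iff]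
  · exact hs_congr h (fun x => by simp) rfl
  · rintro ⟨a, b⟩ hx
    have : a = 0 := by
      by_contra h0
      exact hx ⟨(a - 1, b), by simp; omega⟩
    simp [this]

lemma hasSum_shift2 {f : ℕ × ℕ → ℝ} {s : ℝ} (h : HasSum f s) :
    HasSum (fun x : ℕ × ℕ => if x.2 = 0 then 0 else f (x.1, x.2 - 1)) s := by
  have hi : Function.Injective (fun x : ℕ × ℕ => (x.1, x.2 + 1)) := by
    rintro ⟨a, b⟩ ⟨c, d⟩ h; simp at h; simp [h]
  rw [← hi.hasSum_iff]
  · exact hs_congr h (fun x => by simp) rfl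
  · rintro ⟨a, b⟩ hx
    have : b = 0 := by
      by_contra h0
      exact hx ⟨(a, b - 1), by simp; omega⟩
    simp [this]

lemma summable_poly1 (k : ℕ) {X : ℝ} (hX0 : 0 < X) (hX1 : X < 1) :
    Summable (fun i : ℕ => ((i : ℝ) + 1) ^ k * X ^ i) := by
  have h := summable_pow_mul_geometric_of_norm_lt_one k (r := X) (by rw [Real.norm_eq_abs, abs_of_pos hX0]; exact hX1)
  have h2 := ((summable_nat_add_iff 1).2 h).mul_left X⁻¹
  refine h2.congr fun i => ?_
  rw [pow_succ]; push_cast; field_simp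

lemma hasSum_min {u : ℕ → ℝ} {X U : ℝ} (hX0 : 0 < X) (hX1 : X < 1)
    (h : HasSum (fun r => u r * (X ^ 2) ^ r) U) :
    HasSum (fun x : ℕ × ℕ => u (min x.1 x.2) * X ^ (x.1 + x.2)) ((1 + X) / (1 - X) * U) := by
  have hg : HasSum (fun d : ℕ => X ^ d) (1 - X)⁻¹ := hasSum_geometric_of_lt_one hX0.le hX1
  have hprod : HasSum (fun x : ℕ × ℕ => (u x.1 * (X ^ 2) ^ x.1) * X ^ x.2) (U * (1 - X)⁻¹) :=
    h.mul hg (summable_mul_of_summable_norm h.summable.norm hg.summable.norm)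
  have i1 : Function.Injective (fun x : ℕ × ℕ => (x.1 + x.2, x.1)) := by
    rintro ⟨a, b⟩ ⟨c, d⟩ h; simp at h; simp; omega
  have i2 : Function.Injective (fun x : ℕ × ℕ => (x.1, x.1 + x.2 + 1)) := by
    rintro ⟨a, b⟩ ⟨c, d⟩ h; simp at h; simp; omega
  have s1 : HasSum (fun x : ℕ × ℕ => if x.2 ≤ x.1 then u (min x.1 x.2) * X ^ (x.1 + x.2) else 0) (U * (1 - X)⁻¹) := by
    rw [← i1.hasSum_iff]
    · refine hs_congr hprod (fun x => ?_) rfl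
      simp only [Function.comp]
      rw [if_pos (by omega), min_eq_right (by omega), ← pow_mul, mul_assoc, ← pow_add]
      congr 2; ring
    · rintro ⟨a, b⟩ hx
      refine if_neg fun hle => hx ⟨(b, a - b), ?_⟩
      simp only at hle ⊢
      ext <;> simp; omega
  have s2 : HasSum (fun x : ℕ × ℕ => if x.2 ≤ x.1 then 0 else u (min x.1 x.2) * X ^ (x.1 + x.2)) (X * (U * (1 - X)⁻¹)) := by
    rw [← i2.hasSum_iff]
    · refine hs_congr (hprod.mul_left X) (fun x => ?_) rfl
      simp only [Function.comp]
      rw [if_neg (by omega), min_eq_left (by omega), ← pow_mul, mul_assoc, ← pow_add, mul_left_comm, ← pow_succ']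
      congr 2; ring
    · rintro ⟨a, b⟩ hx
      refine if_pos ?_
      by_contra hle
      simp only at hle
      refine hx ⟨(a, b - a - 1), ?_⟩
      ext <;> simp; omega
  refine hs_congr (s1.add s2) (fun x => ?_) ?_
  · split_ifs <;> simp
  · have : 1 - X ≠ 0 := by linarith
    field_simp

lemma hasSum_antidiag {f : ℕ × ℕ → ℝ} {s : ℝ} (h : HasSum f s) :
    HasSum (fun k => ∑ i ∈ range (k + 1), f (i, k - i)) s := by
  have h1 := (Finset.HasAntidiagonal.sigmaAntidiagonalEquivProd.hasSum_iff).2 h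
  have h2 := h1.sigma (fun k => hasSum_fintype _)
  refine hs_congr h2 (fun k => ?_) rfl
  rw [← Finset.Nat.sum_antidiagonal_eq_sum_range_succ_mk]
  exact (Finset.sum_coe_sort (Finset.HasAntidiagonal.antidiagonal k) f).symm

lemma hasSum_qv {p : ℕ} {X W0 W1 : ℝ} (hX0 : 0 < X) (hX1 : X < 1)
    (h0 : HasSum (fun r => wv p r * (X ^ 2) ^ r) W0)
    (h1 : HasSum (fun r => wv p (r + 1) * (X ^ 2) ^ r) W1) :
    HasSum (fun j => qv p j * X ^ j) ((1 + X) / (1 - X) * W0 - 1 / p * (X * ((1 + X) / (1 - X) * W1))) := by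
  have a0 := hasSum_antidiag (hasSum_min hX0 hX1 h0)
  have a1 := hasSum_antidiag (hasSum_min (u := fun r => wv p (r + 1)) hX0 hX1 h1)
  have b1 : HasSum (fun j => (∑ s ∈ range j, wv p (min (s + 1) (j - s))) * X ^ j)
      (X * ((1 + X) / (1 - X) * W1)) := by
    rw [← hasSum_nat_add_iff' 1]
    simp only [Finset.sum_range_one, Finset.range_zero, Finset.sum_empty, zero_mul, sub_zero]
    refine hs_congr (a1.mul_left X) (fun k => ?_) rfl
    rw [Finset.sum_mul, Finset.mul_sum]
    refine sum_congr rfl fun s hs => ?_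
    rw [mem_range] at hs
    simp only
    have e1 : min (s + 1) (k + 1 - s) = min s (k - s) + 1 := by omega
    have e2 : s + (k - s) = k := by omega
    rw [e1, e2, pow_succ]; ring
  refine hs_congr (a0.sub (b1.mul_left (1 / (p : ℝ)))) (fun j => ?_) rfl
  unfold qv
  rw [sub_mul, Finset.sum_mul]
  congr 1
  · refine sum_congr rfl fun s hs => ?_
    rw [mem_range] at hs
    have e2 : s + (j - s) = j := by omega
    simp only [e2]
  · ring

lemma summable_ee {p : ℕ} (hp : p.Prime) {X : ℝ} (hX0 : 0 < X) (hX1 : X < 1) :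
    Summable (fun x : ℕ × ℕ => ee (p ^ x.1) (p ^ x.2) * X ^ (x.1 + x.2)) := by
  have h := ((summable_poly1 2 hX0 hX1).mul_of_nonneg (summable_poly1 1 hX0 hX1)
    (fun i => by positivity) (fun i => by positivity)).mul_left 8
  refine Summable.of_norm_bounded h fun x => ?_
  rw [norm_mul, Real.norm_eq_abs, Real.norm_eq_abs, abs_of_nonneg (by positivity : (0:ℝ) ≤ X ^ (x.1 + x.2))]
  refine (mul_le_mul_of_nonneg_right (ee_bound hp x.1 x.2) (by positivity)).trans (le_of_eq ?_)
  rw [pow_add]; ring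

lemma ee_gen {p : ℕ} (hp : p.Prime) {X Q S : ℝ} (hX0 : 0 < X) (hX1 : X < 1)
    (hQ : HasSum (fun j => qv p j * (X ^ 2) ^ j) Q)
    (hS : (1 + X) ^ 2 * S = (1 + X) / (1 - X) * Q + 1 / p) :
    HasSum (fun k => dsum ee (p ^ k) * X ^ k) S := by
  have h1 := (summable_ee hp hX0 hX1).hasSum
  set T := ∑' x : ℕ × ℕ, ee (p ^ x.1) (p ^ x.2) * X ^ (x.1 + x.2) with hT
  have h2 := h1.add ((hasSum_shift1 h1).mul_left X)
  have h3 := h2.add ((hasSum_shift2 h2).mul_left X)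
  have h4 := (hasSum_min hX0 hX1 hQ).add (hasSum_ite_eq ((0 : ℕ), (0 : ℕ)) (1 / (p : ℝ)))
  have h5 : HasSum (fun x : ℕ × ℕ => rr p x.1 x.2 * X ^ (x.1 + x.2)) ((1 + X) / (1 - X) * Q + 1 / p) := by
    refine hs_congr h4 (fun x => ?_) rfl
    obtain ⟨i, j⟩ := x
    unfold rr
    by_cases h : i = 0 ∧ j = 0
    · obtain ⟨rfl, rfl⟩ := h; simp
    · have h' : ¬ ((i, j) = ((0 : ℕ), (0 : ℕ))) := by simpa using h
      rw [if_neg h]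
      simp only [h', if_false, add_zero]
  have h6 : HasSum (fun x : ℕ × ℕ => rr p x.1 x.2 * X ^ (x.1 + x.2)) (T + X * T + X * (T + X * T)) := by
    refine hs_congr h3 (fun x => ?_) rfl
    obtain ⟨i, j⟩ := x
    rw [rr_rel hp]
    rcases i with _ | i <;> rcases j with _ | j <;>
      simp only [if_true, Nat.add_sub_cancel, Nat.add_eq_zero_iff, one_ne_zero, and_false, if_false, add_zero,
        zero_add, mul_zero, pow_zero, mul_one] <;> ring
  have h7 := h5.unique h6
  have h8 : T = S := by
    have hne : (1 + X) ^ 2 ≠ 0 := by positivity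
    apply mul_left_cancel₀ hne
    rw [hS, h7]; ring
  rw [← h8]
  refine hs_congr (hasSum_antidiag h1) (fun k => ?_) rfl
  rw [dsum_pp _ hp, Finset.sum_mul]
  refine sum_congr rfl fun s hs => ?_
  rw [mem_range] at hs
  have e2 : s + (k - s) = k := by omega
  simp only [e2]

/-- local factor -/
noncomputable def Fp (p : ℕ) : ℝ :=
  if p = 2 then 1015 / 864 else 1 + ((p : ℝ) ^ 4 - 2 * (p : ℝ) ^ 3 + 1) / ((p : ℝ) ^ 2 - 1) ^ 3

lemma hasSum_geom_shift {u : ℕ → ℝ} {Y c : ℝ} (hY0 : 0 ≤ Y) (hY1 : Y < 1) (k : ℕ) (hu : ∀ r, u (r + k) = c) :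
    HasSum (fun r => u r * Y ^ r) (∑ r ∈ range k, u r * Y ^ r + c * Y ^ k * (1 - Y)⁻¹) := by
  rw [add_comm, ← hasSum_nat_add_iff k]
  refine hs_congr ((hasSum_geometric_of_lt_one hY0 hY1).mul_left (c * Y ^ k)) (fun r => ?_) rfl
  rw [hu, pow_add]; ring

lemma local_hasSum {p : ℕ} (hp : p.Prime) : HasSum (fun k => dsum ee (p ^ k) * ((p : ℝ)⁻¹) ^ k) (Fp p) := by
  have hp2 : (2 : ℝ) ≤ p := by exact_mod_cast hp.two_le
  have hp0 : (0 : ℝ) < p := by linarith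
  have hX0 : 0 < (p : ℝ)⁻¹ := by positivity
  have hX1 : (p : ℝ)⁻¹ < 1 := inv_lt_one_of_one_lt₀ (by linarith)
  have hZ0 : 0 < ((p : ℝ)⁻¹) ^ 2 := by positivity
  have hZ1 : ((p : ℝ)⁻¹) ^ 2 < 1 := pow_lt_one₀ hX0.le hX1 (by norm_num)
  have hY0 : 0 ≤ (((p : ℝ)⁻¹) ^ 2) ^ 2 := by positivity
  have hY1 : (((p : ℝ)⁻¹) ^ 2) ^ 2 < 1 := pow_lt_one₀ hZ0.le hZ1 (by norm_num)
  by_cases h2 : p = 2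
  · have w0 := hasSum_geom_shift (u := wv p) hY0 hY1 3 (c := 4) (fun r => by subst h2; exact wv_two_ge r)
    have w1 := hasSum_geom_shift (u := fun r => wv p (r + 1)) hY0 hY1 2 (c := 4) (fun r => by subst h2; exact wv_two_ge r)
    refine ee_gen hp hX0 hX1 (hasSum_qv hZ0 hZ1 w0 w1) ?_
    subst h2
    simp only [Finset.sum_range_succ, Finset.sum_range_zero, zero_add, one_add_one_eq_two, wv_two_one, wv_two_two, wv_zero, Fp, if_true]
    norm_num
  · have w0 := hasSum_geom_shift (u := wv p) hY0 hY1 1 (c := 2) (fun r => wv_odd hp h2 _ (by omega))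
    have w1 := hasSum_geom_shift (u := fun r => wv p (r + 1)) hY0 hY1 0 (c := 2) (fun r => wv_odd hp h2 _ (by omega))
    refine ee_gen hp hX0 hX1 (hasSum_qv hZ0 hZ1 w0 w1) ?_
    simp only [Finset.sum_range_one, Finset.sum_range_zero, zero_add, wv_zero, Fp, h2, if_false, pow_zero, pow_one, mul_one]
    have a1 : (p : ℝ) - 1 ≠ 0 := by linarith
    have a2 : (p : ℝ) ^ 2 - 1 ≠ 0 := by nlinarith
    have a4 : (p : ℝ) ^ 4 - 1 ≠ 0 := by nlinarith [sq_nonneg ((p : ℝ) ^ 2 - 1)]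
    have e1 : 1 - (p : ℝ)⁻¹ = (p - 1) / p := by field_simp
    have e2 : 1 - ((p : ℝ)⁻¹) ^ 2 = (p ^ 2 - 1) / p ^ 2 := by field_simp
    have e4 : 1 - (((p : ℝ)⁻¹) ^ 2) ^ 2 = (p ^ 4 - 1) / p ^ 4 := by field_simp
    rw [e4, e2, e1]
    have a4' : (p : ℝ) ^ 4 - 1 = (p - 1) * (p + 1) * (p ^ 2 + 1) := by ring
    have a2' : (p : ℝ) ^ 2 - 1 = (p - 1) * (p + 1) := by ring
    have a5 : (p : ℝ) + 1 ≠ 0 := by linarith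
    have a6 : (p : ℝ) ^ 2 + 1 ≠ 0 := by positivity
    rw [a4', a2']
    field_simp
    ring

/-- absolute version -/
noncomputable def fa (m : ℕ) : ℝ := dsum (fun a b => |ee a b|) m
noncomputable def fs (m : ℕ) : ℝ := dsum ee m

lemma fa_nonneg (m : ℕ) : 0 ≤ fa m := by
  unfold fa dsum
  exact Finset.sum_nonneg fun _ _ => abs_nonneg _
lemma fs_le_fa (m : ℕ) : |fs m| ≤ fa m := by
  unfold fs fa dsum
  exact abs_sum_le_sum_abs _ _

lemma fs_mul {m n : ℕ} (h : Nat.Coprime m n) : fs (m * n) = fs m * fs n :=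
  dsum_mul _ (fun _ _ _ _ h1 h2 h3 h4 h5 => ee_mul h1 h2 h3 h4 h5) h
lemma fa_mul {m n : ℕ} (h : Nat.Coprime m n) : fa (m * n) = fa m * fa n :=
  dsum_mul _ (fun _ _ _ _ h1 h2 h3 h4 h5 => by rw [ee_mul h1 h2 h3 h4 h5, abs_mul]) h
lemma fs_one : fs 1 = 1 := by rw [fs, dsum_one, ee_one]
lemma fa_one : fa 1 = 1 := by rw [fa, dsum_one, ee_one, abs_one]

lemma ee_p_one {p : ℕ} (hp : p.Prime) : ee p 1 = -(1 / p) ∧ ee 1 p = -(1 / p) := by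
  have hq : qv p 0 = 1 - 1 / p := by simp [qv, wv_zero]
  have h1 := rr_rel hp 1 0
  have h2 := rr_rel hp 0 1
  simp [rr, hq, ee_one] at h1 h2
  constructor <;> rw [one_div] <;> linarith

lemma fa_prime {p : ℕ} (hp : p.Prime) : fa p = 2 / p := by
  have := dsum_pp (fun a b => |ee a b|) hp 1
  rw [pow_one] at this
  rw [fa, this]
  have hp0 : (0 : ℝ) < p := by exact_mod_cast hp.pos
  simp only [Finset.sum_range_succ, Finset.sum_range_zero, pow_zero, pow_one, Nat.sub_zero, Nat.sub_self, (ee_p_one hp).1, (ee_p_one hp).2,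
    abs_neg, abs_of_pos (show (0:ℝ) < 1 / p by positivity)]
  ring

lemma fa_pp {p : ℕ} (hp : p.Prime) (k : ℕ) : fa (p ^ k) ≤ 8 * ((k : ℝ) + 1) ^ 4 := by
  rw [fa, dsum_pp _ hp]
  calc _ ≤ ∑ i ∈ range (k + 1), 8 * ((k : ℝ) + 1) ^ 3 := by
        refine sum_le_sum fun i hi => ?_
        have hi' : i ≤ k := Nat.lt_succ_iff.mp (Finset.mem_range.mp hi)
        have h1 : (i : ℝ) ≤ k := by exact_mod_cast hi'
        have h2 : ((k - i : ℕ) : ℝ) ≤ k := by exact_mod_cast Nat.sub_le k i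
        refine (ee_bound hp _ _).trans ?_
        calc 8 * ((i : ℝ) + 1) ^ 2 * ((k - i : ℕ) + 1) ≤ 8 * ((k : ℝ) + 1) ^ 2 * (k + 1) := by gcongr
          _ = _ := by ring
    _ = _ := by simp only [Finset.sum_const, Finset.card_range, nsmul_eq_mul]; push_cast; ring

noncomputable def fah (m : ℕ) : ℝ := fa m * (m : ℝ) ^ (-(9 / 10) : ℝ)

lemma fah_nonneg (m : ℕ) : 0 ≤ fah m := mul_nonneg (fa_nonneg m) (by positivity)

lemma fah_mul {m n : ℕ} (h : Nat.Coprime m n) : fah (m * n) = fah m * fah n := by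
  unfold fah
  rw [fa_mul h]; push_cast
  rw [Real.mul_rpow (by positivity) (by positivity)]; ring

lemma fah_local : ∃ C : ℝ, 0 < C ∧ ∀ p : ℕ, p.Prime → Summable (fun k => fah (p ^ k)) ∧
    ∑' k, fah (p ^ k) ≤ exp (C * (p : ℝ) ^ (-(9 / 5) : ℝ)) := by
  set X2 : ℝ := (2 : ℝ) ^ (-(9 / 10) : ℝ) with hX2
  have hX20 : 0 < X2 := by positivity
  have hX21 : X2 < 1 := Real.rpow_lt_one_of_one_lt_of_neg (by norm_num) (by norm_num)
  have hsum := summable_poly1 4 hX20 hX21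
  set C4 := ∑' k : ℕ, ((k : ℝ) + 1) ^ 4 * X2 ^ k with hC4
  have hC40 : 0 ≤ C4 := tsum_nonneg fun k => by positivity
  refine ⟨2 + 648 * C4, by positivity, fun p hp => ?_⟩
  have hp2 : (2 : ℝ) ≤ p := by exact_mod_cast hp.two_le
  have hp0 : (0 : ℝ) < p := by linarith
  set X : ℝ := (p : ℝ) ^ (-(9 / 10) : ℝ) with hX
  have hX0 : 0 < X := by positivity
  have hXX : X ≤ X2 := Real.rpow_le_rpow_of_nonpos (by norm_num) hp2 (by norm_num)
  have hXsq : X ^ 2 = (p : ℝ) ^ (-(9 / 5) : ℝ) := by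
    rw [hX, ← Real.rpow_natCast, ← Real.rpow_mul hp0.le]; norm_num
  have hk : ∀ k, fah (p ^ k) = fa (p ^ k) * X ^ k := by
    intro k
    unfold fah
    push_cast
    rw [hX, ← Real.rpow_natCast, ← Real.rpow_mul hp0.le, mul_comm, ← Real.rpow_natCast, ← Real.rpow_mul hp0.le]
    rw [mul_comm, mul_comm (k : ℝ)]
  have hk2 : ∀ k : ℕ, fah (p ^ (k + 2)) ≤ X ^ 2 * (648 * (((k : ℝ) + 1) ^ 4 * X2 ^ k)) := by
    intro k
    rw [hk]
    have h1 := fa_pp hp (k + 2)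
    push_cast at h1
    have h2 : ((k : ℝ) + 2 + 1) ^ 4 ≤ 81 * ((k : ℝ) + 1) ^ 4 := by
      have : (k : ℝ) + 2 + 1 ≤ 3 * (k + 1) := by
        have h00 : (0:ℝ) ≤ k := by positivity
        linarith
      calc _ ≤ (3 * ((k : ℝ) + 1)) ^ 4 := by gcongr
        _ = _ := by ring
    calc fa (p ^ (k + 2)) * X ^ (k + 2) ≤ (8 * (81 * ((k : ℝ) + 1) ^ 4)) * (X ^ 2 * X2 ^ k) := by
          rw [pow_add X, mul_comm (X ^ k)]
          gcongr
          linarith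
      _ = _ := by ring
  have hs2 : Summable (fun k => fah (p ^ (k + 2))) :=
    Summable.of_nonneg_of_le (fun k => fah_nonneg _) hk2 ((hsum.mul_left 648).mul_left _)
  have hs : Summable (fun k => fah (p ^ k)) := (summable_nat_add_iff 2).1 hs2
  refine ⟨hs, ?_⟩
  rw [← hs.sum_add_tsum_nat_add 2]
  have t2 : ∑' k, fah (p ^ (k + 2)) ≤ X ^ 2 * (648 * C4) := by
    rw [hC4, ← tsum_mul_left, ← tsum_mul_left]
    exact hs2.tsum_le_tsum hk2 ((hsum.mul_left 648).mul_left _)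
  have t1 : ∑ k ∈ range 2, fah (p ^ k) ≤ 1 + 2 * X ^ 2 := by
    rw [Finset.sum_range_succ, Finset.sum_range_one, hk, hk, pow_zero, pow_zero, pow_one, pow_one, fa_one, fa_prime hp]
    have : (1 : ℝ) / p ≤ X := by
      rw [hX, one_div, ← Real.rpow_neg_one]
      exact Real.rpow_le_rpow_of_exponent_le (by linarith) (by norm_num)
    have : 2 / (p : ℝ) * X ≤ 2 * X ^ 2 := by
      rw [show 2 / (p : ℝ) * X = 2 * (1 / p * X) by ring, sq]; gcongr
    linarith
  calc _ ≤ (1 + 2 * X ^ 2) + X ^ 2 * (648 * C4) := add_le_add t1 t2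
    _ = (2 + 648 * C4) * X ^ 2 + 1 := by ring
    _ ≤ _ := by rw [hXsq]; exact Real.add_one_le_exp _

lemma fah_smooth (N : ℕ) : HasSum ((Nat.smoothNumbers N).indicator fah) (∏ p ∈ N.primesBelow, ∑' k, fah (p ^ k)) := by
  obtain ⟨C, hC, h⟩ := fah_local
  have h1 : ∀ {p : ℕ}, p.Prime → Summable (fun n : ℕ => ‖fah (p ^ n)‖) := fun {p} hp =>
    ((h p hp).1).congr fun k => (Real.norm_of_nonneg (fah_nonneg _)).symm
  have h2 : fah 1 = 1 := by rw [fah, fa_one]; simp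
  have := (EulerProduct.summable_and_hasSum_smoothNumbers_prod_primesBelow_tsum (R := ℝ)
    (f := fah) h2 (fun h => fah_mul h) h1 N).2
  exact hasSum_subtype_iff_indicator.mp this

lemma fah_zero : fah 0 = 0 := by rw [fah, fa, dsum_zero, zero_mul]

lemma fah_summable : Summable fah := by
  obtain ⟨C, hC, h⟩ := fah_local
  have hps : Summable (fun m : ℕ => C * (m : ℝ) ^ (-(9 / 5) : ℝ)) :=
    (Real.summable_nat_rpow.2 (by norm_num)).mul_left C
  refine summable_of_sum_range_le (c := exp (∑' m : ℕ, C * (m : ℝ) ^ (-(9 / 5) : ℝ))) fah_nonneg fun N => ?_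
  have hind := fah_smooth N
  have e1 : ∑ m ∈ range N, fah m = ∑ m ∈ range N, (Nat.smoothNumbers N).indicator fah m := by
    refine sum_congr rfl fun m hm => ?_
    rcases Nat.eq_zero_or_pos m with hm0 | hm0
    · rw [hm0, Set.indicator_apply, fah_zero, ite_self]
    · rw [Set.indicator_of_mem]
      exact Nat.mem_smoothNumbers_of_lt hm0 (Finset.mem_range.mp hm)
  have e2 : ∑ m ∈ range N, (Nat.smoothNumbers N).indicator fah m ≤ ∏ p ∈ N.primesBelow, ∑' k, fah (p ^ k) :=
    sum_le_hasSum _ (fun m _ => Set.indicator_nonneg (fun m _ => fah_nonneg m) m) hind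
  have e3 : ∏ p ∈ N.primesBelow, ∑' k, fah (p ^ k) ≤ ∏ p ∈ N.primesBelow, exp (C * (p : ℝ) ^ (-(9 / 5) : ℝ)) := by
    refine Finset.prod_le_prod (fun p _ => tsum_nonneg fun k => fah_nonneg _) fun p hp => ?_
    exact (h p (Nat.prime_of_mem_primesBelow hp)).2
  have e4 : ∑ p ∈ N.primesBelow, C * (p : ℝ) ^ (-(9 / 5) : ℝ) ≤ ∑' m : ℕ, C * (m : ℝ) ^ (-(9 / 5) : ℝ) :=
    hps.sum_le_tsum _ fun m _ => by positivity
  rw [← Real.exp_sum] at e3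
  rw [e1]
  exact e2.trans (e3.trans (Real.exp_le_exp.mpr e4))

lemma fa_div_le (m : ℕ) : fa m / m ≤ fah m := by
  rcases Nat.eq_zero_or_pos m with rfl | hm
  · simp [fah_nonneg]
  have hm1 : (1 : ℝ) ≤ m := by exact_mod_cast hm
  unfold fah
  rw [div_eq_mul_inv, ← Real.rpow_neg_one]
  exact mul_le_mul_of_nonneg_left (Real.rpow_le_rpow_of_exponent_le hm1 (by norm_num)) (fa_nonneg m)

lemma fs_summable : Summable (fun m => ‖fs m / m‖) := by
  refine Summable.of_nonneg_of_le (fun _ => norm_nonneg _) (fun m => ?_) fah_summable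
  rw [norm_div, Real.norm_eq_abs, Real.norm_natCast]
  exact (div_le_div_of_nonneg_right (fs_le_fa m) (by positivity)).trans (fa_div_le m)

lemma hp_congr {f g : ℕ → ℝ} {s t : ℝ} (h : HasProd f s) (hf : ∀ x, g x = f x) (hs : t = s) : HasProd g t := by
  rw [hs, funext hf]; exact h

lemma kappa_eq : ∑' m, fs m / m = kappa := by
  have h := EulerProduct.eulerProduct_hasProd_mulIndicator (R := ℝ) (f := fun m => fs m / m) (by simp [fs_one])
    (fun {m n} hmn => by rw [fs_mul hmn]; push_cast; rw [mul_div_mul_comm]) fs_summable (by simp)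
  have h2 := h.mul (hasProd_ite_eq (2 : ℕ) ((1015 / 864 : ℝ)⁻¹))
  have h3 : HasProd (Set.mulIndicator {p : ℕ | p.Prime ∧ p ≠ 2}
      (fun p : ℕ => 1 + ((p : ℝ) ^ 4 - 2 * (p : ℝ) ^ 3 + 1) / ((p : ℝ) ^ 2 - 1) ^ 3)) ((∑' m, fs m / m) * (1015 / 864 : ℝ)⁻¹) := by
    refine hp_congr h2 (fun p => ?_) rfl
    have hF : p.Prime → ∑' e : ℕ, fs (p ^ e) / ((p ^ e : ℕ) : ℝ) = Fp p := by
      intro hp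
      rw [← (local_hasSum hp).tsum_eq]
      refine tsum_congr fun k => ?_
      unfold fs; push_cast; rw [inv_pow]; rfl
    by_cases hp : p.Prime
    · by_cases hp2 : p = 2
      · subst hp2
        rw [Set.mulIndicator_of_notMem (by simp), Set.mulIndicator_of_mem (by exact hp), hF hp]
        simp [Fp]
      · rw [Set.mulIndicator_of_mem (by exact ⟨hp, hp2⟩), Set.mulIndicator_of_mem (by exact hp), hF hp]
        simp [Fp, hp2]
    · rw [Set.mulIndicator_of_notMem (fun h => hp h.1), Set.mulIndicator_of_notMem (by exact hp)]
      have : p ≠ 2 := by rintro rfl; exact hp Nat.prime_two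
      simp [this]
  rw [← hasProd_subtype_iff_mulIndicator] at h3
  have h4 := h3.tprod_eq
  unfold kappa
  have h5 : ∏' p : {p : ℕ // p.Prime ∧ p ≠ 2}, (1 + ((p.1 : ℝ) ^ 4 - 2 * (p.1 : ℝ) ^ 3 + 1) / ((p.1 : ℝ) ^ 2 - 1) ^ 3) =
    (∑' m, fs m / m) * (1015 / 864 : ℝ)⁻¹ := h4
  rw [h5]; ring

lemma kappa_pos : 0 < kappa := by
  unfold kappa
  refine mul_pos (by norm_num) (lt_of_lt_of_le one_pos ?_)
  have key : ∀ f : {p : ℕ // p.Prime ∧ p ≠ 2} → ℝ, (∀ p, 1 ≤ f p) → 1 ≤ ∏' p, f p := by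
    intro f hf
    by_cases hm : Multipliable f
    · refine ge_of_tendsto' hm.hasProd fun s => ?_
      have := Finset.prod_le_prod (s := s) (f := fun _ => (1:ℝ)) (g := f) (fun _ _ => zero_le_one) fun p _ => hf p
      simpa using this
    · rw [tprod_eq_one_of_not_multipliable hm]
  refine key _ fun p => ?_
  have h2 := p.2.1.two_le
  have h3 : (3 : ℝ) ≤ p.1 := by exact_mod_cast (show 3 ≤ p.1 by have := p.2.2; omega)
  have : 0 ≤ ((p.1 : ℝ) ^ 4 - 2 * (p.1 : ℝ) ^ 3 + 1) / ((p.1 : ℝ) ^ 2 - 1) ^ 3 := by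
    apply div_nonneg
    · have : (p.1 : ℝ) ^ 4 - 2 * (p.1 : ℝ) ^ 3 = (p.1 : ℝ) ^ 3 * (p.1 - 2) := by ring
      rw [this]
      have : 0 ≤ (p.1 : ℝ) ^ 3 * (p.1 - 2) := mul_nonneg (by positivity) (by linarith)
      linarith
    · have : 0 ≤ (p.1 : ℝ) ^ 2 - 1 := by nlinarith
      positivity
  linarith

lemma double_sum_close : ∃ C : ℝ, 0 < C ∧ ∀ M : ℕ, 0 < M →
    |∑ a ∈ Ioc 0 M, ∑ b ∈ Ioc 0 M, ee a b / (a * b) - kappa| ≤ C * (M : ℝ) ^ (-(1 / 10) : ℝ) := by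
  refine ⟨∑' m, fah m + 1, by have h : 0 ≤ ∑' m, fah m := tsum_nonneg fah_nonneg; linarith, fun M hM => ?_⟩
  have hMR : (0 : ℝ) < M := by exact_mod_cast hM
  set c : ℕ → ℝ := fun m => ∑ d ∈ m.divisors.filter (fun d => d ≤ M ∧ m / d ≤ M), ee d (m / d) with hc
  have hc0 : ∀ m ∉ Ioc 0 (M * M), c m / m = 0 := by
    intro m hm
    rw [Finset.mem_Ioc] at hm
    rcases Nat.eq_zero_or_pos m with rfl | hm0
    · simp
    have : m.divisors.filter (fun d => d ≤ M ∧ m / d ≤ M) = ∅ := by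
      refine Finset.filter_eq_empty_iff.mpr fun d hd h => hm ⟨hm0, ?_⟩
      calc m = d * (m / d) := (Nat.mul_div_cancel' (Nat.dvd_of_mem_divisors hd)).symm
        _ ≤ M * M := Nat.mul_le_mul h.1 h.2
    simp [hc, this]
  have hcsum : HasSum (fun m => c m / m) (∑ m ∈ Ioc 0 (M * M), c m / m) :=
    hasSum_sum_of_ne_finset_zero hc0
  have e1 : ∑ a ∈ Ioc 0 M, ∑ b ∈ Ioc 0 M, ee a b / (a * b) = ∑ m ∈ Ioc 0 (M * M), c m / m := by
    simp only [hc, Finset.sum_div]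
    rw [← Finset.sum_product', Finset.sum_sigma']
    refine Finset.sum_nbij' (fun x => ⟨x.1 * x.2, x.1⟩) (fun y => (y.2, y.1 / y.2)) ?_ ?_ ?_ ?_ ?_
    · rintro ⟨a, b⟩ h
      simp only [Finset.mem_product, Finset.mem_Ioc, Finset.mem_sigma, mem_filter, Nat.mem_divisors] at h ⊢
      obtain ⟨⟨h1, h2⟩, h3, h4⟩ := h
      refine ⟨⟨Nat.mul_pos h1 h3, Nat.mul_le_mul h2 h4⟩, ⟨Dvd.intro _ rfl, (Nat.mul_pos h1 h3).ne'⟩, h2, ?_⟩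
      rwa [Nat.mul_div_cancel_left _ h1]
    · rintro ⟨m, d⟩ h
      simp only [Finset.mem_product, Finset.mem_Ioc, Finset.mem_sigma, mem_filter, Nat.mem_divisors] at h ⊢
      obtain ⟨⟨h1, h2⟩, ⟨h3, h4⟩, h5, h6⟩ := h
      exact ⟨⟨Nat.pos_of_dvd_of_pos h3 h1, h5⟩, Nat.div_pos (Nat.le_of_dvd h1 h3) (Nat.pos_of_dvd_of_pos h3 h1), h6⟩
    · rintro ⟨a, b⟩ h
      simp only [Finset.mem_product, Finset.mem_Ioc] at h
      simp [Nat.mul_div_cancel_left _ h.1.1]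
    · rintro ⟨m, d⟩ h
      simp only [Finset.mem_Ioc, Finset.mem_sigma, mem_filter, Nat.mem_divisors] at h
      simp [Nat.mul_div_cancel' h.2.1.1]
    · rintro ⟨a, b⟩ h
      simp only [Finset.mem_product, Finset.mem_Ioc] at h
      simp [Nat.mul_div_cancel_left _ h.1.1]
  have hs := fs_summable.of_norm
  rw [e1, ← hcsum.tsum_eq, ← kappa_eq, ← hcsum.summable.tsum_sub hs]
  have hb : ∀ m : ℕ, ‖c m / m - fs m / m‖ ≤ fah m * (M : ℝ) ^ (-(1 / 10) : ℝ) := by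
    intro m
    rcases Nat.eq_zero_or_pos m with rfl | hm0
    · simp; exact mul_nonneg (fah_nonneg _) (by positivity)
    have hmR : (0 : ℝ) < m := by exact_mod_cast hm0
    have hdecomp : fs m = c m + ∑ d ∈ m.divisors.filter (fun d => ¬ (d ≤ M ∧ m / d ≤ M)), ee d (m / d) := by
      simp only [hc]
      rw [Finset.sum_filter_add_sum_filter_not]; rfl
    rw [← sub_div, norm_div, Real.norm_natCast, Real.norm_eq_abs, hdecomp, sub_add_cancel_left, abs_neg]
    rcases Nat.lt_or_ge M m with hMm | hMm
    · have h1 : |∑ d ∈ m.divisors.filter (fun d => ¬ (d ≤ M ∧ m / d ≤ M)), ee d (m / d)| ≤ fa m := by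
        refine (abs_sum_le_sum_abs _ _).trans ?_
        exact Finset.sum_le_sum_of_subset_of_nonneg (Finset.filter_subset _ _) fun _ _ _ => abs_nonneg _
      refine (div_le_div_of_nonneg_right h1 hmR.le).trans ?_
      unfold fah
      rw [div_eq_mul_inv, mul_assoc]
      refine mul_le_mul_of_nonneg_left ?_ (fa_nonneg m)
      calc (m : ℝ)⁻¹ = (m : ℝ) ^ (-(9 / 10) : ℝ) * (m : ℝ) ^ (-(1 / 10) : ℝ) := by
            rw [← Real.rpow_add hmR, ← Real.rpow_neg_one]; norm_num
        _ ≤ _ := by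
            refine mul_le_mul_of_nonneg_left ?_ (by positivity)
            have hMm' : (M : ℝ) ≤ m := by exact_mod_cast hMm.le
            exact Real.rpow_le_rpow_of_nonpos hMR hMm' (by norm_num)
    · have : m.divisors.filter (fun d => ¬ (d ≤ M ∧ m / d ≤ M)) = ∅ := by
        refine Finset.filter_eq_empty_iff.mpr fun d hd h => h ⟨?_, ?_⟩
        · exact (Nat.le_of_dvd hm0 (Nat.dvd_of_mem_divisors hd)).trans hMm
        · exact (Nat.div_le_self _ _).trans hMm
      rw [this]; simp
      exact mul_nonneg (fah_nonneg _) (by positivity)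
  have := tsum_of_norm_bounded (f := fun m : ℕ => c m / m - fs m / m) (fah_summable.hasSum.mul_right _) hb
  rw [Real.norm_eq_abs] at this
  refine this.trans ?_
  have : 0 ≤ (M : ℝ) ^ (-(1 / 10) : ℝ) := by positivity
  linarith

lemma meansq_ev : ∃ C : ℝ, 0 < C ∧ ∀ᶠ x : ℕ in atTop,
    |∑ n ∈ Icc 3 x, ampA n ^ 2 - kappa * x| ≤ C * (x : ℝ) ^ (1 - 1 / 12000 : ℝ) := by
  obtain ⟨C2, hC2, h2⟩ := approx_final
  obtain ⟨C1, hC1, h1⟩ := double_sum_close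
  have hk := kappa_pos
  refine ⟨2 * (8 + 2 * C1) + kappa + 2 * C2, by positivity, ?_⟩
  filter_upwards [h2, eventually_ge_atTop 1] with x hx hx1
  have hxR : (1 : ℝ) ≤ x := by exact_mod_cast hx1
  have hx0 : (0 : ℝ) < x := by linarith
  obtain ⟨t, ht⟩ : ∃ t, t = (x : ℝ) ^ (-(1 / 12000) : ℝ) := ⟨_, rfl⟩
  have ht0 : 0 < t := by rw [ht]; positivity
  have ht1 : t ≤ 1 := by rw [ht]; exact Real.rpow_le_one_of_one_le_of_nonpos hxR (by norm_num)
  have hxt : (x : ℝ) ^ (1 - 1 / 12000 : ℝ) = x * t := by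
    rw [ht, sub_eq_add_neg, Real.rpow_add hx0, Real.rpow_one]
  have hxt2 : (x : ℝ) ^ (1 - 1 / 6000 : ℝ) = x * t ^ 2 := by
    rw [ht, ← Real.rpow_natCast, ← Real.rpow_mul hx0.le, sub_eq_add_neg, Real.rpow_add hx0, Real.rpow_one]
    norm_num
  have hz : (1 : ℝ) ≤ (x : ℝ) ^ (1 / 10 : ℝ) := Real.one_le_rpow hxR (by norm_num)
  have hMle : ((Mx x : ℕ) : ℝ) ≤ (x : ℝ) ^ (1 / 10 : ℝ) := Nat.floor_le (by positivity)
  have hMpos : 0 < Mx x := Nat.floor_pos.mpr hz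
  have hM1 : (1 : ℝ) ≤ Mx x := by exact_mod_cast hMpos
  have hMge : (x : ℝ) ^ (1 / 10 : ℝ) / 2 ≤ Mx x := by
    have := Nat.lt_floor_add_one ((x : ℝ) ^ (1 / 10 : ℝ))
    have h' : (x : ℝ) ^ (1 / 10 : ℝ) < (Mx x : ℝ) + 1 := this
    linarith
  have hM6 : ((Mx x : ℕ) : ℝ) ^ 6 ≤ x * t := by
    calc ((Mx x : ℕ) : ℝ) ^ 6 ≤ ((x : ℝ) ^ (1 / 10 : ℝ)) ^ 6 := by gcongr
      _ = (x : ℝ) ^ (6 / 10 : ℝ) := by rw [← Real.rpow_natCast, ← Real.rpow_mul hx0.le]; norm_num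
      _ ≤ (x : ℝ) ^ (1 - 1 / 12000 : ℝ) := Real.rpow_le_rpow_of_exponent_le hxR (by norm_num)
      _ = x * t := hxt
  have hMt : ((Mx x : ℕ) : ℝ) ^ (-(1 / 10) : ℝ) ≤ 2 * t := by
    calc ((Mx x : ℕ) : ℝ) ^ (-(1 / 10) : ℝ) ≤ ((x : ℝ) ^ (1 / 10 : ℝ) / 2) ^ (-(1 / 10) : ℝ) :=
          Real.rpow_le_rpow_of_nonpos (by positivity) hMge (by norm_num)
      _ = (x : ℝ) ^ (-(1 / 100) : ℝ) * (2 : ℝ) ^ (1 / 10 : ℝ) := by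
          rw [Real.div_rpow (by positivity) (by norm_num), ← Real.rpow_mul hx0.le, Real.rpow_neg (x := 2) (by norm_num), div_inv_eq_mul]
          norm_num
      _ ≤ t * 2 := by
          refine mul_le_mul ?_ ?_ (by positivity) ht0.le
          · rw [ht]; exact Real.rpow_le_rpow_of_exponent_le hxR (by norm_num)
          · calc (2 : ℝ) ^ (1 / 10 : ℝ) ≤ (2 : ℝ) ^ (1 : ℝ) := Real.rpow_le_rpow_of_exponent_le (by norm_num) (by norm_num)
              _ = 2 := Real.rpow_one 2
      _ = _ := by ring
  obtain ⟨S1, hS1⟩ : ∃ S, S = ∑ n ∈ Icc 3 x, AM n (Mx x) ^ 2 := ⟨_, rfl⟩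
  obtain ⟨S2, hS2⟩ : ∃ S, S = ∑ n ∈ Icc 3 x, (ampA n - AM n (Mx x)) ^ 2 := ⟨_, rfl⟩
  have b1 : |S1 - kappa * x| ≤ (8 + 2 * C1) * (x * t) := by
    have a1 := AM_sq_mean (Mx x) x
    have a2 := h1 (Mx x) hMpos
    rw [← hS1] at a1
    obtain ⟨W, hW⟩ : ∃ W, W = ∑ a ∈ Ioc 0 (Mx x), ∑ b ∈ Ioc 0 (Mx x), ee a b / (a * b) := ⟨_, rfl⟩
    rw [← hW] at a1 a2
    have a3 : |(x : ℝ) * W - kappa * x| ≤ x * (C1 * (2 * t)) := by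
      rw [show (x : ℝ) * W - kappa * x = x * (W - kappa) by ring, abs_mul, abs_of_pos hx0]
      refine mul_le_mul_of_nonneg_left (a2.trans ?_) hx0.le
      exact mul_le_mul_of_nonneg_left hMt hC1.le
    have := abs_sub_le S1 (x * W) (kappa * x)
    linarith
  have hS10 : 0 ≤ S1 := by rw [hS1]; positivity
  have hS20 : 0 ≤ S2 := by rw [hS2]; positivity
  have b2 : |∑ n ∈ Icc 3 x, ampA n ^ 2 - S1| ≤ t * S1 + (1 + 1 / t) * S2 := by
    rw [hS1, hS2, ← Finset.sum_sub_distrib, Finset.mul_sum, Finset.mul_sum, ← Finset.sum_add_distrib]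
    refine (abs_sum_le_sum_abs _ _).trans (sum_le_sum fun n _ => ?_)
    generalize ampA n = A
    generalize AM n (Mx x) = B
    obtain ⟨r, hr⟩ : ∃ r, r = Real.sqrt t := ⟨_, rfl⟩
    have hr0 : 0 < r := by rw [hr]; exact Real.sqrt_pos.mpr ht0
    have hrt : t = r ^ 2 := by rw [hr, Real.sq_sqrt ht0.le]
    have e : ∀ s : ℝ, s ^ 2 = 1 → 0 ≤ r ^ 2 * B ^ 2 + (1 / r ^ 2) * (A - B) ^ 2 - s * (2 * B * (A - B)) := by
      intro s hs
      have : r ^ 2 * B ^ 2 + (1 / r ^ 2) * (A - B) ^ 2 - s * (2 * B * (A - B)) = (r * B - s * (1 / r) * (A - B)) ^ 2 := by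
        have : (r * B - s * (1 / r) * (A - B)) ^ 2 = r ^ 2 * B ^ 2 + s ^ 2 * ((1 / r ^ 2) * (A - B) ^ 2) - s * (2 * B * (A - B)) * (r * (1 / r)) := by
          rw [one_div, one_div]; ring
        rw [this, hs, mul_one_div_cancel hr0.ne']; ring
      rw [this]; positivity
    have e1 := e 1 (by norm_num)
    have e2 := e (-1) (by norm_num)
    have e3 := sq_nonneg (A - B)
    rw [hrt, abs_le]
    constructor <;> nlinarith
  have hS1x : t * S1 ≤ (kappa + (8 + 2 * C1)) * (x * t) := by
    have : S1 ≤ kappa * x + (8 + 2 * C1) * x := by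
      have := (abs_le.mp b1).2
      have h' : (8 + 2 * C1) * (x * t) ≤ (8 + 2 * C1) * (x * 1) := by gcongr
      linarith
    nlinarith
  have hS2x : (1 + 1 / t) * S2 ≤ 2 * C2 * (x * t) := by
    have h3 : S2 ≤ C2 * (x * t ^ 2) := by rw [hS2, ← hxt2]; exact hx
    calc (1 + 1 / t) * S2 ≤ (1 + 1 / t) * (C2 * (x * t ^ 2)) := by gcongr
      _ = C2 * x * t * (t + 1) := by field_simp
      _ ≤ C2 * x * t * 2 := by gcongr; linarith
      _ = _ := by ring
  rw [hxt]
  have := abs_sub_le (∑ n ∈ Icc 3 x, ampA n ^ 2) S1 (kappa * x)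
  nlinarith

/-- mean square of the amplitudes with power saving -/
theorem meansq : ∃ C : ℝ, 0 < C ∧ ∀ x : ℕ, 1 ≤ x →
    |∑ n ∈ Icc 3 x, ampA n ^ 2 - kappa * x| ≤ C * (x : ℝ) ^ (1 - 1 / 12000 : ℝ) := by
  obtain ⟨C, hC, h⟩ := meansq_ev
  obtain ⟨x0, h0⟩ := eventually_atTop.mp h
  have hk := kappa_pos
  have hB : 0 ≤ ∑ n ∈ Icc 3 x0, ampA n ^ 2 := by positivity
  refine ⟨C + (∑ n ∈ Icc 3 x0, ampA n ^ 2 + kappa * x0), by positivity, fun x hx => ?_⟩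
  have hxR : (1 : ℝ) ≤ x := by exact_mod_cast hx
  have hp : 1 ≤ (x : ℝ) ^ (1 - 1 / 12000 : ℝ) := Real.one_le_rpow hxR (by norm_num)
  rcases le_total x0 x with hxx | hxx
  · refine (h0 x hxx).trans ?_
    gcongr
    have : 0 ≤ ∑ n ∈ Icc 3 x0, ampA n ^ 2 + kappa * x0 := by positivity
    linarith
  · have a1 : ∑ n ∈ Icc 3 x, ampA n ^ 2 ≤ ∑ n ∈ Icc 3 x0, ampA n ^ 2 :=
      Finset.sum_le_sum_of_subset_of_nonneg (Finset.Icc_subset_Icc_right hxx) fun _ _ _ => sq_nonneg _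
    have a0 : 0 ≤ ∑ n ∈ Icc 3 x, ampA n ^ 2 := by positivity
    have a2 : (x : ℝ) ≤ x0 := by exact_mod_cast hxx
    have a3 : kappa * x ≤ kappa * x0 := by gcongr
    have a4 : 0 ≤ kappa * x := by positivity
    have a5 : |∑ n ∈ Icc 3 x, ampA n ^ 2 - kappa * x| ≤ ∑ n ∈ Icc 3 x0, ampA n ^ 2 + kappa * x0 := by
      rw [abs_le]; constructor <;> linarith
    refine a5.trans ?_
    nlinarith [mul_le_mul_of_nonneg_left hp (show 0 ≤ ∑ n ∈ Icc 3 x0, ampA n ^ 2 + kappa * x0 by positivity)]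

/-- the unit `(n + √(n²-4))/2` -/
noncomputable def eu (n : ℕ) : ℝ := ((n : ℝ) + Real.sqrt ((n : ℝ) ^ 2 - 4)) / 2
noncomputable def lu (n : ℕ) : ℝ := Real.log (eu n)

lemma D_real_pos {n : ℕ} (hn : 2 < n) : (0 : ℝ) < (n : ℝ) ^ 2 - 4 := by
  have : (3 : ℝ) ≤ n := by exact_mod_cast hn
  nlinarith

lemma eu_gt_one {n : ℕ} (hn : 2 < n) : 1 < eu n := by
  have : (3 : ℝ) ≤ n := by exact_mod_cast hn
  have := Real.sqrt_nonneg ((n : ℝ) ^ 2 - 4)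
  unfold eu; linarith

lemma eu_inv {n : ℕ} (hn : 2 < n) : (eu n)⁻¹ = ((n : ℝ) - Real.sqrt ((n : ℝ) ^ 2 - 4)) / 2 := by
  have h := Real.sq_sqrt (D_real_pos hn).le
  have h1 := eu_gt_one hn
  refine inv_eq_of_mul_eq_one_right ?_
  unfold eu; nlinarith

lemma eu_add_inv {n : ℕ} (hn : 2 < n) : eu n + (eu n)⁻¹ = n := by
  rw [eu_inv hn, eu]; ring

lemma eu_le {n : ℕ} (hn : 2 < n) : eu n ≤ n := by
  have := eu_add_inv hn
  have h2 : 0 < (eu n)⁻¹ := inv_pos.mpr (by linarith [eu_gt_one hn])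
  linarith

lemma eu_gt {n : ℕ} (hn : 2 < n) : (n : ℝ) - 1 < eu n := by
  have := eu_add_inv hn
  have h2 : (eu n)⁻¹ < 1 := inv_lt_one_of_one_lt₀ (eu_gt_one hn)
  linarith

lemma lu_pos {n : ℕ} (hn : 2 < n) : 0 < lu n := Real.log_pos (eu_gt_one hn)

lemma exp_lu {n : ℕ} (hn : 2 < n) : exp (lu n) = eu n := Real.exp_log (by linarith [eu_gt_one hn])

lemma log_Nnorm (n : ℕ) : Real.log (Nnorm n) = 2 * lu n := by
  unfold Nnorm lu eu; rw [Real.log_pow]; norm_num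

lemma add_inv_mono {p q : ℝ} (hp : 1 < p) (hpq : p < q) : p + p⁻¹ < q + q⁻¹ := by
  have h : q + q⁻¹ - (p + p⁻¹) = (q - p) * (p * q - 1) / (p * q) := by
    have : p ≠ 0 := by linarith
    have : q ≠ 0 := by linarith
    field_simp; ring
  have : 0 < (q - p) * (p * q - 1) / (p * q) := by
    have : 1 < p * q := by nlinarith
    apply div_pos (mul_pos (by linarith) (by linarith)) (by linarith)
  linarith

lemma eq_eu {q : ℝ} (hq : 1 < q) {t : ℕ} (ht : 2 < t) (h : q + q⁻¹ = t) : q = eu t := by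
  rw [← eu_add_inv ht] at h
  rcases lt_trichotomy q (eu t) with h1 | h1 | h1
  · exact absurd h (add_inv_mono hq h1).ne
  · exact h1
  · exact absurd h (add_inv_mono (eu_gt_one ht) h1).ne'

lemma eu_strictMono {m n : ℕ} (hm : 2 < m) (h : m < n) : eu m < eu n := by
  by_contra hc
  push Not at hc
  have hn : 2 < n := by omega
  have h2 : (m : ℝ) < n := by exact_mod_cast h
  rcases hc.eq_or_lt with h1 | h1
  · have a := eu_add_inv hm
    have b := eu_add_inv hn
    rw [h1] at b; linarith
  · have := add_inv_mono (eu_gt_one hn) h1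
    rw [eu_add_inv hm, eu_add_inv hn] at this
    linarith

lemma lu_strictMono {m n : ℕ} (hm : 2 < m) (h : m < n) : lu m < lu n :=
  Real.log_lt_log (by linarith [eu_gt_one hm]) (eu_strictMono hm h)

lemma descend {m n : ℕ} (hm : 2 < m) (hmn : m < n) (h : sqRel n m) :
    ∃ t : ℕ, 2 < t ∧ t < n ∧ sqRel t m ∧ lu n = lu t + lu m := by
  have hn : 2 < n := by omega
  obtain ⟨s, hs⟩ := h
  have hm4 := D_pos hm
  have hn4 := D_pos hn
  have eD : ∀ k : ℕ, 2 < k → ((k ^ 2 - 4 : ℕ) : ℤ) = (k : ℤ) ^ 2 - 4 := by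
    intro k hk
    have := D_pos hk; push_cast [show 4 ≤ k ^ 2 by omega]; ring
  have hsz : ((n : ℤ) ^ 2 - 4) * ((m : ℤ) ^ 2 - 4) = s ^ 2 := by
    rw [← eD n hn, ← eD m hm, sq (s : ℤ)]; exact_mod_cast hs
  have hsR : ((n : ℝ) ^ 2 - 4) * ((m : ℝ) ^ 2 - 4) = (s : ℝ) ^ 2 := by exact_mod_cast hsz
  have hev : (2 : ℤ) ∣ n * m - s := by
    have h1 : (2 : ℤ) ∣ (n * m) ^ 2 - s ^ 2 := by
      rw [← hsz]; exact ⟨2 * n ^ 2 + 2 * m ^ 2 - 8, by ring⟩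
    rw [sq_sub_sq] at h1
    rcases Int.prime_two.dvd_mul.mp h1 with h2 | h2
    · have := dvd_sub h2 (Dvd.intro (s : ℤ) rfl : (2 : ℤ) ∣ 2 * s)
      rwa [show (n : ℤ) * m + s - 2 * s = n * m - s by ring] at this
    · exact h2
  obtain ⟨t, ht⟩ := hev
  have htR : (n : ℝ) * m - s = 2 * t := by exact_mod_cast ht
  obtain ⟨q, hq⟩ : ∃ q, q = eu n / eu m := ⟨_, rfl⟩
  have hem := eu_gt_one hm
  have hen := eu_gt_one hn
  have hlt := eu_strictMono hm hmn
  have hq1 : 1 < q := by rw [hq, one_lt_div (by linarith)]; exact hlt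
  have hqn : q < eu n := by rw [hq, div_lt_iff₀ (by linarith)]; nlinarith
  have hsq : Real.sqrt ((n : ℝ) ^ 2 - 4) * Real.sqrt ((m : ℝ) ^ 2 - 4) = s := by
    rw [← Real.sqrt_mul (D_real_pos hn).le, hsR, Real.sqrt_sq (by positivity)]
  have hqt : q + q⁻¹ = t := by
    have : q + q⁻¹ = eu n * (eu m)⁻¹ + (eu n)⁻¹ * eu m := by
      rw [hq, inv_div, div_eq_mul_inv, div_eq_mul_inv]; ring
    rw [this, eu_inv hn, eu_inv hm, eu, eu]
    nlinarith
  have ht2 : 2 < t := by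
    have : (2 : ℝ) < t := by
      have := add_inv_mono (p := 1 + (q - 1) / 2) (by linarith) (show 1 + (q - 1) / 2 < q by linarith)
      have h3 : (0:ℝ) < 1 + (q - 1) / 2 := by linarith
      have h4 : 2 ≤ (1 + (q - 1) / 2) + (1 + (q - 1) / 2)⁻¹ := by
        generalize 1 + (q - 1) / 2 = z at *
        have : z + z⁻¹ - 2 = (z - 1) ^ 2 / z := by field_simp; ring
        have : 0 ≤ (z - 1) ^ 2 / z := by positivity
        linarith
      linarith
    exact_mod_cast this
  lift t to ℕ using by omega
  have ht2' : 2 < t := by exact_mod_cast ht2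
  have hqe := eq_eu hq1 ht2' (by exact_mod_cast hqt)
  refine ⟨t, ht2', ?_, ?_, ?_⟩
  · have := add_inv_mono hq1 hqn
    rw [hqt, eu_add_inv hn] at this
    exact_mod_cast this
  · have key : 4 * (((t : ℤ) ^ 2 - 4) * ((m : ℤ) ^ 2 - 4)) = (m * s - n * ((m : ℤ) ^ 2 - 4)) ^ 2 := by
      have e : (s : ℤ) = n * m - 2 * t := by linarith
      rw [e] at hsz ⊢
      linear_combination 4 * hsz
    have hd : (2 : ℤ) ∣ m * s - n * ((m : ℤ) ^ 2 - 4) := by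
      have : (2 : ℤ) ∣ (m * s - n * ((m : ℤ) ^ 2 - 4)) ^ 2 := by rw [← key]; exact ⟨2 * (((t : ℤ) ^ 2 - 4) * ((m : ℤ) ^ 2 - 4)), by ring⟩
      exact Int.prime_two.dvd_of_dvd_pow this
    obtain ⟨r, hr⟩ := hd
    rw [hr] at key
    refine ⟨r.natAbs, ?_⟩
    have : ((t : ℤ) ^ 2 - 4) * ((m : ℤ) ^ 2 - 4) = r ^ 2 := by linarith
    rw [← eD t ht2', ← eD m hm] at this
    zify
    rw [abs_mul_abs_self, ← sq]
    push_cast at this ⊢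
    exact this
  · unfold lu
    rw [← hqe, hq, Real.log_div (by linarith) (by linarith)]; ring

/-- least element of the class -/
noncomputable def rp (n : ℕ) : ℕ := sInf {m | 2 < m ∧ sqRel n m}

lemma sqRel_refl (n : ℕ) : sqRel n n := ⟨_, rfl⟩

lemma rp_mem {n : ℕ} (hn : 2 < n) : 2 < rp n ∧ sqRel n (rp n) :=
  Nat.sInf_mem (s := {m | 2 < m ∧ sqRel n m}) ⟨n, hn, sqRel_refl n⟩

lemma rp_le {n m : ℕ} (hm : 2 < m) (h : sqRel n m) : rp n ≤ m := Nat.sInf_le ⟨hm, h⟩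

lemma rp_eq {n m : ℕ} (hn : 2 < n) (hm : 2 < m) (h : sqRel n m) : rp n = rp m := by
  apply le_antisymm
  · exact rp_le (rp_mem hm).1 (sqRel_trans hm h (rp_mem hm).2)
  · exact rp_le (rp_mem hn).1 (sqRel_trans hn (sqRel_symm h) (rp_mem hn).2)

lemma rp_pow_aux (m : ℕ) (hm : 2 < m) (hrp : rp m = m) : ∀ n : ℕ, 2 < n → sqRel n m →
    ∃ k : ℕ, 0 < k ∧ lu n = k * lu m := by
  intro n
  induction n using Nat.strong_induction_on with
  | _ n ih =>
    intro hn h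
    have hle : m ≤ n := by rw [← hrp]; exact rp_le hn (sqRel_symm h)
    rcases hle.eq_or_lt with h1 | h1
    · exact ⟨1, one_pos, by rw [h1]; simp⟩
    · obtain ⟨t, ht, htn, hs, he⟩ := descend hm h1 h
      obtain ⟨k, hk, hk2⟩ := ih t htn ht hs
      exact ⟨k + 1, by omega, by rw [he, hk2]; push_cast; ring⟩

lemma rp_rp {n : ℕ} (hn : 2 < n) : rp (rp n) = rp n :=
  (rp_eq hn (rp_mem hn).1 (rp_mem hn).2).symm

lemma rp_pow {n : ℕ} (hn : 2 < n) : ∃ k : ℕ, 0 < k ∧ lu n = k * lu (rp n) :=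
  rp_pow_aux (rp n) (rp_mem hn).1 (rp_rp hn) n hn (rp_mem hn).2

open Classical in
/-- exponent of `n` relative to the representative of its class -/
noncomputable def kk (n : ℕ) : ℕ := if hn : 2 < n then (rp_pow hn).choose else 1

lemma kk_spec {n : ℕ} (hn : 2 < n) : 0 < kk n ∧ lu n = kk n * lu (rp n) := by
  unfold kk; rw [dif_pos hn]; exact (rp_pow hn).choose_spec

lemma kk_inj {n m : ℕ} (hn : 2 < n) (hm : 2 < m) (hr : rp n = rp m) (hk : kk n = kk m) : n = m := by
  have h : lu n = lu m := by rw [(kk_spec hn).2, (kk_spec hm).2, hr, hk]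
  rcases lt_trichotomy n m with h1 | h1 | h1
  · exact absurd h (lu_strictMono hn h1).ne
  · exact h1
  · exact absurd h (lu_strictMono hm h1).ne.symm

/-- algebraic numbers -/
abbrev QK : Type := ↥(algebraicClosure ℚ ℂ)

lemma sK_sq {n : ℕ} (hn : 2 < n) : ((Real.sqrt ((n : ℝ) ^ 2 - 4) : ℝ) : ℂ) ^ 2 = ((n ^ 2 - 4 : ℕ) : ℂ) := by
  have h := Real.sq_sqrt (D_real_pos hn).le
  have h4 := D_pos hn
  rw [← Complex.ofReal_pow, h]
  push_cast [show 4 ≤ n ^ 2 by omega]; ring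

lemma sK_alg (n : ℕ) : ((Real.sqrt ((n : ℝ) ^ 2 - 4) : ℝ) : ℂ) ∈ algebraicClosure ℚ ℂ := by
  rw [mem_algebraicClosure_iff']
  by_cases hn : 2 < n
  · refine IsIntegral.of_pow (n := 2) (by norm_num) ?_
    rw [sK_sq hn]
    exact isIntegral_algebraMap (R := ℚ) (x := ((n ^ 2 - 4 : ℕ) : ℚ)) |> fun h => by simpa using h
  · have : (n : ℝ) ≤ 2 := by exact_mod_cast Nat.not_lt.mp hn
    have h0 : (0 : ℝ) ≤ n := by positivity
    rw [Real.sqrt_eq_zero_of_nonpos (by nlinarith)]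
    simpa using isIntegral_zero

noncomputable def sK (n : ℕ) : QK := ⟨_, sK_alg n⟩
noncomputable def eK (n : ℕ) : QK := ((n : QK) + sK n) / 2

lemma eK_coe (n : ℕ) : ((eK n : QK) : ℂ) = (eu n : ℝ) := by
  unfold eK sK eu
  push_cast
  rfl

lemma sK_sq' {n : ℕ} (hn : 2 < n) : sK n ^ 2 = ((n ^ 2 - 4 : ℕ) : QK) := by
  apply Subtype.ext
  have := sK_sq hn
  push_cast at this ⊢
  exact this

lemma sK_ne {n : ℕ} (hn : 2 < n) : sK n ≠ 0 := by
  intro h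
  have := sK_sq' hn
  rw [h] at this
  have h4 := D_pos hn
  have h5 : ((n ^ 2 - 4 : ℕ) : QK) ≠ 0 := by exact_mod_cast h4.ne'
  simp at this
  exact h5 this.symm

lemma eK_ne {n : ℕ} (hn : 2 < n) : eK n ≠ 0 := by
  intro h
  have := eK_coe n
  rw [h] at this
  have h1 := eu_gt_one hn
  have h2 : (eu n : ℂ) ≠ 0 := by exact_mod_cast (show eu n ≠ 0 by linarith)
  exact h2 (by simpa using this.symm)

lemma eK_inv {n : ℕ} (hn : 2 < n) : (eK n)⁻¹ = ((n : QK) - sK n) / 2 := by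
  refine inv_eq_of_mul_eq_one_right ?_
  have h := sK_sq' hn
  have h4 := D_pos hn
  push_cast [show 4 ≤ n ^ 2 by omega] at h
  unfold eK
  linear_combination (-1 / 4) * h

lemma eK_integral {n : ℕ} (hn : 2 < n) : IsIntegral ℤ (eK n) ∧ IsIntegral ℤ (eK n)⁻¹ := by
  have hsum : (eK n)⁻¹ = (n : QK) - eK n := by rw [eK_inv hn, eK]; ring
  have h1 : IsIntegral ℤ (eK n) := by
    refine ⟨Polynomial.X ^ 2 - Polynomial.C (n : ℤ) * Polynomial.X + 1, ?_, ?_⟩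
    · monicity!
    · have : eK n * (eK n)⁻¹ = 1 := mul_inv_cancel₀ (eK_ne hn)
      rw [hsum] at this
      simp
      linear_combination -this
  refine ⟨h1, ?_⟩
  rw [hsum]
  exact (isIntegral_natCast n).sub h1

instance isGaloisQK : IsGalois ℚ QK :=
  haveI : IsAlgClosure ℚ QK := algebraicClosure.isAlgClosure ℚ ℂ
  IsAlgClosure.isGalois ℚ QK

open Classical in
/-- sign of the action on `√(n²-4)` -/
noncomputable def gsg (n : ℕ) (σ : QK ≃ₐ[ℚ] QK) : ℤˣ := if σ (sK n) = sK n then 1 else -1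

lemma gsg_spec {n : ℕ} (hn : 2 < n) (σ : QK ≃ₐ[ℚ] QK) : σ (sK n) = ((gsg n σ : ℤ) : QK) * sK n := by
  have h : (σ (sK n)) ^ 2 = (sK n) ^ 2 := by
    rw [← map_pow, sK_sq' hn, map_natCast]
  unfold gsg
  split_ifs with h1
  · simp [h1]
  · rcases sq_eq_sq_iff_eq_or_eq_neg.mp h with h2 | h2
    · exact absurd h2 h1
    · simp [h2]

lemma gsg_mul {n : ℕ} (hn : 2 < n) (σ τ : QK ≃ₐ[ℚ] QK) : gsg n (σ * τ) = gsg n σ * gsg n τ := by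
  have h1 := gsg_spec hn (σ * τ)
  rw [AlgEquiv.mul_apply, gsg_spec hn τ, map_mul, map_intCast, gsg_spec hn σ, ← mul_assoc] at h1
  have h2 := mul_right_cancel₀ (sK_ne hn) h1
  have h3 : ((gsg n τ : ℤ) * (gsg n σ : ℤ)) = (gsg n (σ * τ) : ℤ) := by exact_mod_cast h2
  apply Units.ext
  push_cast
  rw [← h3, mul_comm]

lemma gsg_one (n : ℕ) : gsg n 1 = 1 := by simp [gsg]

lemma gsg_eK {n : ℕ} (hn : 2 < n) (σ : QK ≃ₐ[ℚ] QK) : σ (eK n) = eK n ^ ((gsg n σ : ℤˣ) : ℤ) := by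
  have h := gsg_spec hn σ
  rcases Int.units_eq_one_or (gsg n σ) with h1 | h1
  · rw [h1] at h ⊢
    simp at h
    have h2 : σ 2 = 2 := map_ofNat σ 2
    simp [eK, h, h2]
  · rw [h1] at h ⊢
    simp at h
    simp only [Units.val_neg, Units.val_one, zpow_neg, zpow_one]
    rw [eK_inv hn]
    simp only [eK, map_div₀, map_add, map_natCast, h, map_ofNat]
    ring

lemma gsg_inj {n m : ℕ} (hn : 2 < n) (hm : 2 < m) (h : ∀ σ, gsg n σ = gsg m σ) : sqRel n m := by
  have hfix : ∀ σ : QK ≃ₐ[ℚ] QK, σ (sK n * sK m) = sK n * sK m := by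
    intro σ
    rw [map_mul, gsg_spec hn, gsg_spec hm, h σ]
    have : ((gsg m σ : ℤ) : QK) * ((gsg m σ : ℤ) : QK) = 1 := by
      rcases Int.units_eq_one_or (gsg m σ) with h1 | h1 <;> simp [h1]
    linear_combination (sK n * sK m) * this
  obtain ⟨q, hq⟩ : ∃ q : ℚ, algebraMap ℚ QK q = sK n * sK m := by
    have := (InfiniteGalois.mem_bot_iff_fixed (k := ℚ) (K := QK) (sK n * sK m)).mpr hfix
    exact this
  have h2 : q * q = (((n ^ 2 - 4) * (m ^ 2 - 4) : ℕ) : ℚ) := by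
    apply (algebraMap ℚ QK).injective
    rw [map_mul, hq, map_natCast]
    push_cast
    have e1 := sK_sq' hn
    have e2 := sK_sq' hm
    push_cast at e1 e2
    rw [← e1, ← e2]; ring
  unfold sqRel
  rw [← Rat.isSquare_natCast_iff]
  exact ⟨q, h2.symm⟩

lemma prod_coe {ι : Type*} (F : Finset ι) (n : ι → ℕ) (hn : ∀ i ∈ F, 2 < n i) (a : ι → ℤ) :
    (((∏ i ∈ F, eK (n i) ^ a i : QK)) : ℂ) = (exp (∑ i ∈ F, a i * lu (n i)) : ℝ) := by
  rw [Real.exp_sum]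
  have : ((∏ i ∈ F, eK (n i) ^ a i : QK) : ℂ) = ∏ i ∈ F, (((eK (n i) : QK)) : ℂ) ^ a i := by
    push_cast; rfl
  rw [this]
  push_cast
  refine Finset.prod_congr rfl fun i hi => ?_
  rw [eK_coe, ← exp_lu (hn i hi)]
  rw [← Complex.ofReal_zpow, ← Complex.ofReal_intCast, ← Complex.ofReal_mul, ← Complex.ofReal_exp, ← Real.rpow_intCast, ← Real.exp_mul, mul_comm]

lemma prod_sigma {ι : Type*} (F : Finset ι) (n : ι → ℕ) (hn : ∀ i ∈ F, 2 < n i) (a : ι → ℤ) (σ : QK ≃ₐ[ℚ] QK) :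
    σ (∏ i ∈ F, eK (n i) ^ a i) = ∏ i ∈ F, eK (n i) ^ ((gsg (n i) σ : ℤ) * a i) := by
  rw [map_prod]
  refine Finset.prod_congr rfl fun i hi => ?_
  rw [map_zpow₀, gsg_eK (hn i hi), zpow_mul]

/-- distinct classes are independent -/
lemma lu_indep (F : Finset ℕ) (hF : ∀ n ∈ F, 2 < n) (hpair : ∀ n ∈ F, ∀ m ∈ F, sqRel n m → n = m)
    (a : ℕ → ℤ) (h : ∑ n ∈ F, a n * lu n = 0) : ∀ n ∈ F, a n = 0 := by
  have h1 : ∏ i ∈ F, eK i ^ a i = 1 := by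
    apply Subtype.ext
    rw [prod_coe F (fun n => n) hF a, h]; simp
  have h2 : ∀ σ : QK ≃ₐ[ℚ] QK, ∑ n ∈ F, ((a n : ℝ) * lu n) * ((gsg n σ : ℤ) : ℝ) = 0 := by
    intro σ
    have h3 := prod_sigma F (fun n => n) hF a σ
    rw [h1, map_one] at h3
    have h4 := prod_coe F (fun n => n) hF (fun i => (gsg i σ : ℤ) * a i)
    rw [← h3] at h4
    have h5 : (1 : ℝ) = exp (∑ i ∈ F, (((gsg i σ : ℤ) * a i : ℤ) : ℝ) * lu i) := by
      have : ((1 : QK) : ℂ) = ((1 : ℝ) : ℂ) := by simp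
      rw [this] at h4
      exact_mod_cast h4
    rw [eq_comm, Real.exp_eq_one_iff] at h5
    rw [← h5]
    refine sum_congr rfl fun n _ => ?_
    push_cast; ring
  let ch : F → ((QK ≃ₐ[ℚ] QK) →* ℝ) := fun n =>
    { toFun := fun σ => ((gsg n.1 σ : ℤ) : ℝ)
      map_one' := by simp [gsg_one]
      map_mul' := fun σ τ => by rw [gsg_mul (hF n.1 n.2)]; push_cast; rfl }
  have hch : Function.Injective ch := by
    intro n m hnm
    apply Subtype.ext
    refine hpair _ n.2 _ m.2 (gsg_inj (hF _ n.2) (hF _ m.2) fun σ => ?_)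
    have := DFunLike.congr_fun hnm σ
    apply Units.ext
    exact_mod_cast (show ((gsg n.1 σ : ℤ) : ℝ) = ((gsg m.1 σ : ℤ) : ℝ) from this)
  have hli := (linearIndependent_monoidHom (QK ≃ₐ[ℚ] QK) ℝ).comp ch hch
  rw [Fintype.linearIndependent_iff] at hli
  have h6 := hli (fun n => (a n.1 : ℝ) * lu n.1) (by
    funext σ
    have := h2 σ
    rw [← Finset.sum_coe_sort] at this
    simp only [Finset.sum_apply, Pi.smul_apply, Function.comp, smul_eq_mul, Pi.zero_apply]
    exact this)
  intro n hn
  have h7 := h6 ⟨n, hn⟩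
  have h8 := lu_pos (hF n hn)
  have h9 : (a n : ℝ) = 0 := (mul_eq_zero.mp h7).resolve_right h8.ne'
  exact_mod_cast h9

open Classical in
/-- Liouville type lower bound -/
lemma lu_lower (K N : ℕ) (n : Fin K → ℕ) (hn : ∀ i, 2 < n i) (hN : ∀ i, n i ≤ N) (hN1 : 1 ≤ N) (a : Fin K → ℤˣ)
    (h : ∑ i, ((a i : ℤ) : ℝ) * lu (n i) ≠ 0) :
    1 ≤ |exp (∑ i, ((a i : ℤ) : ℝ) * lu (n i)) - 1| * (2 * (N : ℝ) ^ K) ^ (2 ^ K) := by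
  let w : (Fin K → ℤˣ) → QK := fun b => ∏ i, eK (n i) ^ ((b i : ℤˣ) : ℤ)
  let v : (QK ≃ₐ[ℚ] QK) → (Fin K → ℤˣ) := fun σ i => gsg (n i) σ
  have hwc : ∀ b, ((w b : QK) : ℂ) = (exp (∑ i, ((b i : ℤ) : ℝ) * lu (n i)) : ℝ) := fun b =>
    prod_coe Finset.univ n (fun i _ => hn i) (fun i => (b i : ℤ))
  have hws : ∀ σ b, σ (w b) = w (v σ * b) := by
    intro σ b
    have := prod_sigma Finset.univ n (fun i _ => hn i) (fun i => (b i : ℤ)) σ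
    rw [this]
    simp only [w, v, Pi.mul_apply, Units.val_mul]
  have hvm : ∀ σ τ, v (σ * τ) = v σ * v τ := fun σ τ => funext fun i => gsg_mul (hn i) σ τ
  let H : Finset (Fin K → ℤˣ) := Finset.univ.filter (fun η => ∃ σ, v σ = η)
  let P : QK := ∏ η ∈ H, (w (η * a) - 1)
  have hfix : ∀ τ : QK ≃ₐ[ℚ] QK, τ P = P := by
    intro τ
    simp only [P]
    rw [map_prod]
    refine Finset.prod_equiv (Equiv.mulLeft (v τ)) ?_ ?_
    · intro η
      simp only [H, mem_filter, Finset.mem_univ, true_and, Equiv.coe_mulLeft]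
      constructor
      · rintro ⟨σ, rfl⟩; exact ⟨τ * σ, hvm _ _⟩
      · rintro ⟨σ, hσ⟩
        refine ⟨τ⁻¹ * σ, ?_⟩
        have h1 : v τ⁻¹ * v τ = 1 := by
          rw [← hvm, inv_mul_cancel]; funext i; exact gsg_one _
        rw [hvm, hσ, ← mul_assoc, h1, one_mul]
    · intro η _
      rw [map_sub, map_one, hws, Equiv.coe_mulLeft, mul_assoc]
  obtain ⟨q, hq⟩ : ∃ q : ℚ, algebraMap ℚ QK q = P :=
    (InfiniteGalois.mem_bot_iff_fixed (k := ℚ) (K := QK) P).mpr hfix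
  have hwint : ∀ b, IsIntegral ℤ (w b) := by
    intro b
    refine IsIntegral.prod _ fun i _ => ?_
    rcases Int.units_eq_one_or (b i) with h1 | h1
    · rw [h1]; simpa using (eK_integral (hn i)).1
    · rw [h1]; simpa using (eK_integral (hn i)).2
  have hPint : IsIntegral ℤ P := IsIntegral.prod _ fun η _ => (hwint _).sub isIntegral_one
  have hqint : IsIntegral ℤ q := by
    rw [← hq] at hPint
    exact (isIntegral_algebraMap_iff (algebraMap ℚ QK).injective).mp hPint
  obtain ⟨z, hz⟩ := IsIntegrallyClosed.isIntegral_iff.mp hqint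
  have hwa : w a - 1 ≠ 0 := by
    intro h0
    have h1 := hwc a
    rw [sub_eq_zero.mp h0] at h1
    have h2 : exp (∑ i, ((a i : ℤ) : ℝ) * lu (n i)) = 1 := by
      have : ((1 : QK) : ℂ) = ((1 : ℝ) : ℂ) := by simp
      rw [this] at h1
      exact_mod_cast h1.symm
    exact h (Real.exp_eq_one_iff _ |>.mp h2)
  have hP0 : P ≠ 0 := by
    refine Finset.prod_ne_zero_iff.mpr fun η hη => ?_
    simp only [H, mem_filter, Finset.mem_univ, true_and] at hη
    obtain ⟨σ, rfl⟩ := hη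
    rw [← hws, ← map_one σ, ← map_sub]
    exact (map_ne_zero σ).mpr hwa
  have hz0 : z ≠ 0 := by
    rintro rfl
    apply hP0
    rw [← hq, ← hz]; simp
  have hPz : ((P : QK) : ℂ) = (z : ℂ) := by
    rw [← hq, ← hz]; simp
  have hnorm : 1 ≤ ‖((P : QK) : ℂ)‖ := by
    rw [hPz, Complex.norm_intCast]
    exact_mod_cast Int.one_le_abs hz0
  have hB1 : (1 : ℝ) ≤ (N : ℝ) ^ K := one_le_pow₀ (by exact_mod_cast hN1)
  have hwb : ∀ b, ‖((w b : QK) : ℂ) - 1‖ ≤ 2 * (N : ℝ) ^ K := by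
    intro b
    have h1 : ‖((w b : QK) : ℂ)‖ ≤ (N : ℝ) ^ K := by
      rw [hwc, Complex.norm_real, Real.norm_of_nonneg (Real.exp_pos _).le, Real.exp_sum]
      calc _ ≤ ∏ i : Fin K, (N : ℝ) := by
            refine Finset.prod_le_prod (fun _ _ => (Real.exp_pos _).le) fun i _ => ?_
            have h3 : exp (lu (n i)) ≤ N := by
              rw [exp_lu (hn i)]; exact (eu_le (hn i)).trans (by exact_mod_cast hN i)
            refine le_trans (Real.exp_le_exp.mpr ?_) h3
            have := lu_pos (hn i)
            rcases Int.units_eq_one_or (b i) with h1 | h1 <;> rw [h1] <;> simp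
            linarith
        _ = _ := by simp
    calc _ ≤ ‖((w b : QK) : ℂ)‖ + ‖(1 : ℂ)‖ := norm_sub_le _ _
      _ ≤ _ := by rw [norm_one]; linarith
  have hPn : ‖((P : QK) : ℂ)‖ = ∏ η ∈ H, ‖((w (η * a) : QK) : ℂ) - 1‖ := by
    rw [← norm_prod]; congr 1
    simp only [P]; push_cast; rfl
  have h1H : (1 : Fin K → ℤˣ) ∈ H := by
    simp only [H, mem_filter, Finset.mem_univ, true_and]
    exact ⟨1, funext fun i => gsg_one _⟩
  rw [hPn, ← Finset.mul_prod_erase _ _ h1H, one_mul] at hnorm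
  have e1 : ‖((w a : QK) : ℂ) - 1‖ = |exp (∑ i, ((a i : ℤ) : ℝ) * lu (n i)) - 1| := by
    rw [hwc, ← Complex.ofReal_one, ← Complex.ofReal_sub, Complex.norm_real, Real.norm_eq_abs]
  rw [e1] at hnorm
  refine hnorm.trans (mul_le_mul_of_nonneg_left ?_ (abs_nonneg _))
  calc _ ≤ ∏ η ∈ H.erase 1, (2 * (N : ℝ) ^ K) := Finset.prod_le_prod (fun _ _ => norm_nonneg _) fun η _ => hwb _
    _ = (2 * (N : ℝ) ^ K) ^ (H.erase 1).card := by simp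
    _ ≤ _ := by
        refine pow_le_pow_right₀ (by linarith) ?_
        refine (Finset.card_le_card (Finset.subset_univ _)).trans ?_
        simp

/-- Taylor polynomial of `e^{ix}` -/
noncomputable def tayP (K : ℕ) (x : ℝ) : ℂ := ∑ k ∈ range K, (Complex.I * x) ^ k / (k.factorial : ℂ)

lemma tayP_deriv (K : ℕ) (x : ℝ) : HasDerivAt (fun y : ℝ => tayP (K + 1) y) (Complex.I * tayP K x) x := by
  have h0 : ∀ k : ℕ, HasDerivAt (fun y : ℝ => (Complex.I * y) ^ k / (k.factorial : ℂ))
      ((k : ℂ) * (Complex.I * x) ^ (k - 1) * Complex.I / (k.factorial : ℂ)) x := by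
    intro k
    have h1 : HasDerivAt (fun y : ℝ => Complex.I * (y : ℂ)) (Complex.I * 1) x :=
      (Complex.ofRealCLM.hasDerivAt (x := x)).const_mul Complex.I
    simpa using (h1.pow k).div_const (k.factorial : ℂ)
  have h2 := HasDerivAt.fun_sum (u := range (K + 1)) (fun k _ => h0 k)
  refine h2.congr_deriv ?_
  rw [Finset.sum_range_succ', tayP, Finset.mul_sum]
  simp only [Nat.cast_zero, zero_mul, zero_div, add_zero]
  refine sum_congr rfl fun k _ => ?_
  have hk : ((k.factorial : ℕ) : ℂ) ≠ 0 := by exact_mod_cast k.factorial_ne_zero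
  have hk1 : ((k + 1 : ℕ) : ℂ) ≠ 0 := by exact_mod_cast k.succ_ne_zero
  rw [Nat.factorial_succ, Nat.add_sub_cancel]
  push_cast at hk1 ⊢
  field_simp

lemma expI_deriv (x : ℝ) : HasDerivAt (fun y : ℝ => Complex.exp (Complex.I * y)) (Complex.I * Complex.exp (Complex.I * x)) x := by
  have h1 : HasDerivAt (fun y : ℝ => Complex.I * (y : ℂ)) (Complex.I * 1) x :=
      (Complex.ofRealCLM.hasDerivAt (x := x)).const_mul Complex.I
  refine h1.cexp.congr_deriv ?_
  ring

lemma tay_nonneg (K : ℕ) : ∀ x : ℝ, 0 ≤ x → ‖Complex.exp (Complex.I * x) - tayP K x‖ ≤ x ^ K / K.factorial := by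
  induction K with
  | zero => intro x _; simp [tayP, mul_comm Complex.I, Complex.norm_exp_ofReal_mul_I]
  | succ K ih =>
    intro x hx
    have hd : ∀ y : ℝ, HasDerivAt (fun y : ℝ => Complex.exp (Complex.I * y) - tayP (K + 1) y)
        (Complex.I * (Complex.exp (Complex.I * y) - tayP K y)) y := fun y =>
      ((expI_deriv y).sub (tayP_deriv K y)).congr_deriv (by ring)
    have hB : ∀ y : ℝ, HasDerivAt (fun y : ℝ => y ^ (K + 1) / ((K + 1).factorial : ℝ)) (y ^ K / K.factorial) y := by
      intro y
      refine ((hasDerivAt_pow (K + 1) y).div_const _).congr_deriv ?_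
      have hk : ((K.factorial : ℕ) : ℝ) ≠ 0 := by exact_mod_cast K.factorial_ne_zero
      rw [Nat.factorial_succ, Nat.add_sub_cancel]
      push_cast
      field_simp
    refine image_norm_le_of_norm_deriv_right_le_deriv_boundary (a := 0) (b := x)
      (f := fun y : ℝ => Complex.exp (Complex.I * y) - tayP (K + 1) y)
      (B := fun y : ℝ => y ^ (K + 1) / ((K + 1).factorial : ℝ)) (fun y _ => (hd y).continuousAt.continuousWithinAt)
      (fun y _ => (hd y).hasDerivWithinAt) ?_ hB ?_ (x := x) ⟨hx, le_rfl⟩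
    · simp [tayP, Finset.sum_range_succ']
    · intro y hy
      rw [norm_mul, Complex.norm_I, one_mul]
      exact ih y hy.1

lemma tay (K : ℕ) (x : ℝ) : ‖Complex.exp (Complex.I * x) - tayP K x‖ ≤ |x| ^ K / K.factorial := by
  rcases le_total 0 x with h | h
  · rw [abs_of_nonneg h]; exact tay_nonneg K x h
  · have h2 := tay_nonneg K (-x) (by linarith)
    rw [abs_of_nonpos h]
    refine le_of_eq_of_le ?_ h2
    rw [← Complex.norm_conj, map_sub, ← Complex.exp_conj]
    unfold tayP
    simp only [map_mul, Complex.conj_I, Complex.conj_ofReal, map_sum, map_div₀, map_pow, map_natCast]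
    congr 2
    · push_cast; ring_nf
    · refine sum_congr rfl fun k _ => ?_
      push_cast; ring_nf

/-- comparison of the characteristic function with its Taylor polynomial -/
lemma cf_tay {Ω : Type*} [MeasurableSpace Ω] (μ : Measure Ω) [IsProbabilityMeasure μ] (S : Ω → ℝ)
    (hS : Measurable S) (B : ℝ) (hB : ∀ ω, |S ω| ≤ B) (K : ℕ) (hK : Even K) (ξ : ℝ) :
    ‖∫ ω, Complex.exp (Complex.I * (ξ * S ω : ℝ)) ∂μ - ∑ k ∈ range K,
      (Complex.I * ξ) ^ k / (k.factorial : ℂ) * ((∫ ω, S ω ^ k ∂μ : ℝ) : ℂ)‖ ≤ |ξ| ^ K / K.factorial * ∫ ω, S ω ^ K ∂μ := by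
  have hin : ∀ k : ℕ, Integrable (fun ω => S ω ^ k) μ := fun k =>
    Integrable.of_bound (hS.pow_const k).aestronglyMeasurable (B ^ k) (Eventually.of_forall fun ω => by
      rw [Real.norm_eq_abs, abs_pow]; exact pow_le_pow_left₀ (abs_nonneg _) (hB ω) k)
  have hintE : Integrable (fun ω => Complex.exp (Complex.I * (ξ * S ω : ℝ))) μ := by
    refine Integrable.of_bound (Measurable.aestronglyMeasurable (by fun_prop)) 1 (Eventually.of_forall fun ω => ?_)
    rw [mul_comm, Complex.norm_exp_ofReal_mul_I]
  have hintC : ∀ k ∈ range K, Integrable (fun ω => (Complex.I * ξ) ^ k / (k.factorial : ℂ) * ((S ω ^ k : ℝ) : ℂ)) μ :=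
    fun k _ => ((hin k).ofReal).const_mul _
  have e1 : ∑ k ∈ range K, (Complex.I * ξ) ^ k / (k.factorial : ℂ) * ((∫ ω, S ω ^ k ∂μ : ℝ) : ℂ)
      = ∫ ω, tayP K (ξ * S ω) ∂μ := by
    have : ∀ ω, tayP K (ξ * S ω) = ∑ k ∈ range K, (Complex.I * ξ) ^ k / (k.factorial : ℂ) * ((S ω ^ k : ℝ) : ℂ) := by
      intro ω
      unfold tayP
      refine sum_congr rfl fun k _ => ?_
      push_cast; rw [← mul_assoc, mul_pow _ (S ω : ℂ)]; ring
    simp_rw [this]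
    rw [integral_finsetSum _ hintC]
    refine sum_congr rfl fun k _ => ?_
    rw [integral_const_mul, integral_complex_ofReal]
  have hintT : Integrable (fun ω => tayP K (ξ * S ω)) μ := by
    have : (fun ω => tayP K (ξ * S ω)) = fun ω => ∑ k ∈ range K, (Complex.I * ξ) ^ k / (k.factorial : ℂ) * ((S ω ^ k : ℝ) : ℂ) := by
      funext ω
      unfold tayP
      refine sum_congr rfl fun k _ => ?_
      push_cast; rw [← mul_assoc, mul_pow _ (S ω : ℂ)]; ring
    rw [this]
    exact integrable_finsetSum _ hintC
  rw [e1, ← integral_sub hintE hintT, ← integral_const_mul]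
  refine norm_integral_le_of_norm_le ((hin K).const_mul _) (Eventually.of_forall fun ω => ?_)
  refine (tay K (ξ * S ω)).trans_eq ?_
  rw [abs_mul, mul_pow, hK.pow_abs (S ω)]; ring

lemma cf_compare {Ω₁ Ω₂ : Type*} [MeasurableSpace Ω₁] [MeasurableSpace Ω₂] (μ : Measure Ω₁) [IsProbabilityMeasure μ]
    (P : Measure Ω₂) [IsProbabilityMeasure P] (S : Ω₁ → ℝ) (S' : Ω₂ → ℝ)
    (hS : Measurable S) (hS' : Measurable S') (B : ℝ) (hB : ∀ ω, |S ω| ≤ B) (hB' : ∀ ω, |S' ω| ≤ B)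
    (K : ℕ) (hK : Even K) (ξ η : ℝ) (hη : ∀ k ≤ K, |∫ ω, S ω ^ k ∂μ - ∫ ω, S' ω ^ k ∂P| ≤ η) :
    ‖∫ ω, Complex.exp (Complex.I * (ξ * S ω : ℝ)) ∂μ - ∫ ω, Complex.exp (Complex.I * (ξ * S' ω : ℝ)) ∂P‖
      ≤ η * exp |ξ| + 2 * (|ξ| ^ K / K.factorial * ∫ ω, S' ω ^ K ∂P) := by
  have h1 := cf_tay μ S hS B hB K hK ξ
  have h2 := cf_tay P S' hS' B hB' K hK ξ
  obtain ⟨m, hm⟩ : ∃ m : ℕ → ℝ, m = fun k => ∫ ω, S ω ^ k ∂μ := ⟨_, rfl⟩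
  obtain ⟨m', hm'⟩ : ∃ m' : ℕ → ℝ, m' = fun k => ∫ ω, S' ω ^ k ∂P := ⟨_, rfl⟩
  have e : ∀ k, ∫ ω, S ω ^ k ∂μ = m k := fun k => by rw [hm]
  have e' : ∀ k, ∫ ω, S' ω ^ k ∂P = m' k := fun k => by rw [hm']
  simp only [e, e'] at h1 h2 hη ⊢
  have h3 : ‖∑ k ∈ range K, (Complex.I * ξ) ^ k / (k.factorial : ℂ) * ((m k : ℝ) : ℂ) -
      ∑ k ∈ range K, (Complex.I * ξ) ^ k / (k.factorial : ℂ) * ((m' k : ℝ) : ℂ)‖ ≤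
      η * ∑ k ∈ range K, |ξ| ^ k / k.factorial := by
    rw [← Finset.sum_sub_distrib, Finset.mul_sum]
    refine norm_sum_le_of_le _ fun k hk => ?_
    rw [← mul_sub, ← Complex.ofReal_sub, norm_mul, norm_div, norm_pow, norm_mul, Complex.norm_I, one_mul,
      Complex.norm_real, Complex.norm_real, Complex.norm_natCast, mul_comm]
    exact mul_le_mul_of_nonneg_right (hη k (Finset.mem_range.mp hk).le) (by positivity)
  have h4 : |ξ| ^ K / K.factorial * m K ≤ |ξ| ^ K / K.factorial * m' K + η * (|ξ| ^ K / K.factorial) := by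
    have := (abs_le.mp (hη K le_rfl)).2
    have h5 : m K ≤ m' K + η := by linarith
    have := mul_le_mul_of_nonneg_left h5 (show 0 ≤ |ξ| ^ K / K.factorial by positivity)
    linarith
  have h5 : ∑ k ∈ range K, |ξ| ^ k / k.factorial + |ξ| ^ K / K.factorial ≤ exp |ξ| := by
    rw [← Finset.sum_range_succ]
    exact Real.sum_le_exp_of_nonneg (abs_nonneg _) _
  have hη0 : 0 ≤ η := (abs_nonneg _).trans (hη 0 (Nat.zero_le _))
  have h6 := mul_le_mul_of_nonneg_left h5 hη0
  obtain ⟨a, ha⟩ : ∃ a, a = ∫ ω, Complex.exp (Complex.I * (ξ * S ω : ℝ)) ∂μ := ⟨_, rfl⟩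
  obtain ⟨b, hb⟩ : ∃ b, b = ∫ ω, Complex.exp (Complex.I * (ξ * S' ω : ℝ)) ∂P := ⟨_, rfl⟩
  rw [← ha] at h1 ⊢
  rw [← hb] at h2 ⊢
  obtain ⟨p, hp⟩ : ∃ p, p = ∑ k ∈ range K, (Complex.I * ξ) ^ k / (k.factorial : ℂ) * ((m k : ℝ) : ℂ) := ⟨_, rfl⟩
  obtain ⟨q, hq⟩ : ∃ q, q = ∑ k ∈ range K, (Complex.I * ξ) ^ k / (k.factorial : ℂ) * ((m' k : ℝ) : ℂ) := ⟨_, rfl⟩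
  rw [← hp] at h1 h3
  rw [← hq] at h2 h3
  have h7 : ‖a - b‖ ≤ ‖a - p‖ + ‖p - q‖ + ‖b - q‖ := by
    have : a - b = (a - p) + (p - q) - (b - q) := by ring
    rw [this]
    exact (norm_sub_le _ _).trans (by gcongr; exact norm_add_le _ _)
  linarith

lemma moment_time {J : Type*} [Fintype J] (w : J → ℂ) (l : J → ℝ) (K : ℕ) (T δ : ℝ) (hT : 0 < T) (hδ : 0 < δ)
    (h : ∀ p : Fin K → J, ∑ i, l (p i) ≠ 0 → δ ≤ |∑ i, l (p i)|) :
    ‖(1 / T : ℂ) * (∫ τ in T..2 * T, (∑ j, w j * Complex.exp (Complex.I * (l j * τ : ℝ))) ^ K) -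
      ∑ p : Fin K → J, (∏ i, w (p i)) * (if ∑ i, l (p i) = 0 then 1 else 0)‖ ≤ (∑ j, ‖w j‖) ^ K * (2 / (T * δ)) := by
  have e1 : ∀ τ : ℝ, (∑ j, w j * Complex.exp (Complex.I * (l j * τ : ℝ))) ^ K =
      ∑ p : Fin K → J, (∏ i, w (p i)) * Complex.exp (Complex.I * (∑ i, l (p i) : ℝ) * τ) := by
    intro τ
    rw [Fintype.sum_pow]
    refine sum_congr rfl fun p _ => ?_
    rw [Finset.prod_mul_distrib, ← Complex.exp_sum]
    congr 2
    push_cast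
    rw [Finset.mul_sum, Finset.sum_mul]
    exact sum_congr rfl fun i _ => by ring
  have e2 : ∀ p : Fin K → J, ‖(1 / T : ℂ) * (∫ τ in T..2 * T, Complex.exp (Complex.I * (∑ i, l (p i) : ℝ) * τ)) -
      (if ∑ i, l (p i) = 0 then 1 else 0)‖ ≤ 2 / (T * δ) := by
    intro p
    have hTc : (T : ℂ) ≠ 0 := by exact_mod_cast hT.ne'
    split_ifs with h0
    · rw [h0]
      have : (1 / T : ℂ) * (∫ τ in T..2 * T, Complex.exp (Complex.I * (0 : ℝ) * τ)) - 1 = 0 := by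
        simp
        have : ((2 * T - T : ℝ) : ℂ) = T := by push_cast; ring
        push_cast at this
        rw [this, inv_mul_cancel₀ hTc, sub_self]
      rw [this, norm_zero]; positivity
    · have hs := h p h0
      obtain ⟨s, hsd⟩ : ∃ s, s = ∑ i, l (p i) := ⟨_, rfl⟩
      rw [← hsd] at hs h0 ⊢
      have hc : Complex.I * (s : ℂ) ≠ 0 := mul_ne_zero Complex.I_ne_zero (by exact_mod_cast h0)
      rw [integral_exp_mul_complex hc, sub_zero, norm_mul, norm_div, norm_div, norm_one, norm_mul, Complex.norm_I, one_mul,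
        Complex.norm_real, Complex.norm_real, Real.norm_of_nonneg hT.le, Real.norm_eq_abs]
      have hn : ∀ t : ℝ, ‖Complex.exp (Complex.I * s * t)‖ = 1 := by
        intro t
        rw [mul_assoc, ← Complex.ofReal_mul, mul_comm, Complex.norm_exp_ofReal_mul_I]
      have h2 : ‖Complex.exp (Complex.I * s * (2 * T : ℝ)) - Complex.exp (Complex.I * s * T)‖ ≤ 2 := by
        refine (norm_sub_le _ _).trans ?_
        rw [hn, hn]; norm_num
      have h3 : 0 < |s| := abs_pos.mpr h0
      calc 1 / T * (‖Complex.exp (Complex.I * s * (2 * T : ℝ)) - Complex.exp (Complex.I * s * T)‖ / |s|)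
          ≤ 1 / T * (2 / δ) := by gcongr
        _ = 2 / (T * δ) := by field_simp
  simp_rw [e1]
  rw [intervalIntegral.integral_finset_sum]
  · simp_rw [intervalIntegral.integral_const_mul]
    rw [Finset.mul_sum, ← Finset.sum_sub_distrib, Fintype.sum_pow, Finset.sum_mul]
    refine norm_sum_le_of_le _ fun p _ => ?_
    rw [mul_left_comm, ← mul_sub, norm_mul, norm_prod]
    exact mul_le_mul_of_nonneg_left (e2 p) (Finset.prod_nonneg fun i _ => norm_nonneg _)
  · intro p _
    apply Continuous.intervalIntegrable
    fun_prop

lemma moment_model {J Ω : Type*} [Fintype J] [MeasurableSpace Ω] (P : Measure Ω) [IsProbabilityMeasure P]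
    (w : J → ℂ) (l : J → ℝ) (K : ℕ) (u : J → Ω → ℂ) (hu : ∀ j, Measurable (u j)) (hu1 : ∀ j ω, ‖u j ω‖ ≤ 1)
    (h : ∀ p : Fin K → J, ∫ ω, ∏ i, u (p i) ω ∂P = if ∑ i, l (p i) = 0 then 1 else 0) :
    ∫ ω, (∑ j, w j * u j ω) ^ K ∂P = ∑ p : Fin K → J, (∏ i, w (p i)) * (if ∑ i, l (p i) = 0 then 1 else 0) := by
  simp_rw [Fintype.sum_pow, Finset.prod_mul_distrib]
  rw [integral_finsetSum]
  · refine sum_congr rfl fun p _ => ?_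
    rw [integral_const_mul, h p]
  · intro p _
    refine Integrable.const_mul ?_ _
    refine Integrable.of_bound (Measurable.aestronglyMeasurable (Finset.measurable_fun_prod _ fun i _ => hu (p i))) 1
      (Eventually.of_forall fun ω => ?_)
    rw [norm_prod]
    exact Finset.prod_le_one (fun i _ => norm_nonneg _) (fun i _ => hu1 _ _)

lemma norm_prod_diff {ι : Type*} (s : Finset ι) (a b : ι → ℂ) (ha : ∀ i, ‖a i‖ ≤ 1) (hb : ∀ i, ‖b i‖ ≤ 1) :
    ‖∏ i ∈ s, a i - ∏ i ∈ s, b i‖ ≤ ∑ i ∈ s, ‖a i - b i‖ := by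
  classical
  induction s using Finset.induction_on with
  | empty => simp
  | insert i s hi ih =>
    rw [Finset.prod_insert hi, Finset.prod_insert hi, Finset.sum_insert hi]
    have e : a i * ∏ i ∈ s, a i - b i * ∏ i ∈ s, b i =
        (a i - b i) * ∏ i ∈ s, a i + b i * (∏ i ∈ s, a i - ∏ i ∈ s, b i) := by ring
    rw [e]
    refine (norm_add_le _ _).trans ?_
    rw [norm_mul, norm_mul]
    have h1 : ‖∏ i ∈ s, a i‖ ≤ 1 := by
      rw [norm_prod]; exact Finset.prod_le_one (fun i _ => norm_nonneg _) (fun i _ => ha i)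
    have h2 := mul_le_mul_of_nonneg_left h1 (norm_nonneg (a i - b i))
    have h3 := mul_le_mul_of_nonneg_right (hb i) (norm_nonneg (∏ i ∈ s, a i - ∏ i ∈ s, b i))
    linarith

lemma bdd_int {Ω : Type*} [MeasurableSpace Ω] (P : Measure Ω) [IsProbabilityMeasure P] (Y : Ω → ℝ)
    (hY : Measurable Y) (y : ℝ) (hy : ∀ ω, |Y ω| ≤ y) (f : ℝ → ℝ) (hf : Continuous f) : Integrable (fun ω => f (Y ω)) P := by
  obtain ⟨C, hC⟩ := (isCompact_Icc (a := -y) (b := y)).exists_bound_of_continuousOn hf.continuousOn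
  exact Integrable.of_bound (hf.measurable.comp hY).aestronglyMeasurable C
    (Eventually.of_forall fun ω => hC _ (abs_le.mp (hy ω)))

lemma var_le {Ω : Type*} [MeasurableSpace Ω] (P : Measure Ω) [IsProbabilityMeasure P] (Y : Ω → ℝ)
    (hY : Measurable Y) (y : ℝ) (hy : ∀ ω, |Y ω| ≤ y) (v : ℝ) (hv : ∫ ω, Y ω ^ 2 ∂P = v) : 0 ≤ v ∧ v ≤ y ^ 2 := by
  refine ⟨hv ▸ integral_nonneg fun ω => sq_nonneg _, ?_⟩
  have : ∫ ω, Y ω ^ 2 ∂P ≤ ∫ _, y ^ 2 ∂P :=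
    integral_mono (bdd_int P Y hY y hy (fun x => x ^ 2) (by fun_prop)) (integrable_const _) fun ω => sq_le_sq' (abs_le.mp (hy ω)).1 (abs_le.mp (hy ω)).2
  simpa [hv] using this

lemma cf_one {Ω : Type*} [MeasurableSpace Ω] (P : Measure Ω) [IsProbabilityMeasure P] (Y : Ω → ℝ)
    (hY : Measurable Y) (y : ℝ) (hy : ∀ ω, |Y ω| ≤ y) (v : ℝ) (h0 : ∫ ω, Y ω ∂P = 0) (hv : ∫ ω, Y ω ^ 2 ∂P = v) (ξ : ℝ) (hξ : |ξ| * y ≤ 1) :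
    ‖∫ ω, Complex.exp (Complex.I * (ξ * Y ω : ℝ)) ∂P - ((exp (-(ξ ^ 2 * v) / 2) : ℝ) : ℂ)‖ ≤
      v * (|ξ| ^ 3 * y + ξ ^ 4 * y ^ 2) := by
  obtain ⟨hv0, hvy⟩ := var_le P Y hY y hy v hv
  have hintE : Integrable (fun ω => Complex.exp (Complex.I * (ξ * Y ω : ℝ))) P := by
    refine Integrable.of_bound (Measurable.aestronglyMeasurable (by fun_prop)) 1 (Eventually.of_forall fun ω => ?_)
    rw [mul_comm, Complex.norm_exp_ofReal_mul_I]
  have hi1 : Integrable (fun ω => ((Y ω : ℝ) : ℂ)) P := (bdd_int P Y hY y hy _ continuous_id).ofReal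
  have hi2 : Integrable (fun ω => ((Y ω ^ 2 : ℝ) : ℂ)) P := (bdd_int P Y hY y hy (fun x => x ^ 2) (by fun_prop)).ofReal
  have hintT : Integrable (fun ω => 1 + Complex.I * ξ * Y ω + (-(ξ ^ 2 / 2) : ℂ) * ((Y ω ^ 2 : ℝ) : ℂ)) P :=
    ((integrable_const 1).add (hi1.const_mul _)).add (hi2.const_mul _)
  have e1 : ∫ ω, (1 + Complex.I * ξ * Y ω + (-(ξ ^ 2 / 2) : ℂ) * ((Y ω ^ 2 : ℝ) : ℂ)) ∂P = ((1 - ξ ^ 2 * v / 2 : ℝ) : ℂ) := by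
    have := integral_add ((integrable_const (μ := P) (1 : ℂ)).add (hi1.const_mul (Complex.I * ξ))) (hi2.const_mul (-(ξ ^ 2 / 2) : ℂ))
    simp only [Pi.add_apply] at this
    rw [this, integral_add (integrable_const 1) (hi1.const_mul _), integral_const_mul, integral_const_mul,
      integral_complex_ofReal, integral_complex_ofReal, h0, hv]
    simp; ring
  have h1 : ‖∫ ω, Complex.exp (Complex.I * (ξ * Y ω : ℝ)) ∂P - ((1 - ξ ^ 2 * v / 2 : ℝ) : ℂ)‖ ≤ |ξ| ^ 3 * y * v := by
    rw [← e1, ← integral_sub hintE hintT, ← hv, ← integral_const_mul]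
    refine norm_integral_le_of_norm_le ((bdd_int P Y hY y hy (fun x => x ^ 2) (by fun_prop)).const_mul _) (Eventually.of_forall fun ω => ?_)
    have h := tay 3 (ξ * Y ω)
    have e : tayP 3 (ξ * Y ω) = 1 + Complex.I * ξ * Y ω + (-(ξ ^ 2 / 2) : ℂ) * ((Y ω ^ 2 : ℝ) : ℂ) := by
      simp only [tayP, Finset.sum_range_succ, Finset.range_zero, Finset.sum_empty, Nat.factorial]
      push_cast
      linear_combination (ξ ^ 2 * Y ω ^ 2 / 2 : ℂ) * Complex.I_sq
    rw [e] at h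
    refine h.trans ?_
    have h3 : |Y ω| ^ 3 ≤ y * Y ω ^ 2 := by
      rw [← sq_abs (Y ω)]
      nlinarith [mul_le_mul_of_nonneg_right (hy ω) (sq_nonneg |Y ω|)]
    rw [abs_mul, mul_pow]
    have h4 := mul_le_mul_of_nonneg_left h3 (show 0 ≤ |ξ| ^ 3 by positivity)
    have h5 : 0 ≤ |ξ| ^ 3 * |Y ω| ^ 3 := by positivity
    have : ((Nat.factorial 3 : ℕ) : ℝ) = 6 := by norm_num [Nat.factorial]
    rw [this]
    linarith
  have hy0 : 0 ≤ y := by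
    obtain ⟨ω⟩ := P.nonempty_of_neZero
    exact (abs_nonneg _).trans (hy ω)
  have ha : ξ ^ 2 * v ≤ 1 := by
    calc ξ ^ 2 * v ≤ ξ ^ 2 * y ^ 2 := by gcongr
      _ = (|ξ| * y) ^ 2 := by rw [mul_pow, sq_abs]
      _ ≤ 1 := pow_le_one₀ (by positivity) hξ
  have ha0 : 0 ≤ ξ ^ 2 * v := by positivity
  have h2 : |exp (-(ξ ^ 2 * v) / 2) - 1 - (-(ξ ^ 2 * v) / 2)| ≤ (-(ξ ^ 2 * v) / 2) ^ 2 :=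
    Real.abs_exp_sub_one_sub_id_le (by rw [abs_le]; constructor <;> linarith)
  have h3 : ‖((1 - ξ ^ 2 * v / 2 : ℝ) : ℂ) - ((exp (-(ξ ^ 2 * v) / 2) : ℝ) : ℂ)‖ ≤ v * (ξ ^ 4 * y ^ 2) := by
    rw [← Complex.ofReal_sub, Complex.norm_real, Real.norm_eq_abs, abs_sub_comm]
    have e : exp (-(ξ ^ 2 * v) / 2) - (1 - ξ ^ 2 * v / 2) = exp (-(ξ ^ 2 * v) / 2) - 1 - (-(ξ ^ 2 * v) / 2) := by ring
    rw [e]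
    refine h2.trans ?_
    have : v * v ≤ v * y ^ 2 := mul_le_mul_of_nonneg_left hvy hv0
    have h6 := mul_le_mul_of_nonneg_left this (show 0 ≤ ξ ^ 4 by positivity)
    nlinarith [show 0 ≤ ξ ^ 4 * (v * v) by positivity]
  have h7 := norm_sub_le_norm_sub_add_norm_sub (∫ ω, Complex.exp (Complex.I * (ξ * Y ω : ℝ)) ∂P) ((1 - ξ ^ 2 * v / 2 : ℝ) : ℂ)
    ((exp (-(ξ ^ 2 * v) / 2) : ℝ) : ℂ)
  linarith

lemma mgf_one {Ω : Type*} [MeasurableSpace Ω] (P : Measure Ω) [IsProbabilityMeasure P] (Y : Ω → ℝ)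
    (hY : Measurable Y) (y : ℝ) (hy : ∀ ω, |Y ω| ≤ y) (v : ℝ) (h0 : ∫ ω, Y ω ∂P = 0) (hv : ∫ ω, Y ω ^ 2 ∂P = v) (A : ℝ) (hA : |A| * y ≤ 1) :
    ∫ ω, exp (A * Y ω) ∂P ≤ exp (A ^ 2 * v) := by
  have hi1 : Integrable Y P := bdd_int P Y hY y hy _ continuous_id
  have hi2 := bdd_int P Y hY y hy (fun x => x ^ 2) (by fun_prop)
  have h1 : ∫ ω, exp (A * Y ω) ∂P ≤ ∫ ω, (1 + A * Y ω + A ^ 2 * Y ω ^ 2) ∂P := by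
    refine integral_mono (bdd_int P Y hY y hy (fun x => exp (A * x)) (by fun_prop))
      (((integrable_const 1).add (hi1.const_mul _)).add (hi2.const_mul _)) fun ω => ?_
    have h2 : |A * Y ω| ≤ 1 := by
      rw [abs_mul]; exact (mul_le_mul_of_nonneg_left (hy ω) (abs_nonneg _)).trans hA
    have := (abs_le.mp (Real.abs_exp_sub_one_sub_id_le h2)).2
    simp only
    nlinarith
  have e1 : ∫ ω, (1 + A * Y ω + A ^ 2 * Y ω ^ 2) ∂P = 1 + A ^ 2 * v := by
    have := integral_add ((integrable_const (μ := P) (1 : ℝ)).add (hi1.const_mul A)) (hi2.const_mul (A ^ 2))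
    simp only [Pi.add_apply] at this
    rw [this, integral_add (integrable_const 1) (hi1.const_mul _), integral_const_mul, integral_const_mul]
    simp [h0, hv]
  rw [e1] at h1
  linarith [Real.add_one_le_exp (A ^ 2 * v)]

lemma model_cf {I Ω : Type*} [Fintype I] [MeasurableSpace Ω] (P : Measure Ω) [IsProbabilityMeasure P] (Y : I → Ω → ℝ)
    (hY : ∀ r, Measurable (Y r)) (y : ℝ) (hy : ∀ r ω, |Y r ω| ≤ y) (v : I → ℝ)
    (h0 : ∀ r, ∫ ω, Y r ω ∂P = 0) (hv : ∀ r, ∫ ω, Y r ω ^ 2 ∂P = v r) (ξ : ℝ) (hξ : |ξ| * y ≤ 1) :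
    ‖∫ ω, Complex.exp (Complex.I * (ξ * ∑ r, Y r (ω r) : ℝ)) ∂(Measure.pi fun _ : I => P) -
      ((exp (-(ξ ^ 2 * ∑ r, v r) / 2) : ℝ) : ℂ)‖ ≤ (∑ r, v r) * (|ξ| ^ 3 * y + ξ ^ 4 * y ^ 2) := by
  have e1 : ∀ ω : I → Ω, Complex.exp (Complex.I * (ξ * ∑ r, Y r (ω r) : ℝ)) = ∏ r, Complex.exp (Complex.I * (ξ * Y r (ω r) : ℝ)) := by
    intro ω
    rw [← Complex.exp_sum]; congr 1
    push_cast
    rw [Finset.mul_sum, Finset.mul_sum]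
  have e2 : ((exp (-(ξ ^ 2 * ∑ r, v r) / 2) : ℝ) : ℂ) = ∏ r, ((exp (-(ξ ^ 2 * v r) / 2) : ℝ) : ℂ) := by
    rw [← Complex.ofReal_prod, ← Real.exp_sum]; congr 2
    rw [Finset.mul_sum, ← Finset.sum_neg_distrib, Finset.sum_div]
  simp_rw [e1]
  rw [integral_fintype_prod_eq_prod (f := fun r x => Complex.exp (Complex.I * (ξ * Y r x : ℝ))), e2, Finset.sum_mul]
  refine (norm_prod_diff _ _ _ ?_ ?_).trans (sum_le_sum fun r _ => cf_one P (Y r) (hY r) y (hy r) (v r) (h0 r) (hv r) ξ hξ)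
  · intro r
    refine (norm_integral_le_of_norm_le_const (C := 1) (Eventually.of_forall fun ω => ?_)).trans (by simp)
    rw [mul_comm, Complex.norm_exp_ofReal_mul_I]
  · intro r
    rw [Complex.norm_real, Real.norm_eq_abs, Real.abs_exp, Real.exp_le_one_iff]
    have := (var_le P (Y r) (hY r) y (hy r) (v r) (hv r)).1
    have : 0 ≤ ξ ^ 2 * v r := by positivity
    linarith

lemma model_mgf {I Ω : Type*} [Fintype I] [MeasurableSpace Ω] (P : Measure Ω) [IsProbabilityMeasure P] (Y : I → Ω → ℝ)
    (hY : ∀ r, Measurable (Y r)) (y : ℝ) (hy : ∀ r ω, |Y r ω| ≤ y) (v : I → ℝ)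
    (h0 : ∀ r, ∫ ω, Y r ω ∂P = 0) (hv : ∀ r, ∫ ω, Y r ω ^ 2 ∂P = v r) (A : ℝ) (hA : |A| * y ≤ 1) :
    ∫ ω, exp (A * ∑ r, Y r (ω r)) ∂(Measure.pi fun _ : I => P) ≤ exp (A ^ 2 * ∑ r, v r) := by
  have e1 : ∀ ω : I → Ω, exp (A * ∑ r, Y r (ω r)) = ∏ r, exp (A * Y r (ω r)) := by
    intro ω
    rw [← Real.exp_sum, Finset.mul_sum]
  simp_rw [e1]
  rw [integral_fintype_prod_eq_prod (f := fun r x => exp (A * Y r x)), Finset.mul_sum, Real.exp_sum]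
  exact Finset.prod_le_prod (fun r _ => integral_nonneg fun ω => (Real.exp_pos _).le)
    fun r _ => mgf_one P (Y r) (hY r) y (hy r) (v r) (h0 r) (hv r) A hA

lemma model_bdd {I Ω : Type*} [Fintype I] (Y : I → Ω → ℝ) (y : ℝ) (hy : ∀ r ω, |Y r ω| ≤ y) (ω : I → Ω) : |∑ r, Y r (ω r)| ≤ Fintype.card I * y := by
  refine (abs_sum_le_sum_abs _ _).trans ((Finset.sum_le_card_nsmul _ _ y fun r _ => hy r _).trans_eq ?_)
  simp

lemma model_mom {I Ω : Type*} [Fintype I] [MeasurableSpace Ω] (P : Measure Ω) [IsProbabilityMeasure P] (Y : I → Ω → ℝ)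
    (hY : ∀ r, Measurable (Y r)) (y : ℝ) (hy : ∀ r ω, |Y r ω| ≤ y) (v : I → ℝ)
    (h0 : ∀ r, ∫ ω, Y r ω ∂P = 0) (hv : ∀ r, ∫ ω, Y r ω ^ 2 ∂P = v r) (A : ℝ) (hA0 : 0 < A) (hA : A * y ≤ 1) (K : ℕ) (hK : Even K) (ξ : ℝ) :
    |ξ| ^ K / K.factorial * ∫ ω, (∑ r, Y r (ω r)) ^ K ∂(Measure.pi fun _ : I => P) ≤
      (|ξ| / A) ^ K * (2 * exp (A ^ 2 * ∑ r, v r)) := by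
  have hm : Measurable fun ω : I → Ω => ∑ r, Y r (ω r) :=
    Finset.measurable_fun_sum _ fun r _ => (hY r).comp (measurable_pi_apply r)
  have hb := model_bdd Y y hy
  have hi := bdd_int (Measure.pi fun _ : I => P) _ hm _ hb
  have h1 := model_mgf P Y hY y hy v h0 hv A (by rwa [abs_of_pos hA0])
  have h2 := model_mgf P Y hY y hy v h0 hv (-A) (by rwa [abs_neg, abs_of_pos hA0])
  have h3 : ∫ ω, A ^ K / K.factorial * (∑ r, Y r (ω r)) ^ K ∂(Measure.pi fun _ : I => P) ≤
      ∫ ω, (exp (A * ∑ r, Y r (ω r)) + exp (-A * ∑ r, Y r (ω r))) ∂(Measure.pi fun _ : I => P) := by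
    refine integral_mono (hi (fun x => A ^ K / K.factorial * x ^ K) (by fun_prop))
      (hi (fun x => exp (A * x) + exp (-A * x)) (by fun_prop)) fun ω => ?_
    simp only
    generalize ∑ r, Y r (ω r) = s
    have := Real.pow_div_factorial_le_exp (A * |s|) (by positivity) K
    rw [mul_pow, hK.pow_abs] at this
    have h4 : exp (A * |s|) ≤ exp (A * s) + exp (-A * s) := by
      rcases abs_cases s with h | h <;> rw [h.1]
      · linarith [Real.exp_pos (-A * s)]
      · rw [mul_neg, ← neg_mul]; linarith [Real.exp_pos (A * s)]
    calc _ = A ^ K * s ^ K / K.factorial := by ring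
      _ ≤ _ := this.trans h4
  rw [integral_const_mul, integral_add (hi (fun x => exp (A * x)) (by fun_prop)) (hi (fun x => exp (-A * x)) (by fun_prop))] at h3
  rw [neg_sq] at h2
  have h5 := mul_le_mul_of_nonneg_left (h3.trans (add_le_add h1 h2)) (show 0 ≤ (|ξ| / A) ^ K by positivity)
  calc _ = (|ξ| / A) ^ K * (A ^ K / K.factorial * ∫ ω, (∑ r, Y r (ω r)) ^ K ∂(Measure.pi fun _ : I => P)) := by
        rw [div_pow]; field_simp
    _ ≤ _ := h5.trans_eq (by ring)

/-- Haar probability measure on the unit circle -/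
noncomputable def hc : Measure UnitAddCircle := AddCircle.haarAddCircle
instance hc_prob : IsProbabilityMeasure hc := inferInstanceAs (IsProbabilityMeasure (AddCircle.haarAddCircle (T := 1)))

lemma int_fourier (n : ℤ) : ∫ x, fourier n x ∂hc = if n = 0 then 1 else 0 := by
  have h := congrFun (fourierCoeff_fourier (T := 1) n) 0
  unfold fourierCoeff at h
  simp only [neg_zero, fourier_zero, one_smul] at h
  unfold hc
  rw [h]
  by_cases hn : n = 0
  · subst hn; simp
  · rw [if_neg hn, Pi.single_eq_of_ne (Ne.symm hn)]

lemma fourier_int (n : ℤ) : Integrable (fun x => fourier n x) hc :=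
  Integrable.of_bound (fourier (T := 1) n).continuous.measurable.aestronglyMeasurable 1
    (Eventually.of_forall fun x => by rw [fourier_apply, Circle.norm_coe])

lemma int_re (n : ℤ) : ∫ x, (fourier n x : ℂ).re ∂hc = if n = 0 then 1 else 0 := by
  have h := integral_re (fourier_int n)
  simp only [RCLike.re_to_complex] at h
  rw [h, int_fourier]
  split_ifs <;> simp

lemma re_meas (n : ℤ) : Measurable fun x : UnitAddCircle => (fourier n x : ℂ).re :=
  (Complex.continuous_re.comp (fourier (T := 1) n).continuous).measurable

lemma re_abs (n : ℤ) (x : UnitAddCircle) : |(fourier n x : ℂ).re| ≤ 1 :=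
  (Complex.abs_re_le_norm _).trans (by rw [fourier_apply, Circle.norm_coe])

lemma re_int (n : ℤ) : Integrable (fun x => (fourier n x : ℂ).re) hc :=
  Integrable.of_bound (re_meas n).aestronglyMeasurable 1 (Eventually.of_forall fun x => re_abs n x)

lemma int_re_re (k l : ℕ) (hk : 0 < k) (hl : 0 < l) :
    ∫ x, (fourier (k : ℤ) x : ℂ).re * (fourier (l : ℤ) x : ℂ).re ∂hc = if k = l then 1 / 2 else 0 := by
  have e : ∀ x : UnitAddCircle, (fourier (k : ℤ) x : ℂ).re * (fourier (l : ℤ) x : ℂ).re =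
      1 / 2 * ((fourier ((k : ℤ) + l) x : ℂ).re + (fourier ((k : ℤ) + -l) x : ℂ).re) := by
    intro x
    rw [fourier_add, fourier_add, fourier_neg, Complex.mul_re, Complex.mul_re, Complex.conj_re, Complex.conj_im]
    ring
  simp_rw [e]
  rw [integral_const_mul, integral_add (re_int _) (re_int _), int_re, int_re, if_neg (by omega)]
  by_cases h : k = l
  · rw [if_pos h, if_pos (by omega)]; norm_num
  · rw [if_neg h, if_neg (by omega)]; norm_num

/-- index set -/
abbrev Ix (N : ℕ) := {n : ℕ // n ∈ Icc 3 N}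

lemma Ix_gt {N : ℕ} (n : Ix N) : 2 < n.1 := (Finset.mem_Icc.mp n.2).1
lemma Ix_le {N : ℕ} (n : Ix N) : n.1 ≤ N := (Finset.mem_Icc.mp n.2).2

noncomputable def rh {N : ℕ} (n : Ix N) : Ix N :=
  ⟨rp n.1, Finset.mem_Icc.mpr ⟨(rp_mem (Ix_gt n)).1, (rp_le (Ix_gt n) (sqRel_refl _)).trans (Ix_le n)⟩⟩

noncomputable def uu {N : ℕ} (j : Ix N × ℤˣ) (ω : Ix N → UnitAddCircle) : ℂ :=
  fourier ((j.2 : ℤ) * kk j.1.1) (ω (rh j.1))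

noncomputable def ll {N : ℕ} (j : Ix N × ℤˣ) : ℝ := ((j.2 : ℤ) : ℝ) * (2 * lu j.1.1)

noncomputable def modelP (N : ℕ) : Measure (Ix N → UnitAddCircle) := Measure.pi fun _ => hc
instance modelP_prob (N : ℕ) : IsProbabilityMeasure (modelP N) :=
  inferInstanceAs (IsProbabilityMeasure (Measure.pi fun _ : Ix N => hc))

lemma fourier_prod {ι : Type*} (s : Finset ι) (a : ι → ℤ) (x : UnitAddCircle) :
    ∏ i ∈ s, (fourier (a i) x : ℂ) = fourier (∑ i ∈ s, a i) x := by
  classical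
  induction s using Finset.induction_on with
  | empty => simp
  | insert i s hi ih => rw [Finset.prod_insert hi, Finset.sum_insert hi, fourier_add, ih]

noncomputable def coefA {N K : ℕ} (p : Fin K → Ix N × ℤˣ) (m : ℕ) : ℤ :=
  ∑ i, if rp (p i).1.1 = m then ((p i).2 : ℤ) * kk (p i).1.1 else 0

lemma prod_uu {N K : ℕ} (p : Fin K → Ix N × ℤˣ) (ω : Ix N → UnitAddCircle) :
    ∏ i, uu (p i) ω = ∏ r : Ix N, (fourier (coefA p r.1) (ω r) : ℂ) := by
  unfold coefA
  simp_rw [← fourier_prod]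
  rw [Finset.prod_comm]
  refine Finset.prod_congr rfl fun i _ => ?_
  rw [Finset.prod_eq_single (rh (p i).1)]
  · rw [if_pos (by rfl)]; rfl
  · intro r _ hr
    rw [if_neg, fourier_zero]
    intro h; apply hr; exact Subtype.ext h.symm
  · intro h; exact absurd (Finset.mem_univ _) h

lemma sum_ll {N K : ℕ} (p : Fin K → Ix N × ℤˣ) :
    ∑ i, ll (p i) = 2 * ∑ m ∈ (Icc 3 N).filter (fun r => rp r = r), (coefA p m : ℝ) * lu m := by
  unfold coefA ll
  push_cast
  simp_rw [Finset.sum_mul]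
  rw [Finset.sum_comm, Finset.mul_sum]
  refine sum_congr rfl fun i _ => ?_
  have hgt := Ix_gt (p i).1
  rw [Finset.sum_eq_single (rp (p i).1.1)]
  · rw [if_pos rfl, (kk_spec hgt).2]; ring
  · intro b _ hb
    rw [if_neg (Ne.symm hb), zero_mul]
  · intro h
    exact (h (Finset.mem_filter.mpr ⟨(rh (p i).1).2, rp_rp hgt⟩)).elim

lemma orth {N K : ℕ} (p : Fin K → Ix N × ℤˣ) :
    ∫ ω, ∏ i, uu (p i) ω ∂(modelP N) = if ∑ i, ll (p i) = 0 then 1 else 0 := by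
  simp_rw [prod_uu]
  unfold modelP
  rw [integral_fintype_prod_eq_prod (f := fun (r : Ix N) (x : UnitAddCircle) => (fourier (coefA p r.1) x : ℂ))]
  simp_rw [int_fourier]
  split_ifs with h
  · rw [sum_ll] at h
    have h1 := lu_indep ((Icc 3 N).filter (fun r => rp r = r))
      (fun n hn => (Finset.mem_Icc.mp (Finset.mem_filter.mp hn).1).1)
      (fun n hn m hm hs => by
        rw [mem_filter, mem_Icc] at hn hm
        rw [← hn.2, ← hm.2]; exact rp_eq hn.1.1 hm.1.1 hs) (coefA p) (by linarith)
    refine Finset.prod_eq_one fun r _ => ?_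
    rw [if_pos]
    by_cases hr : rp r.1 = r.1
    · exact h1 _ (Finset.mem_filter.mpr ⟨r.2, hr⟩)
    · unfold coefA
      refine Finset.sum_eq_zero fun i _ => ?_
      rw [if_neg]
      intro h2; apply hr; rw [← h2, rp_rp (Ix_gt _)]
  · by_contra h2
    apply h
    rw [sum_ll, Finset.sum_eq_zero, mul_zero]
    intro m hm
    have hm' := (Finset.mem_filter.mp hm).1
    have h3 := Finset.prod_ne_zero_iff.mp h2 ⟨m, hm'⟩ (Finset.mem_univ _)
    have h4 : coefA p m = 0 := by
      by_contra h5; exact h3 (if_neg h5)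
    rw [h4]; simp

lemma ll_lower {N K : ℕ} (hN : 1 ≤ N) (p : Fin K → Ix N × ℤˣ) (h : ∑ i, ll (p i) ≠ 0) :
    1 / (2 * (N : ℝ) ^ K) ^ (2 ^ K) ≤ |∑ i, ll (p i)| := by
  have e : ∑ i, ll (p i) = 2 * ∑ i, (((p i).2 : ℤ) : ℝ) * lu (p i).1.1 := by
    rw [Finset.mul_sum]; exact sum_congr rfl fun i _ => by unfold ll; ring
  rw [e] at h ⊢
  have h0 : ∑ i, (((p i).2 : ℤ) : ℝ) * lu (p i).1.1 ≠ 0 := fun h1 => h (by rw [h1, mul_zero])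
  have h1 := lu_lower K N (fun i => (p i).1.1) (fun i => Ix_gt _) (fun i => Ix_le _) hN (fun i => (p i).2) h0
  generalize ∑ i, (((p i).2 : ℤ) : ℝ) * lu (p i).1.1 = s at *
  have hN' : (1 : ℝ) ≤ N := by exact_mod_cast hN
  have hM : 1 ≤ (2 * (N : ℝ) ^ K) ^ (2 ^ K) := one_le_pow₀ (by linarith [one_le_pow₀ hN' (n := K)])
  generalize (2 * (N : ℝ) ^ K) ^ (2 ^ K) = M at *
  have hM0 : 0 < M := by linarith
  rw [abs_mul, abs_two, div_le_iff₀ hM0]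
  rcases le_or_gt |s| 1 with hs | hs
  · have := Real.abs_exp_sub_one_le hs
    exact h1.trans (mul_le_mul_of_nonneg_right this hM0.le)
  · nlinarith

noncomputable def SS (N : ℕ) (c : ℕ → ℝ) (τ : ℝ) : ℝ := ∑ n ∈ Icc 3 N, c n * Real.cos (τ * (2 * lu n))

noncomputable def YY {N : ℕ} (c : ℕ → ℝ) (r : Ix N) (x : UnitAddCircle) : ℝ :=
  ∑ n : Ix N, if rh n = r then c n.1 * (fourier (kk n.1 : ℤ) x : ℂ).re else 0

lemma YY_meas {N : ℕ} (c : ℕ → ℝ) (r : Ix N) : Measurable (YY c r) := by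
  unfold YY
  refine Finset.measurable_fun_sum _ fun n _ => ?_
  split_ifs
  · exact (re_meas _).const_mul _
  · exact measurable_const

lemma YY_int {N : ℕ} (c : ℕ → ℝ) (r : Ix N) : ∫ x, YY c r x ∂hc = 0 := by
  unfold YY
  rw [integral_finsetSum]
  · refine Finset.sum_eq_zero fun n _ => ?_
    split_ifs
    · rw [integral_const_mul, int_re, if_neg, mul_zero]
      exact_mod_cast (kk_spec (Ix_gt n)).1.ne'
    · simp
  · intro n _
    split_ifs
    · exact (re_int _).const_mul _
    · exact integrable_const _

lemma YY_sq {N : ℕ} (c : ℕ → ℝ) (r : Ix N) :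
    ∫ x, YY c r x ^ 2 ∂hc = ∑ n : Ix N, if rh n = r then c n.1 ^ 2 / 2 else 0 := by
  have e : ∀ x, YY c r x ^ 2 = ∑ n : Ix N, ∑ m : Ix N, (if rh n = r ∧ rh m = r then c n.1 * c m.1 else 0) *
      ((fourier (kk n.1 : ℤ) x : ℂ).re * (fourier (kk m.1 : ℤ) x : ℂ).re) := by
    intro x
    unfold YY
    rw [sq, Finset.sum_mul_sum]
    refine sum_congr rfl fun n _ => sum_congr rfl fun m _ => ?_
    by_cases h1 : rh n = r <;> by_cases h2 : rh m = r <;> simp [h1, h2]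
    ring
  have hi : ∀ n m : Ix N, Integrable (fun x => (if rh n = r ∧ rh m = r then c n.1 * c m.1 else 0) *
      ((fourier (kk n.1 : ℤ) x : ℂ).re * (fourier (kk m.1 : ℤ) x : ℂ).re)) hc := by
    intro n m
    refine Integrable.const_mul ?_ _
    refine Integrable.of_bound ((re_meas _).mul (re_meas _)).aestronglyMeasurable 1 (Eventually.of_forall fun x => ?_)
    rw [Real.norm_eq_abs, abs_mul]
    exact mul_le_one₀ (re_abs _ _) (abs_nonneg _) (re_abs _ _)
  simp_rw [e]
  rw [integral_finsetSum _ fun n _ => integrable_finsetSum _ fun m _ => hi n m]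
  refine sum_congr rfl fun n _ => ?_
  rw [integral_finsetSum _ fun m _ => hi n m, Finset.sum_eq_single n]
  · rw [integral_const_mul, int_re_re _ _ (kk_spec (Ix_gt n)).1 (kk_spec (Ix_gt n)).1, if_pos rfl]
    by_cases h : rh n = r <;> simp [h]
    ring
  · intro m _ hm
    rw [integral_const_mul, int_re_re _ _ (kk_spec (Ix_gt n)).1 (kk_spec (Ix_gt m)).1]
    by_cases h : rh n = r ∧ rh m = r
    · rw [if_neg (fun hk => hm (Subtype.ext (kk_inj (Ix_gt n) (Ix_gt m) (congrArg Subtype.val (h.1.trans h.2.symm)) hk).symm)), mul_zero]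
    · rw [if_neg h, zero_mul]
  · intro h; exact absurd (Finset.mem_univ _) h

lemma YY_abs {N : ℕ} (c : ℕ → ℝ) (b : ℝ) (hb : ∀ n ∈ Icc 3 N, |c n| ≤ b) (r : Ix N) (x : UnitAddCircle) :
    |YY c r x| ≤ (Nat.log 2 N + 1 : ℕ) * b := by
  classical
  have hb0 : 0 ≤ b := (abs_nonneg _).trans (hb r.1 r.2)
  have h1 : |YY c r x| ≤ ∑ n : Ix N, if sqRel r.1 n.1 then b else 0 := by
    unfold YY
    refine (abs_sum_le_sum_abs _ _).trans (sum_le_sum fun n _ => ?_)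
    by_cases h : rh n = r
    · have : sqRel r.1 n.1 := by
        rw [← h]; exact sqRel_symm (rp_mem (Ix_gt n)).2
      rw [if_pos h, if_pos this, abs_mul]
      exact (mul_le_mul (hb _ n.2) (re_abs _ _) (abs_nonneg _) hb0).trans_eq (mul_one _)
    · rw [if_neg h, abs_zero]; split_ifs <;> linarith
  refine h1.trans ?_
  rw [Finset.sum_coe_sort (Icc 3 N) (fun n => if sqRel r.1 n then b else 0), ← Finset.sum_filter, Finset.sum_const, nsmul_eq_mul]
  refine mul_le_mul_of_nonneg_right ?_ hb0
  have := class_card N r.1 (Ix_gt r)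
  exact_mod_cast (le_trans (le_of_eq (by congr)) this)

lemma sum_YY {N : ℕ} (c : ℕ → ℝ) (ω : Ix N → UnitAddCircle) :
    ∑ r, YY c r (ω r) = ∑ n : Ix N, c n.1 * (fourier (kk n.1 : ℤ) (ω (rh n)) : ℂ).re := by
  unfold YY
  rw [Finset.sum_comm]
  exact sum_congr rfl fun n _ => by simp

lemma sum_vv {N : ℕ} (c : ℕ → ℝ) :
    ∑ r : Ix N, ∑ n : Ix N, (if rh n = r then c n.1 ^ 2 / 2 else 0) = ∑ n ∈ Icc 3 N, c n ^ 2 / 2 := by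
  rw [Finset.sum_comm, ← Finset.sum_coe_sort (Icc 3 N)]
  exact sum_congr rfl fun n _ => by simp

/-- weights -/
noncomputable def ww {N : ℕ} (c : ℕ → ℝ) (j : Ix N × ℤˣ) : ℂ := ((c j.1.1 / 2 : ℝ) : ℂ)

lemma model_eq {N : ℕ} (c : ℕ → ℝ) (ω : Ix N → UnitAddCircle) :
    ((∑ r, YY c r (ω r) : ℝ) : ℂ) = ∑ j, ww c j * uu j ω := by
  rw [sum_YY, Fintype.sum_prod_type]
  push_cast
  refine sum_congr rfl fun n _ => ?_
  rw [UnitsInt.univ, Finset.sum_pair (by decide)]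
  unfold ww uu
  simp only [Units.val_one, one_mul, Units.val_neg, neg_mul, fourier_neg]
  rw [← mul_add, Complex.add_conj]
  push_cast; ring

lemma time_eq {N : ℕ} (c : ℕ → ℝ) (τ : ℝ) :
    ((SS N c τ : ℝ) : ℂ) = ∑ j : Ix N × ℤˣ, ww c j * Complex.exp (Complex.I * (ll j * τ : ℝ)) := by
  rw [Fintype.sum_prod_type]
  unfold SS
  rw [← Finset.sum_coe_sort (Icc 3 N)]
  push_cast
  refine sum_congr rfl fun n _ => ?_
  rw [UnitsInt.univ, Finset.sum_pair (by decide)]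
  unfold ww ll
  simp only [Units.val_one, Units.val_neg]
  push_cast
  rw [← mul_add, Complex.cos]
  have e1 : Complex.I * (1 * (2 * (lu n.1 : ℂ)) * τ) = τ * (2 * lu n.1) * Complex.I := by ring
  have e2 : Complex.I * (-1 * (2 * (lu n.1 : ℂ)) * τ) = -(τ * (2 * lu n.1)) * Complex.I := by ring
  rw [e1, e2]; ring

lemma sum_ww {N : ℕ} (c : ℕ → ℝ) (b : ℝ) (hb0 : 0 ≤ b) (hb : ∀ n ∈ Icc 3 N, |c n| ≤ b) : ∑ j : Ix N × ℤˣ, ‖ww c j‖ ≤ N * b := by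
  rw [Fintype.sum_prod_type]
  have : ∀ n : Ix N, ∑ s : ℤˣ, ‖ww c (n, s)‖ ≤ b := by
    intro n
    have h := hb n.1 n.2
    rw [UnitsInt.univ, Finset.sum_pair (by decide)]
    unfold ww
    rw [Complex.norm_real, Real.norm_eq_abs, abs_div, abs_two]
    linarith
  refine (sum_le_sum fun n _ => this n).trans ?_
  rw [Finset.sum_const, nsmul_eq_mul]
  refine mul_le_mul_of_nonneg_right ?_ hb0
  simp

/-- uniform probability measure on `[T,2T]` -/
noncomputable def muT (T : ℝ) : Measure ℝ := (ENNReal.ofReal T)⁻¹ • volume.restrict (Set.Icc T (2 * T))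

lemma muT_prob {T : ℝ} (hT : 0 < T) : IsProbabilityMeasure (muT T) := by
  constructor
  unfold muT
  rw [Measure.smul_apply, Measure.restrict_apply_univ, Real.volume_Icc, smul_eq_mul]
  have : 2 * T - T = T := by ring
  rw [this]
  exact ENNReal.inv_mul_cancel (by simpa using hT) ENNReal.ofReal_ne_top

lemma muT_integral {E : Type*} [NormedAddCommGroup E] [NormedSpace ℝ E] {T : ℝ} (hT : 0 < T) (f : ℝ → E) :
    ∫ τ, f τ ∂(muT T) = T⁻¹ • ∫ τ in T..2 * T, f τ := by
  unfold muT
  rw [integral_smul_measure, ENNReal.toReal_inv, ENNReal.toReal_ofReal hT.le, integral_Icc_eq_integral_Ioc,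
    intervalIntegral.integral_of_le (by linarith)]

lemma moment_diff {N : ℕ} (hN : 1 ≤ N) (c : ℕ → ℝ) (T : ℝ) (hT : 0 < T) (K : ℕ) :
    |∫ τ, SS N c τ ^ K ∂(muT T) - ∫ ω, (∑ r, YY c r (ω r)) ^ K ∂(modelP N)| ≤
      (∑ j : Ix N × ℤˣ, ‖ww c j‖) ^ K * (2 / (T * (1 / (2 * (N : ℝ) ^ K) ^ (2 ^ K)))) := by
  have hN' : (1 : ℝ) ≤ N := by exact_mod_cast hN
  have h1 := moment_time (ww (N := N) c) ll K T (1 / (2 * (N : ℝ) ^ K) ^ (2 ^ K)) hT (by positivity)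
    (fun p hp => ll_lower hN p hp)
  rw [← moment_model (modelP N) (ww c) ll K uu
    (fun j => ((fourier (T := 1) _).continuous.measurable).comp (measurable_pi_apply _))
    (fun j ω => by unfold uu; rw [fourier_apply, Circle.norm_coe]) (fun p => orth p)] at h1
  simp_rw [← time_eq, ← model_eq] at h1
  have e1 : (1 / T : ℂ) * (∫ τ in T..2 * T, ((SS N c τ : ℝ) : ℂ) ^ K) = ((∫ τ, SS N c τ ^ K ∂(muT T) : ℝ) : ℂ) := by
    rw [muT_integral hT, smul_eq_mul]
    push_cast
    rw [one_div]; congr 1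
    rw [← intervalIntegral.integral_ofReal]
    push_cast; rfl
  have e2 : ∫ ω, ((∑ r, YY c r (ω r) : ℝ) : ℂ) ^ K ∂(modelP N) = ((∫ ω, (∑ r, YY c r (ω r)) ^ K ∂(modelP N) : ℝ) : ℂ) := by
    rw [← integral_complex_ofReal]; push_cast; rfl
  rw [e1, e2, ← Complex.ofReal_sub, Complex.norm_real] at h1
  exact h1

lemma finite_cf {N : ℕ} (hN : 1 ≤ N) (c : ℕ → ℝ) (b : ℝ) (hb0 : 0 ≤ b) (hb : ∀ n ∈ Icc 3 N, |c n| ≤ b) (T : ℝ) (hT : 0 < T)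
    (K : ℕ) (hK : Even K) (ξ A y V : ℝ) (hy : y = (Nat.log 2 N + 1 : ℕ) * b) (hV : V = ∑ n ∈ Icc 3 N, c n ^ 2 / 2)
    (hA : 0 < A) (hAy : A * y ≤ 1) (hξy : |ξ| * y ≤ 1) :
    ‖∫ τ, Complex.exp (Complex.I * (ξ * SS N c τ : ℝ)) ∂(muT T) - ((exp (-(ξ ^ 2 * V) / 2) : ℝ) : ℂ)‖ ≤
      (1 + N * b) ^ K * (2 * (2 * (N : ℝ) ^ K) ^ (2 ^ K) / T) * exp |ξ| +
        2 * ((|ξ| / A) ^ K * (2 * exp (A ^ 2 * V))) + V * (|ξ| ^ 3 * y + ξ ^ 4 * y ^ 2) := by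
  have := muT_prob hT
  have hN' : (1 : ℝ) ≤ N := by exact_mod_cast hN
  have hYm : ∀ r : Ix N, Measurable (YY c r) := fun r => YY_meas c r
  have hYb : ∀ (r : Ix N) x, |YY c r x| ≤ y := fun r x => by rw [hy]; exact YY_abs c b hb r x
  have hmS : Measurable (SS N c) := by unfold SS; fun_prop
  have hmS' : Measurable fun ω : Ix N → UnitAddCircle => ∑ r, YY c r (ω r) :=
    Finset.measurable_fun_sum _ fun r _ => (hYm r).comp (measurable_pi_apply r)
  have hSb : ∀ τ, |SS N c τ| ≤ ∑ n ∈ Icc 3 N, |c n| := by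
    intro τ
    unfold SS
    refine (abs_sum_le_sum_abs _ _).trans (sum_le_sum fun n _ => ?_)
    rw [abs_mul]
    exact mul_le_of_le_one_right (abs_nonneg _) (Real.abs_cos_le_one _)
  have hsw := sum_ww c b hb0 hb
  have hw0 : 0 ≤ ∑ j : Ix N × ℤˣ, ‖ww c j‖ := Finset.sum_nonneg fun j _ => norm_nonneg _
  have hη : ∀ k ≤ K, |∫ τ, SS N c τ ^ k ∂(muT T) - ∫ ω, (∑ r, YY c r (ω r)) ^ k ∂(modelP N)| ≤
      (1 + N * b) ^ K * (2 * (2 * (N : ℝ) ^ K) ^ (2 ^ K) / T) := by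
    intro k hk
    refine (moment_diff hN c T hT k).trans ?_
    have hNb : 0 ≤ N * b := by positivity
    have h1 : (∑ j : Ix N × ℤˣ, ‖ww c j‖) ^ k ≤ (1 + N * b) ^ K :=
      (pow_le_pow_left₀ hw0 (by linarith) k).trans (pow_le_pow_right₀ (by linarith) hk)
    have h2 : (2 * (N : ℝ) ^ k) ^ (2 ^ k) ≤ (2 * (N : ℝ) ^ K) ^ (2 ^ K) := by
      have h3 : 2 * (N : ℝ) ^ k ≤ 2 * (N : ℝ) ^ K := by
        have := pow_le_pow_right₀ hN' hk
        linarith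
      have h4 : 1 ≤ 2 * (N : ℝ) ^ K := by linarith [one_le_pow₀ hN' (n := K)]
      exact (pow_le_pow_left₀ (by positivity) h3 _).trans (pow_le_pow_right₀ h4 (Nat.pow_le_pow_right (by norm_num) hk))
    have e : 2 / (T * (1 / (2 * (N : ℝ) ^ k) ^ (2 ^ k))) = 2 * (2 * (N : ℝ) ^ k) ^ (2 ^ k) / T := by
      field_simp
    rw [e]
    gcongr
  have h1 := cf_compare (muT T) (modelP N) (SS N c) (fun ω => ∑ r, YY c r (ω r)) hmS hmS'
    (max (∑ n ∈ Icc 3 N, |c n|) (Fintype.card (Ix N) * y)) (fun τ => (hSb τ).trans (le_max_left _ _))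
    (fun ω => (model_bdd (YY c) y hYb ω).trans (le_max_right _ _)) K hK ξ _ hη
  have h2 := model_mom hc (YY (N := N) c) hYm y hYb _ (fun r => YY_int c r) (fun r => YY_sq c r) A hA hAy K hK ξ
  have h3 := model_cf hc (YY (N := N) c) hYm y hYb _ (fun r => YY_int c r) (fun r => YY_sq c r) ξ hξy
  rw [sum_vv, ← hV] at h2 h3
  have h4 := norm_sub_le_norm_sub_add_norm_sub (∫ τ, Complex.exp (Complex.I * (ξ * SS N c τ : ℝ)) ∂(muT T))
    (∫ ω, Complex.exp (Complex.I * (ξ * ∑ r, YY c r (ω r) : ℝ)) ∂(modelP N)) ((exp (-(ξ ^ 2 * V) / 2) : ℝ) : ℂ)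
  change _ ≤ _ + ‖∫ ω, Complex.exp (Complex.I * (ξ * ∑ r, YY c r (ω r) : ℝ)) ∂(Measure.pi fun _ : Ix N => hc) - _‖ at h4
  change |ξ| ^ K / K.factorial * ∫ ω, (∑ r, YY c r (ω r)) ^ K ∂(modelP N) ≤ _ at h2
  linarith

theorem master (N : ℝ → ℕ) (c : ℝ → ℕ → ℝ) (b : ℝ → ℝ) (hN : ∀ᶠ T in atTop, 1 ≤ N T)
    (h1 : ∀ M : ℕ, Tendsto (fun T => (N T : ℝ) ^ M / T) atTop (nhds 0)) (hb0 : ∀ᶠ T in atTop, 0 ≤ b T)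
    (h2 : ∀ᶠ T in atTop, ∀ n ∈ Icc 3 (N T), |c T n| ≤ b T)
    (h3 : Tendsto (fun T => ((Nat.log 2 (N T) + 1 : ℕ) : ℝ) * b T) atTop (nhds 0))
    (h4 : Tendsto (fun T => ∑ n ∈ Icc 3 (N T), c T n ^ 2 / 2) atTop (nhds 1)) (ξ : ℝ) :
    Tendsto (fun T => ∫ τ, Complex.exp (Complex.I * (ξ * SS (N T) (c T) τ : ℝ)) ∂(muT T)) atTop
      (nhds ((exp (-ξ ^ 2 / 2) : ℝ) : ℂ)) := by
  obtain ⟨V, hV⟩ : ∃ V : ℝ → ℝ, V = fun T => ∑ n ∈ Icc 3 (N T), c T n ^ 2 / 2 := ⟨_, rfl⟩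
  obtain ⟨y, hy⟩ : ∃ y : ℝ → ℝ, y = fun T => ((Nat.log 2 (N T) + 1 : ℕ) : ℝ) * b T := ⟨_, rfl⟩
  rw [← hV] at h4
  rw [← hy] at h3
  have hlim : Tendsto (fun T => ((exp (-(ξ ^ 2 * V T) / 2) : ℝ) : ℂ)) atTop (nhds ((exp (-ξ ^ 2 / 2) : ℝ) : ℂ)) := by
    refine (Complex.continuous_ofReal.tendsto _).comp ?_
    refine (Real.continuous_exp.tendsto _).comp ?_
    have := ((h4.const_mul (ξ ^ 2)).neg).div_const 2
    rwa [mul_one] at this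
  suffices h : Tendsto (fun T => ∫ τ, Complex.exp (Complex.I * (ξ * SS (N T) (c T) τ : ℝ)) ∂(muT T) -
      ((exp (-(ξ ^ 2 * V T) / 2) : ℝ) : ℂ)) atTop (nhds 0) by
    have := h.add hlim
    simpa using this
  obtain ⟨A, hA⟩ : ∃ A, A = 2 * |ξ| + 1 := ⟨_, rfl⟩
  have hξ0 := abs_nonneg ξ
  have hA0 : 0 < A := by linarith
  rw [Metric.tendsto_nhds]
  intro ε hε
  simp only [dist_zero_right]
  -- choose the order of the moment expansion
  obtain ⟨k, hk⟩ : ∃ k : ℕ, 4 * exp (A ^ 2) * (1 / 4 : ℝ) ^ k < ε := by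
    have : Tendsto (fun k : ℕ => 4 * exp (A ^ 2) * (1 / 4 : ℝ) ^ k) atTop (nhds (4 * exp (A ^ 2) * 0)) :=
      (tendsto_pow_atTop_nhds_zero_of_lt_one (by norm_num) (by norm_num)).const_mul _
    rw [mul_zero] at this
    exact (this.eventually (gt_mem_nhds hε)).exists
  obtain ⟨K, hK⟩ : ∃ K, K = 2 * k := ⟨_, rfl⟩
  have hKe : Even K := ⟨k, by omega⟩
  have hAK : (|ξ| / A) ^ K ≤ (1 / 4 : ℝ) ^ k := by
    rw [hK, pow_mul]
    refine pow_le_pow_left₀ (by positivity) ?_ k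
    have : |ξ| / A ≤ 1 / 2 := by rw [div_le_iff₀ hA0]; linarith
    calc (|ξ| / A) ^ 2 ≤ (1 / 2) ^ 2 := pow_le_pow_left₀ (by positivity) this 2
      _ = 1 / 4 := by norm_num
  have hF : Tendsto (fun T => (2 ^ K * (2 * 2 ^ (2 ^ K)) * exp |ξ|) * ((N T : ℝ) ^ (K + K * 2 ^ K) / T) +
      2 * ((1 / 4 : ℝ) ^ k * (2 * exp (A ^ 2 * V T))) + V T * (|ξ| ^ 3 * y T + ξ ^ 4 * y T ^ 2)) atTop
      (nhds ((2 ^ K * (2 * 2 ^ (2 ^ K)) * exp |ξ|) * 0 + 2 * ((1 / 4 : ℝ) ^ k * (2 * exp (A ^ 2 * 1))) +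
        1 * (|ξ| ^ 3 * 0 + ξ ^ 4 * 0 ^ 2))) :=
    (((h1 _).const_mul _).add ((((((Real.continuous_exp.tendsto _).comp (h4.const_mul (A ^ 2))).const_mul 2).const_mul _)).const_mul 2)).add
      (h4.mul ((h3.const_mul _).add ((h3.pow 2).const_mul _)))
  have hFε := hF.eventually_lt_const (u := ε)  (by
    have e : (2 ^ K * (2 * 2 ^ (2 ^ K)) * exp |ξ|) * 0 + 2 * ((1 / 4 : ℝ) ^ k * (2 * exp (A ^ 2 * 1))) +
        1 * (|ξ| ^ 3 * 0 + ξ ^ 4 * 0 ^ 2) = 4 * exp (A ^ 2) * (1 / 4 : ℝ) ^ k := by rw [mul_one]; ring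
    rw [e]; exact hk)
  have hyA : ∀ᶠ T in atTop, y T < 1 / A := h3.eventually (gt_mem_nhds (by positivity))
  filter_upwards [hFε, hyA, hN, hb0, h2, eventually_gt_atTop 0] with T hT1 hT2 hT3 hT4 hT5 hT6
  refine lt_of_le_of_lt ?_ hT1
  have hAy : A * y T ≤ 1 := by rw [lt_div_iff₀ hA0] at hT2; linarith
  have hy0 : b T ≤ y T := by
    rw [hy]
    have : (1 : ℝ) ≤ ((Nat.log 2 (N T) + 1 : ℕ) : ℝ) := by exact_mod_cast Nat.le_add_left 1 _
    nlinarith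
  have hξy : |ξ| * y T ≤ 1 := le_trans (mul_le_mul_of_nonneg_right (by linarith) (by linarith)) hAy
  have hb1 : b T ≤ 1 := by
    have : 1 * y T ≤ A * y T := mul_le_mul_of_nonneg_right (by linarith) (by linarith)
    linarith
  refine (finite_cf hT3 (c T) (b T) hT4 hT5 T hT6 K hKe ξ A (y T) (V T) (by rw [hy]) (by rw [hV]) hA0 hAy hξy).trans ?_
  have hN' : (1 : ℝ) ≤ N T := by exact_mod_cast hT3
  have hNb : 1 + N T * b T ≤ 2 * N T := by nlinarith
  have g1 : (1 + N T * b T) ^ K * (2 * (2 * (N T : ℝ) ^ K) ^ (2 ^ K) / T) * exp |ξ| ≤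
      (2 ^ K * (2 * 2 ^ (2 ^ K)) * exp |ξ|) * ((N T : ℝ) ^ (K + K * 2 ^ K) / T) := by
    calc _ ≤ (2 * (N T : ℝ)) ^ K * (2 * (2 * (N T : ℝ) ^ K) ^ (2 ^ K) / T) * exp |ξ| := by
          gcongr
      _ = _ := by
          rw [mul_pow, mul_pow _ ((N T : ℝ) ^ K), ← pow_mul, pow_add]; ring
  have g2 : (|ξ| / A) ^ K * (2 * exp (A ^ 2 * V T)) ≤ (1 / 4 : ℝ) ^ k * (2 * exp (A ^ 2 * V T)) :=
    mul_le_mul_of_nonneg_right hAK (by positivity)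
  linarith

/-- one step of the summation by parts -/
lemma step_int (f : ℝ → ℝ) (hf : Continuous f) (Lp : ℝ) (hL : ∀ u v, |f u - f v| ≤ Lp * |u - v|) (Q : ℝ) (hQ : 0 < Q)
    (a b : ℝ) (hab : a ≤ b) :
    |(exp (Q * b) - exp (Q * a)) * f a - Q * ∫ u in a..b, f u * exp (Q * u)| ≤
      Lp * (b - a) * (exp (Q * b) - exp (Q * a)) := by
  have e0 : ∫ u in a..b, exp (Q * u) = (exp (Q * b) - exp (Q * a)) / Q := by
    rw [intervalIntegral.integral_comp_mul_left _ hQ.ne', integral_exp, smul_eq_mul]; ring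
  have e1 : (exp (Q * b) - exp (Q * a)) * f a - Q * ∫ u in a..b, f u * exp (Q * u) =
      Q * ∫ u in a..b, (f a - f u) * exp (Q * u) := by
    simp_rw [sub_mul]
    rw [intervalIntegral.integral_sub (Continuous.intervalIntegrable (by fun_prop) _ _) (Continuous.intervalIntegrable (by fun_prop) _ _),
      intervalIntegral.integral_const_mul, e0]
    field_simp
  have hLp : 0 ≤ Lp := by
    have := (abs_nonneg _).trans (hL 1 0); simpa using this
  have h2 : |∫ u in a..b, (f a - f u) * exp (Q * u)| ≤ ∫ u in a..b, Lp * (b - a) * exp (Q * u) := by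
    rw [← Real.norm_eq_abs]
    refine intervalIntegral.norm_integral_le_of_norm_le hab (Eventually.of_forall fun u hu => ?_)
      (Continuous.intervalIntegrable (by fun_prop) _ _)
    rw [norm_mul, Real.norm_eq_abs, Real.norm_eq_abs, Real.abs_exp]
    refine mul_le_mul_of_nonneg_right ((hL a u).trans ?_) (Real.exp_pos _).le
    refine mul_le_mul_of_nonneg_left ?_ hLp
    rw [abs_sub_comm, abs_of_nonneg (by linarith [hu.1])]
    linarith [hu.2]
  rw [intervalIntegral.integral_const_mul, e0] at h2
  rw [e1, abs_mul, abs_of_pos hQ]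
  calc _ ≤ Q * (Lp * (b - a) * ((exp (Q * b) - exp (Q * a)) / Q)) := mul_le_mul_of_nonneg_left h2 hQ.le
    _ = _ := by field_simp

lemma exp_Q_lu {n : ℕ} (hn : 2 < n) {Q : ℝ} (hQ : 0 < Q) : exp (Q * (lu n / Q)) = eu n := by
  rw [mul_div_cancel₀ _ hQ.ne', exp_lu hn]

lemma parts (f : ℝ → ℝ) (hf : Continuous f) (Lp : ℝ) (hL : ∀ u v, |f u - f v| ≤ Lp * |u - v|) (Q : ℝ) (hQ : 0 < Q)
    (w : ℕ → ℝ) (R k : ℝ) (hk : 0 ≤ k) (N : ℕ) (hN : 2 ≤ N)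
    (hR : ∀ n ∈ Icc 3 N, |∑ m ∈ Icc 3 n, w m - k * eu (n + 1)| ≤ R) :
    |∑ n ∈ Icc 3 N, w n * f (lu n / Q) - k * (Q * ∫ u in (lu 3 / Q)..(lu (N + 1) / Q), f u * exp (Q * u)) -
      (∑ n ∈ Icc 3 N, w n - k * eu (N + 1)) * f (lu (N + 1) / Q)| ≤
      k * eu 3 * |f (lu 3 / Q)| + Lp * (R + 2 * k) * (lu (N + 1) / Q - lu 3 / Q) := by
  have hLp : 0 ≤ Lp := by
    have := (abs_nonneg _).trans (hL 1 0); simpa using this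
  induction N, hN using Nat.le_induction with
  | base =>
    have := eu_gt_one (n := 3) (by norm_num)
    simp [abs_mul, abs_of_nonneg hk, abs_of_pos (by linarith : 0 < eu 3)]
  | succ N hN ih =>
    have ih' := ih fun n hn => hR n (Finset.Icc_subset_Icc_right (Nat.le_succ N) hn)
    have hR' := hR (N + 1) (Finset.mem_Icc.mpr ⟨by omega, le_rfl⟩)
    have hgt : 2 < N + 1 := by omega
    have hmono : lu (N + 1) < lu (N + 1 + 1) := lu_strictMono hgt (Nat.lt_succ_self _)
    have hab : lu (N + 1) / Q ≤ lu (N + 1 + 1) / Q := by gcongr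
    have hs := step_int f hf Lp hL Q hQ _ _ hab
    rw [exp_Q_lu hgt hQ, exp_Q_lu (by omega) hQ] at hs
    have hx1 := eu_gt (n := N + 1) hgt
    have hx2 := eu_le (n := N + 1 + 1) (by omega)
    have hx3 : eu (N + 1 + 1) - eu (N + 1) ≤ 2 := by push_cast at hx1 hx2; linarith
    have hsum : ∀ v : ℕ → ℝ, ∑ n ∈ Icc 3 (N + 1), v n = ∑ n ∈ Icc 3 N, v n + v (N + 1) :=
      fun v => Finset.sum_Icc_succ_top (by omega) _
    have hin : ∫ u in (lu 3 / Q)..(lu (N + 1 + 1) / Q), f u * exp (Q * u) =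
        (∫ u in (lu 3 / Q)..(lu (N + 1) / Q), f u * exp (Q * u)) + ∫ u in (lu (N + 1) / Q)..(lu (N + 1 + 1) / Q), f u * exp (Q * u) :=
      (intervalIntegral.integral_add_adjacent_intervals (Continuous.intervalIntegrable (by fun_prop) _ _)
        (Continuous.intervalIntegrable (by fun_prop) _ _)).symm
    have hl := hL (lu (N + 1) / Q) (lu (N + 1 + 1) / Q)
    rw [abs_sub_comm (lu (N + 1) / Q), abs_of_nonneg (sub_nonneg.mpr hab)] at hl
    have ha : |(∑ m ∈ Icc 3 (N + 1), w m - k * eu (N + 1 + 1)) * (f (lu (N + 1) / Q) - f (lu (N + 1 + 1) / Q))| ≤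
        R * (Lp * (lu (N + 1 + 1) / Q - lu (N + 1) / Q)) := by
      rw [abs_mul]
      exact mul_le_mul hR' hl (abs_nonneg _) ((abs_nonneg _).trans hR')
    have hb : |k * ((eu (N + 1 + 1) - eu (N + 1)) * f (lu (N + 1) / Q) -
        Q * ∫ u in (lu (N + 1) / Q)..(lu (N + 1 + 1) / Q), f u * exp (Q * u))| ≤
        k * (Lp * (lu (N + 1 + 1) / Q - lu (N + 1) / Q) * 2) := by
      rw [abs_mul, abs_of_nonneg hk]
      refine mul_le_mul_of_nonneg_left (hs.trans (mul_le_mul_of_nonneg_left hx3 ?_)) hk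
      exact mul_nonneg hLp (sub_nonneg.mpr hab)
    have e : ∀ S M w1 f1 f2 I1 I2 x1 x2 : ℝ, S + w1 * f1 - k * (Q * (I1 + I2)) - (M + w1 - k * x2) * f2 =
      (S - k * (Q * I1) - (M - k * x1) * f1) + (M + w1 - k * x2) * (f1 - f2) + k * ((x2 - x1) * f1 - Q * I2) := by
      intros; ring
    rw [hsum (fun n => w n * f (lu n / Q)), hin, hsum w, e _ _ _ _ _ _ _ (eu (N + 1)) _]
    rw [hsum w] at ha
    refine (abs_add_le _ _).trans (le_trans (add_le_add_left (abs_add_le _ _) _) ?_)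
    linarith

/-- cut-off -/
noncomputable def NQ (Q : ℝ) : ℕ := ⌊exp Q⌋₊ + 1

lemma NQ_gt (Q : ℝ) : exp Q < NQ Q := by
  have := Nat.lt_floor_add_one (exp Q); unfold NQ; push_cast; exact this

lemma NQ_le {Q : ℝ} (hQ : 0 ≤ Q) : (NQ Q : ℝ) ≤ 2 * exp Q := by
  have := Nat.floor_le (Real.exp_pos Q).le
  have := Real.one_le_exp hQ
  unfold NQ; push_cast; linarith

lemma NQ_big {Q : ℝ} (hQ : 1 ≤ Q) : 2 ≤ NQ Q := by
  have h1 := NQ_gt Q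
  have h2 := Real.add_one_le_exp Q
  have h3 : (1 : ℝ) < NQ Q := by linarith
  exact_mod_cast h3

lemma lu_gt {Q : ℝ} (hQ : 1 ≤ Q) {n : ℕ} (hn : NQ Q < n) : 1 < lu n / Q := by
  have h0 := NQ_big hQ
  have h2 : 2 < n := by omega
  have h1 := NQ_gt Q
  have h3 := eu_gt h2
  have h4 : ((NQ Q : ℕ) : ℝ) + 1 ≤ n := by exact_mod_cast hn
  rw [lt_div_iff₀ (by linarith), one_mul, ← Real.exp_lt_exp, exp_lu h2]
  linarith

lemma NQ_rpow {Q : ℝ} (hQ : 0 ≤ Q) {s : ℝ} (hs : 0 ≤ s) (hs1 : s ≤ 1) : (NQ Q : ℝ) ^ s ≤ 2 * exp (Q * s) := by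
  calc (NQ Q : ℝ) ^ s ≤ (2 * exp Q) ^ s := Real.rpow_le_rpow (by positivity) (NQ_le hQ) hs
    _ = 2 ^ s * exp (Q * s) := by rw [Real.mul_rpow (by norm_num) (Real.exp_pos _).le, Real.exp_mul]
    _ ≤ _ := by
      refine mul_le_mul_of_nonneg_right ?_ (Real.exp_pos _).le
      calc (2 : ℝ) ^ s ≤ 2 ^ (1 : ℝ) := Real.rpow_le_rpow_of_exponent_le (by norm_num) hs1
        _ = 2 := by simp

lemma asym (f : ℝ → ℝ) (hf : Continuous f) (Lp : ℝ) (hL : ∀ u v, |f u - f v| ≤ Lp * |u - v|) (B : ℝ)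
    (hB : ∀ u, |f u| ≤ B) (hz : ∀ u, 1 < u → f u = 0) :
    ∃ C : ℝ, 0 < C ∧ ∀ Q : ℝ, 1 ≤ Q → |∑ n ∈ Icc 3 (NQ Q), ampA n ^ 2 * f (lu n / Q) -
      kappa * (Q * ∫ u in Set.Ioi (0 : ℝ), f u * exp (Q * u))| ≤ C * exp (Q * (1 - 1 / 12000)) := by
  obtain ⟨C0, hC0, h0⟩ := meansq
  have hk := kappa_pos
  have hLp : 0 ≤ Lp := by
    have := (abs_nonneg _).trans (hL 1 0); simpa using this
  have hB0 : 0 ≤ B := (abs_nonneg _).trans (hB 0)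
  have h3 : (2 : ℕ) < 3 := by norm_num
  have e3 : 0 < eu 3 := by linarith [eu_gt_one h3]
  have l3 := lu_pos h3
  refine ⟨kappa * eu 3 * B + 3 * Lp * (2 * C0 + 3 * kappa) + kappa * (B * eu 3 * lu 3) + 1, by positivity, fun Q hQ => ?_⟩
  have hQ0 : 0 < Q := by linarith
  have hN := NQ_big hQ
  obtain ⟨N, hNe⟩ : ∃ N, N = NQ Q := ⟨_, rfl⟩
  obtain ⟨E, hE⟩ : ∃ E, E = exp (Q * (1 - 1 / 12000)) := ⟨_, rfl⟩
  have hE1 : 1 ≤ E := by rw [hE]; exact Real.one_le_exp (mul_nonneg hQ0.le (by norm_num))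
  have hNE : (N : ℝ) ^ (1 - 1 / 12000 : ℝ) ≤ 2 * E := by
    rw [hNe, hE]; exact NQ_rpow hQ0.le (by norm_num) (by norm_num)
  have hb1 : 1 < lu (N + 1) / Q := lu_gt hQ (by omega)
  have hb3 : lu (N + 1) / Q ≤ 3 := by
    have h2 : 2 < N + 1 := by omega
    rw [div_le_iff₀ hQ0, ← Real.exp_le_exp, exp_lu h2]
    have h4 := eu_le h2
    have h5 := NQ_le hQ0.le
    have h6 := Real.add_one_le_exp (2 * Q)
    have h7 := Real.one_le_exp hQ0.le
    rw [← hNe] at h5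
    push_cast at h4
    rw [show 3 * Q = Q + 2 * Q by ring, Real.exp_add]
    nlinarith
  have hR : ∀ n ∈ Icc 3 N, |∑ m ∈ Icc 3 n, ampA m ^ 2 - kappa * eu (n + 1)| ≤ (2 * C0 + kappa) * E := by
    intro n hn
    rw [mem_Icc] at hn
    have h1 := h0 n (by omega)
    have h2 : 2 < n + 1 := by omega
    have h4 := eu_le h2
    have h5 := eu_gt h2
    push_cast at h4 h5
    have h6 : (n : ℝ) ^ (1 - 1 / 12000 : ℝ) ≤ (N : ℝ) ^ (1 - 1 / 12000 : ℝ) :=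
      Real.rpow_le_rpow (by positivity) (by exact_mod_cast hn.2) (by norm_num)
    have h7 := h1.trans (mul_le_mul_of_nonneg_left (h6.trans hNE) hC0.le)
    rw [abs_le] at h7 ⊢
    constructor <;> nlinarith
  have hp := parts f hf Lp hL Q hQ0 (fun n => ampA n ^ 2) _ kappa hk.le N (by omega) hR
  rw [hz _ hb1, mul_zero, sub_zero] at hp
  have hc : Continuous fun u => f u * exp (Q * u) := by fun_prop
  have hI : ∫ u in Set.Ioi (0 : ℝ), f u * exp (Q * u) = ∫ u in (0 : ℝ)..(lu (N + 1) / Q), f u * exp (Q * u) := by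
    rw [intervalIntegral.integral_of_le (by linarith)]
    refine setIntegral_eq_of_subset_of_forall_sdiff_eq_zero measurableSet_Ioi (fun u hu => hu.1) ?_
    intro u hu
    have : lu (N + 1) / Q < u := by
      by_contra h
      exact hu.2 ⟨hu.1, not_lt.1 h⟩
    rw [hz u (by linarith), zero_mul]
  have hs := intervalIntegral.integral_add_adjacent_intervals (hc.intervalIntegrable (μ := volume) 0 (lu 3 / Q))
    (hc.intervalIntegrable (lu 3 / Q) (lu (N + 1) / Q))
  have hsm : |∫ u in (0 : ℝ)..(lu 3 / Q), f u * exp (Q * u)| ≤ B * eu 3 * (lu 3 / Q) := by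
    have := intervalIntegral.norm_integral_le_of_norm_le_const (a := (0 : ℝ)) (b := lu 3 / Q)
      (f := fun u => f u * exp (Q * u)) (C := B * eu 3) ?_
    · rwa [sub_zero, abs_of_nonneg (by positivity : 0 ≤ lu 3 / Q)] at this
    · intro u hu
      rw [Set.uIoc_of_le (by positivity)] at hu
      rw [norm_mul, Real.norm_eq_abs, Real.norm_eq_abs, Real.abs_exp, ← exp_Q_lu h3 hQ0]
      exact mul_le_mul (hB u) (Real.exp_le_exp.2 (mul_le_mul_of_nonneg_left hu.2 hQ0.le)) (Real.exp_pos _).le hB0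
  rw [← hNe, ← hE, hI, ← hs]
  obtain ⟨X, hX⟩ : ∃ X, X = ∫ u in (0 : ℝ)..(lu 3 / Q), f u * exp (Q * u) := ⟨_, rfl⟩
  obtain ⟨Y, hY⟩ : ∃ Y, Y = ∫ u in (lu 3 / Q)..(lu (N + 1) / Q), f u * exp (Q * u) := ⟨_, rfl⟩
  rw [← hX] at hsm ⊢
  rw [← hY] at hp ⊢
  have hQX : |Q * X| ≤ B * eu 3 * lu 3 := by
    rw [abs_mul, abs_of_pos hQ0]
    calc _ ≤ Q * (B * eu 3 * (lu 3 / Q)) := mul_le_mul_of_nonneg_left hsm hQ0.le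
      _ = _ := by field_simp
  have hd : lu (N + 1) / Q - lu 3 / Q ≤ 3 := by
    have : 0 < lu 3 / Q := by positivity
    linarith
  have g1 : kappa * eu 3 * |f (lu 3 / Q)| ≤ kappa * eu 3 * B := mul_le_mul_of_nonneg_left (hB _) (by positivity)
  have g2 : Lp * ((2 * C0 + kappa) * E + 2 * kappa) * (lu (N + 1) / Q - lu 3 / Q) ≤
      Lp * ((2 * C0 + 3 * kappa) * E) * 3 := by
    refine (mul_le_mul_of_nonneg_left hd (by positivity)).trans ?_
    refine mul_le_mul_of_nonneg_right (mul_le_mul_of_nonneg_left ?_ hLp) (by norm_num)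
    nlinarith
  have g3 : |kappa * (Q * X)| ≤ kappa * (B * eu 3 * lu 3) := by
    rw [abs_mul, abs_of_pos hk]; exact mul_le_mul_of_nonneg_left hQX hk.le
  have p1 : 0 ≤ kappa * eu 3 * B := by positivity
  have p2 : 0 ≤ kappa * (B * eu 3 * lu 3) := by positivity
  have h9 := abs_sub (∑ n ∈ Icc 3 N, ampA n ^ 2 * f (lu n / Q) - kappa * (Q * Y)) (kappa * (Q * X))
  calc _ = |∑ n ∈ Icc 3 N, ampA n ^ 2 * f (lu n / Q) - kappa * (Q * Y) - kappa * (Q * X)| := by congr 1; ring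
    _ ≤ kappa * eu 3 * B + Lp * ((2 * C0 + 3 * kappa) * E) * 3 + kappa * (B * eu 3 * lu 3) := by
      linarith
    _ ≤ _ := by nlinarith [mul_le_mul_of_nonneg_left hE1 p1, mul_le_mul_of_nonneg_left hE1 p2]

lemma g_zero (g : ℝ → ℝ) (hs : HasCompactSupport g) (h1 : sSup {r : ℝ | ∃ ξ : ℝ, g ξ ≠ 0 ∧ |ξ| = r} = 1)
    (u : ℝ) (hu : 1 < u) : g u = 0 := by
  by_contra h
  obtain ⟨R, hR⟩ := hs.isBounded.exists_norm_le
  have : |u| ≤ sSup {r : ℝ | ∃ ξ : ℝ, g ξ ≠ 0 ∧ |ξ| = r} := by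
    refine le_csSup ⟨R, ?_⟩ ⟨u, h, rfl⟩
    rintro r ⟨ξ, h2, rfl⟩
    exact hR ξ (subset_tsupport _ h2)
  rw [h1] at this
  linarith [le_abs_self u]

lemma G_low (g : ℝ → ℝ) (hc : Continuous g) (he : ∀ ξ, g (-ξ) = g ξ) (hs : HasCompactSupport g)
    (h1 : sSup {r : ℝ | ∃ ξ : ℝ, g ξ ≠ 0 ∧ |ξ| = r} = 1) :
    ∃ c : ℝ, 0 < c ∧ ∀ Q : ℝ, 0 ≤ Q → c * exp (Q * (1 - 1 / 24000)) ≤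
      ∫ u in Set.Ioi (0 : ℝ), g u ^ 2 * exp (Q * u) := by
  have hne : {r : ℝ | ∃ ξ : ℝ, g ξ ≠ 0 ∧ |ξ| = r}.Nonempty := by
    by_contra h
    rw [Set.not_nonempty_iff_eq_empty.1 h, Real.sSup_empty] at h1
    norm_num at h1
  obtain ⟨r, ⟨ξ, h2, rfl⟩, h3⟩ := exists_lt_of_lt_csSup hne (show (1 - 1 / 24000 : ℝ) < _ by rw [h1]; norm_num)
  have h4 : g |ξ| ≠ 0 := by
    rcases abs_choice ξ with h | h <;> rw [h]
    · exact h2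
    · rwa [he]
  obtain ⟨u0, hu0⟩ : ∃ u0, u0 = |ξ| := ⟨_, rfl⟩
  rw [← hu0] at h3 h4
  obtain ⟨m, hm⟩ : ∃ m, m = g u0 ^ 2 / 2 := ⟨_, rfl⟩
  have hm0 : 0 < m := by rw [hm]; positivity
  have hcont : Continuous fun u => g u ^ 2 := by fun_prop
  obtain ⟨ρ, hρ, hball⟩ := Metric.eventually_nhds_iff.1
    (hcont.continuousAt.eventually_const_lt (show m < g u0 ^ 2 by rw [hm]; have : 0 < g u0 ^ 2 := by positivity
                                                                  linarith))
  refine ⟨m * (ρ / 2), by positivity, fun Q hQ => ?_⟩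
  have hin : Integrable (fun u => g u ^ 2 * exp (Q * u)) := by
    refine Continuous.integrable_of_hasCompactSupport (by fun_prop) ?_
    have : (fun u => g u ^ 2 * exp (Q * u)) = fun u => g u * (g u * exp (Q * u)) := by ext; ring
    rw [this]
    exact hs.mul_right
  calc m * (ρ / 2) * exp (Q * (1 - 1 / 24000))
      = ∫ u in Set.Icc u0 (u0 + ρ / 2), m * exp (Q * (1 - 1 / 24000)) := by
        rw [setIntegral_const, Real.volume_real_Icc_of_le (by linarith), smul_eq_mul]; ring
    _ ≤ ∫ u in Set.Icc u0 (u0 + ρ / 2), g u ^ 2 * exp (Q * u) := by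
        refine setIntegral_mono_on (integrableOn_const (by simp)) hin.integrableOn measurableSet_Icc fun u hu => ?_
        have hb := hball (y := u) (by rw [Real.dist_eq, abs_of_nonneg (by linarith [hu.1])]; linarith [hu.2])
        exact mul_le_mul hb.le (Real.exp_le_exp.2 (mul_le_mul_of_nonneg_left (by linarith [hu.1]) hQ))
          (Real.exp_pos _).le (by positivity)
    _ ≤ _ := by
        refine setIntegral_mono_set hin.integrableOn (ae_of_all _ fun u => ?_) (HasSubset.Subset.eventuallyLE ?_)
        · simp only [Pi.zero_apply]; positivity
        · intro u hu
          exact lt_of_lt_of_le (by linarith) hu.1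

/-- the coefficients of the normalised sum -/
noncomputable def cQ (g : ℝ → ℝ) (L : ℝ) (n : ℕ) : ℝ :=
  2 / (Real.pi * L * Real.sqrt (sigmaSq g L)) * (ampA n * g (lu n / (Real.pi * L)))

lemma SL_eq (g : ℝ → ℝ) (hz : ∀ u, 1 < u → g u = 0) (L : ℝ) (hL : 1 ≤ Real.pi * L) (τ : ℝ) :
    SL g L τ / Real.sqrt (sigmaSq g L) = SS (NQ (Real.pi * L)) (cQ g L) τ := by
  have h2 : ∀ n : ℕ, Real.log (Nnorm n) / (2 * Real.pi * L) = lu n / (Real.pi * L) := by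
    intro n
    rw [log_Nnorm, mul_assoc, mul_div_mul_left _ _ (by norm_num)]
  unfold SL SS
  rw [tsum_eq_sum (s := Icc 3 (NQ (Real.pi * L)))]
  · rw [Finset.mul_sum, Finset.sum_div]
    refine sum_congr rfl fun n hn => ?_
    rw [mem_Icc] at hn
    rw [if_pos (by omega), h2, log_Nnorm, cQ]
    ring
  · intro n hn
    rw [mem_Icc] at hn
    split_ifs with h
    · rw [h2, hz _ (lu_gt hL (by omega))]; ring
    · rfl

lemma tendsto_exp_pi (D s : ℝ) (hs : 0 < s) :
    Tendsto (fun L : ℝ => D * exp (-(Real.pi * L * s))) atTop (nhds 0) := by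
  have h : Tendsto (fun L : ℝ => Real.pi * L * s) atTop atTop :=
    (tendsto_id.const_mul_atTop Real.pi_pos).atTop_mul_const hs
  simpa using (Real.tendsto_exp_neg_atTop_nhds_zero.comp h).const_mul D

lemma sig_sq (g : ℝ → ℝ) (L : ℝ) (hL : 0 < Real.pi * L) :
    (Real.pi * L) ^ 2 * sigmaSq g L =
      2 * kappa * (Real.pi * L * ∫ u in Set.Ioi (0 : ℝ), g u ^ 2 * exp (Real.pi * L * u)) := by
  unfold sigmaSq; field_simp

lemma sumsq (g : ℝ → ℝ) (hg : ContDiff ℝ (⊤ : ℕ∞) g) (he : ∀ ξ, g (-ξ) = g ξ) (hs : HasCompactSupport g)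
    (h1 : sSup {r : ℝ | ∃ ξ : ℝ, g ξ ≠ 0 ∧ |ξ| = r} = 1) :
    Tendsto (fun L : ℝ => ∑ n ∈ Icc 3 (NQ (Real.pi * L)), cQ g L n ^ 2 / 2) atTop (nhds 1) := by
  obtain ⟨c, hc, hG⟩ := G_low g hg.continuous he hs h1
  have hs2 : HasCompactSupport fun u => g u ^ 2 := by
    have : (fun u => g u ^ 2) = fun u => g u * g u := by ext; ring
    rw [this]; exact hs.mul_right
  have hg2 : ContDiff ℝ (⊤ : ℕ∞) fun u => g u ^ 2 := hg.pow 2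
  obtain ⟨Lp, hLp⟩ := ContDiff.lipschitzWith_of_hasCompactSupport hs2 hg2 (by simp)
  obtain ⟨B, hB⟩ := hs2.exists_bound_of_continuous hg2.continuous
  obtain ⟨C, hC, hA⟩ := asym (fun u => g u ^ 2) hg2.continuous Lp (fun u v => by
    simpa [Real.dist_eq] using hLp.dist_le_mul u v) B hB (fun u hu => by simp [g_zero g hs h1 u hu])
  have hk := kappa_pos
  rw [tendsto_iff_norm_sub_tendsto_zero]
  refine squeeze_zero' (Eventually.of_forall fun _ => norm_nonneg _) ?_
    (tendsto_exp_pi (C / (kappa * c)) (1 / 24000) (by norm_num))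
  filter_upwards [eventually_ge_atTop (1 : ℝ)] with L hL
  have hQ : 1 ≤ Real.pi * L := by nlinarith [Real.pi_gt_three]
  have hsig := sig_sq g L (by linarith)
  have hGL := hG (Real.pi * L) (by linarith)
  have hAL := hA (Real.pi * L) hQ
  obtain ⟨G, hGe⟩ : ∃ G, G = ∫ u in Set.Ioi (0 : ℝ), g u ^ 2 * exp (Real.pi * L * u) := ⟨_, rfl⟩
  rw [← hGe] at hsig hGL hAL
  have hG0 : 0 < G := lt_of_lt_of_le (by positivity) hGL
  have hsp : 0 ≤ sigmaSq g L := by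
    unfold sigmaSq; rw [← hGe]; positivity
  obtain ⟨Q, hQe⟩ : ∃ Q, Q = Real.pi * L := ⟨_, rfl⟩
  have hsum : ∑ n ∈ Icc 3 (NQ (Real.pi * L)), cQ g L n ^ 2 / 2 =
      (∑ n ∈ Icc 3 (NQ Q), ampA n ^ 2 * g (lu n / Q) ^ 2) / (kappa * (Q * G)) := by
    rw [Finset.sum_div, hQe]
    refine sum_congr rfl fun n _ => ?_
    unfold cQ
    rw [mul_pow, div_pow, mul_pow _ (Real.sqrt _), Real.sq_sqrt hsp, hsig]
    field_simp
  rw [← hQe] at hAL hGL hQ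
  have hQ0 : 0 < Q := by linarith
  rw [hsum, ← hQe, Real.norm_eq_abs, div_sub_one (by positivity), abs_div, abs_of_pos (by positivity : 0 < kappa * (Q * G)),
    div_le_iff₀ (by positivity)]
  refine hAL.trans ?_
  calc C * exp (Q * (1 - 1 / 12000))
      = C / (kappa * c) * exp (-(Q * (1 / 24000))) * (kappa * (1 * (c * exp (Q * (1 - 1 / 24000))))) := by
        rw [show Q * (1 - 1 / 12000) = -(Q * (1 / 24000)) + Q * (1 - 1 / 24000) by ring, Real.exp_add]
        field_simp
    _ ≤ _ := by
        refine mul_le_mul_of_nonneg_left (mul_le_mul_of_nonneg_left ?_ hk.le) (by positivity)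
        exact mul_le_mul hQ hGL (by positivity) (by linarith)

lemma c_bound (g : ℝ → ℝ) (hg : Continuous g) (he : ∀ ξ, g (-ξ) = g ξ) (hs : HasCompactSupport g)
    (h1 : sSup {r : ℝ | ∃ ξ : ℝ, g ξ ≠ 0 ∧ |ξ| = r} = 1) :
    ∃ D : ℝ, 0 < D ∧ ∀ L : ℝ, 1 ≤ L → ∀ n ∈ Icc 3 (NQ (Real.pi * L)),
      |cQ g L n| ≤ D * exp (-(Real.pi * L * (1 / 4))) := by
  obtain ⟨c, hc, hG⟩ := G_low g hg he hs h1
  obtain ⟨B, hB⟩ := hs.exists_bound_of_continuous hg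
  obtain ⟨K, hK, hA⟩ := ampA_bound (1 / 8) (by norm_num)
  have hk := kappa_pos
  have hB0 : 0 ≤ B := (norm_nonneg _).trans (hB 0)
  refine ⟨2 / Real.sqrt (2 * kappa * c) * (K * 2 * (B + 1)), by positivity, fun L hL n hn => ?_⟩
  have hQ : 1 ≤ Real.pi * L := by nlinarith [Real.pi_gt_three]
  have hsig := sig_sq g L (by linarith)
  have hGL := hG (Real.pi * L) (by linarith)
  rw [mem_Icc] at hn
  have hAn := hA n (by omega)
  have hden : Real.sqrt (2 * kappa * c) * exp (Real.pi * L * (3 / 8)) ≤ Real.pi * L * Real.sqrt (sigmaSq g L) := by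
    have e : Real.pi * L * Real.sqrt (sigmaSq g L) = Real.sqrt ((Real.pi * L) ^ 2 * sigmaSq g L) := by
      rw [Real.sqrt_mul (by positivity), Real.sqrt_sq (by linarith)]
    rw [e, hsig]
    refine Real.le_sqrt_of_sq_le ?_
    rw [mul_pow, Real.sq_sqrt (by positivity), ← Real.exp_nat_mul, mul_assoc]
    refine mul_le_mul_of_nonneg_left ?_ (by positivity)
    calc _ ≤ 1 * (c * exp (Real.pi * L * (1 - 1 / 24000))) := by
          rw [one_mul]
          refine mul_le_mul_of_nonneg_left (Real.exp_le_exp.2 ?_) hc.le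
          push_cast; nlinarith
      _ ≤ _ := mul_le_mul hQ hGL (by positivity) (by linarith)
  have hn8 : (n : ℝ) ^ (1 / 8 : ℝ) ≤ 2 * exp (Real.pi * L * (1 / 8)) :=
    (Real.rpow_le_rpow (by positivity) (by exact_mod_cast hn.2) (by norm_num)).trans
      (NQ_rpow (by linarith) (by norm_num) (by norm_num))
  have hq : 0 < Real.sqrt (2 * kappa * c) * exp (Real.pi * L * (3 / 8)) := by positivity
  unfold cQ
  rw [abs_mul, abs_mul, abs_of_nonneg (by positivity)]
  calc _ ≤ 2 / (Real.sqrt (2 * kappa * c) * exp (Real.pi * L * (3 / 8))) *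
        (K * (2 * exp (Real.pi * L * (1 / 8))) * (B + 1)) := by
        refine mul_le_mul (div_le_div_of_nonneg_left (by norm_num) hq hden) (mul_le_mul
          (hAn.trans (mul_le_mul_of_nonneg_left hn8 hK.le)) ?_ (abs_nonneg _) (by positivity)) (by positivity) (by positivity)
        have := hB (lu n / (Real.pi * L))
        rw [Real.norm_eq_abs] at this
        linarith
    _ = _ := by
        rw [show Real.pi * L * (3 / 8) = Real.pi * L * (1 / 8) + Real.pi * L * (1 / 4) by ring, Real.exp_add, Real.exp_neg]
        field_simp

lemma N_small (L : ℝ → ℝ) (hi : Tendsto L atTop atTop)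
    (hl : Tendsto (fun T => L T / Real.log T) atTop (nhds 0)) (M : ℕ) :
    Tendsto (fun T => (NQ (Real.pi * L T) : ℝ) ^ M / T) atTop (nhds 0) := by
  have hpi := Real.pi_pos
  have h0 : Tendsto (fun T : ℝ => 2 ^ M * T ^ (-(1 / 2) : ℝ)) atTop (nhds 0) := by
    simpa using (tendsto_rpow_neg_atTop (show (0 : ℝ) < 1 / 2 by norm_num)).const_mul (2 ^ M : ℝ)
  refine squeeze_zero' ?_ ?_ h0
  · filter_upwards [eventually_gt_atTop (0 : ℝ)] with T hT
    positivity
  have hd : (0 : ℝ) < 1 / (2 * (Real.pi * (M + 1))) := by positivity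
  filter_upwards [eventually_gt_atTop (1 : ℝ), hl.eventually_lt_const hd, hi.eventually_ge_atTop 0] with T hT h1 h2
  have hlog : 0 < Real.log T := Real.log_pos hT
  rw [div_lt_div_iff₀ hlog (by positivity)] at h1
  have h3 : (M : ℝ) * (Real.pi * L T) ≤ Real.log T * (1 / 2) := by
    have : 0 ≤ Real.pi * L T := by positivity
    nlinarith
  have hT0 : 0 < T := by linarith
  calc (NQ (Real.pi * L T) : ℝ) ^ M / T ≤ (2 * exp (Real.pi * L T)) ^ M / T := by
        gcongr; exact NQ_le (by positivity)
    _ = 2 ^ M * exp (M * (Real.pi * L T)) / T := by rw [mul_pow, Real.exp_nat_mul]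
    _ ≤ 2 ^ M * exp (Real.log T * (1 / 2)) / T := by gcongr
    _ = _ := by
      rw [← Real.rpow_def_of_pos hT0, mul_div_assoc, show (-(1 / 2) : ℝ) = 1 / 2 - 1 by norm_num,
        Real.rpow_sub_one hT0.ne']

lemma char_lim (g : ℝ → ℝ) (hg : ContDiff ℝ (⊤ : ℕ∞) g) (he : ∀ ξ, g (-ξ) = g ξ) (hs : HasCompactSupport g)
    (h1 : sSup {r : ℝ | ∃ ξ : ℝ, g ξ ≠ 0 ∧ |ξ| = r} = 1) (L : ℝ → ℝ) (hi : Tendsto L atTop atTop)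
    (hl : Tendsto (fun T => L T / Real.log T) atTop (nhds 0)) (ξ : ℝ) :
    Tendsto (fun T => ∫ τ, Complex.exp (Complex.I * (ξ * SS (NQ (Real.pi * L T)) (cQ g (L T)) τ : ℝ)) ∂(muT T)) atTop
      (nhds ((exp (-ξ ^ 2 / 2) : ℝ) : ℂ)) := by
  obtain ⟨D, hD, hc⟩ := c_bound g hg.continuous he hs h1
  obtain ⟨C1, hC1, hlog⟩ := natlog_bound (1 / 8) (by norm_num)
  refine master (fun T => NQ (Real.pi * L T)) (fun T => cQ g (L T))
    (fun T => D * exp (-(Real.pi * L T * (1 / 4)))) (Eventually.of_forall fun T => by unfold NQ; omega)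
    (N_small L hi hl) (Eventually.of_forall fun T => by positivity) ?_ ?_ ((sumsq g hg he hs h1).comp hi) ξ
  · filter_upwards [hi.eventually_ge_atTop 1] with T hT
    exact hc _ hT
  · refine squeeze_zero' (Eventually.of_forall fun T => by positivity) ?_
      ((tendsto_exp_pi (2 * C1 * D) (1 / 8) (by norm_num)).comp hi)
    filter_upwards [hi.eventually_ge_atTop 1] with T hT
    have hQ : 0 ≤ Real.pi * L T := by positivity
    have h2 := hlog (NQ (Real.pi * L T)) (by unfold NQ; omega)
    have h3 := NQ_rpow hQ (show (0 : ℝ) ≤ 1 / 8 by norm_num) (by norm_num)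
    have h4 : (Nat.log 2 (NQ (Real.pi * L T)) : ℝ) + 1 ≤ C1 * (2 * exp (Real.pi * L T * (1 / 8))) :=
      h2.trans (mul_le_mul_of_nonneg_left h3 hC1.le)
    push_cast
    calc _ ≤ C1 * (2 * exp (Real.pi * L T * (1 / 8))) * (D * exp (-(Real.pi * L T * (1 / 4)))) :=
          mul_le_mul_of_nonneg_right h4 (by positivity)
      _ = _ := by
        simp only [Function.comp]
        rw [show -(Real.pi * L T * (1 / 8)) = Real.pi * L T * (1 / 8) + -(Real.pi * L T * (1 / 4)) by ring, Real.exp_add]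
        ring

lemma gauss_Iio (x : ℝ) : ((ProbabilityTheory.gaussianReal 0 1) (Set.Iio x)).toReal =
    (1 / Real.sqrt (2 * Real.pi)) * ∫ u in Set.Iic x, exp (-u ^ 2 / 2) := by
  rw [ProbabilityTheory.gaussianReal_apply_eq_integral 0 one_ne_zero, ENNReal.toReal_ofReal
    (setIntegral_nonneg measurableSet_Iio fun u _ => ProbabilityTheory.gaussianPDFReal_nonneg _ _ _),
    ← integral_Iic_eq_integral_Iio, ← integral_const_mul]
  refine setIntegral_congr_fun measurableSet_Iic fun u _ => ?_
  simp [ProbabilityTheory.gaussianPDFReal]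

lemma muT_set {T : ℝ} (hT : 0 < T) (s : Set ℝ) (hs : MeasurableSet s) :
    (muT T s).toReal = (volume {τ : ℝ | τ ∈ Set.Icc T (2 * T) ∧ τ ∈ s}).toReal / T := by
  unfold muT
  rw [Measure.smul_apply, Measure.restrict_apply hs, smul_eq_mul, ENNReal.toReal_mul, ENNReal.toReal_inv,
    ENNReal.toReal_ofReal hT.le, Set.inter_comm, div_eq_inv_mul]
  rfl

lemma levy (S : ℝ → ℝ → ℝ) (hS : ∀ T, Measurable (S T))
    (h : ∀ ξ : ℝ, Tendsto (fun T => ∫ τ, Complex.exp (Complex.I * (ξ * S T τ : ℝ)) ∂(muT T)) atTop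
      (nhds ((exp (-ξ ^ 2 / 2) : ℝ) : ℂ))) (x : ℝ) :
    Tendsto (fun T : ℝ => (volume {τ : ℝ | τ ∈ Set.Icc T (2 * T) ∧ S T τ < x}).toReal / T) atTop
      (nhds ((1 / Real.sqrt (2 * Real.pi)) * ∫ u in Set.Iic x, exp (-u ^ 2 / 2))) := by
  refine tendsto_of_seq_tendsto fun t ht => ?_
  have hp : ∀ k, 0 < max (t k) 1 := fun k => lt_of_lt_of_le one_pos (le_max_right _ _)
  have ht' : Tendsto (fun k => max (t k) 1) atTop atTop := tendsto_atTop_mono (fun k => le_max_left _ _) ht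
  have hpr : ∀ k, IsProbabilityMeasure ((muT (max (t k) 1)).map (S (max (t k) 1))) := fun k => by
    haveI := muT_prob (hp k)
    exact Measure.isProbabilityMeasure_map (hS _).aemeasurable
  obtain ⟨μ, hμ⟩ : ∃ μ : ℕ → ProbabilityMeasure ℝ, ∀ k, (μ k : Measure ℝ) = (muT (max (t k) 1)).map (S (max (t k) 1)) :=
    ⟨fun k => ⟨_, hpr k⟩, fun k => rfl⟩
  obtain ⟨μ0, hμ0⟩ : ∃ μ0 : ProbabilityMeasure ℝ, (μ0 : Measure ℝ) = ProbabilityTheory.gaussianReal 0 1 :=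
    ⟨⟨ProbabilityTheory.gaussianReal 0 1, inferInstance⟩, rfl⟩
  have hconv : Tendsto μ atTop (nhds μ0) := by
    refine ProbabilityMeasure.tendsto_of_tendsto_charFun fun ξ => ?_
    have e0 : charFun (μ0 : Measure ℝ) ξ = ((exp (-ξ ^ 2 / 2) : ℝ) : ℂ) := by
      rw [hμ0, ProbabilityTheory.charFun_gaussianReal]
      push_cast
      congr 1
      simp [neg_div]
    have e1 : ∀ k, charFun (μ k : Measure ℝ) ξ =
        ∫ τ, Complex.exp (Complex.I * (ξ * S (max (t k) 1) τ : ℝ)) ∂(muT (max (t k) 1)) := by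
      intro k
      rw [hμ, charFun_apply_real, integral_map (hS _).aemeasurable (by fun_prop)]
      refine integral_congr_ae (ae_of_all _ fun τ => ?_)
      simp only []
      congr 1
      push_cast
      ring
    rw [e0]
    simp_rw [e1]
    exact (h ξ).comp ht'
  have hE : (μ0 : Measure ℝ) (frontier (Set.Iio x)) = 0 := by
    rw [hμ0, frontier_Iio]
    haveI := ProbabilityTheory.noAtoms_gaussianReal (μ := 0) (v := 1) one_ne_zero
    exact measure_singleton x
  have hfin := (ENNReal.tendsto_toReal (measure_ne_top _ _)).comp
    (ProbabilityMeasure.tendsto_measure_of_null_frontier_of_tendsto' hconv hE)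
  rw [hμ0, gauss_Iio] at hfin
  refine hfin.congr' ?_
  filter_upwards [ht.eventually_ge_atTop 1] with k hk
  simp only [Function.comp]
  rw [hμ, Measure.map_apply (hS _) measurableSet_Iio, max_eq_left hk, muT_set (by linarith) _ (hS _ measurableSet_Iio)]
  rfl

end MD

/-- **A Central Limit Theorem for the spectrum of the modular domain** (Theorem 1):
if `L(T) → ∞` and `L(T)/log T → 0`, then for every real `x`,
`(1/T)·Leb{τ ∈ [T,2T] : S_{L(T)}(τ)/σ_{L(T)} < x}` tends to the standard Gaussian
distribution function `(1/√(2π))·∫_{−∞}^x e^{−u²/2} du`. -/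
theorem clt_modular_domain
    (g : ℝ → ℝ) (hg_smooth : ContDiff ℝ (⊤ : ℕ∞) g) (hg_even : ∀ ξ, g (-ξ) = g ξ)
    (hg_supp : HasCompactSupport g) (hg_zero : g 0 = 1)
    (hg_sup : sSup {r : ℝ | ∃ ξ : ℝ, g ξ ≠ 0 ∧ |ξ| = r} = 1)
    (L : ℝ → ℝ) (hL_pos : ∀ T : ℝ, 0 < T → 0 < L T)
    (hL_inf : Tendsto L atTop atTop)
    (hL_log : Tendsto (fun T => L T / Real.log T) atTop (nhds 0))
    (x : ℝ) :
    Tendsto (fun T : ℝ =>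
        (volume {τ : ℝ | τ ∈ Set.Icc T (2 * T) ∧
            SL g (L T) τ / Real.sqrt (sigmaSq g (L T)) < x}).toReal / T)
      atTop
      (nhds ((1 / Real.sqrt (2 * Real.pi)) * ∫ u in Set.Iic x, Real.exp (-u ^ 2 / 2))) := by
  refine (MD.levy (fun T => MD.SS (MD.NQ (Real.pi * L T)) (MD.cQ g (L T)))
    (fun T => Finset.measurable_fun_sum _ fun n _ => by fun_prop)
    (MD.char_lim g hg_smooth hg_even hg_supp hg_sup L hL_inf hL_log) x).congr' ?_
  filter_upwards [hL_inf.eventually_ge_atTop 1] with T hT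
  have hQ : 1 ≤ Real.pi * L T := by nlinarith [Real.pi_gt_three]
  simp only [MD.SL_eq g (MD.g_zero g hg_supp hg_sup) (L T) hQ]
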